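/- (Katz, vertical Sato–Tate law for Kloosterman sums) For every 0 ≤ a ≤ b ≤ π and every ε > 0 there exists Q such that for every prime q ≥ Q, | (1/(q−1)) · #{x ∈ (ℤ/qℤ)^× : 2 cos b ≤ Kl₂(x;q) ≤ 2 cos a} − (2/π) ∫_a^b sin²θ dθ | < ε. In other words, the Kloosterman angles θ_{q,x} ∈ [0,π] defined by Kl₂(x;q) = 2 cos θ_{q,x} become equidistributed with respect to the Sato–Tate measure (2/π) sin²θ dθ as q → ∞ over the primes. -/

import Mathlib

/-- The normalized Kloosterman sum `Kl₂(a; c) = c^{-1/2} ∑_{x ∈ (ℤ/cℤ)ˣ} e((x + a x⁻¹)/c)`,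
where `e(t) = exp(2πit)` and an element of `ℤ/cℤ` is identified with its representative
in `{0, …, c-1}` via `ZMod.val`. It is a real number; we work with its real part. -/
noncomputable def Kl2 (c : ℕ) (a : ZMod c) : ℂ :=
  (Real.sqrt c : ℂ)⁻¹ * ∑ x ∈ Finset.range c,
    if Nat.Coprime x c then
      Complex.exp (2 * (Real.pi : ℂ) * Complex.I *
        ((((x : ZMod c) + a * (x : ZMod c)⁻¹).val : ℂ) / (c : ℂ)))
    else 0

/-- The homogenised Chebyshev polynomials of the second kind: the trace of the `k`-th symmetric
power of a `2 × 2` matrix with trace `s` and determinant `q`. -/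
def chebF {R : Type*} [CommRing R] (s q : R) : ℕ → R
  | 0 => 1
  | 1 => s
  | k + 2 => s * chebF s q (k + 1) - q * chebF s q k

theorem map_chebF {R S : Type*} [CommRing R] [CommRing S] (f : R →+* S) (s q : R) :
    ∀ k, f (chebF s q k) = chebF (f s) (f q) k
  | 0 => by simp [chebF]
  | 1 => by simp [chebF]
  | k + 2 => by simp [chebF, map_chebF f s q (k + 1), map_chebF f s q k]

/-- The unnormalised Kloosterman sum of `x` for the additive character `Ψ`. -/
def kloos {F R : Type*} [Field F] [Fintype F] [DecidableEq F] [CommRing R] (Ψ : AddChar F R) (x : F) : R :=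
  ∑ y : Fˣ, Ψ (y + x * (y : F)⁻¹)

/-- Mixed symmetric power moment of Kloosterman sums. -/
def kloosMoment {F R : Type*} [Field F] [Fintype F] [DecidableEq F] [CommRing R] (Ψ : AddChar F R)
    (i j : ℕ) (a : F) : R :=
  ∑ x : Fˣ, chebF (-kloos Ψ x) (Fintype.card F : R) i *
    chebF (-kloos Ψ (a * x)) (Fintype.card F : R) j

/-- `newtonB h m` is `m!` times the `m`-th coefficient of `exp (∑ h n T ^ n / n)`. -/
def newtonB {R : Type*} [CommRing R] (h : ℕ → R) : ℕ → R
  | 0 => 1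
  | m + 1 => ∑ i : Fin (m + 1), (m.descFactorial i : R) * h (i + 1) * newtonB h (m - i)
termination_by m => m
decreasing_by omega

theorem newtonB_zero {R : Type*} [CommRing R] (h : ℕ → R) : newtonB h 0 = 1 := by
  rw [newtonB]

theorem newtonB_succ {R : Type*} [CommRing R] (h : ℕ → R) (m : ℕ) :
    newtonB h (m + 1) =
      ∑ i ∈ Finset.range (m + 1), (m.descFactorial i : R) * h (i + 1) * newtonB h (m - i) := by
  rw [newtonB, Finset.sum_range]

theorem map_newtonB {R S : Type*} [CommRing R] [CommRing S] (f : R →+* S) (h : ℕ → R) (m : ℕ) :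
    f (newtonB h m) = newtonB (fun n => f (h n)) m := by
  induction m using Nat.strong_induction_on with
  | _ m ih =>
    cases m with
    | zero => simp [newtonB_zero]
    | succ m =>
      simp only [newtonB_succ, map_sum, map_mul, map_natCast]
      refine Finset.sum_congr rfl fun i hi => ?_
      rw [ih (m - i) (by omega)]

theorem newtonB_scale {R : Type*} [CommRing R] (c : R) (h : ℕ → R) (m : ℕ) :
    newtonB (fun n => c ^ n * h n) m = c ^ m * newtonB h m := by
  induction m using Nat.strong_induction_on with
  | _ m ih =>
    cases m with
    | zero => simp [newtonB_zero]
    | succ m =>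
      simp only [newtonB_succ, Finset.mul_sum]
      refine Finset.sum_congr rfl fun i hi => ?_
      rw [ih (m - i) (by omega)]
      have : c ^ (m + 1) = c ^ (i + 1) * c ^ (m - i) := by
        rw [← pow_add]; congr 1; simp at hi; omega
      rw [this]; ring

theorem newtonB_congr {R : Type*} [CommRing R] {h h' : ℕ → R} {m : ℕ}
    (H : ∀ n, 1 ≤ n → n ≤ m → h n = h' n) : newtonB h m = newtonB h' m := by
  induction m using Nat.strong_induction_on with
  | _ m ih =>
    cases m with
    | zero => simp [newtonB_zero]
    | succ m =>
      simp only [newtonB_succ]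
      refine Finset.sum_congr rfl fun i hi => ?_
      simp at hi
      rw [ih (m - i) (by omega) fun n h1 h2 => H n h1 (by omega), H (i + 1) (by omega) (by omega)]

open Polynomial in
theorem Matrix.det_one_add_eps {P n : Type*} [CommRing P] [Fintype n] [DecidableEq n]
    (M : Matrix n n P) :
    (1 + M.map (fun x => (TrivSqZeroExt.inr x : DualNumber P))).det =
      1 + TrivSqZeroExt.inr M.trace := by
  have h := Matrix.det_one_add_smul (DualNumber.eps : DualNumber P)
    (M.map (fun x => (TrivSqZeroExt.inl x : DualNumber P)))
  have e1 : M.map (fun x => (TrivSqZeroExt.inr x : DualNumber P)) =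
      (DualNumber.eps : DualNumber P) • M.map (fun x => (TrivSqZeroExt.inl x : DualNumber P)) := by
    ext i j <;> simp
  rw [e1, h]
  ext <;> simp [pow_two, Matrix.trace, TrivSqZeroExt.fst_sum, TrivSqZeroExt.snd_sum]

/-- The ring homomorphism `f ↦ f + ε d f` attached to a derivation. -/
def Derivation.toDual {A P : Type*} [CommRing A] [CommRing P] [Algebra A P]
    (d : Derivation A P P) : P →+* DualNumber P where
  toFun f := TrivSqZeroExt.inl f + TrivSqZeroExt.inr (d f)
  map_one' := by simp
  map_zero' := by simp
  map_add' x y := by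
    ext <;> simp
  map_mul' x y := by
    ext <;> simp [mul_comm]

theorem Derivation.det_eq {A P n : Type*} [CommRing A] [CommRing P] [Algebra A P]
    [Fintype n] [DecidableEq n]
    (d : Derivation A P P) (M N : Matrix n n P) (h : M * N = 1) :
    d M.det = M.det * (N * M.map d).trace := by
  have h1 := RingHom.map_det d.toDual M
  have h2 : d.toDual.mapMatrix M = (TrivSqZeroExt.inlHom P P).mapMatrix M *
      (1 + (N * M.map d).map (fun x => (TrivSqZeroExt.inr x : DualNumber P))) := by
    have : M.map d = M * (N * M.map d) := by rw [← mul_assoc, h, one_mul]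
    generalize N * M.map d = K at *
    rw [mul_add, mul_one]
    ext i j
    · simp [Derivation.toDual, Matrix.mul_apply, TrivSqZeroExt.fst_sum]
    · have := congrFun (congrFun this i) j
      simp [Derivation.toDual, Matrix.mul_apply, TrivSqZeroExt.snd_sum] at this ⊢
      rw [this]
      exact Finset.sum_congr rfl fun _ _ => mul_comm _ _
  rw [h2, Matrix.det_mul, Matrix.det_one_add_eps, ← RingHom.map_det] at h1
  have := congrArg TrivSqZeroExt.snd h1
  simpa [Derivation.toDual] using this

open PowerSeries in
theorem Matrix.newtonB_neg_trace_pow {R n : Type*} [CommRing R] [Fintype n] [DecidableEq n]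
    (Γ : Matrix n n R) (m : ℕ) :
    newtonB (fun k => -(Γ ^ k).trace) m = (m.factorial : R) * Γ.charpolyRev.coeff m := by
  set M : Matrix n n R⟦X⟧ := 1 - (X : R⟦X⟧) • Γ.map (C (R := R)) with hM
  set N : Matrix n n R⟦X⟧ := Matrix.of fun i j => PowerSeries.mk fun k => (Γ ^ k) i j with hN
  have hMN : M * N = 1 := by
    rw [hM, sub_mul, one_mul, sub_eq_iff_eq_add]
    ext i j k
    rw [Matrix.smul_mul, Matrix.add_apply, Matrix.smul_apply, map_add, smul_eq_mul]
    cases k with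
    | zero => simp [hN, Matrix.one_apply]
    | succ k =>
      rw [PowerSeries.coeff_succ_X_mul, Matrix.mul_apply, map_sum]
      simp only [hN, Matrix.of_apply, coeff_mk, Matrix.map_apply, coeff_C_mul]
      rw [pow_succ', Matrix.mul_apply]
      simp [Matrix.one_apply]; split_ifs <;> simp [PowerSeries.coeff_one]
  have hdet : M.det = (Γ.charpolyRev : R⟦X⟧) := by
    rw [Matrix.charpolyRev, ← Polynomial.coeToPowerSeries.ringHom_apply, RingHom.map_det]
    congr 1
    ext i j : 2
    simp [hM, Matrix.one_apply]
    split_ifs <;> simp [mul_comm, Polynomial.coeff_one]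
  have hd := Derivation.det_eq (PowerSeries.derivative R) M N hMN
  rw [hdet] at hd
  have hM' : M.map (PowerSeries.derivative R) = -Γ.map (C (R := R)) := by
    ext i j : 2
    simp [hM, Matrix.one_apply]
    split_ifs <;> simp
  have hT : ∀ k : ℕ, coeff k (N * M.map (PowerSeries.derivative R)).trace = -(Γ ^ (k + 1)).trace := by
    intro k
    rw [hM', mul_neg, Matrix.trace_neg, map_neg]
    simp only [Matrix.trace, Matrix.diag, map_sum, Matrix.mul_apply, hN, Matrix.of_apply,
      Matrix.map_apply, coeff_mul_C, coeff_mk, pow_succ]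
  have hrec : ∀ k : ℕ, ((k : R) + 1) * Γ.charpolyRev.coeff (k + 1) =
      ∑ i ∈ Finset.range (k + 1), -(Γ ^ (i + 1)).trace * Γ.charpolyRev.coeff (k - i) := by
    intro k
    have := congrArg (coeff k) hd
    rw [mul_comm, PowerSeries.coeff_mul, Finset.Nat.sum_antidiagonal_eq_sum_range_succ
      (fun a b => coeff a (N * M.map (PowerSeries.derivative R)).trace *
        coeff b (Γ.charpolyRev : R⟦X⟧))] at this
    simp only [hT, Polynomial.coeff_coe] at this
    rw [← this, PowerSeries.coeff_derivative]
    simp [mul_comm]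
  induction m using Nat.strong_induction_on with
  | _ m ih =>
    cases m with
    | zero => simp [newtonB_zero, Polynomial.coeff_zero_eq_eval_zero]
    | succ m =>
      have e : ((m + 1).factorial : R) * Γ.charpolyRev.coeff (m + 1) =
        (m.factorial : R) * (((m : R) + 1) * Γ.charpolyRev.coeff (m + 1)) := by
        rw [Nat.factorial_succ]; push_cast; ring
      rw [newtonB_succ, e, hrec, Finset.mul_sum]
      refine Finset.sum_congr rfl fun i hi => ?_
      rw [Finset.mem_range] at hi
      rw [ih (m - i) (by omega), ← Nat.factorial_mul_descFactorial (show i ≤ m by omega)]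
      push_cast; ring

theorem Matrix.newtonB_neg_trace_pow_eq_zero {R n : Type*} [CommRing R] [Fintype n]
    [DecidableEq n] (Γ : Matrix n n R) (m : ℕ) (hm : Fintype.card n < m) :
    newtonB (fun k => -(Γ ^ k).trace) m = 0 := by
  nontriviality R
  rw [Matrix.newtonB_neg_trace_pow, ← Matrix.reverse_charpoly, Polynomial.coeff_eq_zero_of_natDegree_lt,
    mul_zero]
  refine (Polynomial.reverse_natDegree_le _).trans_lt ?_
  rwa [Matrix.charpoly_natDegree_eq_dim]

open Polynomial in
/-- The homogenisation of degree `k` of a polynomial, evaluated at two elements. -/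
def Polynomial.homEval {R S : Type*} [CommRing R] [CommRing S] [Algebra R S] (k : ℕ) (u v : S)
    (P : R[X]) : S :=
  ∑ r ∈ Finset.range (k + 1), algebraMap R S (P.coeff r) * (u ^ (k - r) * v ^ r)

open Polynomial in
theorem Polynomial.homEval_mul_linear {R S : Type*} [CommRing R] [CommRing S] [Algebra R S] (k : ℕ)
    (u v : S) (a b : R) (P : R[X]) (hP : P.natDegree ≤ k) :
    homEval (k + 1) u v ((C a + C b * X) * P) =
      (algebraMap R S a * u + algebraMap R S b * v) * homEval k u v P := by
  have h0 : P.coeff (k + 1) = 0 := coeff_eq_zero_of_natDegree_lt (by omega)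
  rw [homEval, add_mul (C a), add_mul, homEval]
  simp only [coeff_add, coeff_C_mul, mul_assoc, map_add, map_mul, add_mul, Finset.sum_add_distrib]
  congr 1
  · rw [Finset.sum_range_succ, h0, map_zero, zero_mul, mul_zero, add_zero, Finset.mul_sum,
      Finset.mul_sum]
    refine Finset.sum_congr rfl fun r hr => ?_
    rw [Finset.mem_range] at hr
    rw [show k + 1 - r = (k - r) + 1 by omega]; ring
  · rw [Finset.sum_range_succ', coeff_X_mul_zero, map_zero, zero_mul, mul_zero, add_zero,
      Finset.mul_sum, Finset.mul_sum]
    refine Finset.sum_congr rfl fun r hr => ?_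
    rw [coeff_X_mul, show k + 1 - (r + 1) = k - r by omega]; ring

open Polynomial in
theorem natDegree_linear_pow_le {R : Type*} [CommRing R] (a b : R) (m : ℕ) :
    ((C a + C b * X) ^ m).natDegree ≤ m := by
  refine natDegree_pow_le.trans ?_
  have : (C a + C b * X).natDegree ≤ 1 := by compute_degree
  nlinarith

open Polynomial in
theorem Polynomial.homEval_linear_pow_mul {R S : Type*} [CommRing R] [CommRing S] [Algebra R S]
    (u v : S) (a b : R) (m k : ℕ) (P : R[X]) (hP : P.natDegree ≤ k) :
    homEval (m + k) u v ((C a + C b * X) ^ m * P) =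
      (algebraMap R S a * u + algebraMap R S b * v) ^ m * homEval k u v P := by
  induction m with
  | zero => simp
  | succ m ih =>
    rw [show m + 1 + k = (m + k) + 1 by ring, pow_succ', mul_assoc, homEval_mul_linear, ih]
    · ring
    · exact (natDegree_mul_le_of_le (natDegree_linear_pow_le a b m) hP)

open Polynomial in
/-- The matrix of the `k`-th symmetric power of a `2 × 2` matrix in the monomial basis. -/
noncomputable def symM {R : Type*} [CommRing R] (k : ℕ) (A : Matrix (Fin 2) (Fin 2) R) :
    Matrix (Fin (k + 1)) (Fin (k + 1)) R :=
  Matrix.of fun r b =>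
    ((C (A 0 0) + C (A 1 0) * X) ^ (k - b) * (C (A 0 1) + C (A 1 1) * X) ^ (b : ℕ)).coeff r

open Polynomial in
theorem symM_mul {R : Type*} [CommRing R] (k : ℕ) (A B : Matrix (Fin 2) (Fin 2) R) :
    symM k (A * B) = symM k A * symM k B := by
  ext r b
  have hb : (k - b) + (b : ℕ) = k := by omega
  have key := homEval_linear_pow_mul (S := R[X]) (C (A 0 0) + C (A 1 0) * X)
    (C (A 0 1) + C (A 1 1) * X) (B 0 0) (B 1 0) (k - b) b _ (natDegree_linear_pow_le (B 0 1) (B 1 1) b)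
  have key2 := homEval_linear_pow_mul (S := R[X]) (C (A 0 0) + C (A 1 0) * X)
    (C (A 0 1) + C (A 1 1) * X) (B 0 1) (B 1 1) b 0 1 (by simp)
  rw [add_zero, mul_one] at key2
  rw [key2, hb] at key
  have h1 : homEval 0 (C (A 0 0) + C (A 1 0) * X) (C (A 0 1) + C (A 1 1) * X) (1 : R[X]) = 1 := by
    simp [homEval]
  rw [h1, mul_one] at key
  have key3 := congrArg (fun P => P.coeff (r : ℕ)) key
  simp only [homEval, finsetSum_coeff, algebraMap_eq, coeff_C_mul] at key3
  rw [Matrix.mul_apply]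
  simp only [symM, Matrix.of_apply]
  rw [Finset.sum_range] at key3
  have e : ∀ i : Fin 2, C ((A * B) 0 i) + C ((A * B) 1 i) * X =
      C (B 0 i) * (C (A 0 0) + C (A 1 0) * X) + C (B 1 i) * (C (A 0 1) + C (A 1 1) * X) := by
    intro i
    simp only [Matrix.mul_apply, Fin.sum_univ_two, map_add, map_mul]; ring
  rw [e, e, ← key3]
  exact Finset.sum_congr rfl fun _ _ => mul_comm _ _

open Polynomial in
theorem map_symM {R S : Type*} [CommRing R] [CommRing S] (f : R →+* S) (k : ℕ)
    (A : Matrix (Fin 2) (Fin 2) R) : (symM k A).map f = symM k (A.map f) := by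
  ext r b
  simp only [symM, Matrix.map_apply, Matrix.of_apply]
  rw [← Polynomial.coeff_map]
  simp

open Polynomial in
theorem symM_scalar {R : Type*} [CommRing R] (k : ℕ) (c : R) :
    symM k (c • (1 : Matrix (Fin 2) (Fin 2) R)) = c ^ k • 1 := by
  ext r b
  have hb : (k - b) + (b : ℕ) = k := by omega
  simp only [symM, Matrix.of_apply]
  simp [mul_pow, ← C_pow, ← mul_assoc, ← C_mul, ← pow_add, hb, -map_pow, -map_mul, coeff_X_pow, Matrix.one_apply, Fin.ext_iff]

theorem symM_one {R : Type*} [CommRing R] (k : ℕ) :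
    symM k (1 : Matrix (Fin 2) (Fin 2) R) = 1 := by
  simpa using symM_scalar k (1 : R)

theorem symM_companion_trace {R : Type*} [CommRing R] (k : ℕ) (x y : R) :
    (symM k !![0, -(x * y); 1, x + y]).trace = chebF (x + y) (x * y) k := by
  have h1 : !![0, -(x * y); 1, x + y] * !![-y, 1; 1, 0] = !![-y, 1; 1, 0] * !![x, 1; 0, y] := by
    ext i j
    fin_cases i <;> fin_cases j <;> simp [Matrix.mul_apply, Fin.sum_univ_two] <;> ring
  have h2 : !![-y, 1; 1, 0] * !![0, 1; 1, y] = 1 := by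
    ext i j
    fin_cases i <;> fin_cases j <;> simp [Matrix.mul_apply, Fin.sum_univ_two]
  have h3 : !![0, 1; 1, y] * !![-y, 1; 1, 0] = 1 := by
    ext i j
    fin_cases i <;> fin_cases j <;> simp [Matrix.mul_apply, Fin.sum_univ_two]
  have h4 : !![0, -(x * y); 1, x + y] = !![-y, 1; 1, 0] * !![x, 1; 0, y] * !![0, 1; 1, y] := by
    rw [← h1, mul_assoc, h2, mul_one]
  rw [h4, symM_mul, symM_mul, mul_assoc, Matrix.trace_mul_comm, mul_assoc, ← symM_mul, h3, symM_one,
    mul_one]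
  have h5 : (symM k !![x, 1; 0, y]).trace = ∑ b ∈ Finset.range (k + 1), x ^ b * y ^ (k - b) := by
    rw [← Finset.sum_range_reflect, Finset.sum_range, Matrix.trace]
    refine Finset.sum_congr rfl fun b _ => ?_
    have hb : (b : ℕ) ≤ k := by omega
    simp only [symM, Matrix.diag, Matrix.of_apply]
    simp only [Matrix.cons_val', Matrix.cons_val_zero, Matrix.cons_val_one,
      Matrix.cons_val_fin_one, map_zero, zero_mul, add_zero, map_one]
    rw [← Polynomial.C_pow, Polynomial.coeff_C_mul, show k + 1 - 1 - (b : ℕ) = k - b by omega,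
      show k - (k - (b : ℕ)) = b by omega]
    congr 1
    have := Polynomial.coeff_pow_of_natDegree_le (m := (b : ℕ)) (n := 1)
      (show (1 + Polynomial.C y * Polynomial.X).natDegree ≤ 1 by compute_degree)
    rw [mul_one] at this
    rw [this]
    simp [Polynomial.coeff_one]
  rw [h5]
  clear h1 h2 h3 h4 h5
  have hT : ∀ n, ∑ b ∈ Finset.range (n + 1 + 1), x ^ b * y ^ (n + 1 - b) =
      y * ∑ b ∈ Finset.range (n + 1), x ^ b * y ^ (n - b) + x ^ (n + 1) := by
    intro n
    rw [Finset.sum_range_succ, Finset.mul_sum]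
    congr 1
    · refine Finset.sum_congr rfl fun b hb => ?_
      rw [Finset.mem_range] at hb
      rw [show n + 1 - b = n - b + 1 by omega]; ring
    · simp
  induction k using Nat.twoStepInduction with
  | zero => simp [chebF]
  | one => rw [hT 0]; simp [chebF, add_comm]
  | more k ih1 ih2 =>
    rw [chebF, ← ih1, ← ih2, hT (k + 1), hT k]; ring

open Polynomial in
theorem symM_companion_trace' {R : Type*} [CommRing R] (k : ℕ) (t q : R) :
    (symM k !![0, -q; 1, t]).trace = chebF t q k := by
  nontriviality R
  set f : R[X] := X ^ 2 - C t * X + C q with hf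
  have hdeg : (-(C t * X) + C q).degree < 2 := by
    refine lt_of_le_of_lt (b := 1) ?_ (by norm_num)
    compute_degree
  have hm : f.Monic := by
    rw [hf, sub_eq_add_neg, add_assoc]
    exact monic_X_pow_add (n := 2) (by exact_mod_cast hdeg)
  have hd : f.natDegree = 2 := by
    rw [hf, sub_eq_add_neg, add_assoc]
    have : (-(C t * X) + C q).degree < ((2 : ℕ) : WithBot ℕ) := by exact_mod_cast hdeg
    exact natDegree_eq_of_degree_eq_some (by rw [degree_add_eq_left_of_degree_lt (by rwa [degree_X_pow])]; simp)
  have hinj : Function.Injective (AdjoinRoot.of f) := by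
    rw [injective_iff_map_eq_zero]
    intro a ha
    rw [← AdjoinRoot.mk_C, AdjoinRoot.mk_eq_zero] at ha
    by_contra h
    have := hm.not_dvd_of_natDegree_lt (p := f) (q := C a) (by simpa using h) (by simp [hd])
    exact this ha
  have hroot : (AdjoinRoot.root f) ^ 2 - AdjoinRoot.of f t * AdjoinRoot.root f + AdjoinRoot.of f q = 0 := by
    have := AdjoinRoot.eval₂_root f
    simpa [hf, eval₂_add, eval₂_sub, eval₂_mul] using this
  apply hinj
  set x := AdjoinRoot.root f
  have ht : AdjoinRoot.of f t = x + (AdjoinRoot.of f t - x) := by ring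
  have hq : AdjoinRoot.of f q = x * (AdjoinRoot.of f t - x) := by linear_combination hroot
  have h1 := symM_companion_trace k x (AdjoinRoot.of f t - x)
  rw [← hq, ← ht] at h1
  rw [map_chebF, ← h1, AddMonoidHom.map_trace, map_symM]
  congr 2
  ext i j
  fin_cases i <;> fin_cases j <;> simp

open Polynomial in
theorem trace_symM {R : Type*} [CommRing R] (k : ℕ) (A : Matrix (Fin 2) (Fin 2) R) :
    (symM k A).trace = chebF A.trace A.det k := by
  set c : R[X] := X + C (A 1 0)
  set B : Matrix (Fin 2) (Fin 2) R[X] := !![C (A 0 0), C (A 0 1); c, C (A 1 1)] with hB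
  have hBA : B.map (evalRingHom 0) = A := by
    ext i j
    fin_cases i <;> fin_cases j <;> simp [hB, c]
  suffices h : (symM k B).trace = chebF B.trace B.det k by
    have := congrArg (evalRingHom 0) h
    rwa [map_chebF, AddMonoidHom.map_trace, AddMonoidHom.map_trace, map_symM, RingHom.map_det,
      RingHom.mapMatrix_apply, hBA] at this
  set P : Matrix (Fin 2) (Fin 2) R[X] := !![1, C (A 0 0); 0, c] with hP
  have h1 : B * P = P * !![0, -B.det; 1, B.trace] := by
    rw [Matrix.det_fin_two, Matrix.trace_fin_two]
    refine Matrix.ext fun i j => ?_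
    fin_cases i <;> fin_cases j <;>
      simp [hB, hP, Matrix.mul_apply, Fin.sum_univ_two] <;> ring
  have h2 : P * P.adjugate = c • 1 := by rw [Matrix.mul_adjugate]; simp [hP, Matrix.det_fin_two]
  have h3 : P.adjugate * P = c • 1 := by rw [Matrix.adjugate_mul]; simp [hP, Matrix.det_fin_two]
  have hc : (c ^ k).Monic := (monic_X_add_C _).pow k
  refine hc.isRegular.left ?_
  show c ^ k * _ = c ^ k * _
  rw [← symM_companion_trace', ← smul_eq_mul, ← smul_eq_mul, ← Matrix.trace_smul,
    ← Matrix.trace_smul, ← mul_one (symM k B), ← mul_smul_comm, ← symM_scalar, ← h2, symM_mul,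
    ← mul_assoc, ← symM_mul, h1, symM_mul, mul_assoc, Matrix.trace_mul_comm, mul_assoc, ← symM_mul, h3,
    symM_scalar, mul_smul_comm, mul_one]

/-- The derivation of the `k`-th symmetric power induced by a `2 × 2` matrix. -/
def dsymM {R : Type*} [CommRing R] (k : ℕ) (G : Matrix (Fin 2) (Fin 2) R) :
    Matrix (Fin (k + 1)) (Fin (k + 1)) R :=
  Matrix.of fun r b =>
    (if r = b then ((k - b : ℕ) : R) * G 0 0 + (b : ℕ) * G 1 1 else 0) +
    (if (r : ℕ) = b + 1 then ((k - b : ℕ) : R) * G 1 0 else 0) +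
    (if (r : ℕ) + 1 = b then ((b : ℕ) : R) * G 0 1 else 0)

open Polynomial in
theorem symM_one_add_eps {R : Type*} [CommRing R] (k : ℕ) (G : Matrix (Fin 2) (Fin 2) R) :
    symM k (1 + G.map (fun x => (TrivSqZeroExt.inr x : DualNumber R))) =
      1 + (dsymM k G).map (fun x => (TrivSqZeroExt.inr x : DualNumber R)) := by
  have hsq : ∀ x y : R, (TrivSqZeroExt.inr x : DualNumber R) * TrivSqZeroExt.inr y = 0 := by
    intro x y; exact TrivSqZeroExt.inr_mul_inr R x y
  have hadd : ∀ x y : R, (TrivSqZeroExt.inr (x + y) : DualNumber R) =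
      TrivSqZeroExt.inr x + TrivSqZeroExt.inr y := fun x y => TrivSqZeroExt.inr_add R x y
  have hn : ∀ (n : ℕ) (x : R), (TrivSqZeroExt.inr (n * x) : DualNumber R) =
      (n : DualNumber R) * TrivSqZeroExt.inr x := by
    intro n x; ext <;> simp [mul_comm]
  have hp1 : ∀ (x y : R) (n : ℕ), (C (1 + TrivSqZeroExt.inr x : DualNumber R) +
      C (TrivSqZeroExt.inr y : DualNumber R) * X) ^ n =
      1 + C ((n : DualNumber R) * TrivSqZeroExt.inr x) +
        C ((n : DualNumber R) * TrivSqZeroExt.inr y) * X := by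
    intro x y n
    induction n with
    | zero => simp
    | succ n ih =>
      rw [pow_succ, ih]
      have h1 := congrArg (C (R := DualNumber R)) (hsq x x)
      have h2 := congrArg (C (R := DualNumber R)) (hsq x y)
      have h3 := congrArg (C (R := DualNumber R)) (hsq y y)
      simp only [map_mul, map_add, map_one, map_zero, map_natCast, Nat.cast_add, Nat.cast_one]
        at h1 h2 h3 ⊢
      linear_combination (n : (DualNumber R)[X]) * h1 + 2 * (n : (DualNumber R)[X]) * X * h2 +
        (n : (DualNumber R)[X]) * X ^ 2 * h3
  have hp2 : ∀ (x y : R) (n : ℕ), (C (TrivSqZeroExt.inr x : DualNumber R) +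
      C (1 + TrivSqZeroExt.inr y : DualNumber R) * X) ^ n =
      X ^ n + C ((n : DualNumber R) * TrivSqZeroExt.inr y) * X ^ n +
        C ((n : DualNumber R) * TrivSqZeroExt.inr x) * X ^ (n - 1) := by
    intro x y n
    induction n with
    | zero => simp
    | succ n ih =>
      rw [pow_succ, ih]
      have h1 := congrArg (C (R := DualNumber R)) (hsq x x)
      have h2 := congrArg (C (R := DualNumber R)) (hsq x y)
      have h3 := congrArg (C (R := DualNumber R)) (hsq y y)
      have h4 : (n : (DualNumber R)[X]) * X ^ n = (n : (DualNumber R)[X]) * (X ^ (n - 1) * X) := by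
        cases n with
        | zero => simp
        | succ n => simp [pow_succ]
      simp only [map_mul, map_add, map_one, map_zero, map_natCast, Nat.cast_add, Nat.cast_one,
        Nat.add_sub_cancel] at h1 h2 h3 ⊢
      linear_combination (n : (DualNumber R)[X]) * X ^ (n - 1) * h1 +
        (n : (DualNumber R)[X]) * (X ^ (n - 1) * X + X ^ n) * h2 +
        (n : (DualNumber R)[X]) * X ^ (n + 1) * h3 - C (TrivSqZeroExt.inr x : DualNumber R) * h4
  refine Matrix.ext fun r b => ?_
  simp only [symM, Matrix.of_apply]
  simp only [Matrix.add_apply, Matrix.one_apply_eq, Matrix.map_apply,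
    Matrix.one_apply_ne (show (1 : Fin 2) ≠ 0 by decide),
    Matrix.one_apply_ne (show (0 : Fin 2) ≠ 1 by decide), zero_add]
  rw [hp1, hp2]
  have hbig : ∀ n m : ℕ, ∀ α β γ δ : R,
    (1 + C ((n : DualNumber R) * TrivSqZeroExt.inr α) +
        C ((n : DualNumber R) * TrivSqZeroExt.inr β) * X) * (X ^ m + C ((m : DualNumber R) * TrivSqZeroExt.inr γ) * X ^ m +
        C ((m : DualNumber R) * TrivSqZeroExt.inr δ) * X ^ (m - 1)) =
     X ^ m + C (TrivSqZeroExt.inr (n * α + m * γ)) * X ^ m +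
      C (TrivSqZeroExt.inr (n * β)) * X ^ (m + 1) + C (TrivSqZeroExt.inr (m * δ)) * X ^ (m - 1) := by
    intro n m α β γ δ
    have h1 := congrArg (C (R := DualNumber R)) (hsq α γ)
    have h2 := congrArg (C (R := DualNumber R)) (hsq α δ)
    have h3 := congrArg (C (R := DualNumber R)) (hsq β γ)
    have h4 := congrArg (C (R := DualNumber R)) (hsq β δ)
    simp only [hadd, hn]
    simp only [map_mul, map_add, map_zero, map_natCast] at h1 h2 h3 h4 ⊢
    linear_combination (n : (DualNumber R)[X]) * m * X ^ m * h1 +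
      (n : (DualNumber R)[X]) * m * X ^ (m - 1) * h2 + (n : (DualNumber R)[X]) * m * X ^ (m + 1) * h3 +
      (n : (DualNumber R)[X]) * m * X ^ (m - 1) * X * h4
  rw [hbig]
  simp only [coeff_add, coeff_C_mul, coeff_X_pow, dsymM, Matrix.of_apply, Matrix.one_apply,
    Fin.ext_iff, hadd]
  have hb0 : ((r : ℕ) + 1 = b) ∨ ((r : ℕ) = b - 1 ∧ (b : ℕ) = 0) ∨ ¬ ((r : ℕ) = b - 1) := by omega
  rcases hb0 with h | ⟨h, h'⟩ | h
  · rw [if_neg (show ¬ (r : ℕ) = b by omega), if_neg (show ¬ (r : ℕ) = b + 1 by omega),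
      if_pos (show (r : ℕ) = b - 1 by omega)]
    split_ifs <;> first | omega | simp
  · simp [h, h']
  · rw [if_neg h, if_neg (show ¬ (r : ℕ) + 1 = b by omega)]
    split_ifs <;> simp [add_smul, add_assoc]

theorem symM_horizontal {P Q : Type*} [CommRing P] [CommRing Q] (k : ℕ) (σ : P →+* DualNumber Q)
    (A : Matrix (Fin 2) (Fin 2) P) (H G : Matrix (Fin 2) (Fin 2) Q)
    (h : A.map (fun x => (σ x).snd) + H * A.map (fun x => (σ x).fst) =
      A.map (fun x => (σ x).fst) * G) :
    (symM k A).map (fun x => (σ x).snd) + dsymM k H * (symM k A).map (fun x => (σ x).fst) =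
      (symM k A).map (fun x => (σ x).fst) * dsymM k G := by
  set iota := (TrivSqZeroExt.inlHom Q Q) with hi
  have key : ∀ {n : Type} [Fintype n] [DecidableEq n] (B : Matrix n n P) (H G : Matrix n n Q),
      (B.map (fun x => (σ x).snd) + H * B.map (fun x => (σ x).fst) = B.map (fun x => (σ x).fst) * G) ↔
      (1 + H.map (fun x => (TrivSqZeroExt.inr x : DualNumber Q))) * B.map σ =
        (B.map (fun x => iota (σ x).fst)) * (1 + G.map (fun x => (TrivSqZeroExt.inr x : DualNumber Q))) := by
    intro n _ _ B H G
    rw [add_mul, mul_add, one_mul, mul_one, ← Matrix.ext_iff, ← Matrix.ext_iff]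
    refine forall_congr' fun i => forall_congr' fun j => ?_
    rw [TrivSqZeroExt.ext_iff]
    simp [Matrix.mul_apply, hi, TrivSqZeroExt.fst_sum, TrivSqZeroExt.snd_sum, mul_comm]
  rw [key] at h ⊢
  have := congrArg (symM k) h
  rw [symM_mul, symM_mul, symM_one_add_eps, symM_one_add_eps, ← map_symM] at this
  rw [this]
  congr 1
  set f : P →+* DualNumber Q := iota.comp ((TrivSqZeroExt.fstHom Q Q Q).toRingHom.comp σ)
  exact (map_symM f k A).symm

/-- The ordered product `f (n - 1) * ⋯ * f 1 * f 0`. -/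
def prodRev {M : Type*} [Monoid M] (f : ℕ → M) : ℕ → M
  | 0 => 1
  | n + 1 => f n * prodRev f n

theorem map_prodRev {M N : Type*} [Monoid M] [Monoid N] (φ : M →* N) (f : ℕ → M) (n : ℕ) :
    φ (prodRev f n) = prodRev (fun i => φ (f i)) n := by
  induction n with
  | zero => simp [prodRev]
  | succ n ih => simp [prodRev, ih]

theorem prodRev_const {M : Type*} [Monoid M] (a : M) (n : ℕ) :
    prodRev (fun _ => a) n = a ^ n := by
  induction n with
  | zero => simp [prodRev]
  | succ n ih => simp [prodRev, ih, pow_succ']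

theorem prodRev_congr {M : Type*} [Monoid M] {f g : ℕ → M} {n : ℕ} (h : ∀ i < n, f i = g i) :
    prodRev f n = prodRev g n := by
  induction n with
  | zero => simp [prodRev]
  | succ n ih => simp [prodRev, ih fun i hi => h i (by omega), h n (by omega)]

open Polynomial in
/-- The matrix of `h ↦ ψ (G h)` on polynomials of degree at most `J`, where `ψ` sends `X ^ (P * l)`
to `X ^ l` and kills the other monomials. -/
def dworkM {R ι : Type*} [CommRing R] (P J : ℕ) (G : Matrix ι ι R[X]) :
    Matrix (Fin (J + 1) × ι) (Fin (J + 1) × ι) R :=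
  Matrix.of fun l m => if (m.1 : ℕ) ≤ P * l.1 then (G l.2 m.2).coeff (P * l.1 - m.1) else 0

open Polynomial in
theorem dworkM_mul {R ι : Type*} [CommRing R] [Fintype ι] [DecidableEq ι] (p P J : ℕ) (hP : 1 ≤ P)
    (G₁ G₀ : Matrix ι ι R[X]) (h₀ : ∀ a b, (G₀ a b).natDegree ≤ (P - 1) * J) :
    dworkM p J G₁ * dworkM P J G₀ = dworkM (p * P) J (G₁.map (expand R P) * G₀) := by
  ext ⟨l, a⟩ ⟨m, b⟩
  simp only [dworkM, Matrix.mul_apply, Matrix.of_apply, Fintype.sum_prod_type, finsetSum_coeff,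
    Matrix.map_apply]
  rw [Finset.sum_comm]
  split_ifs with hm
  swap
  · refine Finset.sum_eq_zero fun c _ => Finset.sum_eq_zero fun k _ => ?_
    split_ifs with h1 h2
    · exfalso; apply hm
      calc (m : ℕ) ≤ P * k := h2
        _ ≤ P * (p * l) := Nat.mul_le_mul_left _ h1
        _ = p * P * l := by ring
    all_goals simp
  refine Finset.sum_congr rfl fun c _ => ?_
  rw [coeff_mul]
  -- reindex both sides by the exponent `k`
  have hR : ∑ x ∈ Finset.HasAntidiagonal.antidiagonal (p * P * (l : ℕ) - (m : ℕ)),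
      (expand R P (G₁ a c)).coeff x.1 * (G₀ c b).coeff x.2 =
      ∑ k ∈ (Finset.range (J + 1)).filter (fun k : ℕ => k ≤ p * (l : ℕ) ∧ (m : ℕ) ≤ P * k),
        (G₁ a c).coeff (p * (l : ℕ) - k) * (G₀ c b).coeff (P * k - (m : ℕ)) := by
    symm
    refine Finset.sum_of_injOn (fun k => (P * (p * l - k), P * k - m)) ?_ ?_ ?_ ?_
    · intro k hk k' hk' h
      simp only [Finset.coe_filter, Set.mem_ofPred_eq, Prod.mk.injEq] at hk hk' h
      have := Nat.eq_of_mul_eq_mul_left hP h.1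
      omega
    · intro k hk
      simp only [Finset.coe_filter, Set.mem_ofPred_eq, Finset.mem_coe, Finset.HasAntidiagonal.mem_antidiagonal] at hk ⊢
      have : P * (p * l - k) + P * k = p * P * l := by
        rw [← mul_add, Nat.sub_add_cancel hk.2.1]; ring
      omega
    · rintro ⟨d, e⟩ hx hn
      rw [Finset.HasAntidiagonal.mem_antidiagonal] at hx
      simp only at hx
      by_cases hd : P ∣ d
      · obtain ⟨d', rfl⟩ := hd
        have hd' : d' ≤ p * l := by
          refine Nat.le_of_mul_le_mul_left (c := P) ?_ hP
          have : P * (p * l) = p * P * l := by ring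
          omega
        have he : e = P * (p * l - d') - m := by
          have : P * (p * l - d') + P * d' = p * P * l := by
            rw [← mul_add, Nat.sub_add_cancel hd']; ring
          omega
        have hm' : (m : ℕ) ≤ P * (p * l - d') := by
          have : P * (p * l - d') + P * d' = p * P * l := by
            rw [← mul_add, Nat.sub_add_cancel hd']; ring
          omega
        rw [coeff_eq_zero_of_natDegree_lt (p := G₀ c b), mul_zero]
        refine (h₀ c b).trans_lt ?_
        by_contra hlt
        apply hn
        refine ⟨p * l - d', ?_, ?_⟩
        · simp only [Finset.coe_filter, Set.mem_ofPred_eq, Finset.mem_range]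
          refine ⟨?_, by omega, hm'⟩
          by_contra hJ
          have h1 : P * (J + 1) ≤ P * (p * l - d') := Nat.mul_le_mul_left _ (by omega)
          have h2 : (P - 1) * J + J = P * J := by
            rw [← Nat.succ_mul]; congr 1; omega
          have h3 : (m : ℕ) < J + 1 := m.2
          rw [mul_add] at h1
          omega
        · rw [Prod.mk.injEq]; exact ⟨by congr 1; omega, he.symm⟩
      · rw [coeff_expand hP, if_neg hd, zero_mul]
    · intro k hk
      change _ = ((expand R P) (G₁ a c)).coeff (P * (p * l - k)) * (G₀ c b).coeff (P * k - m)
      rw [mul_comm P (p * (l : ℕ) - k), coeff_expand_mul hP]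
  rw [hR, Finset.sum_filter, Finset.sum_range]
  refine Finset.sum_congr rfl fun k _ => ?_
  by_cases h1 : (k : ℕ) ≤ p * l <;> by_cases h2 : (m : ℕ) ≤ P * k <;> simp [h1, h2]

open Polynomial in
theorem exists_dworkM_prodRev {R ι : Type*} [CommRing R] [Fintype ι] [DecidableEq ι] (p J : ℕ)
    (hp : 1 ≤ p) (G : ℕ → Matrix ι ι R[X]) (hG : ∀ t a b, (G t a b).natDegree ≤ (p - 1) * J) (n : ℕ) :
    ∃ H : Matrix ι ι R[X], (∀ a b, (H a b).natDegree ≤ (p ^ n - 1) * J) ∧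
      prodRev (fun t => dworkM p J (G t)) n = dworkM (p ^ n) J H ∧
      ∀ y : R, H.map (eval y) = prodRev (fun t => (G t).map (eval (y ^ p ^ t))) n := by
  induction n with
  | zero =>
    refine ⟨1, ?_, ?_, ?_⟩
    · intro a b
      rw [Matrix.one_apply]; split_ifs <;> simp
    · ext ⟨l, a⟩ ⟨m, b⟩
      simp only [prodRev, dworkM, Matrix.one_apply, Matrix.of_apply, Prod.mk.injEq, pow_zero, one_mul,
        Fin.ext_iff]
      by_cases hab : a = b
      · simp only [hab, and_true, if_true, coeff_one]
        split_ifs <;> first | rfl | omega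
      · simp [hab]
    · intro y
      ext a b
      simp only [prodRev, Matrix.map_apply, Matrix.one_apply]; split_ifs <;> simp
  | succ n ih =>
    obtain ⟨H, h1, h2, h3⟩ := ih
    refine ⟨(G n).map (expand R (p ^ n)) * H, ?_, ?_, ?_⟩
    · intro a b
      rw [Matrix.mul_apply]
      refine natDegree_sum_le_of_forall_le _ _ fun c _ => ?_
      refine (natDegree_mul_le_of_le (m := (p - 1) * J * p ^ n) ?_ (h1 c b)).trans (le_of_eq ?_)
      · rw [Matrix.map_apply, natDegree_expand]
        exact Nat.mul_le_mul_right _ (hG n a c)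
      · have h : 1 ≤ p ^ n := Nat.one_le_pow _ _ hp
        obtain ⟨u, hu⟩ := Nat.exists_eq_add_of_le h
        obtain ⟨v, rfl⟩ := Nat.exists_eq_add_of_le hp
        rw [pow_succ, hu]
        simp only [Nat.add_sub_cancel_left]
        have : (1 + u) * (1 + v) - 1 = v + u * v + u := by
          have : (1 + u) * (1 + v) = 1 + (v + u * v + u) := by ring
          omega
        rw [this]; ring
    · rw [prodRev, h2, dworkM_mul p _ J (Nat.one_le_pow _ _ hp) _ _ h1, pow_succ']
    · intro y
      have : ∀ A B : Matrix ι ι R[X], (A * B).map (eval y) = A.map (eval y) * B.map (eval y) :=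
        fun A B => Matrix.map_mul (f := evalRingHom y)
      rw [this, h3, prodRev]
      congr 1
      ext a b
      simp [expand_eval]

open Polynomial in
theorem sum_trace_eval {R ι U : Type*} [CommRing R] [Fintype ι] [DecidableEq ι] [Fintype U]
    (τ : U → R) (q J : ℕ) (hq : 1 ≤ q)
    (hτ : ∀ s, ∑ y, τ y ^ s = if q ∣ s then (q : R) else 0)
    (H : Matrix ι ι R[X]) (hH : ∀ a b, (H a b).natDegree ≤ q * J) :
    ∑ y, (H.map (eval (τ y))).trace = q * (dworkM (q + 1) J H).trace := by
  simp only [Matrix.trace, Matrix.diag, dworkM, Matrix.of_apply, Matrix.map_apply,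
    Fintype.sum_prod_type]
  rw [Finset.sum_comm, Finset.sum_comm (s := (Finset.univ : Finset (Fin (J + 1)))), Finset.mul_sum]
  refine Finset.sum_congr rfl fun a _ => ?_
  have h1 : ∀ y, eval (τ y) (H a a) = ∑ s ∈ Finset.range (q * J + 1), (H a a).coeff s * τ y ^ s :=
    fun y => eval_eq_sum_range' (by have := hH a a; omega) _
  simp only [h1]
  rw [Finset.sum_comm]
  simp only [← Finset.mul_sum, hτ]
  simp only [mul_ite, mul_zero]
  rw [← Finset.sum_filter, Finset.mul_sum]
  symm
  rw [← Finset.sum_range fun l => (q : R) * (if l ≤ (q + 1) * l then (H a a).coeff ((q + 1) * l - l) else 0)]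
  refine Finset.sum_bij (fun l _ => q * l) ?_ ?_ ?_ ?_
  · intro l hl
    simp only [Finset.mem_filter, Finset.mem_range] at hl ⊢
    refine ⟨?_, dvd_mul_right _ _⟩
    have : q * l ≤ q * J := Nat.mul_le_mul_left _ (by omega)
    omega
  · intro l _ l' _ h
    exact Nat.eq_of_mul_eq_mul_left hq h
  · intro s hs
    simp only [Finset.mem_filter, Finset.mem_range] at hs
    obtain ⟨hs, l, rfl⟩ := hs
    refine ⟨l, ?_, rfl⟩
    rw [Finset.mem_range]
    have : l ≤ J := Nat.le_of_mul_le_mul_left (show q * l ≤ q * J by omega) hq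
    omega
  · intro l _
    rw [if_pos (by nlinarith), show (q + 1) * l - l = q * l by rw [add_mul]; omega, mul_comm]

open Polynomial in
/-- The Dwork trace formula. -/
theorem dwork_trace_formula {R ι U : Type*} [CommRing R] [Fintype ι] [DecidableEq ι] [Fintype U]
    (τ : U → R) (p n J : ℕ) (hp : 2 ≤ p) (hn : n ≠ 0)
    (hτ : ∀ s, ∑ y, τ y ^ s = if p ^ n - 1 ∣ s then ((p ^ n - 1 : ℕ) : R) else 0)
    (G : ℕ → Matrix ι ι R[X]) (hG : ∀ t a b, (G t a b).natDegree ≤ (p - 1) * J) :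
    ∑ y, (prodRev (fun t => (G t).map (eval (τ y ^ p ^ t))) n).trace =
      ((p ^ n - 1 : ℕ) : R) * (prodRev (fun t => dworkM p J (G t)) n).trace := by
  obtain ⟨H, h1, h2, h3⟩ := exists_dworkM_prodRev p J (by omega) G hG n
  have hq : 1 ≤ p ^ n - 1 := by
    have : p ^ 1 ≤ p ^ n := Nat.pow_le_pow_right (by omega) (by omega)
    rw [pow_one] at this; omega
  have := sum_trace_eval τ (p ^ n - 1) J hq hτ H h1
  rw [show p ^ n - 1 + 1 = p ^ n by omega] at this
  rw [h2, ← this]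
  exact Finset.sum_congr rfl fun y _ => by rw [h3]

open PowerSeries in
theorem PowerSeries.eq_zero_of_derivative_eq {k : Type*} [Field k] [CharZero k] {f Y : k⟦X⟧}
    (h : d⁄dX k Y = f * Y) (h0 : constantCoeff Y = 0) : Y = 0 := by
  suffices ∀ n, coeff n Y = 0 by ext n; simpa using this n
  intro n
  induction n using Nat.strong_induction_on with
  | _ n ih =>
    cases n with
    | zero => simpa using h0
    | succ n =>
      have h1 : coeff n (d⁄dX k Y) = 0 := by
        rw [h, coeff_mul]
        refine Finset.sum_eq_zero fun x hx => ?_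
        rw [Finset.HasAntidiagonal.mem_antidiagonal] at hx
        rw [ih x.2 (by omega), mul_zero]
      rw [coeff_derivative] at h1
      have : ((n : k) + 1) ≠ 0 := by exact_mod_cast Nat.succ_ne_zero n
      exact (mul_eq_zero.1 h1).resolve_right this

/-- The coefficients of `exp (T + T ^ p / p)`. -/
def ahCoeff (k : Type*) [Field k] (p : ℕ) : ℕ → k
  | 0 => 1
  | n + 1 => (ahCoeff k p n + if p ≤ n + 1 then ahCoeff k p (n + 1 - max p 1) else 0) / (n + 1)
termination_by n => n
decreasing_by all_goals omega

theorem ahCoeff_zero (k : Type*) [Field k] (p : ℕ) : ahCoeff k p 0 = 1 := by rw [ahCoeff]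

theorem ahCoeff_succ (k : Type*) [Field k] [CharZero k] (p : ℕ) (hp : 1 ≤ p) (n : ℕ) :
    ((n : k) + 1) * ahCoeff k p (n + 1) =
      ahCoeff k p n + if p ≤ n + 1 then ahCoeff k p (n + 1 - p) else 0 := by
  have : ((n : k) + 1) ≠ 0 := by exact_mod_cast Nat.succ_ne_zero n
  rw [ahCoeff, max_eq_left hp]
  field_simp

theorem ahCoeff_of_lt (k : Type*) [Field k] [CharZero k] (p : ℕ) {n : ℕ} (h : n < p) :
    ahCoeff k p n * (n.factorial : k) = 1 := by
  induction n with
  | zero => simp [ahCoeff_zero]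
  | succ n ih =>
    have h1 := ahCoeff_succ k p (by omega) n
    rw [if_neg (by omega), add_zero] at h1
    rw [Nat.factorial_succ, ← ih (by omega), ← h1]
    push_cast; ring

open PowerSeries in
/-- The power series `exp (T + T ^ p / p)`. -/
def ahSeries (k : Type*) [Field k] (p : ℕ) : k⟦X⟧ := mk (ahCoeff k p)

open PowerSeries in
/-- The power series `exp (c T ^ p)`. -/
def expPow {k : Type*} [Field k] (p : ℕ) (c : k) : k⟦X⟧ :=
  mk fun n => if p ∣ n then c ^ (n / p) / ((n / p).factorial : k) else 0

open PowerSeries in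
theorem derivative_ahSeries (k : Type*) [Field k] [CharZero k] (p : ℕ) (hp : 1 ≤ p) :
    d⁄dX k (ahSeries k p) = (1 + X ^ (p - 1)) * ahSeries k p := by
  ext n
  rw [coeff_derivative, add_mul, one_mul, map_add, coeff_X_pow_mul', ahSeries, coeff_mk, coeff_mk,
    mul_comm, ahCoeff_succ k p hp]
  congr 1
  by_cases h : p ≤ n + 1
  · rw [if_pos h, if_pos (by omega), coeff_mk]; congr 1; omega
  · rw [if_neg h, if_neg (by omega)]

open PowerSeries in
theorem derivative_expPow {k : Type*} [Field k] [CharZero k] (p : ℕ) (hp : 1 ≤ p) (c : k) :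
    d⁄dX k (expPow p c) = ((p : k⟦X⟧) * C c * X ^ (p - 1)) * expPow p c := by
  ext n
  rw [mul_assoc, mul_assoc, ← map_natCast (C (R := k)), coeff_C_mul, coeff_C_mul,
    coeff_derivative, coeff_X_pow_mul', expPow, coeff_mk, coeff_mk]
  by_cases h : p ∣ n + 1
  · obtain ⟨m, hm⟩ := h
    obtain ⟨m, rfl⟩ : ∃ m', m = m' + 1 := ⟨m - 1, by
      have : m ≠ 0 := by rintro rfl; simp at hm
      omega⟩
    have hn : n - (p - 1) = p * m := by
      rw [mul_add] at hm; omega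
    have hle : p - 1 ≤ n := by rw [mul_add] at hm; omega
    rw [hn, if_pos hle, hm, if_pos (dvd_mul_right _ _), if_pos (dvd_mul_right _ _),
      Nat.mul_div_cancel_left _ hp, Nat.mul_div_cancel_left _ hp]
    have h1 : ((n : k) + 1) = p * (m + 1) := by exact_mod_cast hm
    have h2 : ((m : k) + 1) ≠ 0 := by exact_mod_cast Nat.succ_ne_zero m
    have h3 : (m.factorial : k) ≠ 0 := by exact_mod_cast m.factorial_ne_zero
    rw [h1, Nat.factorial_succ]
    push_cast
    field_simp
    ring
  · rw [if_neg h]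
    split_ifs with h1 h2
    · exfalso; apply h
      have : n + 1 = (n - (p - 1)) + p := by omega
      rw [this]; exact dvd_add h2 dvd_rfl
    all_goals simp

open PowerSeries in
theorem constantCoeff_expPow {k : Type*} [Field k] (p : ℕ) (c : k) :
    constantCoeff (expPow p c) = 1 := by
  rw [← coeff_zero_eq_constantCoeff_apply, expPow, coeff_mk]; simp

open PowerSeries in
theorem constantCoeff_ahSeries (k : Type*) [Field k] (p : ℕ) :
    constantCoeff (ahSeries k p) = 1 := by
  rw [← coeff_zero_eq_constantCoeff_apply, ahSeries, coeff_mk, ahCoeff_zero]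

open PowerSeries in
theorem ahSeries_pow (k : Type*) [Field k] [CharZero k] (p : ℕ) (hp : 1 ≤ p) :
    ahSeries k p ^ p = expPow p 1 * expPow 1 (p : k) := by
  rw [← sub_eq_zero]
  refine PowerSeries.eq_zero_of_derivative_eq (f := (p : k⟦X⟧) * (1 + X ^ (p - 1))) ?_ ?_
  · obtain ⟨m, rfl⟩ : ∃ m, p = m + 1 := ⟨p - 1, by omega⟩
    rw [map_sub, derivative_pow, derivative_ahSeries k _ hp, Derivation.leibniz,
      derivative_expPow _ hp, derivative_expPow _ le_rfl, map_natCast, map_one]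
    simp only [smul_eq_mul, Nat.add_sub_cancel, Nat.sub_self, pow_zero]
    push_cast
    ring
  · simp [constantCoeff_expPow, constantCoeff_ahSeries]

open PowerSeries in
theorem ahSeries_pow_mul (k : Type*) [Field k] [CharZero k] (p : ℕ) (hp : 1 ≤ p) :
    ahSeries k p ^ p * expPow p (-1) = expPow 1 (p : k) := by
  rw [← sub_eq_zero]
  refine PowerSeries.eq_zero_of_derivative_eq (f := (p : k⟦X⟧)) ?_ ?_
  · obtain ⟨m, rfl⟩ : ∃ m, p = m + 1 := ⟨p - 1, by omega⟩
    rw [map_sub, Derivation.leibniz, derivative_pow, derivative_ahSeries k _ hp,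
      derivative_expPow _ hp, derivative_expPow _ le_rfl, map_natCast, map_neg, map_one]
    simp only [smul_eq_mul, Nat.add_sub_cancel, Nat.sub_self, pow_zero]
    push_cast
    ring
  · simp [constantCoeff_expPow, constantCoeff_ahSeries]

theorem PadicInt.exists_mul_natCast_eq_one (p : ℕ) [Fact p.Prime] {n : ℕ} (h : ¬ p ∣ n) :
    ∃ u : ℤ_[p], u * n = 1 := by
  have : IsUnit (n : ℤ_[p]) := by
    rw [PadicInt.isUnit_iff, PadicInt.norm_natCast_eq_one_iff]
    exact ((Nat.Prime.coprime_iff_not_dvd Fact.out).2 h)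
  exact this.exists_left_inv

theorem not_dvd_factorial_of_lt {p : ℕ} [Fact p.Prime] {n : ℕ} (h : n < p) :
    ¬ p ∣ n.factorial := by
  rw [Nat.Prime.dvd_factorial Fact.out]; omega

open PowerSeries in
theorem exists_expPow_one_coeff (p : ℕ) [Fact p.Prime] (i : ℕ) (hi : i < p ^ 2) :
    ∃ u : ℤ_[p], coeff i (expPow 1 (p : ℚ_[p])) = ((p ^ (i - i / p) * u : ℤ_[p]) : ℚ_[p]) := by
  have hp : 1 < p := (Fact.out : p.Prime).one_lt
  simp only [expPow, coeff_mk, one_dvd, if_true, Nat.div_one]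
  induction i with
  | zero => exact ⟨1, by simp⟩
  | succ i ih =>
    obtain ⟨u, hu⟩ := ih (by omega)
    have h1 : ((i : ℚ_[p]) + 1) ≠ 0 := by exact_mod_cast Nat.succ_ne_zero i
    have h0 : (i.factorial : ℚ_[p]) ≠ 0 := by exact_mod_cast i.factorial_ne_zero
    have hstep : (p : ℚ_[p]) ^ (i + 1) / ((i + 1).factorial : ℚ_[p]) * (i + 1) =
        p * ((p : ℚ_[p]) ^ i / (i.factorial : ℚ_[p])) := by
      rw [Nat.factorial_succ, pow_succ]; push_cast; field_simp
    have hle : i / p ≤ i := Nat.div_le_self _ _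
    by_cases hd : p ∣ i + 1
    · have hdiv : (i + 1) / p = i / p + 1 := by
        rw [Nat.succ_div, if_pos hd]
      obtain ⟨m, hm⟩ := hd
      have hm0 : m ≠ 0 := by rintro rfl; simp at hm
      have hmp : m < p := by
        rw [hm, sq] at hi
        exact Nat.lt_of_mul_lt_mul_left hi
      obtain ⟨v, hv⟩ := PadicInt.exists_mul_natCast_eq_one p (n := m)
        (fun h => by have := Nat.le_of_dvd (by omega) h; omega)
      refine ⟨u * v, ?_⟩
      rw [hdiv, show i + 1 - (i / p + 1) = i - i / p by omega]
      have h2 : ((i : ℚ_[p]) + 1) = p * m := by exact_mod_cast hm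
      have hp0 : (p : ℚ_[p]) ≠ 0 := by exact_mod_cast (Fact.out : p.Prime).ne_zero
      have hm0' : (m : ℚ_[p]) ≠ 0 := by exact_mod_cast hm0
      have hv' : (v : ℚ_[p]) * m = 1 := by exact_mod_cast congrArg (fun z : ℤ_[p] => (z : ℚ_[p])) hv
      rw [h2, hu] at hstep
      have : (p : ℚ_[p]) ^ (i + 1) / ((i + 1).factorial : ℚ_[p]) * m =
          ((p ^ (i - i / p) * u : ℤ_[p]) : ℚ_[p]) := by
        apply mul_left_cancel₀ hp0
        rw [← hstep]; ring
      calc _ = (p : ℚ_[p]) ^ (i + 1) / ((i + 1).factorial : ℚ_[p]) * m * v := by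
            rw [mul_assoc, mul_comm _ (v : ℚ_[p]), hv', mul_one]
        _ = _ := by rw [this]; push_cast; ring
    · have hdiv : (i + 1) / p = i / p := by
        rw [Nat.succ_div, if_neg hd, add_zero]
      obtain ⟨v, hv⟩ := PadicInt.exists_mul_natCast_eq_one p hd
      have hv' : (v : ℚ_[p]) * (i + 1) = 1 := by
        exact_mod_cast congrArg (fun z : ℤ_[p] => (z : ℚ_[p])) hv
      refine ⟨u * v, ?_⟩
      rw [hdiv, show i + 1 - i / p = (i - i / p) + 1 by omega]
      calc _ = (p : ℚ_[p]) ^ (i + 1) / ((i + 1).factorial : ℚ_[p]) * (i + 1) * v := by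
            rw [mul_assoc, mul_comm _ (v : ℚ_[p]), hv', mul_one]
        _ = _ := by rw [hstep, hu]; push_cast; ring

open PowerSeries in
theorem exists_expPow_coeff (p : ℕ) [Fact p.Prime] (c : ℤ_[p]) (i : ℕ) (hi : i < p ^ 2) :
    ∃ u : ℤ_[p], coeff i (expPow p (c : ℚ_[p])) = (u : ℚ_[p]) := by
  rw [expPow, coeff_mk]
  split_ifs with h
  · have hlt : i / p < p := Nat.div_lt_of_lt_mul (by rwa [← sq])
    obtain ⟨v, hv⟩ := PadicInt.exists_mul_natCast_eq_one p (not_dvd_factorial_of_lt hlt)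
    have hv' : (v : ℚ_[p]) * ((i / p).factorial : ℚ_[p]) = 1 := by
      exact_mod_cast congrArg (fun z : ℤ_[p] => (z : ℚ_[p])) hv
    have h0 : ((i / p).factorial : ℚ_[p]) ≠ 0 := by exact_mod_cast (i / p).factorial_ne_zero
    refine ⟨c ^ (i / p) * v, ?_⟩
    rw [div_eq_iff h0]; push_cast; rw [mul_assoc, hv', mul_one]
  · exact ⟨0, by simp⟩

theorem expPow_coeff_mul {k : Type*} [Field k] [CharZero k] (p : ℕ) (hp : 1 ≤ p) {j : ℕ} (hj : j < p)
    (c : k) : PowerSeries.coeff (p * j) (expPow p c) = c ^ j * ahCoeff k p j := by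
  have h0 : (j.factorial : k) ≠ 0 := by exact_mod_cast j.factorial_ne_zero
  rw [expPow, PowerSeries.coeff_mk, if_pos (dvd_mul_right _ _), Nat.mul_div_cancel_left _ hp,
    div_eq_iff h0, mul_assoc, ahCoeff_of_lt k p hj, mul_one]

open PowerSeries in
theorem exists_ahCoeff (p : ℕ) [Fact p.Prime] (n : ℕ) (hn : n < p ^ 2) :
    ∃ u : ℤ_[p], ahCoeff ℚ_[p] p n = (u : ℚ_[p]) := by
  have hp : 1 < p := (Fact.out : p.Prime).one_lt
  induction n using Nat.strong_induction_on with
  | _ n ih =>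
    obtain rfl | hn0 := Nat.eq_zero_or_pos n
    · exact ⟨1, by simp [ahCoeff_zero]⟩
    have ih' : ∀ i : ℕ, ∃ u : ℤ_[p], i < n → ahCoeff ℚ_[p] p i = (u : ℚ_[p]) := by
      intro i
      by_cases h : i < n
      · obtain ⟨u, hu⟩ := ih i h (by omega); exact ⟨u, fun _ => hu⟩
      · exact ⟨0, fun h' => absurd h' h⟩
    choose a ha using ih'
    have hk : ∀ i : ℕ, ∃ u : ℤ_[p], i < p ^ 2 → coeff i (expPow p (1 : ℚ_[p])) = (u : ℚ_[p]) := by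
      intro i
      by_cases h : i < p ^ 2
      · obtain ⟨u, hu⟩ := exists_expPow_coeff p 1 i h; exact ⟨u, fun _ => by simpa using hu⟩
      · exact ⟨0, fun h' => absurd h' h⟩
    choose κ hκ using hk
    have hx : ∀ i : ℕ, ∃ u : ℤ_[p], i < p ^ 2 →
        coeff i (expPow 1 (p : ℚ_[p])) = ((p ^ (i - i / p) * u : ℤ_[p]) : ℚ_[p]) := by
      intro i
      by_cases h : i < p ^ 2
      · obtain ⟨u, hu⟩ := exists_expPow_one_coeff p i h; exact ⟨u, fun _ => hu⟩
      · exact ⟨0, fun h' => absurd h' h⟩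
    choose ξ hξ using hx
    set A : Polynomial ℤ_[p] := ∑ i ∈ Finset.range n, Polynomial.monomial i (a i) with hA
    have hAc : ∀ i, A.coeff i = if i < n then a i else 0 := by
      intro i; simp [hA, Polynomial.coeff_monomial]
    set c : ℤ_[p] →+* ℚ_[p] := PadicInt.Coe.ringHom with hc
    set As : ℚ_[p]⟦X⟧ := ((A.map c : Polynomial ℚ_[p]) : ℚ_[p]⟦X⟧) with hAs
    obtain ⟨B, hB⟩ : X ^ n ∣ ahSeries ℚ_[p] p - As := by
      rw [X_pow_dvd_iff]
      intro m hm
      rw [map_sub, ahSeries, coeff_mk, hAs, Polynomial.coeff_coe, Polynomial.coeff_map, hAc, if_pos hm,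
        ha m hm]
      exact sub_self _
    have hB' : ahSeries ℚ_[p] p = As + X ^ n * B := by rw [← hB]; ring
    have hB0 : constantCoeff B = ahCoeff ℚ_[p] p n := by
      have := congrArg (coeff n) hB'
      rw [ahSeries, coeff_mk, map_add, hAs, Polynomial.coeff_coe, Polynomial.coeff_map, hAc,
        if_neg (lt_irrefl n), map_zero, zero_add, coeff_X_pow_mul', if_pos le_rfl, Nat.sub_self] at this
      rw [this, coeff_zero_eq_constantCoeff_apply]
    have hA0 : constantCoeff As = 1 := by
      have h := hB'
      have := congrArg constantCoeff h
      rw [constantCoeff_ahSeries, map_add, map_mul, map_pow, constantCoeff_X,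
        zero_pow (by omega), zero_mul, add_zero] at this
      exact this.symm
    obtain ⟨R, hR⟩ := Polynomial.powAddExpansion As (X ^ n * B) p
    have hL : coeff n (ahSeries ℚ_[p] p ^ p) = c ((A ^ p).coeff n) + p * ahCoeff ℚ_[p] p n := by
      rw [hB', hR, map_add, map_add, hAs, ← Polynomial.coe_pow, Polynomial.coeff_coe,
        ← Polynomial.map_pow, Polynomial.coeff_map]
      have e1 : (p : ℚ_[p]⟦X⟧) * As ^ (p - 1) * (X ^ n * B) = X ^ n * ((p : ℚ_[p]⟦X⟧) * As ^ (p - 1) * B) := by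
        ring
      have e2 : R * (X ^ n * B) ^ 2 = X ^ n * (X ^ n * (R * B ^ 2)) := by ring
      rw [e2, coeff_X_pow_mul', if_pos le_rfl, Nat.sub_self, coeff_X_pow_mul', if_neg (by omega),
        add_zero, ← hAs, e1, coeff_X_pow_mul', if_pos le_rfl, Nat.sub_self,
        coeff_zero_eq_constantCoeff_apply, map_mul, map_mul, map_pow, hA0, hB0]
      simp
    have hξ0 : ξ 0 = 1 := by
      have := hξ 0 (by positivity)
      rw [coeff_zero_eq_constantCoeff_apply, constantCoeff_expPow] at this
      simp at this
      exact Subtype.ext this.symm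
    have hRHS : coeff n (expPow p (1 : ℚ_[p]) * expPow 1 (p : ℚ_[p])) =
        c (∑ x ∈ Finset.HasAntidiagonal.antidiagonal n, κ x.1 * (p ^ (x.2 - x.2 / p) * ξ x.2)) := by
      rw [coeff_mul, map_sum]
      refine Finset.sum_congr rfl fun x hx => ?_
      rw [Finset.HasAntidiagonal.mem_antidiagonal] at hx
      rw [hκ _ (by omega), hξ _ (by omega), map_mul]
      rfl
    have hmod : (p : ℤ_[p]) ∣ (∑ x ∈ Finset.HasAntidiagonal.antidiagonal n,
        κ x.1 * (p ^ (x.2 - x.2 / p) * ξ x.2)) - κ n := by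
      rw [← Finset.add_sum_erase _ _ (show (n, 0) ∈ Finset.HasAntidiagonal.antidiagonal n by simp)]
      simp only [Nat.zero_div, Nat.sub_self, pow_zero, hξ0, mul_one, add_sub_cancel_left]
      refine Finset.dvd_sum fun x hx => ?_
      rw [Finset.mem_erase, Finset.HasAntidiagonal.mem_antidiagonal] at hx
      have hx2 : x.2 ≠ 0 := by
        intro h; apply hx.1; ext <;> simp <;> omega
      have : x.2 / p < x.2 := Nat.div_lt_self (by omega) hp
      exact dvd_mul_of_dvd_right (dvd_mul_of_dvd_left (dvd_pow_self _ (by omega)) _) _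
    have hmod2 : (p : ℤ_[p]) ∣ (A ^ p).coeff n - κ n := by
      have hker : ∀ z : ℤ_[p], PadicInt.toZMod z = 0 → (p : ℤ_[p]) ∣ z := by
        intro z hz
        rw [← RingHom.mem_ker, PadicInt.ker_toZMod, PadicInt.maximalIdeal_eq_span_p,
          Ideal.mem_span_singleton] at hz
        exact hz
      apply hker
      rw [map_sub, ← Polynomial.coeff_map, Polynomial.map_pow, ← ZMod.expand_card,
        Polynomial.coeff_expand (by omega), sub_eq_zero]
      split_ifs with hd
      · obtain ⟨j, rfl⟩ := hd
        have hj : j < p := by rw [sq] at hn; exact Nat.lt_of_mul_lt_mul_left hn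
        have hj0 : j ≠ 0 := by rintro rfl; simp at hn0
        have hjn : j < p * j := by nlinarith [Nat.pos_of_ne_zero hj0]
        rw [Nat.mul_div_cancel_left _ (by omega), Polynomial.coeff_map, hAc, if_pos hjn]
        congr 1
        have h1 := hκ (p * j) hn
        rw [expPow_coeff_mul p (by omega) hj, one_pow, one_mul, ha j hjn] at h1
        exact Subtype.ext h1
      · have h1 := hκ n hn
        rw [expPow, coeff_mk, if_neg hd] at h1
        have : κ n = 0 := Subtype.ext h1.symm
        rw [this, map_zero]
    obtain ⟨v, hv⟩ := dvd_sub hmod hmod2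
    refine ⟨v, ?_⟩
    have hp0 : (p : ℚ_[p]) ≠ 0 := by exact_mod_cast (Fact.out : p.Prime).ne_zero
    apply mul_left_cancel₀ hp0
    have := congrArg (coeff n) (ahSeries_pow ℚ_[p] p (by omega))
    rw [hL, hRHS] at this
    have h3 : (p : ℚ_[p]) * v = c (p * v) := by rw [map_mul, map_natCast]; rfl
    rw [h3, ← hv, map_sub, map_sub, map_sub, ← this]
    ring

open Polynomial in
/-- Truncated Artin-Hasse coefficients modulo `p ^ M`. -/
theorem exists_artinHasse (p M : ℕ) [Fact p.Prime] (hM : M < p) :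
    ∃ e : ℕ → ZMod (p ^ M), e 0 = 1 ∧
      (∀ i, i + 1 < p ^ 2 →
        ((i : ZMod (p ^ M)) + 1) * e (i + 1) = e i + if p ≤ i + 1 then e (i + 1 - p) else 0) ∧
      (∀ i, p ^ 2 ≤ i → e i = 0) ∧
      (X : (ZMod (p ^ M))[X]) ^ p ^ 2 ∣
        (∑ i ∈ Finset.range (p ^ 2), monomial i (e i)) ^ p *
          (∑ j ∈ Finset.range p, monomial (p * j) ((-1) ^ j * e j)) -
        ∑ j ∈ Finset.range p, monomial j ((p : ZMod (p ^ M)) ^ j * e j) := by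
  have hp : 1 < p := (Fact.out : p.Prime).one_lt
  have hlt : ∀ {i}, i < p → i < p ^ 2 := fun h => by nlinarith
  have hε : ∀ i : ℕ, ∃ u : ℤ_[p], i < p ^ 2 → ahCoeff ℚ_[p] p i = (u : ℚ_[p]) := by
    intro i
    by_cases h : i < p ^ 2
    · obtain ⟨u, hu⟩ := exists_ahCoeff p i h; exact ⟨u, fun _ => hu⟩
    · exact ⟨0, fun h' => absurd h' h⟩
  choose ε hε using hε
  have hx : ∀ i : ℕ, ∃ u : ℤ_[p], i < p ^ 2 →
      PowerSeries.coeff i (expPow 1 (p : ℚ_[p])) = ((p ^ (i - i / p) * u : ℤ_[p]) : ℚ_[p]) := by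
    intro i
    by_cases h : i < p ^ 2
    · obtain ⟨u, hu⟩ := exists_expPow_one_coeff p i h; exact ⟨u, fun _ => hu⟩
    · exact ⟨0, fun h' => absurd h' h⟩
  choose ξ hξ using hx
  set c : ℤ_[p] →+* ℚ_[p] := PadicInt.Coe.ringHom with hc
  have cinj : Function.Injective c := Subtype.coe_injective
  set E : ℤ_[p][X] := ∑ i ∈ Finset.range (p ^ 2), monomial i (ε i) with hE
  set K : ℤ_[p][X] := ∑ j ∈ Finset.range p, monomial (p * j) ((-1) ^ j * ε j) with hK
  have hEc : ∀ i, E.coeff i = if i < p ^ 2 then ε i else 0 := by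
    intro i; simp [hE, coeff_monomial]
  have hKc : ∀ i < p ^ 2, c (K.coeff i) = PowerSeries.coeff i (expPow p (-1 : ℚ_[p])) := by
    intro i hi
    by_cases hd : p ∣ i
    · obtain ⟨j, rfl⟩ := hd
      have hj : j < p := by rw [sq] at hi; exact Nat.lt_of_mul_lt_mul_left hi
      rw [expPow_coeff_mul p (by omega) hj, hε j (hlt hj), hK, finsetSum_coeff,
        Finset.sum_eq_single j]
      · rw [coeff_monomial, if_pos rfl, map_mul, map_pow, map_neg, map_one]; rfl
      · intro b _ hb
        rw [coeff_monomial, if_neg fun h => hb (Nat.eq_of_mul_eq_mul_left (by omega) h)]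
      · intro h; exact absurd (Finset.mem_range.2 hj) h
    · rw [expPow, PowerSeries.coeff_mk, if_neg hd, hK, finsetSum_coeff, Finset.sum_eq_zero, map_zero]
      intro b _
      rw [coeff_monomial, if_neg]
      rintro rfl; exact hd (dvd_mul_right _ _)
  have hEpow : ∀ r i, i < p ^ 2 →
      c ((E ^ r).coeff i) = PowerSeries.coeff i (ahSeries ℚ_[p] p ^ r) := by
    intro r
    induction r with
    | zero => intro i _; simp [coeff_one, PowerSeries.coeff_one, apply_ite c]
    | succ r ih =>
      intro i hi
      rw [pow_succ, pow_succ, coeff_mul, PowerSeries.coeff_mul, map_sum]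
      refine Finset.sum_congr rfl fun x hx => ?_
      rw [Finset.HasAntidiagonal.mem_antidiagonal] at hx
      rw [map_mul, ih _ (by omega), hEc, if_pos (by omega), ahSeries, PowerSeries.coeff_mk,
        hε x.2 (by omega)]
      rfl
  have hmain : ∀ i < p ^ 2, (E ^ p * K).coeff i = p ^ (i - i / p) * ξ i := by
    intro i hi
    apply cinj
    have : c (p ^ (i - i / p) * ξ i) = PowerSeries.coeff i (expPow 1 (p : ℚ_[p])) := (hξ i hi).symm
    rw [this, ← ahSeries_pow_mul ℚ_[p] p (by omega), coeff_mul, PowerSeries.coeff_mul, map_sum]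
    refine Finset.sum_congr rfl fun x hx => ?_
    rw [Finset.HasAntidiagonal.mem_antidiagonal] at hx
    rw [map_mul, hEpow _ _ (by omega), hKc _ (by omega)]
  set φ : ℤ_[p] →+* ZMod (p ^ M) := PadicInt.toZModPow M with hφ
  have hpM : (p : ZMod (p ^ M)) ^ M = 0 := by
    have := ZMod.natCast_self (p ^ M); push_cast at this; exact this
  refine ⟨fun i => if i < p ^ 2 then φ (ε i) else 0, ?_, ?_, ?_, ?_⟩
  · have h1 := hε 0 (by positivity)
    rw [ahCoeff_zero] at h1
    have : ε 0 = 1 := Subtype.ext h1.symm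
    simp only [this, map_one]
    exact if_pos (by positivity)
  · intro i hi
    have h1 := ahCoeff_succ ℚ_[p] p (by omega) i
    have h2 : ((i : ℤ_[p]) + 1) * ε (i + 1) = ε i + if p ≤ i + 1 then ε (i + 1 - p) else 0 := by
      apply cinj
      rw [map_mul, map_add, map_add, map_one, map_natCast, apply_ite c, map_zero]
      rw [hε _ hi, hε _ (by omega), hε (i + 1 - p) (by omega)] at h1
      exact h1
    have h3 := congrArg φ h2
    rw [map_mul, map_add, map_add, map_one, map_natCast, apply_ite φ, map_zero] at h3
    simp only [if_pos hi, if_pos (show i < p ^ 2 by omega), if_pos (show i + 1 - p < p ^ 2 by omega)]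
    exact h3
  · intro i hi
    exact if_neg (by omega)
  · have h1 : (∑ i ∈ Finset.range (p ^ 2), monomial i (if i < p ^ 2 then φ (ε i) else 0)) = E.map φ := by
      rw [hE, Polynomial.map_sum]
      refine Finset.sum_congr rfl fun i hi => ?_
      rw [if_pos (Finset.mem_range.1 hi), map_monomial]
    have h2 : (∑ j ∈ Finset.range p, monomial (p * j) ((-1) ^ j * if j < p ^ 2 then φ (ε j) else 0)) =
        K.map φ := by
      rw [hK, Polynomial.map_sum]
      refine Finset.sum_congr rfl fun i hi => ?_
      rw [if_pos (hlt (Finset.mem_range.1 hi)), map_monomial]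
      simp only [map_mul φ, map_pow φ, map_neg φ, map_one φ]
    rw [h1, h2, ← Polynomial.map_pow, ← Polynomial.map_mul, X_pow_dvd_iff]
    intro i hi
    rw [coeff_sub, coeff_map, hmain i hi, finsetSum_coeff, sub_eq_zero]
    simp only [coeff_monomial, Finset.sum_ite_eq', Finset.mem_range]
    by_cases hip : i < p
    · rw [if_pos hip, if_pos hi, ← map_natCast φ, ← map_pow, ← map_mul]
      congr 1
      apply cinj
      have : c (p ^ (i - i / p) * ξ i) = PowerSeries.coeff i (expPow 1 (p : ℚ_[p])) := (hξ i hi).symm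
      have h3 := ahCoeff_of_lt ℚ_[p] p hip
      have h0 : (i.factorial : ℚ_[p]) ≠ 0 := by exact_mod_cast i.factorial_ne_zero
      rw [this, expPow, PowerSeries.coeff_mk, if_pos (one_dvd _), Nat.div_one, div_eq_iff h0, map_mul,
        map_pow, map_natCast, mul_assoc]
      rw [hε i hi] at h3
      rw [show c (ε i) * (i.factorial : ℚ_[p]) = 1 from h3, mul_one]
    · rw [if_neg hip, map_mul, map_pow, map_natCast]
      have h4 : M ≤ i - i / p := by
        have h5 : p * (i / p) + i % p = i := Nat.div_add_mod i p
        have h6 : 1 ≤ i / p := Nat.div_pos (by omega) (by omega)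
        have h7 : (p - 1) * (i / p) + i / p = p * (i / p) := by
          rw [← Nat.succ_mul]; congr 1; omega
        have h8 : p - 1 ≤ (p - 1) * (i / p) := Nat.le_mul_of_pos_right _ h6
        omega
      obtain ⟨t, ht⟩ := Nat.exists_eq_add_of_le h4
      rw [ht, pow_add, hpM, zero_mul, zero_mul]

/-- A ring `O` with residue field `F`, whose maximal ideal is generated by a `(p-1)`-st root of `-p`,
together with multiplicative representatives of the residue field. -/
structure PiRing (p : ℕ) (F O : Type*) [Field F] [CommRing O] where
  pi : O
  res : O →+* F
  teich : F →*₀ O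
  pi_pow : pi ^ (p - 1) = -p
  pi_reg : ∀ x, pi * x = 0 → x = 0
  dvd_of_res : ∀ x, res x = 0 → pi ∣ x
  res_pi : res pi = 0
  res_teich : ∀ x, res (teich x) = x

open Polynomial in
theorem PiRing.exists_piRing (p : ℕ) [Fact p.Prime] (F : Type) [Field F] [CharP F p] [PerfectRing F p] :
    ∃ (O : Type) (_ : CommRing O), Nonempty (PiRing p F O) := by
  have hp : 1 < p := (Fact.out : p.Prime).one_lt
  set W := WittVector p F
  set f : W[X] := X ^ (p - 1) + C (p : W) with hf
  have hmon : f.Monic := monic_X_pow_add_C _ (by omega)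
  have hres : eval₂ (WittVector.constantCoeff : W →+* F) 0 f = 0 := by
    rw [hf, eval₂_add, eval₂_pow, eval₂_X, zero_pow (by omega), eval₂_C, map_natCast, zero_add,
      CharP.cast_eq_zero]
  set O := AdjoinRoot f
  set π : O := AdjoinRoot.root f
  have hpi : π ^ (p - 1) = -(p : O) := by
    have := AdjoinRoot.eval₂_root f
    rw [hf, eval₂_add, eval₂_pow, eval₂_X, eval₂_C, map_natCast] at this
    exact eq_neg_of_add_eq_zero_left this
  have hW : ∀ w : W, WittVector.constantCoeff w = 0 → (p : W) ∣ w := by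
    intro w hw
    by_cases h0 : w = 0
    · rw [h0]; exact dvd_zero _
    obtain ⟨m, b, hb, hab⟩ := WittVector.exists_eq_pow_p_mul w h0
    have hm : m ≠ 0 := by
      rintro rfl
      apply hb
      rw [pow_zero, one_mul] at hab
      rw [← hab]; exact hw
    rw [hab]
    exact dvd_mul_of_dvd_left (dvd_pow_self _ hm) _
  have hpd : π ∣ (p : O) := by
    rw [← neg_neg (p : O), ← hpi, dvd_neg]
    exact dvd_pow_self _ (by omega)
  have hfree : Module.Free W O := hmon.free_adjoinRoot
  refine ⟨O, inferInstance, ⟨⟨π, AdjoinRoot.lift WittVector.constantCoeff 0 hres,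
    { toFun := fun x => AdjoinRoot.of f (WittVector.teichmuller p x)
      map_zero' := by simp
      map_one' := by simp
      map_mul' := by intro x y; simp }, hpi, ?_, ?_, ?_, ?_⟩⟩⟩
  · intro x hx
    have h1 : (p : W) • x = 0 := by
      rw [Nat.cast_smul_eq_nsmul, nsmul_eq_mul, ← neg_neg (p : O), ← hpi,
        show p - 1 = (p - 2) + 1 by omega, pow_succ, neg_mul, mul_assoc, hx, mul_zero, neg_zero]
    exact (smul_eq_zero.1 h1).resolve_left (WittVector.p_nonzero p F)
  · intro x hx
    obtain ⟨g, rfl⟩ := AdjoinRoot.mk_surjective x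
    rw [← divX_mul_X_add g, map_add, map_mul] at hx ⊢
    rw [AdjoinRoot.mk_X, AdjoinRoot.mk_C] at hx ⊢
    refine dvd_add (dvd_mul_left _ _) ?_
    rw [map_add, map_mul, AdjoinRoot.lift_root, mul_zero, zero_add, AdjoinRoot.lift_of] at hx
    obtain ⟨v, hv⟩ := hW _ hx
    rw [hv, map_mul, map_natCast]
    exact dvd_mul_of_dvd_left hpd _
  · exact AdjoinRoot.lift_root _
  · intro x
    change AdjoinRoot.lift WittVector.constantCoeff 0 hres (AdjoinRoot.of f _) = x
    rw [AdjoinRoot.lift_of]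
    simp

namespace PiRing

variable {p : ℕ} {F O : Type*} [Field F] [CommRing O] (P : PiRing p F O)
include P

theorem pi_pow_reg (k : ℕ) (x : O) (h : P.pi ^ k * x = 0) : x = 0 := by
  induction k with
  | zero => simpa using h
  | succ k ih =>
    rw [pow_succ', mul_assoc] at h
    exact ih (P.pi_reg _ h)

theorem pi_dvd_of_mul {u x : O} (hu : P.res u ≠ 0) (h : P.pi ∣ u * x) : P.pi ∣ x := by
  apply P.dvd_of_res
  obtain ⟨c, hc⟩ := h
  have := congrArg P.res hc
  rw [map_mul, map_mul, P.res_pi, zero_mul] at this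
  exact (mul_eq_zero.1 this).resolve_left hu

theorem pi_pow_dvd_of_mul {u x : O} (hu : P.res u ≠ 0) (k : ℕ) (h : P.pi ^ k ∣ u * x) :
    P.pi ^ k ∣ x := by
  induction k with
  | zero => simp
  | succ k ih =>
    obtain ⟨y, rfl⟩ := ih ((pow_dvd_pow _ (by omega)).trans h)
    obtain ⟨c, hc⟩ := h
    have h1 : u * y - P.pi * c = 0 := by
      apply P.pi_pow_reg k
      rw [pow_succ] at hc
      linear_combination hc
    rw [pow_succ]
    exact mul_dvd_mul_left _ (P.pi_dvd_of_mul hu ⟨c, sub_eq_zero.1 h1⟩)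

theorem natCast_eq : (p : O) = -P.pi ^ (p - 1) := by rw [P.pi_pow, neg_neg]

theorem natCast_pow_eq (m : ℕ) : (p : O) ^ m = (-1) ^ m * P.pi ^ ((p - 1) * m) := by
  rw [pow_mul, P.pi_pow, ← mul_pow]; ring

theorem natCast_pow_dvd_iff (m : ℕ) (x : O) : (p : O) ^ m ∣ x ↔ P.pi ^ ((p - 1) * m) ∣ x := by
  rw [P.natCast_pow_eq]
  constructor
  · intro h; exact (dvd_mul_left _ _).trans h
  · rintro ⟨c, hc⟩
    refine ⟨(-1) ^ m * c, ?_⟩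
    rw [hc]
    have : ((-1 : O)) ^ m * (-1) ^ m = 1 := by rw [← mul_pow]; simp
    linear_combination (-(P.pi ^ ((p - 1) * m) * c)) * this

omit P in
theorem add_pow_prime_expansion (hp : p.Prime) (x y : O) :
    ∃ s : O, (x + y) ^ p = x ^ p + p * x ^ (p - 1) * y + p * y ^ 2 * s + y ^ p := by
  obtain ⟨q, rfl⟩ : ∃ q, p = q + 2 := ⟨p - 2, by have := hp.two_le; omega⟩
  have h : ((q + 2 : ℕ) : O) * y ^ 2 ∣ ∑ m ∈ Finset.range q,
      y ^ (m + 1 + 1) * x ^ (q + 2 - (m + 1 + 1)) * ((q + 2).choose (m + 1 + 1) : O) := by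
    refine Finset.dvd_sum fun m hm => ?_
    rw [Finset.mem_range] at hm
    obtain ⟨c, hc⟩ := hp.dvd_choose_self (k := m + 1 + 1) (by omega) (by omega)
    rw [hc]
    exact ⟨y ^ m * x ^ (q + 2 - (m + 1 + 1)) * c, by push_cast; ring⟩
  obtain ⟨s, hs⟩ := h
  refine ⟨s, ?_⟩
  rw [add_comm x y, add_pow, Finset.sum_range_succ, Finset.sum_range_succ', Finset.sum_range_succ', hs]
  simp
  ring

theorem pow_congr (hp : p.Prime) (A B : O) (k : ℕ) (hk : 1 ≤ k) (h : P.pi ^ k ∣ A - B) :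
    P.pi ^ (k + 1) ∣ A ^ p - B ^ p := by
  have h2 := hp.two_le
  obtain ⟨y, hy⟩ := h
  obtain ⟨s, hs⟩ := add_pow_prime_expansion hp B (A - B)
  rw [add_sub_cancel] at hs
  have hpp : P.pi ∣ (p : O) := by
    rw [P.natCast_eq, dvd_neg]; exact dvd_pow_self _ (by omega)
  have e : A ^ p - B ^ p = p * (P.pi ^ k * (B ^ (p - 1) * y + y * (A - B) * s)) + P.pi ^ (k * p) * y ^ p := by
    rw [hs, pow_mul, ← mul_pow, ← hy]
    linear_combination ((p : O) * B ^ (p - 1) + p * (A - B) * s) * hy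
  rw [e]
  refine dvd_add ?_ ?_
  · rw [pow_succ']
    exact mul_dvd_mul hpp (dvd_mul_right _ _)
  · refine dvd_mul_of_dvd_left (pow_dvd_pow _ ?_) _
    nlinarith

theorem congr_of_pow_congr (hp : p.Prime) (m : ℕ) (hm : 2 ≤ (p - 1) * m) (A B : O)
    (hB : P.res B ≠ 0) (h2 : P.pi ^ 2 ∣ A - B)
    (h : (p : O) ^ (m + 1) ∣ A ^ p - B ^ p) : (p : O) ^ m ∣ A - B := by
  have hp2 := hp.two_le
  rw [P.natCast_pow_dvd_iff] at h ⊢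
  suffices ∀ k, k + 2 ≤ (p - 1) * m → P.pi ^ (k + 2) ∣ A - B by
    have := this ((p - 1) * m - 2) (by omega)
    rwa [Nat.sub_add_cancel hm] at this
  intro k
  induction k with
  | zero => intro _; exact h2
  | succ k ih =>
    intro hk
    obtain ⟨y, hy⟩ := ih (by omega)
    obtain ⟨s, hs⟩ := add_pow_prime_expansion hp B (A - B)
    rw [add_sub_cancel] at hs
    obtain ⟨c, hc⟩ := (pow_dvd_pow P.pi (show (k + 2) + (p - 1) + 1 ≤ (p - 1) * (m + 1) by
      rw [mul_add, mul_one]; omega)).trans h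
    obtain ⟨t, ht⟩ := Nat.exists_eq_add_of_le (show (k + 2) + (p - 1) + 1 ≤ (k + 2) * p by
      have : (k + 2) * p = k * p + 2 * p := by ring
      have : k ≤ k * p := Nat.le_mul_of_pos_right _ hp.pos
      omega)
    have hpe := P.natCast_eq
    have h0 : P.pi ^ ((k + 2) + (p - 1)) *
        (B ^ (p - 1) * y + P.pi * (P.pi ^ (k + 1) * y ^ 2 * s - P.pi ^ t * y ^ p + c)) = 0 := by
      have e1 : (A - B) ^ p = P.pi ^ ((k + 2) + (p - 1)) * P.pi * P.pi ^ t * y ^ p := by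
        rw [hy, mul_pow, ← pow_mul, ht]; ring
      rw [e1, hy, hpe] at hs
      have e2 : P.pi ^ (k + 2 + (p - 1)) = P.pi ^ (k + 2) * P.pi ^ (p - 1) := pow_add _ _ _
      have e3 : P.pi ^ (k + 2 + (p - 1) + 1) = P.pi ^ (k + 2) * P.pi ^ (p - 1) * P.pi := by
        rw [pow_succ, e2]
      rw [e3] at hc
      rw [e2] at hs ⊢
      have e4 : P.pi ^ (k + 2) = P.pi ^ (k + 1) * P.pi := pow_succ _ _
      linear_combination hs - hc
    have h1 := P.pi_pow_reg _ _ h0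
    have h3 : P.pi ∣ y := by
      refine P.pi_dvd_of_mul (u := B ^ (p - 1)) (by rw [map_pow]; exact pow_ne_zero _ hB) ?_
      exact ⟨-(P.pi ^ (k + 1) * y ^ 2 * s - P.pi ^ t * y ^ p + c), by linear_combination h1⟩
    rw [hy, pow_succ]
    exact mul_dvd_mul_left _ h3

end PiRing

open Finset in
theorem prod_artinHasse_pow_eq_one {p m : ℕ} [Fact p.Prime] (hm : m < p) {R : Type*} [CommRing R]
    (ι : ZMod (p ^ m) →+* R) (π : R) (hπ : π ^ (p - 1) = -p) (e : ℕ → ZMod (p ^ m)) (he0 : e 0 = 1)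
    (he : (Polynomial.X : Polynomial (ZMod (p ^ m))) ^ p ^ 2 ∣
      (∑ i ∈ range (p ^ 2), Polynomial.monomial i (e i)) ^ p *
        (∑ j ∈ range p, Polynomial.monomial (p * j) ((-1) ^ j * e j)) -
        ∑ j ∈ range p, Polynomial.monomial j ((p : ZMod (p ^ m)) ^ j * e j))
    (n : ℕ) (u : ℕ → R) (hu : ∀ j, u (j + 1) = u j ^ p) (hn : u n = u 0) :
    (∏ j ∈ range n, ∑ i ∈ range (p ^ 2), ι (e i) * (π * u j) ^ i) ^ p = 1 := by
  have hp : 2 ≤ p := (Fact.out : p.Prime).two_le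
  have hpm : (p : R) ^ m = 0 := by
    rw [← Nat.cast_pow, ← map_natCast ι, ZMod.natCast_self, map_zero]
  have hnil : π ^ p ^ 2 = 0 := by
    have e1 : p ^ 2 = (p - 1) * (p + 1) + 1 := by
      obtain ⟨q, rfl⟩ : ∃ q, p = q + 1 := ⟨p - 1, by omega⟩
      simp; ring
    rw [e1, pow_add, pow_mul, hπ, neg_pow, show p + 1 = m + (p + 1 - m) by omega, pow_add (p : R), hpm]
    ring
  set K : R → R := fun y => ∑ j ∈ range p, ι (e j) * y ^ j with hK
  have hKu : ∀ x, IsUnit (K (p * x)) := by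
    intro x
    obtain ⟨q, hq⟩ : ∃ q, p = q + 1 := ⟨p - 1, by omega⟩
    have : K (p * x) = 1 + p * (x * ∑ j ∈ range q, ι (e (j + 1)) * (p * x) ^ j) := by
      simp only [hK]
      rw [show range p = range (q + 1) by rw [hq], sum_range_succ', he0, map_one, pow_zero, mul_one,
        add_comm, mul_sum, mul_sum]
      congr 1
      refine sum_congr rfl fun j _ => ?_
      rw [pow_succ]; ring
    rw [this]
    refine IsNilpotent.isUnit_one_add ?_
    exact Commute.isNilpotent_mul_right (Commute.all _ _) ⟨m, hpm⟩
  have key : ∀ j, (∑ i ∈ range (p ^ 2), ι (e i) * (π * u j) ^ i) ^ p * K (p * (π * u (j + 1))) =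
      K (p * (π * u j)) := by
    intro j
    obtain ⟨c, hc⟩ := he
    have h := congrArg (Polynomial.eval₂ ι (π * u j)) hc
    simp only [Polynomial.eval₂_sub, Polynomial.eval₂_mul, Polynomial.eval₂_pow,
      Polynomial.eval₂_finsetSum, Polynomial.eval₂_monomial, Polynomial.eval₂_X] at h
    rw [mul_pow π (u j) (p ^ 2), hnil, zero_mul, zero_mul, sub_eq_zero] at h
    convert h using 1
    · congr 1
      simp only [hK]
      refine sum_congr rfl fun i _ => ?_
      rw [hu, pow_mul, map_mul, map_pow, map_neg, map_one]
      have : (p : R) * (π * u j ^ p) = -1 * (π * u j) ^ p := by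
        rw [mul_pow]
        have : π ^ p = π ^ (p - 1) * π := by rw [← pow_succ]; congr 1; omega
        rw [this, hπ]; ring
      rw [this, mul_pow]; ring
    · simp only [hK]
      refine sum_congr rfl fun i _ => ?_
      rw [map_mul, map_pow, map_natCast, mul_pow]; ring
  have hprod : ∏ j ∈ range n, K (p * (π * u (j + 1))) = ∏ j ∈ range n, K (p * (π * u j)) := by
    have h1 := prod_range_succ (fun j => K (p * (π * u j))) n
    rw [prod_range_succ', hn] at h1
    exact (hKu _).mul_left_injective h1
  have hunit : IsUnit (∏ j ∈ range n, K (p * (π * u j))) := by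
    exact (IsUnit.prod_iff).2 fun j _ => hKu _
  apply hunit.mul_left_injective
  change _ * _ = _ * _
  rw [one_mul]
  nth_rw 1 [← hprod]
  rw [← prod_pow, ← prod_mul_distrib]
  exact prod_congr rfl fun j _ => key j

/-- A lifting of the additive characters of a finite field with `p ^ n` elements to a ring in which
`p ^ M = 0`, given by Dwork's splitting function with coefficients `e`. -/
structure DworkChar (p M n : ℕ) [Fact p.Prime] (e : ℕ → ZMod (p ^ M)) (F : Type*) [Field F] [Fintype F]
    [DecidableEq F] [Algebra (ZMod p) F] (R : Type*) [CommRing R] where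
  ι : ZMod (p ^ M) →+* R
  pi : R
  τ : F →*₀ R
  Ψ : AddChar F R
  pi_pow : pi ^ (p - 1) = -p
  Ψ_apply : ∀ x, Ψ x = ∏ t ∈ Finset.range n, ∑ i ∈ Finset.range (p ^ 2), ι (e i) * (pi * τ x ^ p ^ t) ^ i
  sum_τ : ∀ s : ℕ, ∑ x : Fˣ, τ x ^ s = if p ^ n - 1 ∣ s then ((p ^ n - 1 : ℕ) : R) else 0
  sum_Ψ : ∀ t : F, ∑ c : ZMod p, Ψ (c • t) =
    if Algebra.trace (ZMod p) F t = 0 then (p : R) else 0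
  dvd_of_cast : ∀ k : ℤ, (k : R) = 0 → ((p ^ M : ℕ) : ℤ) ∣ k
  τ_algebraMap : ∀ a : ZMod p, τ (algebraMap (ZMod p) F a) = ι ((a.val : ZMod (p ^ M)) ^ p ^ ((p - 1) * M))

namespace PiRing

variable {p : ℕ} {F O : Type*} [Field F] [CommRing O] (P : PiRing p F O)
include P

theorem pow_dvd_of_cast [CharP F p] (m : ℕ) (k : ℤ) (h : (p : O) ^ m ∣ (k : O)) :
    (p : ℤ) ^ m ∣ k := by
  induction m generalizing k with
  | zero => simp
  | succ m ih =>
    obtain ⟨c, hc⟩ := h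
    have h1 : ((k : ℤ) : F) = 0 := by
      rw [← map_intCast P.res, hc, map_mul, map_pow, map_natCast, CharP.cast_eq_zero, pow_succ,
        mul_zero, zero_mul]
    obtain ⟨k', rfl⟩ := (CharP.intCast_eq_zero_iff F p k).1 h1
    rw [pow_succ', ]
    refine mul_dvd_mul_left _ (ih _ ⟨c, ?_⟩)
    rw [← sub_eq_zero]
    apply P.pi_pow_reg (p - 1)
    rw [P.pi_pow]
    push_cast at hc
    linear_combination -hc

end PiRing

open Finset in
theorem exists_dworkChar (p M : ℕ) [Fact p.Prime] (hM : M + 2 < p) (hM0 : M ≠ 0) :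
    ∃ e : ℕ → ZMod (p ^ M), e 0 = 1 ∧ (∀ i, i + 1 < p ^ 2 → ((i : ZMod (p ^ M)) + 1) * e (i + 1) =
      e i + if p ≤ i + 1 then e (i + 1 - p) else 0) ∧ (∀ i, p ^ 2 ≤ i → e i = 0) ∧
      ∀ (n : ℕ) (_ : n ≠ 0) (F : Type) [Field F] [Fintype F] [DecidableEq F] [Algebra (ZMod p) F],
        Fintype.card F = p ^ n → ∃ (R : Type) (_ : CommRing R), Nonempty (DworkChar p M n e F R) := by
  have hp : p.Prime := Fact.out
  have hp2 := hp.two_le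
  obtain ⟨e, he0, hrec, hvan, hAH⟩ := exists_artinHasse p (M + 2) hM
  have hdvd : p ^ M ∣ p ^ (M + 2) := pow_dvd_pow _ (by omega)
  refine ⟨fun i => ZMod.castHom hdvd (ZMod (p ^ M)) (e i), by simp only [he0, map_one], ?_, ?_, ?_⟩
  · intro i hi
    have := congrArg (ZMod.castHom hdvd (ZMod (p ^ M))) (hrec i hi)
    rw [map_mul, map_add, map_add, map_natCast, map_one] at this
    rw [this]
    congr 1
    split_ifs <;> simp
  · intro i hi
    simp [hvan i hi]
  intro n hn F _ _ _ _ hcard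
  have hcharF : CharP F p := (Algebra.charP_iff (ZMod p) F p).1 inferInstance
  obtain ⟨O, _, ⟨P⟩⟩ := PiRing.exists_piRing p F
  have he1 : e 1 = 1 := by
    have := hrec 0 (by nlinarith)
    simpa [he0, show ¬ p ≤ 1 by omega] using this
  have hFr : ∀ (x : F), x ^ p ^ n = x := by
    intro x; rw [← hcard]; exact FiniteField.pow_card x
  have hone : Fact (1 < p ^ (M + 2)) := ⟨Nat.one_lt_pow (by omega) (by omega)⟩
  set E : O → O := fun x => ∑ i ∈ range (p ^ 2), ((e i).val : O) * x ^ i with hE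
  have hE1 : ∀ u, P.pi ^ 2 ∣ E (P.pi * u) - (1 + P.pi * u) := by
    intro u
    obtain ⟨q, hq⟩ : ∃ q, p ^ 2 = q + 2 := ⟨p ^ 2 - 2, (Nat.sub_add_cancel (by nlinarith)).symm⟩
    refine ⟨∑ i ∈ range q, ((e (i + 2)).val : O) * (P.pi ^ i * u ^ (i + 2)), ?_⟩
    simp only [hE, hq, sum_range_succ', he0, he1, ZMod.val_one]
    have : ∑ k ∈ range q, ((e (k + 1 + 1)).val : O) * (P.pi * u) ^ (k + 1 + 1) =
        P.pi ^ 2 * ∑ i ∈ range q, ((e (i + 2)).val : O) * (P.pi ^ i * u ^ (i + 2)) := by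
      rw [mul_sum]
      exact sum_congr rfl fun k _ => by ring
    rw [this]; push_cast; ring
  set z : F → O := fun t => ∏ j ∈ range n, E (P.pi * P.teich t ^ p ^ j) with hz
  have hz1 : ∀ t, P.pi ^ 2 ∣ z t - (1 + P.pi * ∑ j ∈ range n, P.teich t ^ p ^ j) := by
    intro t
    change P.pi ^ 2 ∣ ∏ j ∈ range n, E (P.pi * P.teich t ^ p ^ j) - _
    clear hn hcard hFr hz z
    induction n with
    | zero => simp
    | succ n ih =>
      rw [prod_range_succ, sum_range_succ]
      obtain ⟨c, hc⟩ := ih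
      obtain ⟨d, hd⟩ := hE1 (P.teich t ^ p ^ n)
      refine ⟨c * E (P.pi * P.teich t ^ p ^ n) + (1 + P.pi * ∑ j ∈ range n, P.teich t ^ p ^ j) * d +
        (∑ j ∈ range n, P.teich t ^ p ^ j) * P.teich t ^ p ^ n, ?_⟩
      linear_combination E (P.pi * P.teich t ^ p ^ n) * hc + (1 + P.pi * ∑ j ∈ range n, P.teich t ^ p ^ j) * hd
  have hzres : ∀ t, P.res (z t) = 1 := by
    intro t
    obtain ⟨c, hc⟩ := hz1 t
    have := congrArg P.res hc
    simp only [map_sub, map_mul, map_pow, map_add, map_one, P.res_pi] at this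
    linear_combination this
  have htr : ∀ t, P.res (∑ j ∈ range n, P.teich t ^ p ^ j) =
      algebraMap (ZMod p) F (Algebra.trace (ZMod p) F t) := by
    intro t
    rw [FiniteField.algebraMap_trace_eq_sum_pow, map_sum]
    have hf : Module.finrank (ZMod p) F = n := by
      have h := Module.card_eq_pow_finrank (K := ZMod p) (V := F)
      rw [hcard, ZMod.card] at h
      exact (Nat.pow_right_injective hp2 h).symm
    simp [hf, P.res_teich, map_pow]
  have hzp : ∀ t, (p : O) ^ (M + 2) ∣ z t ^ p - 1 := by
    intro t
    have hch : CharP (O ⧸ Ideal.span {(p : O) ^ (M + 2)}) (p ^ (M + 2)) := by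
      constructor
      intro k
      rw [← map_natCast (Ideal.Quotient.mk _), Ideal.Quotient.eq_zero_iff_mem, Ideal.mem_span_singleton]
      constructor
      · intro h
        have := P.pow_dvd_of_cast (M + 2) k (by exact_mod_cast h)
        exact_mod_cast this
      · rintro ⟨c, rfl⟩
        push_cast
        exact dvd_mul_right _ _
    set mk := Ideal.Quotient.mk (Ideal.span {(p : O) ^ (M + 2)})
    have h := prod_artinHasse_pow_eq_one hM (ZMod.castHom dvd_rfl (O ⧸ Ideal.span {(p : O) ^ (M + 2)}))
      (mk P.pi) (by rw [← map_pow, P.pi_pow]; simp) e he0 hAH n (fun j => mk (P.teich t ^ p ^ j))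
      (by intro j; rw [← map_pow mk, ← pow_mul]; rfl)
      (by rw [← map_pow P.teich, hFr]; simp)
    rw [← Ideal.mem_span_singleton, ← Ideal.Quotient.eq_zero_iff_mem, map_sub, map_one, sub_eq_zero,
      map_pow, ← h]
    congr 1
    simp only [hz, hE, map_prod, map_sum, map_mul, map_pow, map_natCast]
    refine prod_congr rfl fun j _ => sum_congr rfl fun i _ => ?_
    rw [ZMod.castHom_apply, ZMod.natCast_val]
  have hbig : 2 ≤ (p - 1) * (M + 1) := by
    have : 1 * (M + 1) ≤ (p - 1) * (M + 1) := Nat.mul_le_mul_right _ (by omega)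
    omega
  have hcong : ∀ A B : O, P.res B ≠ 0 → P.pi ^ 2 ∣ A - B → (p : O) ^ (M + 2) ∣ A ^ p - B ^ p →
      (p : O) ^ (M + 1) ∣ A - B :=
    fun A B h1 h2 h3 => P.congr_of_pow_congr hp (M + 1) hbig A B h1 h2 h3
  have hadd : ∀ s t, (p : O) ^ (M + 1) ∣ z (s + t) - z s * z t := by
    intro s t
    refine hcong _ _ (by rw [map_mul, hzres, hzres]; simp) ?_ ?_
    · obtain ⟨a, ha⟩ := hz1 s
      obtain ⟨b, hb⟩ := hz1 t
      obtain ⟨c, hc⟩ := hz1 (s + t)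
      obtain ⟨d, hd⟩ := P.dvd_of_res (∑ j ∈ range n, P.teich (s + t) ^ p ^ j -
        ∑ j ∈ range n, P.teich s ^ p ^ j - ∑ j ∈ range n, P.teich t ^ p ^ j) (by
          rw [map_sub, map_sub, htr, htr, htr]; simp)
      refine ⟨c + d - (∑ j ∈ range n, P.teich s ^ p ^ j) * (∑ j ∈ range n, P.teich t ^ p ^ j)
        - a * z t - (1 + P.pi * ∑ j ∈ range n, P.teich s ^ p ^ j) * b, ?_⟩
      linear_combination hc + P.pi * hd - z t * ha - (1 + P.pi * ∑ j ∈ range n, P.teich s ^ p ^ j) * hb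
    · obtain ⟨a, ha⟩ := hzp s
      obtain ⟨b, hb⟩ := hzp t
      obtain ⟨c, hc⟩ := hzp (s + t)
      refine ⟨c - a * z t ^ p - b, ?_⟩
      rw [mul_pow]
      linear_combination hc - z t ^ p * ha - hb
  have htr0 : ∀ t, Algebra.trace (ZMod p) F t = 0 → (p : O) ^ (M + 1) ∣ z t - 1 := by
    intro t ht
    refine hcong _ _ (by simp) ?_ (by simpa using hzp t)
    obtain ⟨a, ha⟩ := hz1 t
    obtain ⟨d, hd⟩ := P.dvd_of_res (∑ j ∈ range n, P.teich t ^ p ^ j) (by rw [htr, ht, map_zero])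
    exact ⟨a + d, by linear_combination ha + P.pi * hd⟩
  have hz0 : z 0 = 1 := by
    simp only [hz, hE]
    refine prod_eq_one fun j _ => ?_
    rw [map_zero, zero_pow (by positivity), mul_zero]
    rw [sum_eq_single 0]
    · simp [he0, ZMod.val_one]
    · intro i _ hi; rw [zero_pow hi, mul_zero]
    · intro h; exact absurd (mem_range.2 (by positivity)) h
  set I := Ideal.span {(p : O) ^ M} with hI
  have mk0 : ∀ x, Ideal.Quotient.mk I x = 0 ↔ (p : O) ^ M ∣ x := by
    intro x; rw [Ideal.Quotient.eq_zero_iff_mem, hI, Ideal.mem_span_singleton]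
  have hle : (p : O) ^ M ∣ (p : O) ^ (M + 1) := pow_dvd_pow _ (by omega)
  have hch : CharP (O ⧸ I) (p ^ M) := by
    constructor
    intro k
    rw [← map_natCast (Ideal.Quotient.mk _), mk0]
    constructor
    · intro h
      have := P.pow_dvd_of_cast M k (by exact_mod_cast h)
      exact_mod_cast this
    · rintro ⟨c, rfl⟩
      push_cast
      exact dvd_mul_right _ _
  have hpiM : Ideal.Quotient.mk I P.pi ^ ((p - 1) * M) = 0 := by
    rw [pow_mul, ← map_pow, P.pi_pow, map_neg, neg_pow, ← map_pow, (mk0 _).2 dvd_rfl, mul_zero]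
  refine ⟨O ⧸ I, inferInstance, ⟨{
    ι := ZMod.castHom dvd_rfl _
    pi := Ideal.Quotient.mk I P.pi
    τ := MonoidWithZeroHom.comp (RingHom.toMonoidWithZeroHom (Ideal.Quotient.mk I)) P.teich
    Ψ := { toFun := fun x => Ideal.Quotient.mk I (z x)
           map_zero_eq_one' := by rw [hz0, map_one]
           map_add_eq_mul' := fun s t => by
            rw [← map_mul, ← sub_eq_zero, ← map_sub, mk0]
            exact hle.trans (hadd s t) }
    pi_pow := by rw [← map_pow, P.pi_pow]; simp
    Ψ_apply := ?_
    sum_τ := ?_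
    sum_Ψ := ?_
    dvd_of_cast := ?_
    τ_algebraMap := ?_ }⟩⟩
  · intro x
    change Ideal.Quotient.mk I (z x) = _
    simp only [hz, hE, map_prod, map_sum, map_mul, map_pow, map_natCast]
    refine prod_congr rfl fun j _ => sum_congr rfl fun i _ => ?_
    refine congrArg₂ _ ?_ rfl
    rw [← map_natCast (ZMod.castHom dvd_rfl (O ⧸ I))]
    congr 1
    rw [ZMod.castHom_apply, ZMod.natCast_val]
  · intro s
    have hcu : Fintype.card Fˣ = p ^ n - 1 := by rw [Fintype.card_units, hcard]
    change ∑ x : Fˣ, (Ideal.Quotient.mk I (P.teich x)) ^ s = _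
    split_ifs with hs
    · obtain ⟨c, rfl⟩ := hs
      rw [sum_congr rfl (g := fun _ => 1), sum_const, card_univ, hcu, nsmul_one]
      intro x _
      have : P.teich x ^ Fintype.card Fˣ = 1 := by
        rw [← map_pow, ← Units.val_pow_eq_pow_val, pow_card_eq_one]
        simp
      rw [pow_mul, ← hcu, ← map_pow, this]
      simp
    · obtain ⟨g, hg⟩ := IsCyclic.exists_generator (α := Fˣ)
      have hgs : g ^ s ≠ 1 := by
        intro h
        apply hs
        rw [← hcu, ← orderOf_eq_card_of_forall_mem_zpowers hg |>.trans Nat.card_eq_fintype_card]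
        exact orderOf_dvd_of_pow_eq_one h
      have h0 : (P.teich g ^ s - 1) * ∑ x : Fˣ, P.teich x ^ s = 0 := by
        rw [sub_mul, one_mul, mul_sum, sub_eq_zero]
        refine Fintype.sum_equiv (Equiv.mulLeft g) _ _ fun x => ?_
        simp [mul_pow]
      have : P.pi ^ ((p - 1) * M) ∣ ∑ x : Fˣ, P.teich x ^ s := by
        refine P.pi_pow_dvd_of_mul (u := P.teich g ^ s - 1) ?_ _ (h0 ▸ dvd_zero _)
        rw [map_sub, map_pow, P.res_teich, map_one, sub_ne_zero]
        intro h
        apply hgs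
        ext
        simpa using h
      simp only [← map_pow (Ideal.Quotient.mk I), ← map_sum]
      rw [mk0, P.natCast_pow_dvd_iff]
      exact this
  · intro t
    change ∑ c : ZMod p, Ideal.Quotient.mk I (z (c • t)) = _
    split_ifs with ht
    · rw [sum_congr rfl (g := fun _ => 1), sum_const, card_univ, ZMod.card, nsmul_one]
      intro c _
      rw [← map_one (Ideal.Quotient.mk I), ← sub_eq_zero, ← map_sub, mk0]
      exact hle.trans (htr0 _ (by rw [map_smul, ht, smul_zero]))
    · rw [← map_sum, mk0]
      have h1 : (p : O) ^ (M + 1) ∣ (z t - 1) * ∑ c : ZMod p, z (c • t) := by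
        have : (z t - 1) * ∑ c : ZMod p, z (c • t) =
            - ∑ c : ZMod p, (z (t + c • t) - z t * z (c • t)) := by
          rw [sum_sub_distrib, sub_mul, one_mul, mul_sum, neg_sub]
          congr 1
          symm
          refine Fintype.sum_equiv (Equiv.addLeft 1) _ _ fun x => ?_
          simp [add_smul]
        rw [this, dvd_neg]
        exact dvd_sum fun c _ => hadd _ _
      obtain ⟨a, ha⟩ := hz1 t
      have h2 : z t - 1 = P.pi * (∑ j ∈ range n, P.teich t ^ p ^ j + P.pi * a) := by
        linear_combination ha
      rw [P.natCast_pow_dvd_iff] at h1 ⊢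
      refine P.pi_pow_dvd_of_mul (u := ∑ j ∈ range n, P.teich t ^ p ^ j + P.pi * a) ?_ _ ?_
      · rw [map_add, htr, map_mul, P.res_pi, zero_mul, add_zero]
        simpa using ht
      · obtain ⟨c, hc⟩ := h1
        refine ⟨P.pi ^ (p - 2) * c, ?_⟩
        rw [h2] at hc
        rw [← sub_eq_zero]
        apply P.pi_reg
        rw [show (p - 1) * (M + 1) = 1 + (p - 1) * M + (p - 2) by
          rw [mul_add]; omega, pow_add, pow_add] at hc
        linear_combination hc
  · intro k hk
    rw [← map_intCast (Ideal.Quotient.mk I), mk0] at hk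
    exact_mod_cast P.pow_dvd_of_cast M k hk
  · intro a
    change Ideal.Quotient.mk I (P.teich (algebraMap (ZMod p) F a)) = _
    have h1 : ∀ k, P.pi ^ (k + 1) ∣ P.teich (algebraMap (ZMod p) F a) - (a.val : O) ^ p ^ k := by
      intro k
      induction k with
      | zero =>
        rw [zero_add, pow_one, pow_zero, pow_one]
        apply P.dvd_of_res
        rw [map_sub, P.res_teich, map_natCast, ← map_natCast (algebraMap (ZMod p) F),
          ZMod.natCast_zmod_val, sub_self]
      | succ k ih =>
        have := P.pow_congr hp _ _ (k + 1) (by omega) ih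
        rw [← map_pow, ← map_pow, ZMod.pow_card, ← pow_mul, ← pow_succ] at this
        exact this
    rw [map_pow, map_natCast, ← map_natCast (Ideal.Quotient.mk I), ← map_pow, ← sub_eq_zero, ← map_sub,
      mk0, P.natCast_pow_dvd_iff]
    exact (pow_dvd_pow _ (by omega)).trans (h1 _)

section
open Polynomial Finset

/-- The Euler derivation `X d/dX`. -/
noncomputable def eulerD (R : Type*) [CommRing R] : Derivation R R[X] R[X] :=
  (X : R[X]) • Polynomial.derivative'

theorem eulerD_apply {R : Type*} [CommRing R] (f : R[X]) : eulerD R f = X * derivative f := rfl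

theorem eulerD_monomial {R : Type*} [CommRing R] (n : ℕ) (a : R) :
    eulerD R (monomial n a) = monomial n ((n : R) * a) := by
  rw [eulerD_apply, derivative_monomial]
  cases n with
  | zero => simp
  | succ n => rw [X_mul_monomial, Nat.add_sub_cancel, mul_comm]

theorem eulerD_X_pow {R : Type*} [CommRing R] (n : ℕ) :
    eulerD R (X ^ n) = (n : R[X]) * X ^ n := by
  rw [X_pow_eq_monomial, eulerD_monomial, ← C_mul_monomial]; simp

theorem coeff_eulerD {R : Type*} [CommRing R] (f : R[X]) (n : ℕ) :
    (eulerD R f).coeff n = n * f.coeff n := by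
  rw [eulerD_apply]
  cases n with
  | zero => simp
  | succ n => rw [coeff_X_mul, coeff_derivative]; push_cast; ring

/-- Extension of a sequence by zero to negative indices. -/
def extInt {R : Type*} [CommRing R] (e : ℕ → R) (i : ℤ) : R := if i < 0 then 0 else e i.toNat

theorem extInt_natCast {R : Type*} [CommRing R] (e : ℕ → R) (i : ℕ) : extInt e i = e i := by
  simp [extInt]

theorem extInt_rec {R : Type*} [CommRing R] {e : ℕ → R} {p N : ℕ} (hp : 2 ≤ p)
    (he : ∀ i, i + 1 < N → ((i : R) + 1) * e (i + 1) = e i + if p ≤ i + 1 then e (i + 1 - p) else 0)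
    (i : ℤ) (hi : i < N) : (i : R) * extInt e i = extInt e (i - 1) + extInt e (i - p) := by
  rcases lt_trichotomy i 0 with h | rfl | h
  · simp [extInt, h, show i - 1 < 0 by omega, show i - p < 0 by omega]
  · simp [extInt, show 0 < p by omega]
  · obtain ⟨k, rfl⟩ : ∃ k : ℕ, i = k + 1 := ⟨(i - 1).toNat, by omega⟩
    have := he k (by omega)
    rw [show ((k : ℤ) + 1) = ((k + 1 : ℕ) : ℤ) by push_cast; rfl, extInt_natCast,
      show ((k + 1 : ℕ) : ℤ) - 1 = (k : ℤ) by push_cast; ring, extInt_natCast]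
    push_cast
    rw [this]
    congr 1
    split_ifs with h1
    · rw [show ((k : ℤ) + 1) - p = ((k + 1 - p : ℕ) : ℤ) by omega, extInt_natCast]
    · simp [extInt, show (k : ℤ) + 1 - p < 0 by omega]

/-- The coefficient of `Y ^ k` in `E(Y) E(X / Y)`, `E = ∑ e i T ^ i`, truncated at `X ^ L`. -/
noncomputable def gPoly {R : Type*} [CommRing R] (e : ℕ → R) (L : ℕ) (k : ℤ) : R[X] :=
  ∑ j ∈ range L, monomial j (extInt e (j + k) * e j)

section

variable {R : Type*} [CommRing R] {e : ℕ → R} {p N L : ℕ}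

theorem coeff_gPoly (k : ℤ) (j : ℕ) :
    (gPoly e L k).coeff j = if j < L then extInt e (j + k) * e j else 0 := by
  simp [gPoly, finsetSum_coeff, coeff_monomial]

theorem eulerD_gPoly_add (hp : 2 ≤ p)
    (he : ∀ i, i + 1 < N → ((i : R) + 1) * e (i + 1) = e i + if p ≤ i + 1 then e (i + 1 - p) else 0)
    (k : ℤ) (hk : k + L ≤ N) :
    eulerD R (gPoly e L k) + (k : R[X]) * gPoly e L k = gPoly e L (k - 1) + gPoly e L (k - p) := by
  ext j
  rw [coeff_add, coeff_add, coeff_eulerD, coeff_gPoly, coeff_gPoly, coeff_gPoly, ← C_eq_intCast,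
    coeff_C_mul, coeff_gPoly]
  split_ifs with hj
  · have := extInt_rec hp he (j + k) (by omega)
    rw [← add_sub_assoc, ← add_sub_assoc]
    push_cast at this
    linear_combination (e j) * this
  · simp

theorem X_pow_dvd_eulerD_gPoly (hp : 2 ≤ p) (hL : L ≤ N)
    (he : ∀ i, i + 1 < N → ((i : R) + 1) * e (i + 1) = e i + if p ≤ i + 1 then e (i + 1 - p) else 0)
    (k : ℤ) :
    (X : R[X]) ^ L ∣ eulerD R (gPoly e L k) - (X * gPoly e L (k + 1) + X ^ p * gPoly e L (k + p)) := by
  rw [X_pow_dvd_iff]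
  intro j hj
  have h := extInt_rec hp he j (by omega)
  have h1 : (X * gPoly e L (k + 1)).coeff j = extInt e (j - 1) * extInt e (j + k) := by
    cases j with
    | zero => simp [extInt]
    | succ j =>
      rw [coeff_X_mul, coeff_gPoly, if_pos (by omega)]
      push_cast
      rw [add_sub_cancel_right, extInt_natCast, mul_comm,
        show (j : ℤ) + (k + 1) = (j : ℤ) + 1 + k by ring]
  have h2 : (X ^ p * gPoly e L (k + p)).coeff j = extInt e (j - p) * extInt e (j + k) := by
    rw [coeff_X_pow_mul']
    split_ifs with hpj
    · rw [coeff_gPoly, if_pos (by omega), mul_comm]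
      rw [show (j : ℤ) - p = ((j - p : ℕ) : ℤ) by omega, extInt_natCast,
        show ((j - p : ℕ) : ℤ) + (k + p) = j + k by omega]
    · simp [extInt, show (j : ℤ) < p by omega]
  rw [coeff_sub, coeff_add, h1, h2, coeff_eulerD, coeff_gPoly, if_pos hj, ← add_mul, ← h,
    extInt_natCast]
  push_cast; ring

theorem X_pow_dvd_gPoly_neg (d : ℕ) :
    (X : R[X]) ^ L ∣ gPoly e L (-d) - X ^ d * gPoly e L d := by
  rw [X_pow_dvd_iff]
  intro j hj
  rw [coeff_sub, coeff_X_pow_mul', coeff_gPoly, if_pos hj]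
  split_ifs with h
  · rw [coeff_gPoly, if_pos (by omega), show (j : ℤ) + -d = ((j - d : ℕ) : ℤ) by omega, extInt_natCast,
      show ((j - d : ℕ) : ℤ) + d = j by omega, extInt_natCast]
    ring
  · simp [extInt, show (j : ℤ) + -d < 0 by omega]

end

/-- The solution of `r (l + 2) = x * r l + y * (l + 1) * r (l + 1)` with given initial values. -/
def rSeq {R : Type*} [CommRing R] (x y c₀ c₁ : R) : ℕ → R
  | 0 => c₀
  | 1 => c₁
  | l + 2 => x * rSeq x y c₀ c₁ l + y * (l + 1) * rSeq x y c₀ c₁ (l + 1)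

theorem rSeq_succ_succ {R : Type*} [CommRing R] (x y c₀ c₁ : R) (l : ℕ) :
    rSeq x y c₀ c₁ (l + 2) = x * rSeq x y c₀ c₁ l + y * (l + 1) * rSeq x y c₀ c₁ (l + 1) := rfl

theorem map_rSeq {R S : Type*} [CommRing R] [CommRing S] (f : R →+* S) (x y c₀ c₁ : R) :
    ∀ l, f (rSeq x y c₀ c₁ l) = rSeq (f x) (f y) (f c₀) (f c₁) l
  | 0 => rfl
  | 1 => rfl
  | l + 2 => by simp [rSeq, map_rSeq f x y c₀ c₁ l, map_rSeq f x y c₀ c₁ (l + 1)]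

theorem rSeq_scale {R : Type*} [CommRing R] (t x y c₀ c₁ : R) :
    ∀ l, t ^ l * rSeq x y c₀ c₁ l = rSeq (t ^ 2 * x) (t * y) c₀ (t * c₁) l
  | 0 => by simp [rSeq]
  | 1 => by simp [rSeq]
  | l + 2 => by
    rw [rSeq, rSeq, ← rSeq_scale t x y c₀ c₁ l, ← rSeq_scale t x y c₀ c₁ (l + 1)]; ring

theorem rSeq_smul {R : Type*} [CommRing R] (t x y c₀ c₁ : R) :
    ∀ l, rSeq x y (t * c₀) (t * c₁) l = t * rSeq x y c₀ c₁ l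
  | 0 => rfl
  | 1 => rfl
  | l + 2 => by
    rw [rSeq, rSeq, rSeq_smul t x y c₀ c₁ l, rSeq_smul t x y c₀ c₁ (l + 1)]; ring

/-- High terms of the sequence lie in high powers of the ideal `(x, y)`, where `x` has weight two. -/
theorem rSeq_eq_zero {R : Type*} [CommRing R] {x y c₀ c₁ : R} {m : ℕ} (hx : x ^ m = 0)
    (hy : y ^ m = 0) (l : ℕ) (hl : 3 * m ≤ l) : rSeq x y c₀ c₁ l = 0 := by
  suffices H : ∀ l, ∀ a b, l + a + 2 * b ≥ 3 * m → y ^ a * x ^ b * rSeq x y c₀ c₁ l = 0 by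
    simpa using H l 0 0 (by omega)
  have base : ∀ a b, 1 + a + 2 * b ≥ 3 * m → y ^ a * x ^ b = 0 := by
    intro a b h
    by_cases ha : m ≤ a
    · rw [← Nat.sub_add_cancel ha, pow_add, hy]; simp
    · by_cases hb : m ≤ b
      · rw [← Nat.sub_add_cancel hb, pow_add x, hx]; simp
      · omega
  intro l
  induction l using Nat.strong_induction_on with
  | _ l ih =>
    intro a b h
    match l with
    | 0 => rw [base a b (by omega), zero_mul]
    | 1 => rw [base a b (by omega), zero_mul]
    | l + 2 =>
      have h1 := ih l (by omega) a (b + 1) (by omega)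
      have h2 := ih (l + 1) (by omega) (a + 1) b (by omega)
      rw [rSeq]
      linear_combination h1 + (l + 1) * h2

section

variable {R : Type*} [CommRing R]

theorem eulerD_rSeq_succ_succ (p : ℕ) (c₀ c₁ : R[X]) (l : ℕ) :
    eulerD R (rSeq (X ^ p) (p : R[X]) c₀ c₁ (l + 2)) =
      (p : R[X]) * X ^ p * rSeq (X ^ p) (p : R[X]) c₀ c₁ l + X ^ p * eulerD R (rSeq (X ^ p) (p : R[X]) c₀ c₁ l) +
        (p : R[X]) * ((l : R[X]) + 1) * eulerD R (rSeq (X ^ p) (p : R[X]) c₀ c₁ (l + 1)) := by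
  have hcl : eulerD R ((p : R[X]) * ((l : R[X]) + 1)) = 0 := by
    rw [← Nat.cast_succ, ← Nat.cast_mul, Derivation.map_natCast]
  rw [rSeq_succ_succ]
  simp only [map_add, Derivation.leibniz (eulerD R) (X ^ p), Derivation.leibniz (eulerD R) ((p : R[X]) * ((l : R[X]) + 1)),
    smul_eq_mul, eulerD_X_pow, hcl]
  ring

theorem eulerD_rSeq (p l : ℕ) :
    eulerD R (rSeq (X ^ p) (p : R[X]) 1 0 (l + 1)) =
        X ^ p * (rSeq (X ^ p) (p : R[X]) 0 1 (l + 1) - rSeq (X ^ p) (p : R[X]) 1 0 l) ∧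
      eulerD R (rSeq (X ^ p) (p : R[X]) 0 1 (l + 1)) =
        rSeq (X ^ p) (p : R[X]) 1 0 (l + 1) - X ^ p * rSeq (X ^ p) (p : R[X]) 0 1 l := by
  induction l using Nat.strong_induction_on with
  | _ l ih =>
    match l with
    | 0 => simp [rSeq]
    | 1 =>
      rw [eulerD_rSeq_succ_succ p 1 0, eulerD_rSeq_succ_succ p 0 1]
      simp [rSeq]
      ring
    | l + 2 =>
      obtain ⟨h1, h2⟩ := ih l (by omega)
      obtain ⟨h3, h4⟩ := ih (l + 1) (by omega)
      rw [eulerD_rSeq_succ_succ p 1 0, eulerD_rSeq_succ_succ p 0 1, h1, h2, h3, h4,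
        rSeq_succ_succ _ _ 1 0 (l + 1), rSeq_succ_succ _ _ 0 1 (l + 1),
        rSeq_succ_succ _ _ 1 0 l, rSeq_succ_succ _ _ 0 1 l]
      push_cast
      constructor <;> ring

end

section

variable {P Q : Type*} [CommRing P] [CommRing Q] {p : ℕ}

/-- The first of the two telescoping sums behind the horizontality of the Frobenius matrix. -/
theorem telescope_first {x : Q} {G dG : ℤ → Q} {W dW W' : ℕ → Q} (n : ℕ)
    (h₁ : ∀ l : ℕ, l ≤ n → dG (p * l) + (p * l : ℕ) * G (p * l) = G (p * l - 1) + G (p * l - p))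
    (h₂ : ∀ k, dG k = x * G (k + 1) + x ^ p * G (k + p)) (h₃ : G (-1) = x * G 1)
    (hW : ∀ l, W (l + 2) = x ^ p * W l + p * (l + 1) * W (l + 1))
    (hdW₀ : dW 0 = W' 0 - W 1) (hdW : ∀ l, dW (l + 1) = W' (l + 1) - x ^ p * W l) :
    dG 0 * W 0 + G 0 * dW 0 + ∑ l ∈ range n, 2 * (dG (p * (l + 1 : ℕ)) * W (l + 1) +
        G (p * (l + 1 : ℕ)) * dW (l + 1)) =
      (G (-1) * W 0 + ∑ l ∈ range n, (G (p * (l + 1 : ℕ) - 1) + x * G (p * (l + 1 : ℕ) + 1)) * W (l + 1)) +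
      (G 0 * W' 0 + ∑ l ∈ range n, 2 * G (p * (l + 1 : ℕ)) * W' (l + 1)) +
      (x ^ p * G (p * (n + 1 : ℕ)) * W n - G (p * n) * W (n + 1)) := by
  induction n with
  | zero =>
    have := h₂ 0
    simp only [range_zero, sum_empty, hdW₀, h₃, this]
    simp only [zero_add, Nat.cast_zero, mul_zero, Nat.cast_one, mul_one]
    ring
  | succ n ih =>
    have e₁ := h₁ (n + 1) le_rfl
    have e₂ := h₂ (p * (n + 1 : ℕ))
    rw [sum_range_succ, sum_range_succ, sum_range_succ, hdW, hW]
    have ih := ih fun l hl => h₁ l (by omega)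
    rw [show (p : ℤ) * (n + 1 : ℕ) - p = p * n by push_cast; ring] at e₁
    rw [show (p : ℤ) * (n + 1 : ℕ) + p = p * (n + 1 + 1 : ℕ) by push_cast; ring] at e₂
    push_cast at *
    linear_combination ih + W (n + 1) * e₁ + W (n + 1) * e₂

/-- The second of the two telescoping sums behind the horizontality of the Frobenius matrix. -/
theorem telescope_second {x : Q} {G dG : ℤ → Q} {W dW W' : ℕ → Q} (n : ℕ)
    (h₁ : ∀ l : ℕ, l ≤ n → dG (p * l + 1) + (p * l + 1 : ℕ) * G (p * l + 1) =
      G (p * l) + G (p * l + 1 - p))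
    (h₂ : ∀ k, dG k = x * G (k + 1) + x ^ p * G (k + p)) (h₃ : G (-1) = x * G 1)
    (hW : ∀ l, W (l + 2) = x ^ p * W l + p * (l + 1) * W (l + 1))
    (hdW₀ : dW 0 = W' 0 - W 1) (hdW : ∀ l, dW (l + 1) = W' (l + 1) - x ^ p * W l) :
    dG (-1) * W 0 + G (-1) * dW 0 + ∑ l ∈ range n, ((dG (p * (l + 1 : ℕ) - 1) +
        (x * G (p * (l + 1 : ℕ) + 1) + x * dG (p * (l + 1 : ℕ) + 1))) * W (l + 1) +
        (G (p * (l + 1 : ℕ) - 1) + x * G (p * (l + 1 : ℕ) + 1)) * dW (l + 1)) =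
      x * (G 0 * W 0 + ∑ l ∈ range n, 2 * G (p * (l + 1 : ℕ)) * W (l + 1)) +
      (G (-1) * W' 0 + ∑ l ∈ range n, (G (p * (l + 1 : ℕ) - 1) + x * G (p * (l + 1 : ℕ) + 1)) * W' (l + 1)) +
      (x ^ p * G (p * (n + 1 : ℕ) - 1) * W n - x * G (p * n + 1) * W (n + 1)) := by
  induction n with
  | zero =>
    have := h₂ (-1)
    simp only [range_zero, sum_empty, hdW₀, h₃, this]
    rw [show (-1 : ℤ) + p = p - 1 by ring]
    simp only [zero_add, Nat.cast_zero, mul_zero, Nat.cast_one, mul_one, neg_add_cancel]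
    ring
  | succ n ih =>
    have e₁ := h₁ (n + 1) le_rfl
    have e₂ := h₂ (p * (n + 1 : ℕ) - 1)
    rw [sum_range_succ, sum_range_succ, sum_range_succ, hdW, hW]
    have ih := ih fun l hl => h₁ l (by omega)
    rw [show (p : ℤ) * (n + 1 : ℕ) + 1 - p = p * n + 1 by push_cast; ring] at e₁
    rw [show (p : ℤ) * (n + 1 : ℕ) - 1 + p = p * (n + 1 + 1 : ℕ) - 1 by push_cast; ring,
      sub_add_cancel] at e₂
    push_cast at *
    linear_combination ih + x * W (n + 1) * e₁ + W (n + 1) * e₂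

end

section

variable {R : Type*} [CommRing R]

/-- First columns of the Frobenius matrix, as linear functions of a sequence. -/
noncomputable def frobCol₀ (e : ℕ → R) (p L B : ℕ) (w : ℕ → R[X]) : R[X] :=
  gPoly e L 0 * w 0 + ∑ l ∈ range B, 2 * gPoly e L (p * (l + 1 : ℕ)) * w (l + 1)

/-- Second columns of the Frobenius matrix, as linear functions of a sequence. -/
noncomputable def frobCol₁ (e : ℕ → R) (p L B : ℕ) (w : ℕ → R[X]) : R[X] :=
  gPoly e L (-1) * w 0 + ∑ l ∈ range B, (gPoly e L (p * (l + 1 : ℕ) - 1) +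
    X * gPoly e L (p * (l + 1 : ℕ) + 1)) * w (l + 1)

theorem frobCol₀_mul (e : ℕ → R) (p L B : ℕ) (c : R[X]) (w : ℕ → R[X]) :
    frobCol₀ e p L B (fun l => c * w l) = c * frobCol₀ e p L B w := by
  simp only [frobCol₀, mul_add, Finset.mul_sum]
  exact congrArg₂ (· + ·) (by ring) (sum_congr rfl fun _ _ => by ring)

theorem frobCol₁_mul (e : ℕ → R) (p L B : ℕ) (c : R[X]) (w : ℕ → R[X]) :
    frobCol₁ e p L B (fun l => c * w l) = c * frobCol₁ e p L B w := by
  simp only [frobCol₁, mul_add, Finset.mul_sum]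
  exact congrArg₂ (· + ·) (by ring) (sum_congr rfl fun _ _ => by ring)

variable {e : ℕ → R} {p N L B : ℕ}

theorem eulerD_frobCol {Q : Type*} [CommRing Q] (q : R[X] →+* Q) (hqL : q X ^ L = 0) (hp : 2 ≤ p)
    (he : ∀ i, i + 1 < N → ((i : R) + 1) * e (i + 1) = e i + if p ≤ i + 1 then e (i + 1 - p) else 0)
    (hN : p * B + 1 + L ≤ N) (w w' : ℕ → R[X]) (hw : ∀ l, B ≤ l → q (w l) = 0)
    (hrec : ∀ l, w (l + 2) = X ^ p * w l + (p : R[X]) * ((l : R[X]) + 1) * w (l + 1))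
    (hdw₀ : eulerD R (w 0) = w' 0 - w 1)
    (hdw : ∀ l, eulerD R (w (l + 1)) = w' (l + 1) - X ^ p * w l) :
    q (eulerD R (frobCol₀ e p L B w)) = q (frobCol₁ e p L B w + frobCol₀ e p L B w') ∧
    q (eulerD R (frobCol₁ e p L B w)) = q (X * frobCol₀ e p L B w + frobCol₁ e p L B w') := by
  have hdvd : ∀ f g : R[X], X ^ L ∣ f - g → q f = q g := by
    rintro f g ⟨c, hc⟩
    rw [← sub_eq_zero, ← map_sub, hc, map_mul, map_pow, hqL, zero_mul]
  have H₁ : ∀ k : ℤ, k + L ≤ N → q (eulerD R (gPoly e L k)) + k * q (gPoly e L k) =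
      q (gPoly e L (k - 1)) + q (gPoly e L (k - p)) := by
    intro k hk
    rw [← map_add, ← eulerD_gPoly_add hp he k hk]; simp
  have H₂ : ∀ k : ℤ, q (eulerD R (gPoly e L k)) = q X * q (gPoly e L (k + 1)) +
      q X ^ p * q (gPoly e L (k + p)) := by
    intro k
    rw [hdvd _ _ (X_pow_dvd_eulerD_gPoly hp (by omega) he k)]; simp
  have H₃ : q (gPoly e L (-1)) = q X * q (gPoly e L 1) := by
    have := hdvd _ _ (X_pow_dvd_gPoly_neg (e := e) (L := L) 1)
    simpa using this
  have hW : ∀ l, q (w (l + 2)) = q X ^ p * q (w l) + p * (l + 1) * q (w (l + 1)) := by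
    intro l; rw [hrec]; simp
  have hdW₀ : q (eulerD R (w 0)) = q (w' 0) - q (w 1) := by rw [hdw₀, map_sub]
  have hdW : ∀ l, q (eulerD R (w (l + 1))) = q (w' (l + 1)) - q X ^ p * q (w l) := by
    intro l; rw [hdw]; simp
  have hc2 : ∀ f : R[X], eulerD R (2 * f) = 2 * eulerD R f := by
    intro f; rw [two_mul, map_add, two_mul]
  have hX : eulerD R X = X := by simpa using eulerD_X_pow (R := R) 1
  have hmono : ∀ l, l ≤ B → (p : ℤ) * l + 1 + L ≤ N := fun l hl => by
    exact_mod_cast (by have := Nat.mul_le_mul_left p hl; omega : p * l + 1 + L ≤ N)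
  constructor
  · have := telescope_first (p := p) (x := q X) (G := fun k => q (gPoly e L k))
      (dG := fun k => q (eulerD R (gPoly e L k))) (W := fun l => q (w l))
      (dW := fun l => q (eulerD R (w l))) (W' := fun l => q (w' l)) B
      (fun l hl => by
        have h := H₁ (p * l) (by have := hmono l hl; linarith)
        push_cast at h ⊢; exact h) H₂ H₃ hW hdW₀ hdW
    simp only [hw B le_rfl, hw (B + 1) (by omega), mul_zero, sub_zero, add_zero] at this
    simp only [frobCol₀, frobCol₁, map_add, map_sum, map_mul, Derivation.leibniz, smul_eq_mul, hc2,
      map_ofNat]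
    refine Eq.trans (congrArg₂ (· + ·) ?_ (sum_congr rfl fun l _ => ?_)) (this.trans ?_)
    · ring
    · ring
    · rfl
  · have := telescope_second (p := p) (x := q X) (G := fun k => q (gPoly e L k))
      (dG := fun k => q (eulerD R (gPoly e L k))) (W := fun l => q (w l))
      (dW := fun l => q (eulerD R (w l))) (W' := fun l => q (w' l)) B
      (fun l hl => by
        have h := H₁ (p * l + 1) (by have := hmono l hl; linarith)
        push_cast at h ⊢; rw [add_sub_cancel_right] at h; exact h) H₂ H₃ hW hdW₀ hdW
    simp only [hw B le_rfl, hw (B + 1) (by omega), mul_zero, sub_zero, add_zero] at this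
    simp only [frobCol₀, frobCol₁, map_add, map_sum, map_mul, Derivation.leibniz, smul_eq_mul, hX,
      map_ofNat]
    refine Eq.trans (congrArg₂ (· + ·) ?_ (sum_congr rfl fun l _ => ?_)) (this.trans ?_)
    · ring
    · ring
    · rfl

/-- The Frobenius matrix of the Bessel (Kloosterman) differential equation, up to a diagonal matrix. -/
noncomputable def frobHat (e : ℕ → R) (p L B : ℕ) : Matrix (Fin 2) (Fin 2) R[X] :=
  !![frobCol₀ e p L B (rSeq (X ^ p) (p : R[X]) 1 0), frobCol₁ e p L B (rSeq (X ^ p) (p : R[X]) 1 0);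
    frobCol₀ e p L B (rSeq (X ^ p) (p : R[X]) 0 1), frobCol₁ e p L B (rSeq (X ^ p) (p : R[X]) 0 1)]

/-- The differential equation satisfied by the Frobenius matrix. -/
theorem eulerD_frobHat {Q : Type*} [CommRing Q] (q : R[X] →+* Q) (hqL : q X ^ L = 0) (hp : 2 ≤ p)
    (he : ∀ i, i + 1 < N → ((i : R) + 1) * e (i + 1) = e i + if p ≤ i + 1 then e (i + 1 - p) else 0)
    (hN : p * B + 1 + L ≤ N) (m : ℕ) (hL : L = p * m) (hm : (p : Q) ^ m = 0) (hB : 3 * m ≤ B) :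
    ((frobHat e p L B).map fun f => q (eulerD R f)) =
      (frobHat e p L B).map q * !![0, q X; 1, 0] - !![0, -q X ^ p; -1, 0] * (frobHat e p L B).map q := by
  have hz : ∀ (c₀ c₁ : R[X]) l, B ≤ l → q (rSeq (X ^ p) (p : R[X]) c₀ c₁ l) = 0 := by
    intro c₀ c₁ l hl
    rw [map_rSeq]
    refine rSeq_eq_zero (m := m) ?_ ?_ l (by omega)
    · rw [map_pow, ← pow_mul, ← hL, hqL]
    · rw [map_natCast, hm]
  have hu := eulerD_frobCol q hqL hp he hN (rSeq (X ^ p) (p : R[X]) 1 0)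
    (fun l => X ^ p * rSeq (X ^ p) (p : R[X]) 0 1 l) (hz 1 0) (fun l => rSeq_succ_succ _ _ _ _ l)
    (by simp [rSeq]) (fun l => by rw [(eulerD_rSeq p l).1]; ring)
  have hv := eulerD_frobCol q hqL hp he hN (rSeq (X ^ p) (p : R[X]) 0 1)
    (rSeq (X ^ p) (p : R[X]) 1 0) (hz 0 1) (fun l => rSeq_succ_succ _ _ _ _ l)
    (by simp [rSeq]) (fun l => by rw [(eulerD_rSeq p l).2])
  rw [frobCol₀_mul, frobCol₁_mul] at hu
  ext i j
  fin_cases i <;> fin_cases j <;>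
    simp only [Matrix.sub_apply, Matrix.mul_apply, Fin.sum_univ_two, Matrix.map_apply] <;>
    simp [frobHat, hu, hv, mul_comm (q X)]

end

theorem coeff_zero_gPoly {R : Type*} [CommRing R] (e : ℕ → R) {L : ℕ} (hL : 0 < L) (k : ℤ) :
    (gPoly e L k).coeff 0 = extInt e k * e 0 := by
  simp [coeff_gPoly, hL]

theorem frobHat_eval_zero {R : Type*} [CommRing R] {e : ℕ → R} {p L B : ℕ} (hp : p ≠ 0) (hL : 0 < L)
    (he : e 0 = 1) :
    (frobHat e p L B 0 0).coeff 0 = 1 ∧ (frobHat e p L B 0 1).coeff 0 = 0 := by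
  have h0 : ∀ l, (rSeq ((0 : R) ^ p) (p : R) 1 0 (l + 1)) = 0 := by
    intro l
    induction l with
    | zero => rfl
    | succ l ih => rw [rSeq_succ_succ, ih]; simp [hp]
  have h1 : ∀ l, (rSeq (X ^ p) (p : R[X]) 1 0 (l + 1)).coeff 0 = 0 := by
    intro l
    rw [coeff_zero_eq_eval_zero, ← coe_evalRingHom, map_rSeq]
    simpa using h0 l
  constructor
  · simp [frobHat, frobCol₀, h1, mul_coeff_zero, finsetSum_coeff, coeff_zero_gPoly e hL, rSeq, he, extInt]
  · simp [frobHat, frobCol₁, h1, mul_coeff_zero, finsetSum_coeff, coeff_zero_gPoly e hL, rSeq, extInt]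

theorem natCast_mul_eq_zero_of_mul {p M j : ℕ} (hp : p.Prime) (hM : M ≤ p) (hj : j ≠ 0) (hjM : j < p * M)
    (c : ZMod (p ^ M)) (h : (j : ZMod (p ^ M)) * c = 0) : (p : ZMod (p ^ M)) * c = 0 := by
  obtain ⟨d, u, hdvd, hd⟩ : ∃ d u : ℕ, u.Coprime (p ^ M) ∧ u * d = j ∧ d ∣ p := by
    by_cases hpj : p ∣ j
    · obtain ⟨u, rfl⟩ := hpj
      refine ⟨p, u, ?_, by ring, dvd_rfl⟩
      have hu0 : u ≠ 0 := by rintro rfl; simp at hj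
      refine Nat.Coprime.pow_right _ ((Nat.coprime_comm).1 ((hp.coprime_iff_not_dvd).2 fun hdu => ?_))
      have := Nat.le_of_dvd (Nat.pos_of_ne_zero hu0) hdu
      have := lt_of_mul_lt_mul_left hjM (Nat.zero_le p)
      omega
    · exact ⟨1, j, Nat.Coprime.pow_right _ ((Nat.coprime_comm).1 ((hp.coprime_iff_not_dvd).2 hpj)),
        by ring, one_dvd _⟩
  obtain ⟨h1, k, hk⟩ := hd
  have hu : IsUnit (u : ZMod (p ^ M)) := (ZMod.isUnit_iff_coprime u (p ^ M)).2 hdvd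
  rw [← h1, Nat.cast_mul, mul_assoc, hu.mul_right_eq_zero] at h
  rw [show (p : ZMod (p ^ M)) = ((d * k : ℕ) : ZMod (p ^ M)) by rw [← hk], Nat.cast_mul,
    mul_right_comm, h, zero_mul]

/-- The Frobenius matrix of the Kloosterman equation. -/
noncomputable def frobMat {R : Type*} [CommRing R] (e : ℕ → R) (p L B : ℕ) :
    Matrix (Fin 2) (Fin 2) R[X] :=
  Matrix.diagonal ![1, -(p : R[X])] * frobHat e p L B

theorem X_pow_dvd_det_frobMat {p M : ℕ} (hp : p.Prime) (hM0 : M ≠ 0) (hM : 4 * M + 1 ≤ p)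
    {e : ℕ → ZMod (p ^ M)} (he0 : e 0 = 1)
    (he : ∀ i, i + 1 < p ^ 2 → ((i : ZMod (p ^ M)) + 1) * e (i + 1) =
      e i + if p ≤ i + 1 then e (i + 1 - p) else 0) :
    X ^ (p * M) ∣ (frobMat e p (p * M) (3 * M)).det - (p : (ZMod (p ^ M))[X]) := by
  set A := frobHat e p (p * M) (3 * M) with hA
  let I : Ideal (ZMod (p ^ M))[X] := Ideal.span {X ^ (p * M)}
  let q := Ideal.Quotient.mk I
  have hq : ∀ f, q f = 0 ↔ X ^ (p * M) ∣ f := fun f => by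
    rw [Ideal.Quotient.eq_zero_iff_mem, Ideal.mem_span_singleton]
  have hode := eulerD_frobHat (N := p ^ 2) (L := p * M) (B := 3 * M) q
    (by rw [← map_pow, hq]) hp.two_le he (by nlinarith [hp.two_le]) M rfl (by
      rw [← map_natCast q, ← map_pow, ← Nat.cast_pow]
      have : ((p ^ M : ℕ) : (ZMod (p ^ M))[X]) = 0 := by
        rw [← C_eq_natCast, ZMod.natCast_self, C_0]
      rw [this, map_zero]) le_rfl
  rw [← hA] at hode
  have h00 := congrFun (congrFun hode 0) 0
  have h01 := congrFun (congrFun hode 0) 1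
  have h10 := congrFun (congrFun hode 1) 0
  have h11 := congrFun (congrFun hode 1) 1
  simp only [Matrix.sub_apply, Matrix.mul_apply, Fin.sum_univ_two, Matrix.map_apply] at h00 h01 h10 h11
  simp at h00 h01 h10 h11
  have hdet : q (eulerD _ A.det) = 0 := by
    rw [Matrix.det_fin_two]
    simp only [map_sub, Derivation.leibniz, smul_eq_mul, map_add, map_mul, h00, h01, h10, h11]
    ring
  rw [hq, X_pow_dvd_iff] at hdet
  have hpos : 0 < p * M := Nat.mul_pos hp.pos (Nat.pos_of_ne_zero hM0)
  obtain ⟨z00, z01⟩ := frobHat_eval_zero (B := 3 * M) hp.ne_zero hpos he0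
  rw [← hA] at z00 z01
  have z11 : (A 1 1).coeff 0 = -1 := by
    have : q (eulerD _ (A 1 0) - (A 1 1 + A 0 0)) = 0 := by rw [map_sub, map_add, h10]; ring
    rw [hq, X_pow_dvd_iff] at this
    have := this 0 hpos
    rw [coeff_sub, coeff_add, coeff_eulerD, z00] at this
    simp at this
    linear_combination -this
  rw [X_pow_dvd_iff]
  intro j hj
  have hdetA : (frobMat e p (p * M) (3 * M)).det = C (-(p : ZMod (p ^ M))) * A.det := by
    rw [frobMat, Matrix.det_mul, Matrix.det_diagonal, Fin.prod_univ_two]; simp [hA]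
  rw [hdetA, coeff_sub, coeff_C_mul, ← C_eq_natCast, coeff_C]
  by_cases hj0 : j = 0
  · subst hj0
    rw [Matrix.det_fin_two, coeff_sub, mul_coeff_zero, mul_coeff_zero, z00, z01, z11]
    simp
  · have := hdet j hj
    rw [coeff_eulerD] at this
    rw [if_neg hj0, neg_mul, natCast_mul_eq_zero_of_mul hp (by omega) hj0 hj _ this]; simp
end

section
open Polynomial Finset

section

variable {R I K : Type*} [CommRing R]

theorem finsupp_linearMap_apply_eq_sum (U : Finset I) (h : (I →₀ R) →ₗ[R] (K →₀ R)) (v : I →₀ R)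
    (b : K) (hv : v.support ⊆ U) : h v b = ∑ a ∈ U, v a * h (Finsupp.single a 1) b := by
  conv_lhs => rw [← Finsupp.sum_single v, Finsupp.sum_of_support_subset v hv _ (by simp)]
  rw [map_sum, Finsupp.finsetSum_apply]
  refine sum_congr rfl fun a _ => ?_
  rw [← Finsupp.smul_single_one, map_smul, Finsupp.smul_apply, smul_eq_mul]

/-- Cyclicity of traces over finite sets of basis vectors. -/
theorem sum_apply_comp_comm (S : Finset I) (T : Finset K) (f : (I →₀ R) →ₗ[R] (K →₀ R))
    (g : (K →₀ R) →ₗ[R] (I →₀ R)) (hf : ∀ k ∈ S, (f (Finsupp.single k 1)).support ⊆ T)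
    (hg : ∀ l ∈ T, (g (Finsupp.single l 1)).support ⊆ S) :
    ∑ l ∈ T, f (g (Finsupp.single l 1)) l = ∑ k ∈ S, g (f (Finsupp.single k 1)) k := by
  have e1 : ∀ l ∈ T, f (g (Finsupp.single l 1)) l =
      ∑ k ∈ S, g (Finsupp.single l 1) k * f (Finsupp.single k 1) l :=
    fun l hl => finsupp_linearMap_apply_eq_sum S f _ l (hg l hl)
  have e2 : ∀ k ∈ S, g (f (Finsupp.single k 1)) k =
      ∑ l ∈ T, f (Finsupp.single k 1) l * g (Finsupp.single l 1) k :=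
    fun k hk => finsupp_linearMap_apply_eq_sum T g _ k (hf k hk)
  rw [sum_congr rfl e1, sum_congr rfl e2, sum_comm]
  exact sum_congr rfl fun k _ => sum_congr rfl fun l _ => mul_comm _ _

/-- The trace of an operator which commutes with a split injection `D` up to the factor `q`
reduces to the trace on the cokernel of `D`. -/
theorem sum_trace_eq_mul_add [Fintype K] (S S' : Finset I) (hS : S ⊆ S')
    (T D s : (I →₀ R) →ₗ[R] (I →₀ R)) (ρ : (I →₀ R) →ₗ[R] (K →₀ R)) (ι : (K →₀ R) →ₗ[R] (I →₀ R))
    (q : R) (hT : ∀ v, (T v).support ⊆ S) (hD : ∀ k ∈ S, (D (Finsupp.single k 1)).support ⊆ S')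
    (hs : ∀ v, s (D v) = v) (hι : ∀ v, D (s v) + ι (ρ v) = v) (hTD : ∀ v, T (D v) = q • D (T v)) :
    ∑ l ∈ S, T (Finsupp.single l 1) l =
      q * ∑ l ∈ S, T (Finsupp.single l 1) l + ∑ k, ρ (T (ι (Finsupp.single k 1))) k := by
  have h1 : ∑ l ∈ S, T (Finsupp.single l 1) l = ∑ l ∈ S', T (Finsupp.single l 1) l := by
    refine sum_subset hS fun l _ hl => ?_
    by_contra h
    exact hl (hT _ (Finsupp.mem_support_iff.2 h))
  have h2 : ∀ l, T (Finsupp.single l 1) l = q * D ((T ∘ₗ s) (Finsupp.single l 1)) l +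
      (T ∘ₗ ι) (ρ (Finsupp.single l 1)) l := by
    intro l
    conv_lhs => rw [← hι (Finsupp.single l 1), map_add, hTD]
    simp
  rw [h1]
  conv_lhs => rw [sum_congr rfl fun l _ => h2 l]
  rw [sum_add_distrib, ← mul_sum,
    sum_apply_comp_comm S S' D (T ∘ₗ s) hD (fun l _ => hT _),
    ← sum_apply_comp_comm S' univ ρ (T ∘ₗ ι) (fun _ _ => subset_univ _) (fun _ _ => (hT _).trans hS)]
  simp only [LinearMap.comp_apply, hs]
  rw [← h1]

end

section

variable {R : Type*} [CommRing R]

/-- The operator `D = θ + U - V` on `R[U, V] / (U V = x)` in the basis of powers of `U` and `V`. -/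
noncomputable def zD (x : R) : (ℤ →₀ R) →ₗ[R] (ℤ →₀ R) :=
  Finsupp.linearCombination R fun m => Finsupp.single m (m : R) +
    Finsupp.single (m + 1) (if 0 ≤ m then 1 else x) - Finsupp.single (m - 1) (if m ≤ 0 then 1 else x)

/-- Values on the positive half of a left inverse of `zD`. -/
noncomputable def zSpos (x : R) : ℕ → (ℤ →₀ R)
  | 0 => 0
  | 1 => 0
  | d + 2 => Finsupp.single (d + 1 : ℤ) 1 - ((d : R) + 1) • zSpos x (d + 1) + x • zSpos x d

/-- Values on the negative half of a left inverse of `zD`. -/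
noncomputable def zSneg (x : R) : ℕ → (ℤ →₀ R)
  | 0 => 0
  | 1 => -Finsupp.single 0 1
  | d + 2 => -Finsupp.single (-(d + 1) : ℤ) 1 - ((d : R) + 1) • zSneg x (d + 1) + x • zSneg x d

/-- A left inverse of `zD`. -/
noncomputable def zS (x : R) : (ℤ →₀ R) →ₗ[R] (ℤ →₀ R) :=
  Finsupp.linearCombination R fun m => if 0 ≤ m then zSpos x m.toNat else zSneg x (-m).toNat

/-- The projection to the cokernel of `zD`. -/
noncomputable def zRho (x : R) : (ℤ →₀ R) →ₗ[R] (Fin 2 →₀ R) :=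
  Finsupp.linearCombination R fun m => Finsupp.single 0 (rSeq x (-1) 1 0 m.natAbs) +
    Finsupp.single 1 (rSeq x (-1) 0 1 m.natAbs)

/-- A section of `zRho`. -/
noncomputable def zIota (R : Type*) [CommRing R] : (Fin 2 →₀ R) →ₗ[R] (ℤ →₀ R) :=
  Finsupp.linearCombination R fun i => Finsupp.single (i : ℤ) 1

theorem int_cases_three (m : ℤ) : m = 0 ∨ (∃ d : ℕ, m = d + 1) ∨ ∃ d : ℕ, m = -(d + 1) := by
  rcases lt_trichotomy m 0 with h | h | h
  · exact Or.inr (Or.inr ⟨(-m - 1).toNat, by omega⟩)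
  · exact Or.inl h
  · exact Or.inr (Or.inl ⟨(m - 1).toNat, by omega⟩)

theorem zD_single (x : R) (m : ℤ) : zD x (Finsupp.single m 1) = (m : R) • Finsupp.single m 1 +
    (if 0 ≤ m then 1 else x) • Finsupp.single (m + 1) 1 -
    (if m ≤ 0 then 1 else x) • Finsupp.single (m - 1) 1 := by
  simp only [zD, Finsupp.linearCombination_single, one_smul, Finsupp.smul_single_one]

theorem zS_single_natCast (x : R) (d : ℕ) : zS x (Finsupp.single (d : ℤ) 1) = zSpos x d := by
  simp [zS]

theorem zS_single_neg (x : R) (d : ℕ) : zS x (Finsupp.single (-(d : ℤ)) 1) = zSneg x d := by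
  cases d with
  | zero => simp [zS, zSpos, zSneg]
  | succ d => 
    rw [zS, Finsupp.linearCombination_single, one_smul, if_neg (by omega), neg_neg, Int.toNat_natCast]

theorem zS_zD (x : R) (v : ℤ →₀ R) : zS x (zD x v) = v := by
  suffices zS x ∘ₗ zD x = LinearMap.id from LinearMap.congr_fun this v
  refine Finsupp.lhom_ext' fun m => LinearMap.ext_ring ?_
  simp only [LinearMap.comp_apply, Finsupp.lsingle_apply, LinearMap.id_apply, zD_single, map_sub,
    map_add, map_smul]
  rcases int_cases_three m with rfl | ⟨d, rfl⟩ | ⟨d, rfl⟩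
  · have h1 := zS_single_natCast x 1
    have h2 := zS_single_neg x 1
    simp only [Nat.cast_one] at h1 h2
    simp [h1, h2, zSpos, zSneg]
  · have h0 := zS_single_natCast x d
    have h1 := zS_single_natCast x (d + 1)
    have h2 := zS_single_natCast x (d + 2)
    push_cast at h0 h1 h2
    rw [add_sub_cancel_right, h0, h1, show (d : ℤ) + 1 + 1 = d + 2 by ring, h2, zSpos,
      if_pos (by omega), if_neg (by omega)]
    push_cast
    module
  · have h0 := zS_single_neg x d
    have h1 := zS_single_neg x (d + 1)
    have h2 := zS_single_neg x (d + 2)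
    push_cast at h0 h1 h2
    rw [show -((d : ℤ) + 1) + 1 = -d by ring, h0, h1, show -((d : ℤ) + 1) - 1 = -(d + 2) by ring, h2,
      zSneg, if_neg (by omega), if_pos (by omega)]
    push_cast
    module

theorem zRho_single (x : R) (m : ℤ) : zRho x (Finsupp.single m 1) =
    rSeq x (-1) 1 0 m.natAbs • Finsupp.single 0 1 + rSeq x (-1) 0 1 m.natAbs • Finsupp.single 1 1 := by
  simp [zRho]

theorem zRho_zD (x : R) (v : ℤ →₀ R) : zRho x (zD x v) = 0 := by
  suffices zRho x ∘ₗ zD x = 0 from LinearMap.congr_fun this v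
  refine Finsupp.lhom_ext' fun m => LinearMap.ext_ring ?_
  simp only [LinearMap.comp_apply, Finsupp.lsingle_apply, zD_single, map_sub,
    map_add, map_smul, zRho_single]
  rcases int_cases_three m with rfl | ⟨d, rfl⟩ | ⟨d, rfl⟩
  · simp
  · rw [add_sub_cancel_right, show ((d : ℤ) + 1).natAbs = d + 1 by omega,
      show ((d : ℤ) + 1 + 1).natAbs = d + 2 by omega, Int.natAbs_natCast, rSeq_succ_succ,
      rSeq_succ_succ, if_pos (by omega), if_neg (by omega)]
    push_cast
    simp only [LinearMap.zero_apply]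
    module
  · rw [show (-((d : ℤ) + 1)).natAbs = d + 1 by omega, show (-((d : ℤ) + 1) + 1).natAbs = d by omega,
      show (-((d : ℤ) + 1) - 1).natAbs = d + 2 by omega, rSeq_succ_succ,
      rSeq_succ_succ, if_neg (by omega), if_pos (by omega)]
    push_cast
    simp only [LinearMap.zero_apply]
    module

theorem zRho_zIota (x : R) (v : Fin 2 →₀ R) : zRho x (zIota R v) = v := by
  suffices zRho x ∘ₗ zIota R = LinearMap.id from LinearMap.congr_fun this v
  refine Finsupp.lhom_ext' fun m => LinearMap.ext_ring ?_
  fin_cases m <;> simp [zIota, zRho, rSeq]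

theorem zD_zS_add (x : R) (v : ℤ →₀ R) : zD x (zS x v) + zIota R (zRho x v) = v := by
  suffices zD x ∘ₗ zS x + zIota R ∘ₗ zRho x = LinearMap.id from LinearMap.congr_fun this v
  refine Finsupp.lhom_ext' fun m => LinearMap.ext_ring ?_
  simp only [LinearMap.comp_apply, Finsupp.lsingle_apply, LinearMap.id_apply, LinearMap.add_apply]
  have h0 : zIota R (Finsupp.single 0 1) = Finsupp.single 0 1 := by simp [zIota]
  have h1 : zIota R (Finsupp.single 1 1) = Finsupp.single 1 1 := by simp [zIota]
  have hpos : ∀ d : ℕ, zD x (zSpos x d) + zIota R (zRho x (Finsupp.single (d : ℤ) 1)) =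
      Finsupp.single (d : ℤ) 1 := by
    intro d
    induction d using Nat.twoStepInduction with
    | zero => simp [zSpos, zRho_single, rSeq, h0]
    | one => simp [zSpos, zRho_single, rSeq, h1]
    | more d ih0 ih1 =>
      simp only [zRho_single, map_add, map_smul, h0, h1, Int.natAbs_natCast] at ih0 ih1 ⊢
      simp only [zSpos, rSeq_succ_succ, map_add, map_sub, map_smul, zD_single]
      rw [if_pos (by omega), if_neg (by omega), add_sub_cancel_right]
      rw [← eq_sub_iff_add_eq] at ih0 ih1
      push_cast at *
      rw [show (d : ℤ) + 1 + 1 = d + 2 by ring, ih0, ih1]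
      module
  have hneg : ∀ d : ℕ, zD x (zSneg x d) + zIota R (zRho x (Finsupp.single (-(d : ℤ)) 1)) =
      Finsupp.single (-(d : ℤ)) 1 := by
    intro d
    induction d using Nat.twoStepInduction with
    | zero => simp [zSneg, zRho_single, rSeq, h0]
    | one => simp [zSneg, zRho_single, rSeq, h1, zD_single]
    | more d ih0 ih1 =>
      simp only [zRho_single, map_add, map_smul, h0, h1, Int.natAbs_neg, Int.natAbs_natCast] at ih0 ih1 ⊢
      simp only [zSneg, rSeq_succ_succ, map_add, map_sub, map_smul, map_neg, zD_single]
      rw [if_neg (by omega), if_pos (by omega)]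
      rw [← eq_sub_iff_add_eq] at ih0 ih1
      push_cast at *
      rw [show -((d : ℤ) + 1) + 1 = -d by ring, show -((d : ℤ) + 1) - 1 = -(d + 2) by ring, ih0, ih1]
      module
  rcases le_total 0 m with h | h
  · obtain ⟨d, rfl⟩ := Int.eq_ofNat_of_zero_le h
    rw [zS_single_natCast]; exact hpos d
  · obtain ⟨d, hd⟩ := Int.eq_ofNat_of_zero_le (neg_nonneg.2 h)
    obtain rfl : m = -(d : ℤ) := by omega
    rw [zS_single_neg]; exact hneg d

end
end

section
open Polynomial Finset

section

variable {R : Type*} [CommRing R]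

/-- The lower half of the matrix of Dwork's operator on the Kloosterman fibre. -/
def zNHalf (p : ℕ) (x : R) (g : ℤ → R) (l : ℕ) (m : ℤ) : R :=
  (-(p : R)) ^ l * x ^ (-m).toNat * g (p * l - m)

/-- The matrix of Dwork's operator on the Kloosterman fibre. -/
def zN (p : ℕ) (x : R) (g : ℤ → R) (l m : ℤ) : R :=
  if 0 ≤ l then zNHalf p x g l.toNat m else zNHalf p x g (-l).toNat (-m)

variable {p M L : ℕ} {x x' : R} {g : ℤ → R}

theorem zN_natCast (l : ℕ) (m : ℤ) : zN p x g l m = zNHalf p x g l m := by simp [zN]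

theorem zN_neg (hsym : ∀ (a b : ℕ) (k : ℤ), (b : ℤ) = a + k → x ^ a * g (-k) = x ^ b * g k) (l m : ℤ) :
    zN p x g (-l) (-m) = zN p x g l m := by
  rcases lt_trichotomy l 0 with h | rfl | h
  · simp [zN, h.le, show ¬ 0 ≤ l by omega]
  · simp only [zN, zNHalf, neg_zero, le_refl, if_true, Int.toNat_zero, pow_zero, Nat.cast_zero, mul_zero,
      zero_sub, neg_neg, one_mul]
    have := hsym m.toNat (-m).toNat (-m) (by omega)
    rwa [neg_neg] at this
  · simp [zN, h.le, show ¬ l ≤ 0 by omega]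

theorem zN_natCast_neg (hsym : ∀ (a b : ℕ) (k : ℤ), (b : ℤ) = a + k → x ^ a * g (-k) = x ^ b * g k)
    (l : ℕ) (m : ℤ) : zN p x g (-(l : ℤ)) m = zNHalf p x g l (-m) := by
  have := zN_neg (p := p) hsym l (-m)
  rw [neg_neg] at this
  rw [this, zN_natCast]

theorem zN_eq_zero (hsym : ∀ (a b : ℕ) (k : ℤ), (b : ℤ) = a + k → x ^ a * g (-k) = x ^ b * g k)
    (hp : (p : R) ^ M = 0) (l m : ℤ) (hl : M ≤ l.natAbs) : zN p x g l m = 0 := by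
  have H : ∀ (l : ℕ) m, M ≤ l → zNHalf p x g l m = 0 := by
    intro l m h
    rw [zNHalf, neg_pow, ← Nat.sub_add_cancel h, pow_add (p : R), hp]; simp
  rcases le_total 0 l with h | h
  · obtain ⟨d, rfl⟩ := Int.eq_ofNat_of_zero_le h
    rw [zN_natCast]; exact H _ _ (by simpa using hl)
  · obtain ⟨d, hd⟩ := Int.eq_ofNat_of_zero_le (neg_nonneg.2 h)
    obtain rfl : l = -(d : ℤ) := by omega
    rw [zN_natCast_neg hsym]; exact H _ _ (by simpa using hl)

theorem zN_rel (hL : L = p * M) (hMp : 3 * M ≤ p) (hp2 : 2 ≤ p) (hx : x ^ L = 0) (hp : (p : R) ^ M = 0)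
    (hxx : x ^ p = p ^ 2 * x')
    (hsym : ∀ (a b : ℕ) (k : ℤ), (b : ℤ) = a + k → x ^ a * g (-k) = x ^ b * g k)
    (hg : ∀ k : ℤ, k + L ≤ p ^ 2 → k * g k = g (k - 1) - x * g (k + 1) + g (k - p) - x ^ p * g (k + p))
    (l m : ℤ) :
    m * zN p x g l m + (if 0 ≤ m then 1 else x) * zN p x g l (m + 1) -
        (if m ≤ 0 then 1 else x) * zN p x g l (m - 1) =
      p * (l * zN p x g l m + (if 1 ≤ l then 1 else x') * zN p x g (l - 1) m -
        (if l ≤ -1 then 1 else x') * zN p x g (l + 1) m) := by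
  have left : ∀ (l : ℕ) (m : ℤ), m * zNHalf p x g l m + (if 0 ≤ m then 1 else x) * zNHalf p x g l (m + 1) -
        (if m ≤ 0 then 1 else x) * zNHalf p x g l (m - 1) =
      (-(p : R)) ^ l * x ^ (-m).toNat *
        (m * g (p * l - m) + g (p * l - m - 1) - x * g (p * l - m + 1)) := by
    intro l m
    simp only [zNHalf]
    have h1 : (if 0 ≤ m then 1 else x) * x ^ (-(m + 1)).toNat = x ^ (-m).toNat := by
      split_ifs with h
      · rw [one_mul, show (-(m + 1)).toNat = (-m).toNat by omega]
      · rw [← pow_succ', show (-(m + 1)).toNat + 1 = (-m).toNat by omega]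
    have h2 : (if m ≤ 0 then 1 else x) * x ^ (-(m - 1)).toNat = x * x ^ (-m).toNat := by
      rw [← pow_succ']
      split_ifs with h
      · rw [one_mul, show (-(m - 1)).toNat = (-m).toNat + 1 by omega]
      · rw [← pow_succ', show (-(m - 1)).toNat + 1 = (-m).toNat + 1 by omega]
    rw [show (p : ℤ) * l - (m + 1) = p * l - m - 1 by ring,
      show (p : ℤ) * l - (m - 1) = p * l - m + 1 by ring]
    linear_combination (-(p : R)) ^ l * g (p * l - m - 1) * h1 - (-(p : R)) ^ l * g (p * l - m + 1) * h2
  have key : ∀ (l : ℕ) (m : ℤ), l < M → x ^ (-m).toNat * ((p * l - m : ℤ) * g (p * l - m)) =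
      x ^ (-m).toNat * (g (p * l - m - 1) - x * g (p * l - m + 1) + g (p * l - m - p)
        - x ^ p * g (p * l - m + p)) := by
    intro l m hl
    by_cases hm : (L : ℤ) ≤ -m
    · obtain ⟨k, hk⟩ : ∃ k, (-m).toNat = L + k := ⟨(-m).toNat - L, by omega⟩
      rw [hk, pow_add, hx]; simp
    · rw [← hg]
      have h1 : p * l + p ≤ p * M := by
        rw [← Nat.mul_succ]; exact Nat.mul_le_mul_left p hl
      have h2 : 3 * (p * M) ≤ p ^ 2 := by nlinarith
      have h3 : ((p * l + p : ℕ) : ℤ) ≤ L := by rw [hL]; exact_mod_cast h1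
      have h4 : 3 * (L : ℤ) ≤ p ^ 2 := by rw [hL]; exact_mod_cast h2
      push_cast at h3
      omega
  suffices H : ∀ (l : ℕ) (m : ℤ), m * zN p x g l m + (if 0 ≤ m then 1 else x) * zN p x g l (m + 1) -
        (if m ≤ 0 then 1 else x) * zN p x g l (m - 1) =
      p * (l * zN p x g l m + (if 1 ≤ (l : ℤ) then 1 else x') * zN p x g (l - 1) m -
        (if (l : ℤ) ≤ -1 then 1 else x') * zN p x g (l + 1) m) by
    rcases le_total 0 l with h | h
    · obtain ⟨d, rfl⟩ := Int.eq_ofNat_of_zero_le h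
      exact_mod_cast H d m
    · obtain ⟨d, hd⟩ := Int.eq_ofNat_of_zero_le (neg_nonneg.2 h)
      obtain rfl : l = -(d : ℤ) := by omega
      have := H d (-m)
      rw [← zN_neg hsym d, ← zN_neg hsym d, ← zN_neg hsym d, ← zN_neg hsym (d - 1 : ℤ),
        ← zN_neg hsym (d + 1 : ℤ)] at this
      rw [neg_neg, show -(-m + 1) = m - 1 by ring, show -(-m - 1) = m + 1 by ring,
        show -((d : ℤ) - 1) = -d + 1 by ring, show -((d : ℤ) + 1) = -d - 1 by ring] at this
      simp only [Left.nonneg_neg_iff, Left.neg_nonpos_iff] at this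
      simp only [show (1 : ℤ) ≤ -d ↔ (d : ℤ) ≤ -1 by omega, show -(d : ℤ) ≤ -1 ↔ 1 ≤ (d : ℤ) by omega]
      push_cast at this ⊢
      linear_combination -this
  intro l m
  rw [zN_natCast, zN_natCast, zN_natCast, left, if_neg (show ¬ (l : ℤ) ≤ -1 by omega)]
  cases l with
  | zero =>
    have h1 : zN p x g (((0 : ℕ) : ℤ) - 1) m = zNHalf p x g 1 (-m) := zN_natCast_neg hsym 1 m
    have h2 : zN p x g (((0 : ℕ) : ℤ) + 1) m = zNHalf p x g 1 m := zN_natCast 1 m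
    rw [h1, h2, if_neg (by simp)]
    rcases Nat.eq_zero_or_pos M with hM | hM
    · have : (1 : R) = 0 := by rw [← hp, hM, pow_zero]
      exact eq_of_zero_eq_one this.symm _ _
    have k0 := key 0 m hM
    have hs := hsym (-m).toNat (m.toNat + p) (m + p) (by push_cast; omega)
    rw [pow_add] at hs
    simp only [zNHalf, Nat.cast_zero, mul_zero, zero_sub, pow_zero, one_mul, pow_one, neg_neg, zero_mul,
      Nat.cast_one, mul_one, zero_add, sub_neg_eq_add] at k0 ⊢
    rw [show -(m + (p : ℤ)) = -m - p by ring] at hs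
    rw [show -m + (p : ℤ) = p - m by ring] at k0
    rw [show (p : ℤ) + m = m + p by ring]
    push_cast at k0 ⊢
    linear_combination -k0 - hs - (x ^ m.toNat * g (m + p) - x ^ (-m).toNat * g (p - m)) * hxx
  | succ l =>
    have h1 : zN p x g (((l + 1 : ℕ) : ℤ) - 1) m = zNHalf p x g l m := by
      rw [← zN_natCast]; push_cast; rw [add_sub_cancel_right]
    have h2 : zN p x g (((l + 1 : ℕ) : ℤ) + 1) m = zNHalf p x g (l + 2) m := by
      rw [← zN_natCast]; push_cast; rfl
    rw [h1, h2, if_pos (by push_cast; omega)]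
    simp only [zNHalf]
    rw [show (p : ℤ) * (l + 2 : ℕ) - m = p * (l + 1 : ℕ) - m + p by push_cast; ring,
      show (p : ℤ) * l - m = p * (l + 1 : ℕ) - m - p by push_cast; ring]
    by_cases hl : l + 1 < M
    · have k0 := key (l + 1) m hl
      generalize g (p * (l + 1 : ℕ) - m) = g0 at *
      generalize g (p * (l + 1 : ℕ) - m - 1) = g1 at *
      generalize g (p * (l + 1 : ℕ) - m + 1) = g2 at *
      generalize g (p * (l + 1 : ℕ) - m - p) = g3 at *
      generalize g (p * (l + 1 : ℕ) - m + p) = g4 at *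
      push_cast at k0 ⊢
      linear_combination -(-(p : R)) ^ (l + 1) * k0 + (-(p : R)) ^ (l + 1) * x ^ (-m).toNat * g4 * hxx
    · have hz : (-(p : R)) ^ (l + 1) = 0 := by
        rw [neg_pow, show l + 1 = (l + 1 - M) + M by omega, pow_add (p : R), hp]; simp
      have hz' : (p : R) * (-(p : R)) ^ l = 0 := by
        rw [← neg_eq_zero, ← neg_mul, ← pow_succ', hz]
      have hz'' : (-(p : R)) ^ (l + 2) = 0 := by rw [pow_succ, hz, zero_mul]
      rw [hz, hz'']
      linear_combination -x ^ (-m).toNat * g (p * (l + 1 : ℕ) - m - p) * hz'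

end
end

section
open Polynomial Finset

section

variable {R : Type*} [CommRing R]

theorem zD_apply (x : R) (w : ℤ →₀ R) (l : ℤ) :
    zD x w l = l * w l + (if 1 ≤ l then 1 else x) * w (l - 1) - (if l ≤ -1 then 1 else x) * w (l + 1) := by
  let f : (ℤ →₀ R) →ₗ[R] R := Finsupp.lapply l ∘ₗ zD x
  let g : (ℤ →₀ R) →ₗ[R] R := (l : R) • Finsupp.lapply l +
    (if 1 ≤ l then 1 else x) • Finsupp.lapply (l - 1) - (if l ≤ -1 then 1 else x) • Finsupp.lapply (l + 1)
  suffices f = g from LinearMap.congr_fun this w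
  refine Finsupp.lhom_ext fun m b => ?_
  rw [← Finsupp.smul_single_one, map_smul, map_smul]
  refine congrArg _ ?_
  simp only [f, g, LinearMap.comp_apply, zD_single, Finsupp.lapply_apply, LinearMap.add_apply,
    LinearMap.sub_apply, LinearMap.smul_apply, Finsupp.add_apply, Finsupp.sub_apply, Finsupp.smul_apply,
    Finsupp.single_apply, smul_eq_mul]
  by_cases h1 : m = l
  · subst h1; simp [show ¬ m = m - 1 by omega]
  by_cases h2 : m = l - 1
  · subst h2; simp [show ¬ l - 1 - 1 = l by omega, show ¬ l - 1 = l + 1 by omega]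
  by_cases h3 : m = l + 1
  · subst h3; simp [show ¬ l + 1 + 1 = l by omega, show ¬ l + 1 = l - 1 by omega,
      show l + 1 ≤ 0 ↔ l ≤ -1 by omega]
  · simp [h1, h2, h3, show ¬ m + 1 = l by omega, show ¬ m - 1 = l by omega]

/-- Dwork's operator on the Kloosterman fibre. -/
noncomputable def zPsi (p J : ℕ) (x : R) (g : ℤ → R) : Module.End R (ℤ →₀ R) :=
  Finsupp.linearCombination R fun m => ∑ l ∈ Icc (-J : ℤ) J, Finsupp.single l (zN p x g l m)

/-- The hypotheses on the coefficients of the Dwork exponential on a Kloosterman fibre. -/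
structure ZData (p M : ℕ) (x x' : R) (g : ℤ → R) : Prop where
  hx : x ^ (p * M) = 0
  hp : (p : R) ^ M = 0
  hxx : x ^ p = p ^ 2 * x'
  hsym : ∀ (a b : ℕ) (k : ℤ), (b : ℤ) = a + k → x ^ a * g (-k) = x ^ b * g k
  hg : ∀ k : ℤ, k + (p * M : ℕ) ≤ p ^ 2 →
    k * g k = g (k - 1) - x * g (k + 1) + g (k - p) - x ^ p * g (k + p)

namespace ZData

variable {p M J : ℕ} {x x' : R} {g : ℤ → R}

theorem zPsi_single_apply (h : ZData p M x x' g) (hJ : M ≤ J) (l m : ℤ) :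
    zPsi p J x g (Finsupp.single m 1) l = zN p x g l m := by
  rw [zPsi, Finsupp.linearCombination_single, one_smul, Finsupp.finsetSum_apply]
  simp only [Finsupp.single_apply]
  rw [Finset.sum_ite_eq', ite_eq_left_iff]
  intro hl
  rw [zN_eq_zero h.hsym h.hp l m]
  simp at hl
  omega

theorem zPsi_support (v : ℤ →₀ R) : (zPsi p J x g v).support ⊆ Icc (-J : ℤ) J := by
  intro l hl
  rw [Finsupp.mem_support_iff] at hl
  by_contra hlS
  apply hl
  rw [zPsi, Finsupp.linearCombination_apply, Finsupp.sum, Finsupp.finsetSum_apply]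
  refine sum_eq_zero fun m _ => ?_
  rw [Finsupp.smul_apply, Finsupp.finsetSum_apply, sum_eq_zero, smul_zero]
  intro k hk
  rw [Finsupp.single_apply, if_neg]
  rintro rfl; exact hlS hk

theorem zPsi_zD (h : ZData p M x x' g) (hMp : 3 * M ≤ p) (hp2 : 2 ≤ p) (hJ : M ≤ J) (v : ℤ →₀ R) :
    zPsi p J x g (zD x v) = (p : R) • zD x' (zPsi p J x g v) := by
  suffices zPsi p J x g ∘ₗ zD x = (p : R) • (zD x' ∘ₗ zPsi p J x g) from LinearMap.congr_fun this v
  refine Finsupp.lhom_ext fun m b => ?_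
  rw [← Finsupp.smul_single_one, map_smul, map_smul]
  refine congrArg _ ?_
  ext l
  simp only [LinearMap.comp_apply, LinearMap.smul_apply, Finsupp.smul_apply, smul_eq_mul, zD_apply,
    h.zPsi_single_apply hJ]
  rw [zD_single, map_sub, map_add, map_smul, map_smul, map_smul]
  simp only [Finsupp.sub_apply, Finsupp.add_apply, Finsupp.smul_apply, smul_eq_mul, h.zPsi_single_apply hJ]
  exact zN_rel rfl hMp hp2 h.hx h.hp h.hxx h.hsym h.hg l m

end ZData

/-- The matrix of Dwork's operator on the cohomology of a Kloosterman fibre. -/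
noncomputable def zMat (p J : ℕ) (x x' : R) (g : ℤ → R) : Matrix (Fin 2) (Fin 2) R :=
  Matrix.of fun i k => zRho x' (zPsi p J x g (Finsupp.single (k : ℤ) 1)) i

theorem zIota_single (k : Fin 2) : zIota R (Finsupp.single k 1) = Finsupp.single (k : ℤ) 1 := by
  simp [zIota]

theorem ZData.zRho_zPsi {p M J : ℕ} {x x' : R} {g : ℤ → R} (h : ZData p M x x' g) (hMp : 3 * M ≤ p)
    (hp2 : 2 ≤ p) (hJ : M ≤ J) (v : ℤ →₀ R) :
    ⇑(zRho x' (zPsi p J x g v)) = (zMat p J x x' g).mulVec ⇑(zRho x v) := by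
  have h1 : ∀ w : Fin 2 →₀ R, ⇑(zRho x' (zPsi p J x g (zIota R w))) = (zMat p J x x' g).mulVec ⇑w := by
    intro w
    ext i
    have := finsupp_linearMap_apply_eq_sum univ (zRho x' ∘ₗ zPsi p J x g ∘ₗ zIota R) w i (subset_univ _)
    simp only [LinearMap.comp_apply, zIota_single] at this
    rw [this]
    simp only [Matrix.mulVec, dotProduct, zMat, Matrix.of_apply, mul_comm]
  rw [← h1]
  conv_lhs => rw [← zD_zS_add x v, map_add, h.zPsi_zD hMp hp2 hJ, map_add, map_smul, zRho_zD, smul_zero,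
    zero_add]

/-- The truncated matrix of Dwork's operator. -/
def zTrunc (p J : ℕ) (x : R) (g : ℤ → R) : Matrix (Fin (2 * J + 1) × Unit) (Fin (2 * J + 1) × Unit) R :=
  Matrix.of fun l m => zN p x g ((l.1 : ℤ) - J) ((m.1 : ℤ) - J)

theorem sum_Icc_eq_sum_fin {A : Type*} [AddCommMonoid A] (J : ℕ) (f : ℤ → A) :
    ∑ l ∈ Icc (-J : ℤ) J, f l = ∑ l : Fin (2 * J + 1) × Unit, f ((l.1 : ℤ) - J) := by
  rw [Fintype.sum_prod_type]
  simp only [univ_unique, sum_singleton]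
  rw [← Finset.sum_range fun l => f ((l : ℤ) - J)]
  symm
  refine Finset.sum_bij' (fun l _ => (l : ℤ) - J) (fun l _ => (l + J).toNat) ?_ ?_ ?_ ?_ ?_ <;>
    simp <;> intros <;> omega

/-- The trace formula on a Kloosterman fibre: passing to cohomology. -/
theorem trace_prodRev_zTrunc {p M J n : ℕ} (x : ℕ → R) (g : ℕ → ℤ → R)
    (h : ∀ t, ZData p M (x t) (x (t + 1)) (g t)) (hMp : 3 * M ≤ p) (hp2 : 2 ≤ p) (hJ : M ≤ J) (hn : n ≠ 0)
    (hxn : x n = x 0) :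
    (prodRev (fun t => zTrunc p J (x t) (g t)) n).trace =
      (p : R) ^ n * (prodRev (fun t => zTrunc p J (x t) (g t)) n).trace +
        (prodRev (fun t => zMat p J (x t) (x (t + 1)) (g t)) n).trace := by
  set T : ℕ → Module.End R (ℤ →₀ R) := fun k => prodRev (fun t => zPsi p J (x t) (g t)) k with hTdef
  have hTs : ∀ k v, T (k + 1) v = zPsi p J (x k) (g k) (T k v) := fun k v => rfl
  have hT0 : ∀ v, T 0 v = v := fun v => rfl
  have hD : ∀ k v, T k (zD (x 0) v) = ((p : R) ^ k) • zD (x k) (T k v) := by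
    intro k v
    induction k with
    | zero => simp [hT0]
    | succ k ih => rw [hTs, ih, map_smul, (h k).zPsi_zD hMp hp2 hJ, hTs, smul_smul, pow_succ]
  have hρ : ∀ k v, ⇑(zRho (x k) (T k v)) =
      (prodRev (fun t => zMat p J (x t) (x (t + 1)) (g t)) k).mulVec ⇑(zRho (x 0) v) := by
    intro k v
    induction k with
    | zero => simp [hT0, prodRev]
    | succ k ih => rw [hTs, (h k).zRho_zPsi hMp hp2 hJ, ih, prodRev, Matrix.mulVec_mulVec]
  have hS : ∀ v, (T n v).support ⊆ Icc (-J : ℤ) J := by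
    obtain ⟨k, rfl⟩ := Nat.exists_eq_succ_of_ne_zero hn
    intro v
    exact ZData.zPsi_support _
  have hN : ∀ k (l m : Fin (2 * J + 1) × Unit), T k (Finsupp.single ((m.1 : ℤ) - J) 1) ((l.1 : ℤ) - J) =
      prodRev (fun t => zTrunc p J (x t) (g t)) k l m := by
    intro k
    induction k with
    | zero =>
      intro l m
      rw [hT0, Finsupp.single_apply, prodRev, Matrix.one_apply]
      refine if_congr ?_ rfl rfl
      constructor
      · intro h; refine Prod.ext (Fin.ext ?_) rfl; omega
      · rintro rfl; rfl
    | succ k ih =>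
      intro l m
      have hsupp : (T k (Finsupp.single ((m.1 : ℤ) - J) 1)).support ⊆ Icc (-J : ℤ) J := by
        cases k with
        | zero =>
          rw [hT0]
          refine Finsupp.support_single_subset.trans ?_
          simp; omega
        | succ k => exact ZData.zPsi_support _
      rw [hTs]
      have e : zPsi p J (x k) (g k) (T k (Finsupp.single ((m.1 : ℤ) - J) 1)) ((l.1 : ℤ) - J) = _ :=
        finsupp_linearMap_apply_eq_sum _ (zPsi p J (x k) (g k)) _ _ hsupp
      rw [e, sum_Icc_eq_sum_fin, prodRev, Matrix.mul_apply]
      refine Fintype.sum_congr _ _ fun r => ?_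
      rw [ih, (h k).zPsi_single_apply hJ, mul_comm]
      rfl
  have htr : (prodRev (fun t => zTrunc p J (x t) (g t)) n).trace =
      ∑ l ∈ Icc (-J : ℤ) J, T n (Finsupp.single l 1) l := by
    rw [sum_Icc_eq_sum_fin]
    exact Fintype.sum_congr _ _ fun l => (hN n l l).symm
  rw [htr]
  have main := sum_trace_eq_mul_add (Icc (-J : ℤ) J) (Icc (-(J + 1) : ℤ) (J + 1))
    (Icc_subset_Icc (by omega) (by omega)) (T n) (zD (x 0)) (zS (x 0)) (zRho (x 0)) (zIota R) ((p : R) ^ n)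
    hS ?_ (zS_zD _) (zD_zS_add _) (fun v => by rw [hD, hxn])
  · refine main.trans (congrArg _ ?_)
    rw [Matrix.trace]
    refine Fintype.sum_congr _ _ fun k => ?_
    have := congrFun (hρ n (zIota R (Finsupp.single k 1))) k
    rw [zRho_zIota, hxn] at this
    rw [this, Finsupp.single_eq_pi_single, Matrix.mulVec_single_one]
    rfl
  · intro k hk l hl
    simp only [mem_Icc] at hk ⊢
    rw [Finsupp.mem_support_iff, zD_apply] at hl
    by_contra hc
    apply hl
    simp [show ¬ k = l by omega, show ¬ k = l - 1 by omega, show ¬ k = l + 1 by omega]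

end
end

section
open Polynomial Finset

section

variable {Λ R : Type*} [CommRing Λ] [CommRing R] {p M J : ℕ} {e : ℕ → Λ}

theorem map_gPoly_neg (f : Λ[X] →+* R) {L : ℕ} (hx : f X ^ L = 0) (a b : ℕ) (k : ℤ)
    (h : (b : ℤ) = a + k) : f X ^ a * f (gPoly e L (-k)) = f X ^ b * f (gPoly e L k) := by
  have H : ∀ d : ℕ, f (gPoly e L (-d)) = f X ^ d * f (gPoly e L d) := by
    intro d
    obtain ⟨c, hc⟩ := X_pow_dvd_gPoly_neg (e := e) (L := L) d
    rw [← sub_eq_zero, ← map_pow, ← map_mul, ← map_sub, hc, map_mul, map_pow, hx, zero_mul]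
  rcases le_total 0 k with hk | hk
  · obtain ⟨d, rfl⟩ := Int.eq_ofNat_of_zero_le hk
    rw [H, ← mul_assoc, ← pow_add]
    congr 2; omega
  · obtain ⟨d, hd⟩ := Int.eq_ofNat_of_zero_le (neg_nonneg.2 hk)
    obtain rfl : k = -(d : ℤ) := by omega
    rw [neg_neg, H, ← mul_assoc, ← pow_add]
    congr 2; omega

theorem zData_gPoly (f : Λ[X] →+* R) {x' : R} (hp2 : 2 ≤ p) (hM : M ≤ p) (hx : f X ^ (p * M) = 0)
    (hp : (p : R) ^ M = 0) (hxx : f X ^ p = p ^ 2 * x')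
    (he : ∀ i, i + 1 < p ^ 2 → ((i : Λ) + 1) * e (i + 1) = e i + if p ≤ i + 1 then e (i + 1 - p) else 0) :
    ZData p M (f X) x' fun k => f (gPoly e (p * M) k) where
  hx := hx
  hp := hp
  hxx := hxx
  hsym := map_gPoly_neg f hx
  hg k hk := by
    have h1 := congrArg f (eulerD_gPoly_add hp2 he k hk)
    obtain ⟨c, hc⟩ := X_pow_dvd_eulerD_gPoly hp2 (by nlinarith : p * M ≤ p ^ 2) he k
    have h2 := congrArg f hc
    simp only [map_add, map_sub, map_mul, map_pow, map_intCast, hx, zero_mul] at h1 h2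
    linear_combination h1 - h2

theorem sum_Icc_neg {A : Type*} [AddCommMonoid A] (J : ℕ) (F : ℤ → A) :
    ∑ l ∈ Icc (-J : ℤ) J, F l = F 0 + ∑ l ∈ range J, (F (l + 1 : ℕ) + F (-(l + 1 : ℕ))) := by
  induction J with
  | zero => simp
  | succ J ih =>
    have : Icc (-(J + 1 : ℕ) : ℤ) (J + 1 : ℕ) =
        insert (J + 1 : ℤ) (insert (-(J + 1) : ℤ) (Icc (-J : ℤ) J)) := by
      ext l; simp only [mem_Icc, mem_insert]; push_cast; omega
    rw [this, sum_insert (by simp only [mem_insert, mem_Icc]; omega), sum_insert (by simp), ih,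
      sum_range_succ]
    push_cast
    abel

theorem zMat_eq_frobMat (f : Λ[X] →+* R) {x' : R} (hp2 : 2 ≤ p) (hM : M ≤ p) (hJ : M ≤ J)
    (hx : f X ^ (p * M) = 0)
    (hp : (p : R) ^ M = 0) (hxx : f X ^ p = p ^ 2 * x')
    (he : ∀ i, i + 1 < p ^ 2 → ((i : Λ) + 1) * e (i + 1) = e i + if p ≤ i + 1 then e (i + 1 - p) else 0) :
    zMat p J (f X) x' (fun k => f (gPoly e (p * M) k)) = (frobMat e p (p * M) (3 * M)).map f := by
  have hZ := zData_gPoly f hp2 hM hx hp hxx he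
  set g : ℤ → R := fun k => f (gPoly e (p * M) k) with hg
  have hw : ∀ c₀ c₁ l, (-(p : R)) ^ l * rSeq x' (-1) c₀ c₁ l = rSeq (f X ^ p) p c₀ (-p * c₁) l := by
    intro c₀ c₁ l
    rw [rSeq_scale, hxx]; congr 1 <;> ring
  have hz : ∀ c₀ c₁ l, M ≤ l → rSeq (f X ^ p) (p : R) c₀ (-p * c₁) l = 0 := by
    intro c₀ c₁ l hl
    rw [← hw, neg_pow, ← Nat.sub_add_cancel hl, pow_add (p : R), hp]; simp
  have hcut : ∀ c₀ c₁ (u : ℕ → R), ∑ l ∈ range J, u l * rSeq (f X ^ p) (p : R) c₀ (-p * c₁) (l + 1) =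
      ∑ l ∈ range (3 * M), u l * rSeq (f X ^ p) (p : R) c₀ (-p * c₁) (l + 1) := by
    intro c₀ c₁ u
    have : ∀ N, M ≤ N → ∑ l ∈ range M, u l * rSeq (f X ^ p) (p : R) c₀ (-p * c₁) (l + 1) =
        ∑ l ∈ range N, u l * rSeq (f X ^ p) (p : R) c₀ (-p * c₁) (l + 1) := by
      intro N hN
      refine sum_subset (range_mono hN) fun l _ hl => ?_
      rw [hz _ _ _ (by simp at hl; omega), mul_zero]
    exact (this J hJ).symm.trans (this (3 * M) (by omega))
  have hcoef : ∀ (m : ℤ) (i : Fin 2) (c₀ c₁ : R), (∀ k, zRho x' (Finsupp.single k 1) i =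
        rSeq x' (-1) c₀ c₁ k.natAbs) →
      zRho x' (zPsi p J (f X) g (Finsupp.single m 1)) i = zN p (f X) g 0 m * c₀ +
        ∑ l ∈ range J, (f X ^ (-m).toNat * g (p * (l + 1 : ℕ) - m) +
          f X ^ m.toNat * g (p * (l + 1 : ℕ) + m)) * rSeq (f X ^ p) (p : R) c₀ (-p * c₁) (l + 1) := by
    intro m i c₀ c₁ h
    have h1 : ∀ v : ℤ →₀ R, v.support ⊆ Icc (-J : ℤ) J → zRho x' v i =
        ∑ l ∈ Icc (-J : ℤ) J, v l * rSeq x' (-1) c₀ c₁ l.natAbs := by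
      intro v hv
      rw [finsupp_linearMap_apply_eq_sum _ (zRho x') v i hv]
      exact sum_congr rfl fun l _ => by rw [h]
    rw [h1 _ (ZData.zPsi_support _), sum_Icc_neg]
    simp only [hZ.zPsi_single_apply hJ, Int.natAbs_neg, Int.natAbs_natCast, Int.natAbs_zero, rSeq]
    refine congrArg _ (sum_congr rfl fun l _ => ?_)
    rw [zN_natCast, zN_natCast_neg hZ.hsym, zNHalf, zNHalf, neg_neg, sub_neg_eq_add, ← hw]
    ring
  have h00 : zN p (f X) g 0 0 = g 0 := by simp [zN, zNHalf]
  have h01 : zN p (f X) g 0 1 = g (-1) := by simp [zN, zNHalf]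
  have hr0 : ∀ k, zRho x' (Finsupp.single k 1) 0 = rSeq x' (-1) 1 0 k.natAbs := by
    intro k; simp [zRho_single]
  have hr1 : ∀ k, zRho x' (Finsupp.single k 1) 1 = rSeq x' (-1) 0 1 k.natAbs := by
    intro k; simp [zRho_single]
  have hs : ∀ l, -(p : R) * rSeq (f X ^ p) (p : R) 0 1 l = rSeq (f X ^ p) (p : R) 0 (-p * 1) l := by
    intro l
    have := rSeq_smul (-(p : R)) (f X ^ p) p 0 1 l
    rw [mul_zero] at this
    exact this.symm
  have hs0 : rSeq (f X ^ p) (p : R) 0 1 0 = 0 := rfl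
  have hs0' : rSeq (f X ^ p) (p : R) 1 0 0 = 1 := rfl
  ext i j
  fin_cases i <;> fin_cases j
  · refine (hcoef 0 0 1 0 hr0).trans ?_
    rw [hcut, h00]
    simp [frobMat, frobHat, Matrix.diagonal_mul, frobCol₀, map_rSeq, hs0', hg, two_mul]
  · refine (hcoef 1 0 1 0 hr0).trans ?_
    rw [hcut, h01]
    simp [frobMat, frobHat, Matrix.diagonal_mul, frobCol₁, map_rSeq, hs0', hg]
  · refine (hcoef 0 1 0 1 hr1).trans ?_
    rw [hcut]
    simp only [← hs]
    simp [frobMat, frobHat, Matrix.diagonal_mul, frobCol₀, map_rSeq, hs0, hg, two_mul, mul_left_comm, mul_sum]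
  · refine (hcoef 1 1 0 1 hr1).trans ?_
    rw [hcut]
    simp only [← hs]
    simp [frobMat, frobHat, Matrix.diagonal_mul, frobCol₁, map_rSeq, hs0, hg, mul_left_comm, mul_sum]

end
end

section
open Polynomial Finset

section

variable {R : Type*} [CommRing R]

/-- The coefficient of `Y ^ k` in `E(Z Y) E(Z ξ / Y)`. -/
noncomputable def kapPoly (e : ℕ → R) (N : ℕ) (ξ : R) (k : ℤ) : R[X] :=
  ∑ j ∈ range N, C (extInt e (j + k) * e j * ξ ^ j) * X ^ (2 * j + k).toNat

/-- `Z ^ (-k)` times the coefficient of `Y ^ k` in `E(Z Y) E(Z ξ / Y)`. -/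
noncomputable def gHat (e : ℕ → R) (N : ℕ) (ξ : R) (k : ℤ) : R[X] :=
  (gPoly e N k).eval₂ C (C ξ * X ^ 2)

theorem X_pow_mul_kapPoly (e : ℕ → R) (N : ℕ) (ξ : R) (k : ℤ) (a b : ℕ) (h : (b : ℤ) = a + k) :
    X ^ a * kapPoly e N ξ k = X ^ b * gHat e N ξ k := by
  rw [kapPoly, gHat, gPoly, eval₂_finsetSum, mul_sum, mul_sum]
  refine sum_congr rfl fun j _ => ?_
  rw [eval₂_monomial]
  by_cases hj : (j : ℤ) + k < 0
  · simp [extInt, hj]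
  · have : X ^ a * X ^ (2 * j + k).toNat = (X : R[X]) ^ b * X ^ (2 * j) := by
      rw [← pow_add, ← pow_add]; congr 1; omega
    rw [mul_left_comm, this, mul_pow, ← pow_mul, ← C_pow]
    simp only [C_mul]
    ring

theorem X_pow_mul_gPoly_neg (e : ℕ → R) (N : ℕ) (he : ∀ i, N ≤ i → e i = 0) (a b : ℕ) (k : ℤ)
    (h : (b : ℤ) = a + k) : X ^ a * gPoly e N (-k) = X ^ b * gPoly e N k := by
  have H : ∀ d : ℕ, gPoly e N (-d) = X ^ d * gPoly e N d := by
    intro d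
    ext j
    rw [coeff_X_pow_mul', coeff_gPoly]
    by_cases hd : d ≤ j
    · rw [if_pos hd, coeff_gPoly, show (j : ℤ) + -d = ((j - d : ℕ) : ℤ) by omega,
        show ((j - d : ℕ) : ℤ) + d = j by omega, extInt_natCast, extInt_natCast]
      split_ifs with h1 h2 h2
      · ring
      · omega
      · rw [he j (by omega), zero_mul]
      · rfl
    · simp [hd, extInt, show (j : ℤ) + -d < 0 by omega]
  rcases le_total 0 k with hk | hk
  · obtain ⟨d, rfl⟩ := Int.eq_ofNat_of_zero_le hk
    rw [H, ← mul_assoc, ← pow_add]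
    congr 2; omega
  · obtain ⟨d, hd⟩ := Int.eq_ofNat_of_zero_le (neg_nonneg.2 hk)
    obtain rfl : k = -(d : ℤ) := by omega
    rw [neg_neg, H, ← mul_assoc, ← pow_add]
    congr 2; omega

/-- The lower half of the conjugated matrix of Dwork's operator, before specialisation. -/
noncomputable def hHalf (e : ℕ → R) (p N : ℕ) (ξ : R) (l : ℕ) (m : ℤ) : R[X] :=
  (X ^ (p - 1)) ^ l * (C ξ * X ^ 2) ^ (-m).toNat * gHat e N ξ (p * l - m)

/-- The conjugated matrix of Dwork's operator, before specialisation. -/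
noncomputable def hFull (e : ℕ → R) (p N : ℕ) (ξ : R) (l m : ℤ) : R[X] :=
  if 0 ≤ l then hHalf e p N ξ l.toNat m else hHalf e p N ξ (-l).toNat (-m)

/-- The conjugating weights. -/
noncomputable def hWeight (ξ : R) (m : ℤ) : R[X] := C (ξ ^ (-m).toNat) * X ^ m.natAbs

theorem hWeight_mul_hFull (e : ℕ → R) (p N : ℕ) (hp : 1 ≤ p) (ξ : R) (he : ∀ i, N ≤ i → e i = 0) (l m : ℤ) :
    hWeight (ξ ^ p) l * hFull e p N ξ l m = kapPoly e N ξ (p * l - m) * hWeight ξ m := by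
  have hX : ∀ l : ℕ, (X : R[X]) ^ l * (X ^ (p - 1)) ^ l = X ^ (p * l) := by
    intro l
    rw [← mul_pow, ← pow_succ', Nat.sub_add_cancel hp, pow_mul]
  rcases le_or_gt 0 l with h | h
  · obtain ⟨d, rfl⟩ := Int.eq_ofNat_of_zero_le h
    rw [hFull, if_pos h]
    simp only [hHalf, hWeight, Int.toNat_natCast, Int.natAbs_natCast]
    have h1 := X_pow_mul_kapPoly e N ξ (p * d - m) m.natAbs (p * d + 2 * (-m).toNat) (by omega)
    rw [show (-(d : ℤ)).toNat = 0 by omega, pow_zero, C_1, one_mul, mul_pow, ← pow_mul, C_pow]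
    rw [pow_add] at h1
    linear_combination (C ξ ^ (-m).toNat * X ^ (2 * (-m).toNat) * gHat e N ξ (p * d - m)) * hX d -
      C ξ ^ (-m).toNat * h1
  · obtain ⟨d, hd⟩ := Int.eq_ofNat_of_zero_le (neg_nonneg.2 h.le)
    obtain rfl : l = -(d : ℤ) := by omega
    rw [hFull, if_neg (not_le.2 h)]
    simp only [hHalf, hWeight, neg_neg, Int.toNat_natCast, Int.natAbs_neg, Int.natAbs_natCast]
    refine (monic_X_pow (R := R) (2 * (p * d))).isRegular.left ?_
    have h1 := X_pow_mul_kapPoly e N ξ (p * (-d : ℤ) - m) (m.natAbs + 2 * (p * d)) (2 * (-m).toNat + p * d)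
      (by rw [mul_neg]; omega)
    have h2 := congrArg (eval₂RingHom C (C ξ * X ^ 2 : R[X]))
      (X_pow_mul_gPoly_neg e N he (-m).toNat (p * d + m.toNat) (p * d + m) (by omega))
    simp only [map_mul, map_pow, coe_eval₂RingHom, eval₂_X] at h2
    rw [show -((p : ℤ) * d + m) = p * (-d : ℤ) - m by ring] at h2
    change _ * gHat e N ξ _ = _ * gHat e N ξ _ at h2
    rw [sub_neg_eq_add]
    simp only [mul_pow, pow_add, ← pow_mul, C_pow] at h1 h2 ⊢
    have h3 := hX d
    simp only [← pow_mul] at h1 h2 h3 ⊢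
    linear_combination (X ^ (2 * (p * d)) * C ξ ^ (p * d) * C ξ ^ m.toNat * X ^ (2 * m.toNat) *
      gHat e N ξ (p * d + m)) * h3 - C ξ ^ (-m).toNat * h1 - X ^ (p * d) * h2

theorem isRegular_hWeight {ξ : R} (hξ : IsUnit ξ) (m : ℤ) : IsRegular (hWeight ξ m) :=
  ((isUnit_C.2 (hξ.pow _)).isRegular).mul (monic_X_pow _).isRegular

/-- The polynomial `Y ^ (N - 1) * E(Z Y) * E(Z ξ / Y)`. -/
noncomputable def kapGen (e : ℕ → R) (N : ℕ) (ξ : R) : R[X][X] :=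
  ∑ j ∈ range N, ∑ i ∈ range N, monomial (N - 1 - j + i) (C (e i * e j * ξ ^ j) * X ^ (i + j))

theorem natDegree_kapGen_le (e : ℕ → R) (N : ℕ) (ξ : R) : (kapGen e N ξ).natDegree ≤ 2 * (N - 1) := by
  refine natDegree_sum_le_of_forall_le _ _ fun j hj => natDegree_sum_le_of_forall_le _ _ fun i hi => ?_
  refine (natDegree_monomial_le _).trans ?_
  simp at hi hj
  omega

theorem coeff_kapGen (e : ℕ → R) (N : ℕ) (ξ : R) (he : ∀ i, N ≤ i → e i = 0) (s : ℕ) :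
    (kapGen e N ξ).coeff s = kapPoly e N ξ (s - (N - 1 : ℕ)) := by
  rw [kapGen, kapPoly, finsetSum_coeff]
  refine sum_congr rfl fun j hj => ?_
  simp only [mem_range] at hj
  rw [finsetSum_coeff]
  simp only [coeff_monomial]
  by_cases hs : s + j < N - 1
  · rw [sum_eq_zero, extInt, if_pos (by omega)]
    · simp
    · intro i _; rw [if_neg (by omega)]
  · rw [show (j : ℤ) + (s - (N - 1 : ℕ)) = ((s + j - (N - 1) : ℕ) : ℤ) by omega, extInt_natCast]
    by_cases hN : s + j - (N - 1) < N
    · rw [sum_eq_single (s + j - (N - 1))]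
      · rw [if_pos (by omega)]
        rw [show (2 * (j : ℤ) + (s - (N - 1 : ℕ))).toNat = s + j - (N - 1) + j by omega]
      · intro i _ hi; rw [if_neg (by omega)]
      · intro h; simp at h; omega
    · rw [he (s + j - (N - 1)) (by omega), sum_eq_zero]
      · simp
      · intro i hi
        simp at hi
        rw [if_neg (by omega)]

theorem eval_kapGen (e : ℕ → R) (N : ℕ) (ξ y y' z : R) (hy : y * y' = 1) :
    ((kapGen e N ξ).eval (C y)).eval z =
      y ^ (N - 1) * ((∑ i ∈ range N, e i * (z * y) ^ i) * ∑ j ∈ range N, e j * (z * (ξ * y')) ^ j) := by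
  rw [kapGen, eval_finsetSum, eval_finsetSum, sum_mul_sum, sum_comm, mul_sum]
  refine sum_congr rfl fun j hj => ?_
  simp only [mem_range] at hj
  rw [eval_finsetSum, eval_finsetSum, mul_sum]
  refine sum_congr rfl fun i _ => ?_
  have h : y ^ (N - 1) * y' ^ j = y ^ (N - 1 - j) := by
    rw [show N - 1 = N - 1 - j + j by omega, pow_add, mul_assoc, ← mul_pow, hy]; simp
  simp only [eval_monomial, eval_mul, eval_C, eval_pow, eval_X]
  rw [pow_add y, ← h]
  ring

end

section

variable {p M n : ℕ} [Fact p.Prime] {e : ℕ → ZMod (p ^ M)} {F R : Type*} [Field F] [Fintype F]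
  [DecidableEq F] [Algebra (ZMod p) F] [CommRing R]

/-- The point of the `X`-line at which the Frobenius matrix is to be evaluated. -/
noncomputable def DworkChar.pt (D : DworkChar p M n e F R) (y : F) : (ZMod (p ^ M))[X] →+* R :=
  eval₂RingHom D.ι (D.pi ^ 2 * D.τ y)

theorem DworkChar.natCast_pow_eq_zero (D : DworkChar p M n e F R) : (p : R) ^ M = 0 := by
  have := congrArg D.ι (ZMod.natCast_self (p ^ M))
  rwa [map_natCast, map_zero, Nat.cast_pow] at this

theorem DworkChar.pt_X (D : DworkChar p M n e F R) (y : F) : D.pt y X = D.pi ^ 2 * D.τ y := by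
  simp [pt]

theorem DworkChar.pt_X_pow (D : DworkChar p M n e F R) (y : F) : D.pt y X ^ (p * M) = 0 := by
  have hp : 1 ≤ p := (Fact.out : p.Prime).one_lt.le
  rw [D.pt_X, mul_pow, ← pow_mul, show 2 * (p * M) = (p - 1) * M + (p * M + M) by
    obtain ⟨q, rfl⟩ := Nat.exists_eq_add_of_le hp
    simp; ring, pow_add, pow_mul, D.pi_pow, neg_pow, D.natCast_pow_eq_zero]
  simp

theorem DworkChar.pt_X_pow_p (D : DworkChar p M n e F R) (y : F) :
    D.pt y X ^ p = p ^ 2 * D.pt (y ^ p) X := by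
  have hp : 1 ≤ p := (Fact.out : p.Prime).one_lt.le
  have : D.pi ^ p = -p * D.pi := by rw [← D.pi_pow, ← pow_succ, Nat.sub_add_cancel hp]
  rw [D.pt_X, D.pt_X, mul_pow, pow_right_comm, this, map_pow]
  ring

theorem map_extInt {A B : Type*} [CommRing A] [CommRing B] (f : A →+* B) (e : ℕ → A) (i : ℤ) :
    f (extInt e i) = extInt (fun i => f (e i)) i := by
  unfold extInt; split_ifs <;> simp

theorem DworkChar.eval_gHat (D : DworkChar p M n e F R) (hM : M ≤ p) (y : F) (k : ℤ) :
    (gHat (fun i => D.ι (e i)) (p ^ 2) (D.τ y) k).eval D.pi = D.pt y (gPoly e (p * M) k) := by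
  have h1 : (gHat (fun i => D.ι (e i)) (p ^ 2) (D.τ y) k).eval D.pi = D.pt y (gPoly e (p ^ 2) k) := by
    rw [gHat, gPoly, gPoly, eval₂_finsetSum, eval_finsetSum, map_sum]
    refine sum_congr rfl fun j _ => ?_
    rw [pt, coe_eval₂RingHom, eval₂_monomial, eval₂_monomial, map_mul D.ι, map_extInt D.ι]
    simp only [eval_mul, eval_C, eval_pow, eval_X]
    ring
  rw [h1, gPoly, gPoly, map_sum, map_sum]
  symm
  refine sum_subset (range_mono (by nlinarith)) fun j _ hj => ?_
  have hj' : p * M ≤ j := by simpa using hj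
  rw [← C_mul_X_pow_eq_monomial, map_mul, map_pow, ← Nat.sub_add_cancel hj', pow_add, D.pt_X_pow, mul_zero,
    mul_zero]

theorem DworkChar.eval_hFull (D : DworkChar p M n e F R) (hM : M ≤ p) (y : F) (l m : ℤ) :
    (hFull (fun i => D.ι (e i)) p (p ^ 2) (D.τ y) l m).eval D.pi =
      zN p (D.pt y X) (fun k => D.pt y (gPoly e (p * M) k)) l m := by
  have H : ∀ (l : ℕ) (m : ℤ), (hHalf (fun i => D.ι (e i)) p (p ^ 2) (D.τ y) l m).eval D.pi =
      zNHalf p (D.pt y X) (fun k => D.pt y (gPoly e (p * M) k)) l m := by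
    intro l m
    simp only [hHalf, zNHalf, eval_mul, eval_pow, eval_X, eval_C, D.eval_gHat hM, D.pi_pow, D.pt_X]
    ring
  unfold hFull zN
  split_ifs <;> exact H _ _

theorem prodRev_unit {A : Type*} [CommRing A] (f : ℕ → A) (n : ℕ) :
    (prodRev (fun t => (Matrix.of fun _ _ => f t : Matrix Unit Unit A)) n).trace = ∏ t ∈ range n, f t := by
  have : ∀ n, (prodRev (fun t => (Matrix.of fun _ _ => f t : Matrix Unit Unit A)) n) () () =
      ∏ t ∈ range n, f t := by
    intro n
    induction n with
    | zero => simp [prodRev]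
    | succ n ih => rw [prodRev, Matrix.mul_apply]; simp [ih, prod_range_succ, mul_comm]
  simp [Matrix.trace, this]

/-- Dwork's trace formula for a Kloosterman sum, on the level of functions. -/
theorem DworkChar.kloos_eq_mul_trace (D : DworkChar p M n e F R) (hM : M ≤ p) (hn : n ≠ 0)
    (hF : Fintype.card F = p ^ n) (he : ∀ i, p ^ 2 ≤ i → e i = 0) (x : Fˣ) :
    kloos D.Ψ x = ((p ^ n - 1 : ℕ) : R) *
      (prodRev (fun t => zTrunc p (p + 1) (D.pt (x ^ p ^ t) X)
        (fun k => D.pt (x ^ p ^ t) (gPoly e (p * M) k))) n).trace := by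
  have hp2 : 2 ≤ p := (Fact.out : p.Prime).two_le
  have hpp : (p - 1) * (2 * (p + 1)) = 2 * (p ^ 2 - 1) := by
    obtain ⟨q, rfl⟩ := Nat.exists_eq_add_of_le (by omega : 1 ≤ p)
    rw [show (1 + q) ^ 2 - 1 = q * (q + 2) by rw [Nat.sub_eq_iff_eq_add (by nlinarith)]; ring]
    simp; ring
  set e' : ℕ → R := fun i => D.ι (e i) with he'
  have he0 : ∀ i, p ^ 2 ≤ i → e' i = 0 := fun i hi => by simp [he', he i hi]
  set ξ : ℕ → R := fun t => D.τ ((x : F) ^ p ^ t) with hξ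
  have hτ : ∀ s : ℕ, ∑ y : Fˣ, (C (D.τ y) : R[X]) ^ s =
      if p ^ n - 1 ∣ s then ((p ^ n - 1 : ℕ) : R[X]) else 0 := by
    intro s
    have := congrArg C (D.sum_τ s)
    rw [map_sum] at this
    simp only [C_pow] at this
    rw [this]
    split_ifs <;> simp
  have main := dwork_trace_formula (ι := Unit) (fun y : Fˣ => (C (D.τ y) : R[X])) p n (2 * (p + 1)) hp2 hn hτ
    (fun t => Matrix.of fun _ _ => kapGen e' (p ^ 2) (ξ t))
    (fun t _ _ => by rw [hpp]; exact natDegree_kapGen_le _ _ _)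
  have hmain := congrArg (eval D.pi) main
  rw [eval_finsetSum, eval_mul, eval_natCast] at hmain
  have hL : ∀ y : Fˣ, eval D.pi (prodRev (fun t => (Matrix.of fun _ _ => kapGen e' (p ^ 2) (ξ t) :
      Matrix Unit Unit _).map (eval ((C (D.τ y) : R[X]) ^ p ^ t))) n).trace =
      D.Ψ (y + x * (y : F)⁻¹) := by
    intro y
    have h1 : (fun t => (Matrix.of fun _ _ => kapGen e' (p ^ 2) (ξ t) :
        Matrix Unit Unit _).map (eval ((C (D.τ y) : R[X]) ^ p ^ t))) =
        fun t => (Matrix.of fun _ _ => eval ((C (D.τ y) : R[X]) ^ p ^ t) (kapGen e' (p ^ 2) (ξ t)) :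
          Matrix Unit Unit _) := rfl
    rw [h1, prodRev_unit, eval_prod, AddChar.map_add_eq_mul, D.Ψ_apply, D.Ψ_apply, ← prod_mul_distrib]
    have hy : ∏ t ∈ range n, (D.τ y ^ p ^ t) ^ (p ^ 2 - 1) = 1 := by
      have hs : (∑ t ∈ range n, p ^ t) * (p ^ 2 - 1) = (p ^ n - 1) * (p + 1) := by
        have := Nat.geomSum_eq hp2 n
        obtain ⟨q, rfl⟩ := Nat.exists_eq_add_of_le (by omega : 1 ≤ p)
        rw [show (1 + q) ^ 2 - 1 = q * (q + 2) by rw [Nat.sub_eq_iff_eq_add (by nlinarith)]; ring]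
        rw [← geom_sum_mul_of_one_le (by omega : 1 ≤ 1 + q) n]
        simp; ring
      simp only [← pow_mul]
      rw [prod_pow_eq_pow_sum, ← sum_mul, hs, pow_mul, ← map_pow, ← hF,
        FiniteField.pow_card_sub_one_eq_one _ y.ne_zero]
      simp
    conv_rhs => rw [← one_mul (∏ t ∈ range n, _), ← hy, ← prod_mul_distrib]
    refine prod_congr rfl fun t _ => ?_
    rw [← C_pow, eval_kapGen e' (p ^ 2) (ξ t) (D.τ y ^ p ^ t) (D.τ ((y : F)⁻¹) ^ p ^ t) D.pi
      (by rw [← mul_pow, ← map_mul, mul_inv_cancel₀ y.ne_zero, map_one, one_pow])]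
    simp only [he', hξ, map_mul, map_pow, mul_pow]
  rw [sum_congr rfl fun y _ => hL y] at hmain
  rw [kloos, hmain]
  refine congrArg _ ?_
  set K : ℕ → Matrix (Fin (2 * (p + 1) + 1) × Unit) (Fin (2 * (p + 1) + 1) × Unit) R[X] := fun t =>
    dworkM p (2 * (p + 1)) (Matrix.of fun _ _ => kapGen e' (p ^ 2) (ξ t)) with hK
  set H : ℕ → Matrix (Fin (2 * (p + 1) + 1) × Unit) (Fin (2 * (p + 1) + 1) × Unit) R[X] := fun t =>
    Matrix.of fun l m => hFull e' p (p ^ 2) (ξ t) ((l.1 : ℤ) - (p + 1 : ℕ)) ((m.1 : ℤ) - (p + 1 : ℕ)) with hH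
  set W : ℕ → Fin (2 * (p + 1) + 1) × Unit → R[X] :=
    fun t l => hWeight (ξ t) ((l.1 : ℤ) - (p + 1 : ℕ)) with hW
  have hKapp : ∀ t l m, K t l m =
      kapPoly e' (p ^ 2) (ξ t) (p * ((l.1 : ℤ) - (p + 1 : ℕ)) - ((m.1 : ℤ) - (p + 1 : ℕ))) := by
    intro t l m
    have hq : (p : ℤ) * (p + 1 : ℕ) - (p + 1 : ℕ) = (p ^ 2 - 1 : ℕ) := by
      rw [Nat.cast_sub (Nat.one_le_pow _ _ (by omega))]; push_cast; ring
    have hq' : p * ((l.1 : ℤ) - (p + 1 : ℕ)) - ((m.1 : ℤ) - (p + 1 : ℕ)) =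
        (p * l.1 : ℕ) - m.1 - (p ^ 2 - 1 : ℕ) := by rw [← hq]; push_cast; ring
    rw [hq']
    simp only [hK, dworkM, Matrix.of_apply]
    split_ifs with h
    · rw [coeff_kapGen _ _ _ he0, Nat.cast_sub h]
    · rw [kapPoly, sum_eq_zero]
      intro j hj
      simp only [mem_range] at hj
      rw [extInt, if_pos (by omega)]
      simp
  have hcomm : ∀ t l m, W (t + 1) l * H t l m = K t l m * W t m := by
    intro t l m
    rw [hKapp, ← hWeight_mul_hFull e' p (p ^ 2) (by omega) (ξ t) he0]
    simp only [hW, hH, hξ, Matrix.of_apply]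
    rw [← map_pow, ← pow_mul, ← pow_succ]
  have hprod : ∀ k l m, W k l * prodRev H k l m = prodRev K k l m * W 0 m := by
    intro k
    induction k with
    | zero =>
      intro l m
      rw [prodRev, prodRev, Matrix.one_apply]
      split_ifs with h
      · rw [h]; ring
      · ring
    | succ k ih =>
      intro l m
      rw [prodRev, prodRev, Matrix.mul_apply, Matrix.mul_apply, mul_sum, sum_mul]
      refine sum_congr rfl fun r _ => ?_
      linear_combination prodRev H k r m * hcomm k l r + K k l r * ih r m
  have hWn : W n = W 0 := by
    simp only [hW, hξ]
    rw [← hF, FiniteField.pow_card, pow_zero, pow_one]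
  have hdiag : ∀ l, prodRev H n l l = prodRev K n l l := by
    intro l
    have h1 := hprod n l l
    rw [hWn, mul_comm] at h1
    refine (isRegular_hWeight ?_ _).right h1
    exact (x.isUnit.pow _).map D.τ
  have htr : (prodRev K n).trace = (prodRev H n).trace := by
    rw [Matrix.trace, Matrix.trace]
    exact sum_congr rfl fun l _ => (hdiag l).symm
  rw [htr]
  have hmap := map_prodRev ((evalRingHom D.pi).mapMatrix : Matrix (Fin (2 * (p + 1) + 1) × Unit) _ R[X] →+* _).toMonoidHom H n
  have hev : eval D.pi (prodRev H n).trace = ((evalRingHom D.pi).mapMatrix (prodRev H n)).trace := by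
    simp [Matrix.trace, eval_finsetSum]
  rw [hev]
  refine (congrArg Matrix.trace hmap).trans ?_
  refine congrArg Matrix.trace (prodRev_congr fun t _ => ?_)
  ext l m
  simp only [hH, zTrunc, hξ]
  exact D.eval_hFull hM _ _ _

/-- Kloosterman sums as traces of products of Frobenius matrices. -/
theorem DworkChar.neg_kloos_eq_trace (D : DworkChar p M n e F R) (hM : 3 * M ≤ p) (hn : n ≠ 0)
    (hF : Fintype.card F = p ^ n) (he0 : ∀ i, p ^ 2 ≤ i → e i = 0)
    (he : ∀ i, i + 1 < p ^ 2 → ((i : ZMod (p ^ M)) + 1) * e (i + 1) =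
      e i + if p ≤ i + 1 then e (i + 1 - p) else 0) (x : Fˣ) :
    -kloos D.Ψ x =
      (prodRev (fun t => (frobMat e p (p * M) (3 * M)).map (D.pt (x ^ p ^ t))) n).trace := by
  have hp2 : 2 ≤ p := (Fact.out : p.Prime).two_le
  have hxx : ∀ t, D.pt ((x : F) ^ p ^ t) X ^ p = p ^ 2 * D.pt ((x : F) ^ p ^ (t + 1)) X := by
    intro t
    rw [D.pt_X_pow_p, ← pow_mul, ← pow_succ]
  have h := trace_prodRev_zTrunc (M := M) (J := p + 1) (n := n) (fun t => D.pt ((x : F) ^ p ^ t) X)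
    (fun t k => D.pt ((x : F) ^ p ^ t) (gPoly e (p * M) k))
    (fun t => zData_gPoly _ hp2 (by omega) (D.pt_X_pow _) D.natCast_pow_eq_zero (hxx t) he) hM hp2
    (by omega) hn (by rw [← hF, FiniteField.pow_card, pow_zero, pow_one])
  rw [D.kloos_eq_mul_trace (by omega) hn hF he0, Nat.cast_sub (Nat.one_le_pow _ _ (by omega))]
  have h2 : prodRev (fun t => (frobMat e p (p * M) (3 * M)).map (D.pt ((x : F) ^ p ^ t))) n =
      prodRev (fun t => zMat p (p + 1) (D.pt ((x : F) ^ p ^ t) X) (D.pt ((x : F) ^ p ^ (t + 1)) X)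
        (fun k => D.pt ((x : F) ^ p ^ t) (gPoly e (p * M) k))) n :=
    prodRev_congr fun t _ => (zMat_eq_frobMat _ hp2 (by omega) (by omega) (D.pt_X_pow _)
      D.natCast_pow_eq_zero (hxx t) he).symm
  rw [h2]
  push_cast
  linear_combination h

end
end

section
open Matrix

/-- A matrix whose reduction along a surjective local homomorphism to a field is injective is a split
injection with free complement. -/
theorem Matrix.exists_split_of_injective {R k V V' κ : Type*} [CommRing R] [Field k] [Fintype V] [Fintype V']
    [Fintype κ] [DecidableEq V] [DecidableEq V'] [DecidableEq κ] (π : R →+* k) (hπ : Function.Surjective π)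
    [IsLocalHom π] (hcard : Fintype.card V' = Fintype.card V + Fintype.card κ) (D : Matrix V' V R)
    (hD : ∀ v, (D.map π).mulVec v = 0 → v = 0) :
    ∃ (s : Matrix V V' R) (ρ : Matrix κ V' R) (E : Matrix V' κ R),
      s * D = 1 ∧ ρ * D = 0 ∧ ρ * E = 1 ∧ D * s + E * ρ = 1 := by
  have hli : LinearIndependent k (D.map π).col := by
    rw [← Matrix.mulVec_injective_iff]
    exact (injective_iff_map_eq_zero (D.map π).mulVecLin).2 hD
  let b₀ := Module.Basis.sumExtend hli
  have : Fintype (Module.Basis.sumExtendIndex hli) :=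
    @Fintype.ofFinite _ ((Module.Finite.finite_basis b₀).of_injective _ Sum.inr_injective)
  have hc : Fintype.card (Module.Basis.sumExtendIndex hli) = Fintype.card κ := by
    have h1 := Module.finrank_eq_card_basis b₀
    rw [Module.finrank_fintype_fun_eq_card, Fintype.card_sum, hcard] at h1
    omega
  let b := b₀.reindex (Equiv.sumCongr (Equiv.refl V) (Fintype.equivOfCardEq hc))
  have hb : ∀ v, b (Sum.inl v) = (D.map π).col v := fun v => by
    simp only [b, b₀, Module.Basis.sumExtend, Module.Basis.reindex_apply, Equiv.sumCongr_symm, Equiv.refl_symm,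
      Equiv.sumCongr_apply, Sum.map_inl, Equiv.refl_apply, Module.Basis.extend_apply_self]
    rfl
  let σ := Function.surjInv hπ
  have hσ : ∀ x, π (σ x) = x := Function.surjInv_eq hπ
  let E : Matrix V' κ R := Matrix.of fun i c => σ (b (Sum.inr c) i)
  let B : Matrix V' (V ⊕ κ) R := Matrix.fromCols D E
  let C : Matrix (V ⊕ κ) V' R := (b.toMatrix (Pi.basisFun k V')).map σ
  have hB : B.map π = (Pi.basisFun k V').toMatrix b := by
    ext i (v | c)
    · simp [B, Module.Basis.toMatrix, hb]
    · simp [B, E, Module.Basis.toMatrix, hσ]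
  have hC : C.map π = b.toMatrix (Pi.basisFun k V') := by
    ext i j; simp [C, hσ]
  have hBC : IsUnit (B * C).det := by
    refine isUnit_of_map_unit π _ ?_
    rw [RingHom.map_det, RingHom.mapMatrix_apply, Matrix.map_mul, hB, hC,
      Module.Basis.toMatrix_mul_toMatrix_flip]
    simp
  have hCB : IsUnit (C * B).det := by
    refine isUnit_of_map_unit π _ ?_
    rw [RingHom.map_det, RingHom.mapMatrix_apply, Matrix.map_mul, hB, hC,
      Module.Basis.toMatrix_mul_toMatrix_flip]
    simp
  let C' := C * (B * C)⁻¹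
  have h1 : B * C' = 1 := by
    rw [← Matrix.mul_assoc, Matrix.mul_nonsing_inv _ hBC]
  have h2 : (C * B)⁻¹ * C * B = 1 := by
    rw [Matrix.mul_assoc, Matrix.nonsing_inv_mul _ hCB]
  have h3 : C' * B = 1 := by
    have : (C * B)⁻¹ * C = C' := by
      rw [← Matrix.mul_one ((C * B)⁻¹ * C), ← h1, ← Matrix.mul_assoc, h2, Matrix.one_mul]
    rw [← this, h2]
  have hC' : C' = Matrix.fromRows C'.toRows₁ C'.toRows₂ := (Matrix.fromRows_toRows C').symm
  refine ⟨C'.toRows₁, C'.toRows₂, E, ?_⟩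
  rw [hC'] at h1 h3
  rw [Matrix.fromCols_mul_fromRows] at h1
  rw [Matrix.fromRows_mul_fromCols, ← Matrix.fromBlocks_one, Matrix.fromBlocks_inj] at h3
  exact ⟨h3.1, h3.2.2.1, h3.2.2.2, h1⟩

theorem Matrix.mul_pow_succ_comm {R V V' : Type*} [CommRing R] [Fintype V] [Fintype V'] [DecidableEq V]
    [DecidableEq V'] (A : Matrix V' V R) (B : Matrix V V' R) (n : ℕ) :
    (A * B) ^ (n + 1) = A * (B * A) ^ n * B := by
  induction n with
  | zero => simp
  | succ n ih => rw [pow_succ, ih, pow_succ (B * A)]; simp only [Matrix.mul_assoc]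

theorem Matrix.trace_mul_pow_comm {R V V' : Type*} [CommRing R] [Fintype V] [Fintype V'] [DecidableEq V]
    [DecidableEq V'] (A : Matrix V' V R) (B : Matrix V V' R) {n : ℕ} (hn : n ≠ 0) :
    ((A * B) ^ n).trace = ((B * A) ^ n).trace := by
  obtain ⟨n, rfl⟩ := Nat.exists_eq_succ_of_ne_zero hn
  rw [Nat.succ_eq_add_one, Matrix.mul_pow_succ_comm, Matrix.trace_mul_comm, ← Matrix.mul_assoc, pow_succ',
    Matrix.mul_assoc]
theorem Matrix.one_sub_pow_mul_trace_pow {R V V' κ : Type*} [CommRing R] [Fintype V] [Fintype V']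
    [Fintype κ] [DecidableEq V] [DecidableEq V'] [DecidableEq κ] (q : R) {D : Matrix V' V R} {T : Matrix V' V' R}
    {T' : Matrix V V R} (h : T * D = q • (D * T')) {s : Matrix V V' R} {ρ : Matrix κ V' R} {E : Matrix V' κ R}
    (hsD : s * D = 1) (hρD : ρ * D = 0) (hρE : ρ * E = 1) (hDs : D * s + E * ρ = 1)
    (n : ℕ) (htr : (T ^ n).trace = (T' ^ n).trace) :
    (1 - q ^ n) * (T' ^ n).trace = ((ρ * T * E) ^ n).trace := by
  have h1 : T ^ n * D = q ^ n • (D * T' ^ n) := by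
    clear htr
    induction n with
    | zero => simp
    | succ n ih =>
      rw [pow_succ, Matrix.mul_assoc, h, Matrix.mul_smul, ← Matrix.mul_assoc, ih, Matrix.smul_mul, smul_smul,
        Matrix.mul_assoc, ← pow_succ, ← pow_succ']
  have h2 : ρ * T = ρ * T * E * ρ := by
    conv_lhs => rw [← Matrix.mul_one (ρ * T), ← hDs]
    rw [Matrix.mul_add, ← Matrix.mul_assoc, Matrix.mul_assoc ρ T D, h, Matrix.mul_smul, ← Matrix.mul_assoc ρ D, hρD]
    simp [Matrix.mul_assoc]
  have h3 : ρ * T ^ n = (ρ * T * E) ^ n * ρ := by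
    clear htr h1
    induction n with
    | zero => simp
    | succ n ih =>
      rw [pow_succ, ← Matrix.mul_assoc, ih, pow_succ, Matrix.mul_assoc, Matrix.mul_assoc _ _ ρ]
      exact congrArg _ h2
  have h4 : (T ^ n).trace = (T ^ n * D * s).trace + (T ^ n * E * ρ).trace := by
    rw [← Matrix.trace_add, Matrix.mul_assoc, Matrix.mul_assoc, ← Matrix.mul_add, hDs, Matrix.mul_one]
  rw [h1, Matrix.trace_mul_comm _ s, Matrix.mul_smul, ← Matrix.mul_assoc, hsD, Matrix.one_mul,
    Matrix.trace_mul_comm _ ρ, ← Matrix.mul_assoc, h3, Matrix.mul_assoc _ ρ E, hρE, Matrix.mul_one, htr,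
    Matrix.trace_smul, smul_eq_mul] at h4
  linear_combination h4
end

section
open Polynomial Matrix
open scoped Kronecker

theorem dsymM_add {R : Type*} [CommRing R] (k : ℕ) (G H : Matrix (Fin 2) (Fin 2) R) :
    dsymM k (G + H) = dsymM k G + dsymM k H := by
  ext r b
  simp only [dsymM, Matrix.of_apply, Matrix.add_apply]
  split_ifs <;> ring

theorem dsymM_smul {R : Type*} [CommRing R] (k : ℕ) (c : R) (G : Matrix (Fin 2) (Fin 2) R) :
    dsymM k (c • G) = c • dsymM k G := by
  ext r b
  simp only [dsymM, Matrix.of_apply, Matrix.smul_apply, smul_eq_mul]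
  split_ifs <;> ring

theorem map_dsymM {R S : Type*} [CommRing R] [CommRing S] (f : R →+* S) (k : ℕ) (G : Matrix (Fin 2) (Fin 2) R) :
    (dsymM k G).map f = dsymM k (G.map f) := by
  ext r b
  simp only [dsymM, Matrix.of_apply, Matrix.map_apply, map_add]
  split_ifs <;> simp

theorem dsymM_mul_symM {R : Type*} [CommRing R] (k : ℕ) (A H G : Matrix (Fin 2) (Fin 2) R)
    (h : H * A = A * G) : dsymM k H * symM k A = symM k A * dsymM k G := by
  have := symM_horizontal k (TrivSqZeroExt.inlHom R R) A H G (by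
    have h1 : A.map (fun x => (TrivSqZeroExt.inlHom R R x).snd) = 0 := by ext; simp
    have h2 : A.map (fun x => (TrivSqZeroExt.inlHom R R x).fst) = A := by ext; simp
    rw [h1, h2, h, zero_add])
  have h1 : (symM k A).map (fun x => (TrivSqZeroExt.inlHom R R x).snd) = 0 := by ext; simp
  have h2 : (symM k A).map (fun x => (TrivSqZeroExt.inlHom R R x).fst) = symM k A := by ext; simp
  rwa [h1, h2, zero_add] at this

/-- The ring homomorphism to the dual numbers attached to a derivation. -/
noncomputable def eulerHom {R Q : Type*} [CommRing R] [CommRing Q] (q : R[X] →+* Q) : R[X] →+* DualNumber Q where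
  toFun f := TrivSqZeroExt.inl (q f) + TrivSqZeroExt.inr (q (eulerD R f))
  map_one' := by ext <;> simp
  map_mul' f g := by ext <;> simp [mul_comm]
  map_zero' := by ext <;> simp
  map_add' f g := by ext <;> simp

theorem eulerD_C_mul {R : Type*} [CommRing R] (c : R) (f : R[X]) :
    eulerD R (C c * f) = C c * eulerD R f := by
  rw [Derivation.leibniz, ← Polynomial.algebraMap_eq, Derivation.map_algebraMap]
  simp

theorem eulerD_comp_C_mul_X {R : Type*} [CommRing R] (α : R) (f : R[X]) :
    eulerD R (f.comp (C α * X)) = (eulerD R f).comp (C α * X) := by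
  simp [eulerD, derivative_comp]
  ring

section
variable {R Q : Type*} [CommRing R] [CommRing Q] {e : ℕ → R} {p N L B : ℕ}

theorem exists_eulerD_symM_frobMat (q : R[X] →+* Q) (hqL : q X ^ L = 0) (hp : 2 ≤ p)
    (he : ∀ i, i + 1 < N → ((i : R) + 1) * e (i + 1) = e i + if p ≤ i + 1 then e (i + 1 - p) else 0)
    (hN : p * B + 1 + L ≤ N) (m : ℕ) (hL : L = p * m) (hm : (p : Q) ^ m = 0) (hB : 3 * m ≤ B) (k : ℕ) :
    ∃ K : Matrix (Fin (k + 1)) (Fin (k + 1)) Q,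
      (symM k (frobMat e p L B)).map (fun f => q (eulerD R f)) +
        (p : Q) • (dsymM k !![0, 0; 1, 0] * (symM k (frobMat e p L B)).map q) + q X ^ p • K =
        (symM k (frobMat e p L B)).map q * dsymM k !![0, q X; 1, 0] ∧
      (p : Q) • K = dsymM k !![0, 1; 0, 0] * (symM k (frobMat e p L B)).map q := by
  have h0 := eulerD_frobHat q hqL hp he hN m hL hm hB
  have h1 := symM_horizontal k (eulerHom q) (frobHat e p L B) !![0, -q X ^ p; -1, 0] !![0, q X; 1, 0] (by
    have e1 : (frobHat e p L B).map (fun x => (eulerHom q x).snd) =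
      (frobHat e p L B).map fun f => q (eulerD R f) := by ext; simp [eulerHom]
    have e2 : (frobHat e p L B).map (fun x => (eulerHom q x).fst) =
      (frobHat e p L B).map q := by ext; simp [eulerHom]
    rw [e1, e2, h0, sub_add_cancel])
  have e1 : (symM k (frobHat e p L B)).map (fun x => (eulerHom q x).snd) =
      (symM k (frobHat e p L B)).map fun f => q (eulerD R f) := by ext; simp [eulerHom]
  have e2 : (symM k (frobHat e p L B)).map (fun x => (eulerHom q x).fst) =
      (symM k (frobHat e p L B)).map q := by ext; simp [eulerHom]
  rw [e1, e2] at h1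
  set Δ₂ : Matrix (Fin 2) (Fin 2) Q := Matrix.diagonal ![1, -(p : Q)] with hΔ₂
  have hΔ : symM k (frobMat e p L B) =
      (symM k (Matrix.diagonal ![1, -(p : R)])).map C * symM k (frobHat e p L B) := by
    rw [frobMat, symM_mul, map_symM]
    congr 2
    ext i j; fin_cases i <;> fin_cases j <;> simp
  have hq : (symM k (frobMat e p L B)).map q = symM k Δ₂ * (symM k (frobHat e p L B)).map q := by
    rw [hΔ, Matrix.map_mul, map_symM C, map_symM q (k := k) (A := Matrix.map _ _)]
    congr 2
    ext i j; fin_cases i <;> fin_cases j <;> simp [hΔ₂]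
  have hd : (symM k (frobMat e p L B)).map (fun f => q (eulerD R f)) =
      symM k Δ₂ * (symM k (frobHat e p L B)).map (fun f => q (eulerD R f)) := by
    have : ∀ r s, q (C (symM k (Matrix.diagonal ![1, -(p : R)]) r s)) = symM k Δ₂ r s := by
      intro r s
      have h3 : symM k Δ₂ = (symM k (Matrix.diagonal ![1, -(p : R)])).map (q.comp C) := by
        rw [map_symM]
        congr 1
        ext i j; fin_cases i <;> fin_cases j <;> simp [hΔ₂]
      rw [h3]; simp
    ext r s
    rw [hΔ]
    simp only [Matrix.map_apply, Matrix.mul_apply, map_sum, eulerD_C_mul, map_mul, this]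
  have hG0 : (p : Q) • (dsymM k !![0, 0; 1, 0] * symM k Δ₂) = symM k Δ₂ * dsymM k !![0, 0; -1, 0] := by
    rw [← Matrix.smul_mul, ← dsymM_smul]
    refine dsymM_mul_symM k _ _ _ ?_
    ext i j; fin_cases i <;> fin_cases j <;> simp [hΔ₂, Matrix.mul_apply]
  have hG1 : (p : Q) • (symM k Δ₂ * dsymM k !![0, -1; 0, 0]) = dsymM k !![0, 1; 0, 0] * symM k Δ₂ := by
    rw [← Matrix.mul_smul, ← dsymM_smul]
    refine (dsymM_mul_symM k _ _ _ ?_).symm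
    ext i j; fin_cases i <;> fin_cases j <;> simp [hΔ₂, Matrix.mul_apply]
  have hH : dsymM k !![0, -q X ^ p; -1, 0] = dsymM k !![0, 0; -1, 0] + q X ^ p • dsymM k !![0, -1; 0, 0] := by
    rw [← dsymM_smul, ← dsymM_add]
    congr 1
    ext i j; fin_cases i <;> fin_cases j <;> simp
  refine ⟨symM k Δ₂ * dsymM k !![0, -1; 0, 0] * (symM k (frobHat e p L B)).map q, ?_, ?_⟩
  · rw [hd, hq, ← Matrix.mul_assoc, ← Matrix.smul_mul, hG0, Matrix.mul_assoc _ _ (dsymM k !![0, q X; 1, 0]), ← h1, hH]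
    simp only [Matrix.mul_add, Matrix.add_mul, Matrix.mul_smul, Matrix.smul_mul, Matrix.mul_assoc, add_assoc]
  · rw [hq, ← Matrix.mul_assoc, ← hG1, Matrix.smul_mul]
end

/-- Tensor product of two solutions of Frobenius-type differential equations. -/
theorem kronecker_frobenius {Q m n : Type*} [CommRing Q] [Fintype m] [Fintype n] [DecidableEq m] [DecidableEq n]
    {π x : Q} {A dA K G0 G : Matrix m m Q} {A' dA' K' G0' G' : Matrix n n Q} {G1 : Matrix m m Q} {G1' : Matrix n n Q}
    (h : dA + π • (G0 * A) + x • K = A * G) (hK : π • K = G1 * A)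
    (h' : dA' + π • (G0' * A') + x • K' = A' * G') (hK' : π • K' = G1' * A') :
    (dA ⊗ₖ A' + A ⊗ₖ dA') + π • ((G0 ⊗ₖ 1 + 1 ⊗ₖ G0') * (A ⊗ₖ A')) + x • (K ⊗ₖ A' + A ⊗ₖ K') =
        (A ⊗ₖ A') * (G ⊗ₖ 1 + 1 ⊗ₖ G') ∧
      π • (K ⊗ₖ A' + A ⊗ₖ K') = (G1 ⊗ₖ 1 + 1 ⊗ₖ G1') * (A ⊗ₖ A') := by
  constructor
  · rw [Matrix.mul_add, Matrix.add_mul, ← Matrix.mul_kronecker_mul, ← Matrix.mul_kronecker_mul,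
      ← Matrix.mul_kronecker_mul, ← Matrix.mul_kronecker_mul, Matrix.mul_one, Matrix.mul_one, Matrix.one_mul,
      Matrix.one_mul, ← h, ← h']
    simp only [Matrix.add_kronecker, Matrix.kronecker_add, Matrix.smul_kronecker, Matrix.kronecker_smul, smul_add]
    abel
  · rw [Matrix.add_mul, ← Matrix.mul_kronecker_mul, ← Matrix.mul_kronecker_mul, Matrix.one_mul,
      Matrix.one_mul, ← hK, ← hK', smul_add, Matrix.smul_kronecker, Matrix.kronecker_smul]
end

section
open Polynomial Matrix
open scoped Kronecker

/-- The constant part of the connection matrix of the tensor product of two symmetric powers. -/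
def connZero (R : Type*) [CommRing R] (i j : ℕ) : Matrix (Fin (i + 1) × Fin (j + 1)) (Fin (i + 1) × Fin (j + 1)) R :=
  dsymM i !![0, 0; 1, 0] ⊗ₖ 1 + 1 ⊗ₖ dsymM j !![0, 0; 1, 0]

/-- The linear part of the connection matrix of the tensor product of two symmetric powers. -/
def connOne {R : Type*} [CommRing R] (i j : ℕ) (α : R) :
    Matrix (Fin (i + 1) × Fin (j + 1)) (Fin (i + 1) × Fin (j + 1)) R :=
  dsymM i !![0, 1; 0, 0] ⊗ₖ 1 + 1 ⊗ₖ dsymM j !![0, α; 0, 0]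

theorem map_connZero {R S : Type*} [CommRing R] [CommRing S] (f : R →+* S) (i j : ℕ) :
    (connZero R i j).map f = connZero S i j := by
  have h (k : ℕ) : (dsymM k !![(0 : R), 0; 1, 0]).map f = dsymM k !![(0 : S), 0; 1, 0] := by
    rw [map_dsymM]; congr 1; ext i j; fin_cases i <;> fin_cases j <;> simp
  rw [connZero, connZero, ← h i, ← h j]
  ext ⟨a, b⟩ ⟨c, d⟩
  simp [Matrix.one_apply, apply_ite f]

theorem map_connOne {R S : Type*} [CommRing R] [CommRing S] (f : R →+* S) (i j : ℕ) (α : R) :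
    (connOne i j α).map f = connOne i j (f α) := by
  have h (k : ℕ) (α : R) : (dsymM k !![(0 : R), α; 0, 0]).map f = dsymM k !![(0 : S), f α; 0, 0] := by
    rw [map_dsymM]; congr 1; ext i j; fin_cases i <;> fin_cases j <;> simp
  rw [connOne, connOne, ← map_one f, ← h i, ← h j]
  ext ⟨a, b⟩ ⟨c, d⟩
  simp [Matrix.one_apply, apply_ite f]

section
variable {R : Type*} [CommRing R] {e : ℕ → R} {p N L B : ℕ}

/-- The tensor product of symmetric powers of two Frobenius matrices. -/
noncomputable def frobTensor (e : ℕ → R) (p L B i j : ℕ) (α : R) :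
    Matrix (Fin (i + 1) × Fin (j + 1)) (Fin (i + 1) × Fin (j + 1)) R[X] :=
  symM i (frobMat e p L B) ⊗ₖ (symM j (frobMat e p L B)).map (fun f => f.comp (C α * X))

theorem exists_eulerD_frobTensor {Q : Type*} [CommRing Q] (q : R[X] →+* Q) (hqL : q X ^ L = 0) (hp : 2 ≤ p)
    (he : ∀ i, i + 1 < N → ((i : R) + 1) * e (i + 1) = e i + if p ≤ i + 1 then e (i + 1 - p) else 0)
    (hN : p * B + 1 + L ≤ N) (m : ℕ) (hL : L = p * m) (hm : (p : Q) ^ m = 0) (hB : 3 * m ≤ B) (i j : ℕ)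
    {α : R} (hα : α ^ p = α) :
    ∃ K, (frobTensor e p L B i j α).map (fun f => q (eulerD R f)) +
        (p : Q) • (connZero Q i j * (frobTensor e p L B i j α).map q) + q X ^ p • K =
        (frobTensor e p L B i j α).map q * (connZero Q i j + q X • connOne i j (q (C α))) ∧
      (p : Q) • K = connOne i j (q (C α)) * (frobTensor e p L B i j α).map q := by
  obtain ⟨K, h1, h2⟩ := exists_eulerD_symM_frobMat q hqL hp he hN m hL hm hB i
  let q' : R[X] →+* Q := q.comp (compRingHom (C α * X))
  have hq' (f) : q' f = q (f.comp (C α * X)) := rfl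
  have hq'X : q' X = q (C α) * q X := by rw [hq', X_comp, map_mul]
  obtain ⟨K', h3, h4⟩ := exists_eulerD_symM_frobMat q' (by rw [hq'X, mul_pow, hqL, mul_zero]) hp he hN m hL hm hB j
  set A' := (symM j (frobMat e p L B)).map q' with hA'
  set A := (symM i (frobMat e p L B)).map q with hA
  have hc : q (C α) ^ p = q (C α) := by rw [← map_pow, ← map_pow, hα]
  have h3' : (symM j (frobMat e p L B)).map (fun f => q' (eulerD R f)) +
        (p : Q) • (dsymM j !![0, 0; 1, 0] * A') + q X ^ p • (q (C α) • K') =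
        A' * dsymM j !![0, q' X; 1, 0] := by
    rw [← h3, hq'X, mul_pow, hc, smul_smul, mul_comm (q X ^ p)]
  have h4' : (p : Q) • (q (C α) • K') = dsymM j !![0, q (C α); 0, 0] * A' := by
    rw [smul_comm, h4, ← Matrix.smul_mul, ← dsymM_smul]
    congr 2
    ext i j; fin_cases i <;> fin_cases j <;> simp
  have h5 := kronecker_frobenius h1 h2 h3' h4'
  have e1 : (frobTensor e p L B i j α).map q = A ⊗ₖ A' := by
    ext ⟨a, b⟩ ⟨c, d⟩; simp [frobTensor, hA, hA', hq']
  have e2 : (frobTensor e p L B i j α).map (fun f => q (eulerD R f)) =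
      (symM i (frobMat e p L B)).map (fun f => q (eulerD R f)) ⊗ₖ A' +
      A ⊗ₖ (symM j (frobMat e p L B)).map (fun f => q' (eulerD R f)) := by
    ext ⟨a, b⟩ ⟨c, d⟩
    simp only [frobTensor, hA, hA', hq', Matrix.map_apply, Matrix.kroneckerMap_apply, Matrix.add_apply,
      Derivation.leibniz, eulerD_comp_C_mul_X, smul_eq_mul, map_add, map_mul]
    ring
  have e3 : connZero Q i j + q X • connOne i j (q (C α)) =
      dsymM i !![0, q X; 1, 0] ⊗ₖ 1 + 1 ⊗ₖ dsymM j !![0, q' X; 1, 0] := by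
    have hd (k : ℕ) (c : Q) : dsymM k !![0, q X * c; 1, 0] = dsymM k !![0, 0; 1, 0] + q X • dsymM k !![0, c; 0, 0] := by
      rw [← dsymM_smul, ← dsymM_add]; congr 1; ext i j; fin_cases i <;> fin_cases j <;> simp
    rw [connZero, connOne, hq'X, mul_comm _ (q X), hd, ← mul_one (q X), hd, mul_one]
    simp only [Matrix.add_kronecker, Matrix.kronecker_add, Matrix.smul_kronecker, Matrix.kronecker_smul, smul_add]
    abel
  exact ⟨_, by rw [e1, e2, e3]; exact h5.1, by rw [e1]; exact h5.2⟩

theorem coeff_modByMonic_X_pow (f : R[X]) (L k : ℕ) :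
    (f %ₘ X ^ L).coeff k = if k < L then f.coeff k else 0 := by
  nontriviality R
  split_ifs with h
  · conv_rhs => rw [← modByMonic_add_div f (X ^ L : R[X])]
    rw [coeff_add, coeff_X_pow_mul', if_neg (by omega), add_zero]
  · refine coeff_eq_zero_of_degree_lt ((degree_modByMonic_lt f (monic_X_pow L)).trans_le ?_)
    rw [degree_X_pow]; exact_mod_cast not_lt.1 h

/-- Coefficient form of the Frobenius structure. -/
theorem exists_coeff_frobTensor (hp : 2 ≤ p)
    (he : ∀ i, i + 1 < N → ((i : R) + 1) * e (i + 1) = e i + if p ≤ i + 1 then e (i + 1 - p) else 0)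
    (hN : p * B + 1 + L ≤ N) (m : ℕ) (hL : L = p * m) (hm : (p : R) ^ m = 0) (hB : 3 * m ≤ B) (i j : ℕ)
    {α : R} (hα : α ^ p = α) (A : ℕ → Matrix (Fin (i + 1) × Fin (j + 1)) (Fin (i + 1) × Fin (j + 1)) R)
    (hA : ∀ k, A k = (frobTensor e p L B i j α).map fun f => f.coeff k) :
    ∃ K : ℕ → Matrix (Fin (i + 1) × Fin (j + 1)) (Fin (i + 1) × Fin (j + 1)) R, ∀ k < L,
      (k : R) • A k + (p : R) • (connZero R i j * A k) + (if p ≤ k then K (k - p) else 0) =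
        A k * connZero R i j + (if 1 ≤ k then A (k - 1) * connOne i j α else 0) ∧
      (p : R) • K k = connOne i j α * A k := by
  let I : Ideal R[X] := Ideal.span {X ^ L}
  let q := Ideal.Quotient.mk I
  have hq : ∀ {f g}, q f = q g → ∀ k < L, f.coeff k = g.coeff k := fun {f g} h k hk => by
    rw [Ideal.Quotient.eq, Ideal.mem_span_singleton] at h
    obtain ⟨c, hc⟩ := h
    rw [sub_eq_iff_eq_add.1 hc, coeff_add, coeff_X_pow_mul', if_neg (by omega), zero_add]
  have hqX : q X ^ L = 0 := by
    rw [← map_pow, Ideal.Quotient.eq_zero_iff_mem]; exact Ideal.mem_span_singleton_self _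
  have hpm : ((p : ℕ) : R[X] ⧸ I) ^ m = 0 := by
    rw [← map_natCast q, ← map_pow, ← map_natCast (C : R →+* R[X]), ← map_pow, hm, map_zero, map_zero]
  obtain ⟨K, h1, h2⟩ := exists_eulerD_frobTensor q hqX hp he hN m hL hpm hB i j hα
  obtain ⟨K, rfl⟩ : ∃ K' : Matrix _ _ R[X], K = K'.map q :=
    ⟨fun a b => (Ideal.Quotient.mk_surjective (K a b)).choose, by
      ext a b; exact (Ideal.Quotient.mk_surjective (K a b)).choose_spec.symm⟩
  refine ⟨fun k => K.map fun f => f.coeff k, fun k hk => ⟨?_, ?_⟩⟩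
  · ext a b
    have h3 := congrFun (congrFun h1 a) b
    rw [← map_connZero q, ← map_connZero (C : R →+* R[X]), ← map_connOne q, ← map_connOne (C : R →+* R[X])] at h3
    simp only [Matrix.add_apply, Matrix.smul_apply, Matrix.map_apply, Matrix.mul_apply, smul_eq_mul,
      ← map_natCast q p, ← map_mul, ← map_sum, ← map_add, ← map_pow] at h3
    have h4 := hq h3 k hk
    simp only [coeff_add, coeff_eulerD, coeff_natCast_mul, finsetSum_coeff, coeff_C_mul, coeff_X_pow_mul',
      mul_add, coeff_mul_C, ← mul_assoc, Finset.sum_add_distrib] at h4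
    have h5 : ∀ (f : R[X]), (f * X).coeff k = if 1 ≤ k then f.coeff (k - 1) else 0 := fun f => by
      rw [← coeff_mul_X_pow', pow_one]
    simp only [h5] at h4
    simp only [Matrix.add_apply, Matrix.smul_apply, Matrix.mul_apply, smul_eq_mul, hA, Matrix.map_apply]
    split_ifs at h4 ⊢ <;> simpa [Matrix.mul_apply, hA] using h4
  · ext a b
    have h3 := congrFun (congrFun h2 a) b
    rw [← map_connOne q, ← map_connOne (C : R →+* R[X])] at h3
    simp only [Matrix.smul_apply, Matrix.map_apply, Matrix.mul_apply, smul_eq_mul,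
      ← map_natCast q p, ← map_mul, ← map_sum] at h3
    have h4 := hq h3 k hk
    simp only [coeff_natCast_mul, finsetSum_coeff, coeff_C_mul] at h4
    simpa only [Matrix.smul_apply, Matrix.mul_apply, smul_eq_mul, hA, Matrix.map_apply] using h4
end
end

section
open Polynomial Matrix
open scoped Kronecker

/-- The matrix of the Frobenius operator with coefficient matrices `A k`, the variable being rescaled by a
root of `c`. -/
def frobOp {R κ : Type*} [CommRing R] (c : R) (p J : ℕ) (A : ℕ → Matrix κ κ R) :
    Matrix (Fin (J + 1) × κ) (Fin (J + 1) × κ) R :=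
  Matrix.of fun l m => if (m.1 : ℕ) ≤ p * l.1 then c ^ (l.1 : ℕ) * A (p * l.1 - m.1) l.2 m.2 else 0

theorem map_frobOp {R S κ : Type*} [CommRing R] [CommRing S] (f : R →+* S) (c : R) (p J : ℕ)
    (A : ℕ → Matrix κ κ R) : (frobOp c p J A).map f = frobOp (f c) p J fun k => (A k).map f := by
  ext l m
  simp [frobOp, apply_ite f]

theorem dwork_trace_formula_rescaled {Λ R κ U : Type*} [CommRing Λ] [CommRing R] [Fintype κ] [DecidableEq κ]
    [Fintype U] (ι : Λ →+* R) (ϖ : R) (τ : U → R) (p n J : ℕ) (hp : 2 ≤ p) (hn : n ≠ 0)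
    (hτ : ∀ s, ∑ y, τ y ^ s = if p ^ n - 1 ∣ s then ((p ^ n - 1 : ℕ) : R) else 0)
    (A : Matrix κ κ Λ[X]) (hA : ∀ a b, (A a b).natDegree ≤ (p - 1) * J) :
    ∑ y, (prodRev (fun t => A.map (eval₂RingHom ι (ϖ ^ 2 * τ y ^ p ^ t))) n).trace =
      ((p ^ n - 1 : ℕ) : R) *
        ((frobOp (ϖ ^ (2 * (p - 1))) p J fun k => A.map fun f => ι (f.coeff k)) ^ n).trace := by
  let G : Matrix κ κ R[X][X] := A.map fun f => (f.map ((C : R →+* R[X]).comp ι)).comp (C (X ^ 2) * X)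
  have hGc : ∀ a b k, (G a b).coeff k = C (ι ((A a b).coeff k)) * X ^ (2 * k) := fun a b k => by
    simp only [G, Matrix.map_apply, comp_C_mul_X_coeff, coeff_map, RingHom.comp_apply, pow_mul]
  have h1 := dwork_trace_formula (fun y => (C (τ y) : R[X])) p n J hp hn (fun s => by
    simp only [← C_pow]
    rw [← map_sum, hτ]
    split_ifs <;> simp) (fun _ => G) (fun _ a b => by
      rw [natDegree_le_iff_coeff_eq_zero]
      intro k hk
      rw [hGc, coeff_eq_zero_of_natDegree_lt ((hA a b).trans_lt hk)]; simp)
  rw [prodRev_const] at h1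
  let H := frobOp (X ^ (2 * (p - 1)) : R[X]) p J fun k => A.map fun f => C (ι (f.coeff k))
  let w : Fin (J + 1) × κ → R[X] := fun m => X ^ (2 * (m.1 : ℕ))
  have hs : SemiconjBy (Matrix.diagonal w) H (dworkM p J G) := by
    show _ * _ = _ * _
    ext l m
    rw [Matrix.diagonal_mul, Matrix.mul_diagonal]
    simp only [H, w, frobOp, dworkM, Matrix.of_apply, hGc, Matrix.map_apply]
    split_ifs with h
    · have : 2 * (l.1 : ℕ) + 2 * (p - 1) * l.1 = 2 * (p * l.1 - m.1) + 2 * m.1 := by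
        obtain ⟨p, rfl⟩ := Nat.exists_eq_add_of_le' (show 1 ≤ p by omega)
        simp only [Nat.add_sub_cancel]
        obtain ⟨r, hr⟩ := Nat.exists_eq_add_of_le h
        rw [hr]; simp only [Nat.add_sub_cancel_left]
        linarith
      rw [mul_assoc, ← pow_add, ← this, pow_add, pow_mul X (2 * (p - 1))]
      ring
    · simp
  have htr : (dworkM p J G ^ n).trace = (H ^ n).trace := by
    refine Finset.sum_congr rfl fun v _ => ?_
    have h2 := congrFun (congrFun (hs.pow_right n).eq v) v
    rw [Matrix.diagonal_mul, Matrix.mul_diagonal, mul_comm] at h2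
    exact ((isRegular_X_pow _).right h2).symm
  rw [htr] at h1
  have h3 := congrArg (evalRingHom ϖ) h1
  rw [map_sum, map_mul, map_natCast] at h3
  have h4 : evalRingHom ϖ (H ^ n).trace =
      ((frobOp (ϖ ^ (2 * (p - 1))) p J fun k => A.map fun f => ι (f.coeff k)) ^ n).trace := by
    rw [AddMonoidHom.map_trace, ← RingHom.mapMatrix_apply, map_pow, RingHom.mapMatrix_apply, map_frobOp]
    congr 4
    · simp
    · ext k a b; simp
  rw [h4] at h3
  rw [← h3]
  refine Finset.sum_congr rfl fun y _ => ?_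
  rw [AddMonoidHom.map_trace, ← RingHom.mapMatrix_apply]
  symm
  have h6 := map_prodRev ((evalRingHom ϖ).mapMatrix (m := κ)).toMonoidHom
    (fun t => G.map (eval (C (τ y) ^ p ^ t))) n
  refine Eq.trans (congrArg Matrix.trace h6) (congrArg Matrix.trace ?_)
  refine prodRev_congr fun t _ => ?_
  ext a b
  show eval ϖ (eval (C (τ y) ^ p ^ t) ((map (C.comp ι) (A a b)).comp (C (X ^ 2) * X))) =
    eval₂ ι (ϖ ^ 2 * τ y ^ p ^ t) (A a b)
  simp only [eval_comp, eval_mul, eval_C, eval_X, eval_map]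
  rw [← coe_evalRingHom, hom_eval₂]
  simp only [coe_evalRingHom, eval_mul, eval_pow, eval_C, eval_X]
  congr 1
  ext; simp
end

section
open Polynomial Matrix
open scoped Kronecker

theorem symM_prodRev {R : Type*} [CommRing R] (k : ℕ) (f : ℕ → Matrix (Fin 2) (Fin 2) R) (n : ℕ) :
    symM k (prodRev f n) = prodRev (fun t => symM k (f t)) n := by
  induction n with
  | zero => simp [prodRev, symM_one]
  | succ n ih => simp only [prodRev, symM_mul, ih]

theorem prodRev_kronecker {R m n : Type*} [CommRing R] [Fintype m] [Fintype n] [DecidableEq m] [DecidableEq n]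
    (f : ℕ → Matrix m m R) (g : ℕ → Matrix n n R) (k : ℕ) :
    prodRev f k ⊗ₖ prodRev g k = prodRev (fun t => f t ⊗ₖ g t) k := by
  induction k with
  | zero => simp [prodRev]
  | succ k ih => simp only [prodRev, ← ih, Matrix.mul_kronecker_mul]

theorem mul_chebF_eq_trace_prodRev {R : Type*} [CommRing R] (f g : ℕ → Matrix (Fin 2) (Fin 2) R) (i j n : ℕ) (q : R)
    (hf : (prodRev f n).det = q) (hg : (prodRev g n).det = q) :
    chebF (prodRev f n).trace q i * chebF (prodRev g n).trace q j =
      (prodRev (fun t => symM i (f t) ⊗ₖ symM j (g t)) n).trace := by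
  rw [← prodRev_kronecker, Matrix.trace_kronecker, ← symM_prodRev, ← symM_prodRev, trace_symM, trace_symM, hf, hg]

variable {p M n : ℕ} [Fact p.Prime] {e : ℕ → ZMod (p ^ M)} {F R : Type*} [Field F] [Fintype F]
  [DecidableEq F] [Algebra (ZMod p) F] [CommRing R]

theorem DworkChar.pt_eq_of_X_pow_dvd_sub (D : DworkChar p M n e F R) (y : F) {f g : (ZMod (p ^ M))[X]}
    (h : X ^ (p * M) ∣ f - g) : D.pt y f = D.pt y g := by
  obtain ⟨c, hc⟩ := h
  rw [sub_eq_iff_eq_add.1 hc, map_add, map_mul, map_pow, D.pt_X_pow, zero_mul, zero_add]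

theorem DworkChar.det_prodRev (D : DworkChar p M n e F R) (hM0 : M ≠ 0) (hM : 4 * M + 1 ≤ p) (he0 : e 0 = 1)
    (he : ∀ i, i + 1 < p ^ 2 → ((i : ZMod (p ^ M)) + 1) * e (i + 1) =
      e i + if p ≤ i + 1 then e (i + 1 - p) else 0) (y : ℕ → F) (k : ℕ) :
    (prodRev (fun t => (frobMat e p (p * M) (3 * M)).map (D.pt (y t))) k).det = (p : R) ^ k := by
  rw [← Matrix.coe_detMonoidHom, map_prodRev, ← prodRev_const (p : R)]
  refine prodRev_congr fun t _ => ?_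
  rw [Matrix.coe_detMonoidHom, ← RingHom.mapMatrix_apply, ← RingHom.map_det,
    D.pt_eq_of_X_pow_dvd_sub _ (X_pow_dvd_det_frobMat Fact.out hM0 hM he0 he), map_natCast]

/-- The Teichmüller representative modulo `p ^ M` of a residue class. -/
def teich (p M : ℕ) (a : ZMod p) : ZMod (p ^ M) := (a.val : ZMod (p ^ M)) ^ p ^ ((p - 1) * M)

theorem DworkChar.pt_comp (D : DworkChar p M n e F R) (a : ZMod p) (y : F) (f : (ZMod (p ^ M))[X]) :
    D.pt y (f.comp (C (teich p M a) * X)) = D.pt (algebraMap (ZMod p) F a * y) f := by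
  have : (D.pt y).comp (compRingHom (C (teich p M a) * X)) = D.pt (algebraMap (ZMod p) F a * y) := by
    refine Polynomial.ringHom_ext (fun r => by simp [DworkChar.pt]) ?_
    simp only [RingHom.comp_apply, coe_compRingHom_apply, X_comp, map_mul, D.pt_X, D.τ_algebraMap, teich]
    simp only [DworkChar.pt, coe_eval₂RingHom, eval₂_C]
    ring
  exact congrArg (fun g : (ZMod (p ^ M))[X] →+* R => g f) this

omit [Fintype F] [DecidableEq F] in
theorem algebraMap_zmod_pow_pow (a : ZMod p) (t : ℕ) :
    algebraMap (ZMod p) F a ^ p ^ t = algebraMap (ZMod p) F a := by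
  rw [← map_pow]
  congr 1
  exact ZMod.pow_card_pow a

/-- Coefficient matrices of the tensor Frobenius matrix. -/
noncomputable def frobCoeff (e : ℕ → ZMod (p ^ M)) (i j : ℕ) (a : ZMod p) (k : ℕ) :
    Matrix (Fin (i + 1) × Fin (j + 1)) (Fin (i + 1) × Fin (j + 1)) (ZMod (p ^ M)) :=
  (frobTensor e p (p * M) (3 * M) i j (teich p M a)).map fun f => f.coeff k

theorem DworkChar.kloosMoment_eq (D : DworkChar p M n e F R) (hM0 : M ≠ 0) (hM : 4 * M + 1 ≤ p) (hn : n ≠ 0)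
    (hF : Fintype.card F = p ^ n) (he0 : e 0 = 1) (he1 : ∀ i, p ^ 2 ≤ i → e i = 0)
    (he : ∀ i, i + 1 < p ^ 2 → ((i : ZMod (p ^ M)) + 1) * e (i + 1) =
      e i + if p ≤ i + 1 then e (i + 1 - p) else 0) (i j : ℕ) (a : ZMod p) (ha : a ≠ 0) :
    kloosMoment D.Ψ i j (algebraMap (ZMod p) F a) = ((p : R) ^ n - 1) *
      D.ι ((frobOp ((p : ZMod (p ^ M)) ^ 2) p (2 * M) (frobCoeff e i j a)) ^ n).trace := by
  have hp : 2 ≤ p := (Fact.out : p.Prime).two_le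
  have hp1 : 1 ≤ p ^ n := Nat.one_le_pow _ _ (by omega)
  have ha' : algebraMap (ZMod p) F a ≠ 0 := by simpa using ha
  set 𝒜 := frobTensor e p (p * M) (3 * M) i j (teich p M a) with h𝒜
  let A := 𝒜.map fun f => f %ₘ X ^ (p * M)
  have hAc : ∀ r s k, (A r s).coeff k = if k < p * M then (𝒜 r s).coeff k else 0 := fun r s k =>
    coeff_modByMonic_X_pow _ _ _
  have hA (y : F) : A.map (D.pt y) = symM i ((frobMat e p (p * M) (3 * M)).map (D.pt y)) ⊗ₖ
      symM j ((frobMat e p (p * M) (3 * M)).map (D.pt (algebraMap (ZMod p) F a * y))) := by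
    rw [← map_symM, ← map_symM]
    ext ⟨b, c⟩ ⟨b', c'⟩
    have : X ^ (p * M) ∣ A (b, c) (b', c') - 𝒜 (b, c) (b', c') := by
      rw [dvd_sub_comm]
      refine ⟨𝒜 (b, c) (b', c') /ₘ X ^ (p * M), ?_⟩
      exact sub_eq_iff_eq_add'.2 (modByMonic_add_div _ _).symm
    rw [Matrix.map_apply, D.pt_eq_of_X_pow_dvd_sub y this, h𝒜, frobTensor]
    simp only [Matrix.kroneckerMap_apply, Matrix.map_apply, map_mul, D.pt_comp]
  have h1 := dwork_trace_formula_rescaled D.ι D.pi (fun y : Fˣ => D.τ y) p n (2 * M) hp hn D.sum_τ A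
    (fun r s => by
      rw [natDegree_le_iff_coeff_eq_zero]
      intro k hk
      rw [hAc, if_neg]
      have : p * M ≤ (p - 1) * (2 * M) := by
        obtain ⟨q, rfl⟩ := Nat.exists_eq_add_of_le' hp
        simp only [show q + 2 - 1 = q + 1 by omega]; nlinarith
      omega)
  have h2 : D.pi ^ (2 * (p - 1)) = (p : R) ^ 2 := by rw [mul_comm, pow_mul, D.pi_pow, neg_sq]
  have h3 : (frobOp (D.pi ^ (2 * (p - 1))) p (2 * M) fun k => A.map fun f => D.ι (f.coeff k)) =
      (frobOp ((p : ZMod (p ^ M)) ^ 2) p (2 * M) (frobCoeff e i j a)).map D.ι := by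
    rw [map_frobOp, h2]
    ext l m
    simp only [frobOp, Matrix.of_apply, Matrix.map_apply, frobCoeff, hAc, map_pow, map_natCast]
    split_ifs with h4 h5
    · rfl
    · have : M ≤ l.1 := by
        by_contra hlt
        have : p * (l.1 : ℕ) < p * M := Nat.mul_lt_mul_of_pos_left (by omega) (by omega)
        omega
      obtain ⟨c, hc⟩ := Nat.exists_eq_add_of_le this
      rw [hc, ← pow_mul, show 2 * (M + c) = M + (M + 2 * c) by ring, pow_add, D.natCast_pow_eq_zero]
      simp
    · rfl
  rw [h3, ← RingHom.mapMatrix_apply, ← map_pow, RingHom.mapMatrix_apply, ← AddMonoidHom.map_trace,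
    Nat.cast_sub hp1, Nat.cast_one, Nat.cast_pow] at h1
  rw [← h1, kloosMoment]
  refine Finset.sum_congr rfl fun x _ => ?_
  have hx := D.neg_kloos_eq_trace (by omega) hn hF he1 he x
  have hax := D.neg_kloos_eq_trace (by omega) hn hF he1 he (Units.mk0 _ ha' * x)
  rw [Units.val_mul, Units.val_mk0] at hax
  rw [hx, hax, hF, Nat.cast_pow, mul_chebF_eq_trace_prodRev _ _ _ _ _ _ (D.det_prodRev hM0 hM he0 he _ _)
    (D.det_prodRev hM0 hM he0 he _ _)]
  congr 1
  refine prodRev_congr fun t _ => ?_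
  rw [mul_pow, algebraMap_zmod_pow_pow, ← hA, DworkChar.pt, map_pow]
end

section
open Matrix

/-- The connection on polynomial vectors of degree at most `J`. -/
def connOp {R : Type*} [CommRing R] (i j J : ℕ) (α : R) :
    Matrix (Fin (J + 1 + 1) × (Fin (i + 1) × Fin (j + 1))) (Fin (J + 1) × (Fin (i + 1) × Fin (j + 1))) R :=
  Matrix.of fun l m => (if (l.1 : ℕ) = m.1 then (((m.1 : ℕ) : R) • 1 + connZero R i j) l.2 m.2 else 0) +
    (if (l.1 : ℕ) = m.1 + 1 then connOne i j α l.2 m.2 else 0)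

theorem map_connOp {R S : Type*} [CommRing R] [CommRing S] (f : R →+* S) (i j J : ℕ) (α : R) :
    (connOp i j J α).map f = connOp i j J (f α) := by
  ext l m
  simp only [connOp, Matrix.of_apply, Matrix.map_apply, ← map_connZero f, ← map_connOne f, Matrix.add_apply,
    Matrix.smul_apply, map_add, apply_ite f, map_zero, smul_eq_mul, map_mul, map_natCast, Matrix.one_apply, map_one]

section
variable {R κ : Type*} [CommRing R] [Fintype κ] [DecidableEq κ]

theorem sum_mul_shift (N m : ℕ) (hm : m + 1 < N) (f : ℕ → Matrix κ κ R) (u v : Matrix κ κ R) :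
    ∑ x : Fin N, f x * ((if (x : ℕ) = m then u else 0) + (if (x : ℕ) = m + 1 then v else 0)) =
      f m * u + f (m + 1) * v := by
  rw [Fin.sum_univ_eq_sum_range (fun x => f x * ((if x = m then u else 0) + (if x = m + 1 then v else 0)))]
  simp only [mul_add, mul_ite, mul_zero, Finset.sum_add_distrib, Finset.sum_ite_eq', Finset.mem_range]
  rw [if_pos (by omega), if_pos hm]

theorem sum_shift_mul (N l : ℕ) (hl : l ≤ N) (f : ℕ → Matrix κ κ R) (u : ℕ → Matrix κ κ R) (v : Matrix κ κ R) :
    ∑ x : Fin N, ((if l = (x : ℕ) then u x else 0) + (if l = (x : ℕ) + 1 then v else 0)) * f x =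
      (if l < N then u l * f l else 0) + (if 1 ≤ l then v * f (l - 1) else 0) := by
  rw [Fin.sum_univ_eq_sum_range (fun x => ((if l = x then u x else 0) + (if l = x + 1 then v else 0)) * f x)]
  simp only [add_mul, ite_mul, zero_mul, Finset.sum_add_distrib, Finset.sum_ite_eq, Finset.mem_range]
  congr 1
  split_ifs with h
  · rw [Finset.sum_eq_single (l - 1)]
    · rw [if_pos (by omega)]
    · intro b _ hb; rw [if_neg (by omega)]
    · intro h'; simp at h'; omega
  · refine Finset.sum_eq_zero fun x _ => if_neg (by omega)

/-- The blocks of `frobOp`. -/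
def frobBlk (c : R) (p : ℕ) (A : ℕ → Matrix κ κ R) (l m : ℕ) : Matrix κ κ R :=
  if m ≤ p * l then c ^ l • A (p * l - m) else 0

theorem frobBlk_connection {p M : ℕ} (hp : 1 ≤ p) (hpM : (p : R) ^ M = 0)
    {A K : ℕ → Matrix κ κ R} {G0 G1 : Matrix κ κ R}
    (h : ∀ k < p * M, (k : R) • A k + (p : R) • (G0 * A k) + (if p ≤ k then K (k - p) else 0) =
        A k * G0 + (if 1 ≤ k then A (k - 1) * G1 else 0))
    (hK : ∀ k < p * M, (p : R) • K k = G1 * A k) (l m : ℕ) :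
    frobBlk ((p : R) ^ 2) p A l m * ((m : R) • 1 + G0) + frobBlk ((p : R) ^ 2) p A l (m + 1) * G1 =
      (p : R) • (((l : R) • 1 + G0) * frobBlk ((p : R) ^ 2) p A l m +
        (if 1 ≤ l then G1 * frobBlk ((p : R) ^ 2) p A (l - 1) m else 0)) := by
  have hpow : ∀ s, M ≤ s → (p : R) ^ s = 0 := fun s hs => pow_eq_zero_of_le hs hpM
  rcases le_or_gt M l with hl | hl
  · have h0 : ∀ m, frobBlk ((p : R) ^ 2) p A l m = 0 := fun m => by
      rw [frobBlk, ← pow_mul, hpow _ (by omega)]; simp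
    rw [h0, h0, zero_mul, zero_mul, mul_zero, zero_add, zero_add]
    split_ifs with h1
    · rw [frobBlk]
      split_ifs
      · rw [Matrix.mul_smul, smul_smul, ← pow_mul, ← pow_succ', hpow _ (by omega), zero_smul]
      · simp
    · simp
  · have hlM : p * l + p ≤ p * M := by
      calc p * l + p = p * (l + 1) := by ring
        _ ≤ _ := Nat.mul_le_mul_left _ hl
    by_cases hm : m ≤ p * l
    · obtain ⟨k, hk⟩ := Nat.exists_eq_add_of_le hm
      have hb : frobBlk ((p : R) ^ 2) p A l m = ((p : R) ^ 2) ^ l • A k := by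
        rw [frobBlk, if_pos hm, hk, Nat.add_sub_cancel_left]
      have hb1 : frobBlk ((p : R) ^ 2) p A l (m + 1) * G1 =
          ((p : R) ^ 2) ^ l • (if 1 ≤ k then A (k - 1) * G1 else 0) := by
        rw [frobBlk]
        by_cases h1 : 1 ≤ k
        · rw [if_pos (by omega), if_pos h1, show p * l - (m + 1) = k - 1 by omega, Matrix.smul_mul]
        · rw [if_neg (by omega), if_neg h1]; simp
      have hb2 : (p : R) • (if 1 ≤ l then G1 * frobBlk ((p : R) ^ 2) p A (l - 1) m else 0) =
          ((p : R) ^ 2) ^ l • (if p ≤ k then K (k - p) else 0) := by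
        by_cases h1 : 1 ≤ l
        · obtain ⟨l, rfl⟩ := Nat.exists_eq_add_of_le' h1
          rw [if_pos h1, frobBlk, Nat.add_sub_cancel]
          have h2 : p * (l + 1) = p * l + p := by ring
          by_cases h3 : p ≤ k
          · rw [if_pos (by omega), if_pos h3, show p * l - m = k - p by omega, Matrix.mul_smul,
              ← hK _ (by omega), smul_smul, smul_smul]
            congr 1; ring
          · rw [if_neg (by omega), if_neg h3]; simp
        · rw [if_neg h1, if_neg]
          · simp
          · obtain rfl : l = 0 := by omega
            omega
      have hkl : ((p * l : ℕ) : R) = m + k := by rw [hk, Nat.cast_add]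
      have := h k (by omega)
      rw [smul_add, hb, hb1, hb2, mul_add, Matrix.smul_mul _ _ G0, add_assoc, ← smul_add, ← this, add_mul]
      simp only [smul_add, smul_smul, Matrix.smul_mul, Matrix.mul_smul, Matrix.mul_one, Matrix.one_mul]
      rw [show (p : R) * (((p : R) ^ 2) ^ l * l) = m * ((p : R) ^ 2) ^ l + ((p : R) ^ 2) ^ l * k by
        rw [mul_comm (m : R), ← mul_add, ← hkl]; push_cast; ring, add_smul]
      rw [mul_comm (p : R)]
      abel
    · have hz : frobBlk ((p : R) ^ 2) p A l m = 0 := if_neg hm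
      have hz1 : frobBlk ((p : R) ^ 2) p A l (m + 1) = 0 := if_neg (by omega)
      have hz2 : frobBlk ((p : R) ^ 2) p A (l - 1) m = 0 := if_neg (by
        have : p * (l - 1) ≤ p * l := Nat.mul_le_mul_left _ (by omega)
        omega)
      rw [hz, hz1, hz2]; simp
end

section
variable {R : Type*} [CommRing R]

theorem frobOp_mul_connOp {p M i j J : ℕ} (hp : 1 ≤ p) (hpM : (p : R) ^ M = 0) (hJ : M ≤ J + 1) {α : R}
    {A K : ℕ → Matrix (Fin (i + 1) × Fin (j + 1)) (Fin (i + 1) × Fin (j + 1)) R}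
    (h : ∀ k < p * M, (k : R) • A k + (p : R) • (connZero R i j * A k) + (if p ≤ k then K (k - p) else 0) =
        A k * connZero R i j + (if 1 ≤ k then A (k - 1) * connOne i j α else 0))
    (hK : ∀ k < p * M, (p : R) • K k = connOne i j α * A k) :
    frobOp ((p : R) ^ 2) p (J + 1) A * connOp i j J α =
      (p : R) • (connOp i j J α * frobOp ((p : R) ^ 2) p J A) := by
  ext ⟨l, a⟩ ⟨m, b⟩
  rw [Matrix.smul_apply, Matrix.mul_apply, Matrix.mul_apply, Fintype.sum_prod_type, Fintype.sum_prod_type]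
  have hF : ∀ (J : ℕ) (l m : Fin (J + 1)) a b, frobOp ((p : R) ^ 2) p J A (l, a) (m, b) =
      frobBlk ((p : R) ^ 2) p A l m a b := fun J l m a b => by
    simp only [frobOp, frobBlk, Matrix.of_apply]; split_ifs <;> simp
  have hC : ∀ (l : Fin (J + 1 + 1)) (m : Fin (J + 1)) a b, connOp i j J α (l, a) (m, b) =
      ((if (l : ℕ) = m then ((m : ℕ) : R) • 1 + connZero R i j else 0) +
        (if (l : ℕ) = m + 1 then connOne i j α else 0)) a b := fun l m a b => by
    simp only [connOp, Matrix.of_apply, Matrix.add_apply]; split_ifs <;> simp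
  simp only [hF, hC, ← Matrix.mul_apply, ← Matrix.sum_apply]
  have h3 := sum_shift_mul (J + 1) l (by omega) (fun x => frobBlk ((p : R) ^ 2) p A x m)
    (fun x => (x : R) • 1 + connZero R i j) (connOne i j α)
  have h4 : (if (l : ℕ) < J + 1 then ((l : ℕ) • 1 + connZero R i j) * frobBlk ((p : R) ^ 2) p A l m else 0) =
      ((l : ℕ) • 1 + connZero R i j) * frobBlk ((p : R) ^ 2) p A l m := by
    split_ifs with h1
    · rfl
    · rw [frobBlk, ← pow_mul, pow_eq_zero_of_le (by omega) hpM]; simp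
  simp only [← Nat.cast_smul_eq_nsmul R] at h4
  rw [sum_mul_shift _ _ (by omega), h3, frobBlk_connection hp hpM h hK, ← Matrix.smul_apply, h4]

theorem trace_frobOp_succ_pow {p M J n : ℕ} {κ : Type*} [Fintype κ] [DecidableEq κ] (hpM : (p : R) ^ M = 0) (hJ : M ≤ J + 1)
    (A : ℕ → Matrix κ κ R) (hn : n ≠ 0) :
    (frobOp ((p : R) ^ 2) p (J + 1) A ^ n).trace = (frobOp ((p : R) ^ 2) p J A ^ n).trace := by
  let I : Matrix (Fin (J + 1 + 1) × κ) (Fin (J + 1) × κ) R :=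
    Matrix.of fun l m => if l = (m.1.castSucc, m.2) then 1 else 0
  let S : Matrix (Fin (J + 1) × κ) (Fin (J + 1 + 1) × κ) R :=
    Matrix.of fun l m => frobOp ((p : R) ^ 2) p (J + 1) A (l.1.castSucc, l.2) m
  have h1 : I * S = frobOp ((p : R) ^ 2) p (J + 1) A := by
    ext ⟨l, a⟩ m
    rw [Matrix.mul_apply]
    induction l using Fin.lastCases with
    | last =>
      rw [Finset.sum_eq_zero]
      · simp only [frobOp, Matrix.of_apply, Fin.val_last, ← pow_mul]
        rw [pow_eq_zero_of_le (by omega) hpM]; simp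
      · rintro ⟨x, b⟩ _
        simp only [I, Matrix.of_apply]
        rw [if_neg, zero_mul]
        intro h
        exact absurd (congrArg Prod.fst h) (Fin.castSucc_ne_last x).symm
    | cast l =>
      rw [Finset.sum_eq_single (l, a)]
      · simp [I, S]
      · rintro ⟨x, b⟩ _ hx
        simp only [I, Matrix.of_apply]
        rw [if_neg, zero_mul]
        intro h
        apply hx
        simp only [Prod.mk.injEq, Fin.castSucc_inj] at h
        simp [h.1, h.2]
      · simp
  have h2 : S * I = frobOp ((p : R) ^ 2) p J A := by
    ext l m
    rw [Matrix.mul_apply, Finset.sum_eq_single (m.1.castSucc, m.2)]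
    · simp [I, S, frobOp]
    · intro x _ hx
      simp only [I, Matrix.of_apply]
      rw [if_neg hx, mul_zero]
    · simp
  rw [← h1, ← h2, Matrix.trace_mul_pow_comm _ _ hn]
end
end

section
open Polynomial Matrix

section
variable {p M : ℕ} [Fact p.Prime]

theorem ZMod.natCast_prime_pow_self (p M : ℕ) : ((p : ZMod (p ^ M)) ^ M) = 0 := by
  rw [← Nat.cast_pow, ZMod.natCast_self]

theorem teich_pow (a : ZMod p) : teich p M a ^ p = teich p M a := by
  have hp : 2 ≤ p := (Fact.out : p.Prime).two_le
  have h1 : (p : ℤ) ∣ (a.val : ℤ) ^ p - a.val := by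
    rw [← ZMod.intCast_zmod_eq_zero_iff_dvd]
    push_cast
    rw [ZMod.pow_card, sub_self]
  have h2 : ((p : ZMod (p ^ M))) ∣ (a.val : ZMod (p ^ M)) ^ p - a.val := by
    have := map_dvd (Int.castRingHom (ZMod (p ^ M))) h1
    simpa using this
  have h3 := dvd_sub_pow_of_dvd_sub h2 ((p - 1) * M)
  rw [pow_eq_zero_of_le _ (ZMod.natCast_prime_pow_self p M), zero_dvd_iff, sub_eq_zero] at h3
  · rw [teich, pow_right_comm, h3]
  · have : 1 * M ≤ (p - 1) * M := Nat.mul_le_mul_right _ (by omega)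
    omega

theorem castHom_teich (hM0 : M ≠ 0) (a : ZMod p) :
    ZMod.castHom (dvd_pow_self p hM0) (ZMod p) (teich p M a) = a := by
  rw [teich, map_pow, map_natCast, ZMod.natCast_zmod_val, ZMod.pow_card_pow]

theorem isLocalHom_castHom (hM0 : M ≠ 0) : IsLocalHom (ZMod.castHom (dvd_pow_self p hM0) (ZMod p)) := by
  refine ⟨fun x hx => ?_⟩
  have : NeZero (p ^ M) := ⟨pow_ne_zero _ (Fact.out : p.Prime).ne_zero⟩
  rw [← ZMod.natCast_zmod_val x] at hx ⊢
  rw [map_natCast, ZMod.isUnit_iff_coprime] at hx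
  rw [ZMod.isUnit_iff_coprime]
  exact Nat.Coprime.pow_right _ hx

theorem exists_kloosMoment_eq_neg_trace_pow {e : ℕ → ZMod (p ^ M)} (hM0 : M ≠ 0) (hM : 4 * M + 1 ≤ p)
    (he0 : e 0 = 1) (he1 : ∀ i, p ^ 2 ≤ i → e i = 0)
    (he : ∀ i, i + 1 < p ^ 2 → ((i : ZMod (p ^ M)) + 1) * e (i + 1) =
      e i + if p ≤ i + 1 then e (i + 1 - p) else 0) (i j : ℕ) (a : ZMod p) (ha : a ≠ 0)
    (hinj : ∀ v, (connOp i j (2 * M) a).mulVec v = 0 → v = 0) :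
    ∃ Γ : Matrix (Fin (i + 1) × Fin (j + 1)) (Fin (i + 1) × Fin (j + 1)) (ZMod (p ^ M)),
      ∀ (n : ℕ) (_ : n ≠ 0) (F R : Type) [Field F] [Fintype F] [DecidableEq F] [Algebra (ZMod p) F] [CommRing R]
        (D : DworkChar p M n e F R) (_ : Fintype.card F = p ^ n),
        kloosMoment D.Ψ i j (algebraMap (ZMod p) F a) = -D.ι (Γ ^ n).trace := by
  have hp : 2 ≤ p := (Fact.out : p.Prime).two_le
  have hpM := ZMod.natCast_prime_pow_self p M
  have hN : p * (3 * M) + 1 + p * M ≤ p ^ 2 := by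
    have h1 : p * (4 * M + 1) ≤ p * p := Nat.mul_le_mul_left _ hM
    nlinarith
  obtain ⟨K, hK⟩ := exists_coeff_frobTensor hp he hN M rfl hpM le_rfl i j (teich_pow a) (frobCoeff e i j a)
    fun k => rfl
  have hcomm := frobOp_mul_connOp (J := 2 * M) (by omega) hpM (by omega) (fun k hk => (hK k hk).1)
    (fun k hk => (hK k hk).2)
  have := isLocalHom_castHom (p := p) hM0
  obtain ⟨s, ρ, E, hsD, hρD, hρE, hDs⟩ := Matrix.exists_split_of_injective
    (κ := Fin (i + 1) × Fin (j + 1)) (ZMod.castHom (dvd_pow_self p hM0) (ZMod p))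
    (ZMod.castHom_surjective _) (by simp; ring) (connOp i j (2 * M) (teich p M a)) (by
      rw [map_connOp, castHom_teich]; exact hinj
      exact hM0)
  refine ⟨ρ * frobOp ((p : ZMod (p ^ M)) ^ 2) p (2 * M + 1) (frobCoeff e i j a) * E, fun n hn F R _ _ _ _ _ D hF => ?_⟩
  have htr := Matrix.one_sub_pow_mul_trace_pow _ hcomm hsD hρD hρE hDs n
    (trace_frobOp_succ_pow hpM (by omega) _ hn)
  rw [← htr, D.kloosMoment_eq hM0 hM hn hF he0 he1 he i j a ha, map_mul, map_sub, map_pow, map_natCast, map_one]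
  ring
end
end

section
open Matrix
open scoped Kronecker

section
variable {K : Type*} [CommRing K]

/-- The action of a pair of `2 × 2` matrices on a tensor product of symmetric powers. -/
def dsymTensor (i j : ℕ) (G H : Matrix (Fin 2) (Fin 2) K) :
    Matrix (Fin (i + 1) × Fin (j + 1)) (Fin (i + 1) × Fin (j + 1)) K :=
  dsymM i G ⊗ₖ 1 + 1 ⊗ₖ dsymM j H

theorem dsymTensor_mul (i j : ℕ) {G H G' H' P Q : Matrix (Fin 2) (Fin 2) K} (h : G * P = P * G')
    (h' : H * Q = Q * H') :
    dsymTensor i j G H * (symM i P ⊗ₖ symM j Q) = (symM i P ⊗ₖ symM j Q) * dsymTensor i j G' H' := by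
  rw [dsymTensor, dsymTensor, add_mul, mul_add]
  simp only [← Matrix.mul_kronecker_mul, Matrix.one_mul, Matrix.mul_one, dsymM_mul_symM _ _ _ _ h,
    dsymM_mul_symM _ _ _ _ h']

theorem connZero_add_connOne (i j : ℕ) (α : K) :
    connZero K i j + connOne i j α = dsymTensor i j !![0, 1; 1, 0] !![0, α; 1, 0] := by
  have h (α : K) : !![0, α; 1, 0] = !![0, 0; 1, 0] + !![0, α; 0, 0] := by
    ext i j; fin_cases i <;> fin_cases j <;> simp
  rw [dsymTensor, h 1, h α, dsymM_add, dsymM_add, connZero, connOne, Matrix.add_kronecker, Matrix.kronecker_add]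
  abel

theorem dsymTensor_apply_self (i j : ℕ) (G H : Matrix (Fin 2) (Fin 2) K) (x : Fin (i + 1) × Fin (j + 1)) :
    dsymTensor i j G H x x = ((i - x.1 : ℕ) * G 0 0 + (x.1 : ℕ) * G 1 1) +
      ((j - x.2 : ℕ) * H 0 0 + (x.2 : ℕ) * H 1 1) := by
  simp [dsymTensor, dsymM]

theorem dsymTensor_diag_apply_ne (i j : ℕ) (a b c d : K) {x y : Fin (i + 1) × Fin (j + 1)} (h : x ≠ y) :
    dsymTensor i j !![a, 0; 0, b] !![c, 0; 0, d] x y = 0 := by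
  obtain ⟨x1, x2⟩ := x
  obtain ⟨y1, y2⟩ := y
  simp only [dsymTensor, dsymM, Matrix.add_apply, Matrix.kroneckerMap_apply, Matrix.one_apply, Matrix.of_apply]
  by_cases h1 : x1 = y1
  · by_cases h2 : x2 = y2
    · exact absurd (by rw [h1, h2]) h
    · simp [h2]
  · simp [h1]

theorem symM_last_apply (k : ℕ) (A : Matrix (Fin 2) (Fin 2) K) (b : Fin (k + 1)) :
    symM k A (Fin.last k) b = A 1 0 ^ (k - b) * A 1 1 ^ (b : ℕ) := by
  have hb : (k - b) + (b : ℕ) = k := by omega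
  have h (a b : K) (m : ℕ) : ((Polynomial.C a + Polynomial.C b * Polynomial.X) ^ m).coeff m = b ^ m := by
    have := Polynomial.coeff_pow_of_natDegree_le (n := 1) (m := m)
      (p := Polynomial.C a + Polynomial.C b * Polynomial.X) (by compute_degree)
    rw [mul_one] at this
    rw [this]; simp
  simp only [symM, Matrix.of_apply, Fin.val_last]
  have := Polynomial.coeff_mul_add_eq_of_natDegree_le (natDegree_linear_pow_le (A 0 0) (A 1 0) (k - b))
    (natDegree_linear_pow_le (A 0 1) (A 1 1) b)
  rw [hb] at this
  rw [this, h, h]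

theorem connZero_apply_eq_zero (i j : ℕ) {x y : Fin (i + 1) × Fin (j + 1)}
    (h : (x.1 : ℕ) + x.2 ≠ y.1 + y.2 + 1) : connZero K i j x y = 0 := by
  simp only [connZero, dsymM, Matrix.add_apply, Matrix.kroneckerMap_apply, Matrix.one_apply, Matrix.of_apply]
  by_cases h1 : x.1 = y.1
  · by_cases h2 : (x.2 : ℕ) = y.2 + 1
    · rw [h1] at h; omega
    · simp [h1, h2]
  · by_cases h2 : x.2 = y.2
    · have : ¬ (x.1 : ℕ) = y.1 + 1 := by rw [h2] at h; omega
      simp [this, h1]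
    · simp [h2, h1]

theorem connOne_apply_eq_zero (i j : ℕ) (α : K) {x y : Fin (i + 1) × Fin (j + 1)}
    (h : (x.1 : ℕ) + x.2 + 1 ≠ y.1 + y.2) : connOne i j α x y = 0 := by
  simp only [connOne, dsymM, Matrix.add_apply, Matrix.kroneckerMap_apply, Matrix.one_apply, Matrix.of_apply]
  by_cases h1 : x.1 = y.1
  · by_cases h2 : (x.2 : ℕ) + 1 = y.2
    · rw [h1] at h; omega
    · simp [h1, h2]
  · by_cases h2 : x.2 = y.2
    · have : ¬ (x.1 : ℕ) + 1 = y.1 := by rw [h2] at h; omega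
      simp [this, h1]
    · simp [h2, h1]

theorem ite_finset_sum {ι : Type*} (P : Prop) [Decidable P] (s : Finset ι) (f : ι → K) :
    (if P then ∑ x ∈ s, f x else 0) = ∑ x ∈ s, if P then f x else 0 := by
  split_ifs <;> simp

/-- The component of weight `w` of a polynomial vector, where the variable has weight `2`. -/
def weightPart {i j J : ℕ} (v : Fin (J + 1) × (Fin (i + 1) × Fin (j + 1)) → K) (w : ℕ)
    (x : Fin (i + 1) × Fin (j + 1)) : K :=
  ∑ d : Fin (J + 1), if 2 * (d : ℕ) + x.1 + x.2 = w then v (d, x) else 0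

theorem weightPart_connection {i j J : ℕ} {α : K} {v : Fin (J + 1) × (Fin (i + 1) × Fin (j + 1)) → K}
    (hv : (connOp i j J α).mulVec v = 0) (w : ℕ) (x : Fin (i + 1) × Fin (j + 1)) :
    ((w + 1 : ℕ) - ((x.1 : ℕ) : K) - (x.2 : ℕ)) * weightPart v (w + 1) x +
      2 * (connZero K i j + connOne i j α).mulVec (weightPart v w) x = 0 := by
  have h0 : ∑ l : Fin (J + 1 + 1), (if 2 * (l : ℕ) + x.1 + x.2 = w + 1 then (connOp i j J α).mulVec v (l, x) else 0) = 0 := by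
    rw [hv]; simp
  have hsum (P : ℕ → Prop) [DecidablePred P] (d : Fin (J + 1)) (f g : K) :
      ∑ l : Fin (J + 1 + 1), (if P l then (if (l : ℕ) = d then f else 0) + (if (l : ℕ) = d + 1 then g else 0) else 0) =
        (if P d then f else 0) + (if P (d + 1) then g else 0) := by
    rw [Fin.sum_univ_eq_sum_range (fun l => if P l then (if l = d then f else 0) + (if l = d + 1 then g else 0) else 0)]
    have (l : ℕ) : (if P l then (if l = d then f else 0) + (if l = d + 1 then g else 0) else 0) =
        (if l = d then (if P l then f else 0) else 0) + (if l = d + 1 then (if P l then g else 0) else 0) := by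
      split_ifs <;> simp
    simp only [this, Finset.sum_add_distrib, Finset.sum_ite_eq', Finset.mem_range]
    rw [if_pos (by omega : (d : ℕ) < _), if_pos (by omega : (d : ℕ) + 1 < _)]
  have hz (d : Fin (J + 1)) : (if 2 * (d : ℕ) + x.1 + x.2 = w + 1 then ∑ y, connZero K i j x y * v (d, y) else 0) =
      ∑ y, connZero K i j x y * (if 2 * (d : ℕ) + y.1 + y.2 = w then v (d, y) else 0) := by
    rw [ite_finset_sum]
    refine Finset.sum_congr rfl fun y _ => ?_
    by_cases h : (x.1 : ℕ) + x.2 = y.1 + y.2 + 1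
    · rw [mul_ite, mul_zero]
      exact if_congr (by omega) rfl rfl
    · rw [connZero_apply_eq_zero i j h]; simp
  have ho (d : Fin (J + 1)) : (if 2 * ((d : ℕ) + 1) + x.1 + x.2 = w + 1 then ∑ y, connOne i j α x y * v (d, y) else 0) =
      ∑ y, connOne i j α x y * (if 2 * (d : ℕ) + y.1 + y.2 = w then v (d, y) else 0) := by
    rw [ite_finset_sum]
    refine Finset.sum_congr rfl fun y _ => ?_
    by_cases h : (x.1 : ℕ) + x.2 + 1 = y.1 + y.2
    · rw [mul_ite, mul_zero]
      exact if_congr (by omega) rfl rfl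
    · rw [connOne_apply_eq_zero i j α h]; simp
  have hmv (l : Fin (J + 1 + 1)) : (connOp i j J α).mulVec v (l, x) = ∑ d : Fin (J + 1),
      ((if (l : ℕ) = d then (d : ℕ) * v (d, x) + ∑ y, connZero K i j x y * v (d, y) else 0) +
        (if (l : ℕ) = d + 1 then ∑ y, connOne i j α x y * v (d, y) else 0)) := by
    rw [Matrix.mulVec, dotProduct, Fintype.sum_prod_type]
    refine Finset.sum_congr rfl fun d _ => ?_
    simp only [connOp, Matrix.of_apply, add_mul, ite_mul, zero_mul, Finset.sum_add_distrib,
      Matrix.add_apply, Matrix.smul_apply, Matrix.one_apply, smul_eq_mul, mul_ite, mul_one, mul_zero]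
    rw [← ite_finset_sum, ← ite_finset_sum, Finset.sum_add_distrib]
    simp
  have h1 : ∑ d : Fin (J + 1), ((if 2 * (d : ℕ) + x.1 + x.2 = w + 1 then (d : ℕ) * v (d, x) else 0) +
      ∑ y, (connZero K i j + connOne i j α) x y * (if 2 * (d : ℕ) + y.1 + y.2 = w then v (d, y) else 0)) = 0 := by
    refine Eq.trans ?_ h0
    simp only [hmv]
    symm
    rw [Finset.sum_congr rfl fun l _ => ite_finset_sum _ _ _, Finset.sum_comm]
    refine Finset.sum_congr rfl fun d _ => ?_
    rw [hsum (fun l => 2 * l + x.1 + x.2 = w + 1), ho]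
    have (P : Prop) [Decidable P] (a b : K) : (if P then a + b else 0) = (if P then a else 0) + (if P then b else 0) := by
      split_ifs <;> simp
    rw [this, hz]
    simp only [Matrix.add_apply, add_mul, Finset.sum_add_distrib, add_assoc]
  rw [Finset.sum_add_distrib, Finset.sum_comm] at h1
  simp only [← Finset.mul_sum] at h1
  have h2 : ((w + 1 : ℕ) - ((x.1 : ℕ) : K) - (x.2 : ℕ)) * weightPart v (w + 1) x =
      2 * ∑ d : Fin (J + 1), (if 2 * (d : ℕ) + x.1 + x.2 = w + 1 then (d : ℕ) * v (d, x) else 0) := by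
    rw [weightPart, Finset.mul_sum, Finset.mul_sum]
    refine Finset.sum_congr rfl fun d _ => ?_
    split_ifs with h
    · rw [← h]; push_cast; ring
    · simp
  rw [h2, ← mul_add]
  refine mul_eq_zero_of_right _ (Eq.trans ?_ h1)
  rfl
end

theorem connOp_mulVec_injective {K : Type*} [Field K] (i j J : ℕ) (hij : 0 < i + j) {α β : K} (hβ : β ^ 2 = α) (hβ0 : β ≠ 0)
    (hchar : ∀ n : ℕ, 0 < n → n ≤ 2 * (2 * J + i + j) → (n : K) ≠ 0)
    (hexc : ∀ r s : ℤ, |r| ≤ i → |s| ≤ j → (r : K) + s * β = 0 → r = 0 ∧ s = 0)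
    (v : Fin (J + 1) × (Fin (i + 1) × Fin (j + 1)) → K) (hv : (connOp i j J α).mulVec v = 0) : v = 0 := by
  by_contra hv0
  have h2 : (2 : K) ≠ 0 := by exact_mod_cast hchar 2 (by omega) (by omega)
  obtain ⟨⟨d₀, x₀⟩, hd₀⟩ : ∃ y, v y ≠ 0 := Function.ne_iff.1 hv0
  have hw0 : weightPart v (2 * (d₀ : ℕ) + x₀.1 + x₀.2) ≠ 0 := by
    intro h
    apply hd₀
    have := congrFun h x₀
    rw [weightPart, Finset.sum_eq_single d₀] at this
    · simpa using this
    · intro d _ hd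
      rw [if_neg]
      rw [Ne, Fin.ext_iff] at hd
      omega
    · simp
  have hbig (w : ℕ) (hw : weightPart v w ≠ 0) : w ≤ 2 * J + i + j := by
    by_contra hlt
    apply hw
    ext x
    refine Finset.sum_eq_zero fun d _ => if_neg ?_
    omega
  classical
  set W := Nat.findGreatest (fun w => weightPart v w ≠ 0) (2 * J + i + j) with hW
  have hWne : weightPart v W ≠ 0 :=
    Nat.findGreatest_spec (P := fun w => weightPart v w ≠ 0) (hbig _ hw0) hw0
  have hWle : W ≤ 2 * J + i + j := hbig W hWne
  have hWsucc : weightPart v (W + 1) = 0 := by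
    by_contra h
    have := Nat.le_findGreatest (P := fun w => weightPart v w ≠ 0) (hbig _ h) h
    omega
  set u := weightPart v W with hu
  set P : Matrix (Fin 2) (Fin 2) K := !![1, -1; 1, 1] with hP
  set Pβ : Matrix (Fin 2) (Fin 2) K := !![β, -β; 1, 1] with hPβ
  set M := symM i P ⊗ₖ symM j Pβ with hM
  obtain ⟨M', hMM', hM'M⟩ : ∃ M', M * M' = 1 ∧ M' * M = 1 := by
    have hinv : ∀ γ : K, γ ≠ 0 → !![γ, -γ; 1, 1] * ((2 * γ)⁻¹ • !![1, γ; -1, γ]) = 1 := by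
      intro γ hγ
      ext i j; fin_cases i <;> fin_cases j <;> simp <;> field_simp <;> ring
    have h1 : M * (symM i ((2 * (1 : K))⁻¹ • !![(1 : K), 1; -1, 1]) ⊗ₖ symM j ((2 * β)⁻¹ • !![1, β; -1, β])) = 1 := by
      rw [hM, ← Matrix.mul_kronecker_mul, ← symM_mul, ← symM_mul, hinv β hβ0, hP, hinv 1 one_ne_zero, symM_one,
        symM_one, Matrix.one_kronecker_one]
    exact ⟨_, h1, mul_eq_one_comm.1 h1⟩
  set Λ := connZero K i j + connOne i j α with hΛ
  set Dg := dsymTensor i j !![(1 : K), 0; 0, -1] !![β, 0; 0, -β] with hDg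
  have hΛM : Λ * M = M * Dg := by
    rw [hΛ, connZero_add_connOne]
    refine dsymTensor_mul i j ?_ ?_
    · ext i j; fin_cases i <;> fin_cases j <;> simp [hP]
    · ext i j; fin_cases i <;> fin_cases j <;> simp [hPβ, ← hβ, sq]
  have hDg0 (x : Fin (i + 1) × Fin (j + 1)) (w : Fin (i + 1) × Fin (j + 1) → K) :
      Dg.mulVec w x = ((((i : ℤ) - 2 * (x.1 : ℕ) : ℤ) : K) + (((j : ℤ) - 2 * (x.2 : ℕ) : ℤ) : K) * β) * w x := by
    rw [Matrix.mulVec, dotProduct, Finset.sum_eq_single x]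
    · rw [hDg, dsymTensor_apply_self, Nat.cast_sub (by omega), Nat.cast_sub (by omega)]
      simp; left; ring
    · intro y _ hy
      rw [hDg, dsymTensor_diag_apply_ne _ _ _ _ _ _ hy.symm, zero_mul]
    · simp
  set w := M'.mulVec u with hw
  have hMw : M.mulVec w = u := by rw [hw, Matrix.mulVec_mulVec, hMM', Matrix.one_mulVec]
  have hΛu : Λ.mulVec u = 0 := by
    ext x
    have := weightPart_connection hv W x
    rw [hWsucc] at this
    simpa [h2] using this
  have hDgw : Dg.mulVec w = 0 := by
    have h1 : M.mulVec (Dg.mulVec w) = 0 := by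
      rw [Matrix.mulVec_mulVec, ← hΛM, ← Matrix.mulVec_mulVec, hMw, hΛu]
    rw [← Matrix.one_mulVec (Dg.mulVec w), ← hM'M, ← Matrix.mulVec_mulVec, h1, Matrix.mulVec_zero]
  have hsupp (x) (hx : w x ≠ 0) : i = 2 * (x.1 : ℕ) ∧ j = 2 * (x.2 : ℕ) := by
    have h1 := congrFun hDgw x
    rw [hDg0, Pi.zero_apply, mul_eq_zero, or_iff_left hx] at h1
    have := hexc _ _ (by rw [abs_le]; omega) (by rw [abs_le]; omega) h1
    omega
  obtain ⟨x, hx⟩ : ∃ x, w x ≠ 0 := by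
    by_contra! h
    apply hWne
    rw [← hMw, show w = 0 from funext h, Matrix.mulVec_zero]
  have hxij := hsupp x hx
  have huniq (y) (hy : y ≠ x) : w y = 0 := by
    by_contra h
    have := hsupp y h
    exact hy (Prod.ext (Fin.ext (by omega)) (Fin.ext (by omega)))
  have hulast : u (Fin.last i, Fin.last j) ≠ 0 := by
    rw [← hMw, Matrix.mulVec, dotProduct, Finset.sum_eq_single x (fun y _ hy => by rw [huniq y hy, mul_zero]) (by simp),
      hM, Matrix.kroneckerMap_apply, symM_last_apply, symM_last_apply]
    simpa [hP, hPβ] using hx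
  have hWij : i + j ≤ W := by
    by_contra h
    apply hulast
    refine Finset.sum_eq_zero fun d _ => if_neg ?_
    simp; omega
  obtain ⟨W', hW'⟩ : ∃ W', W = W' + 1 := Nat.exists_eq_add_of_le' (by omega)
  set u' := weightPart v W' with hu'
  set w' := M'.mulVec u' with hw'
  have hMw' : M.mulVec w' = u' := by rw [hw', Matrix.mulVec_mulVec, hMM', Matrix.one_mulVec]
  set N := dsymTensor i j !![(0 : K), 0; 0, 2] !![0, 0; 0, 2] with hN
  set Q := dsymTensor i j !![(1 : K), 1; 1, 1] !![1, 1; 1, 1] with hQ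
  have hNM : N * M = M * Q := by
    refine dsymTensor_mul i j ?_ ?_
    · ext i j; fin_cases i <;> fin_cases j <;> simp [hP] <;> ring
    · ext i j; fin_cases i <;> fin_cases j <;> simp [hPβ] <;> ring
  have hNu (y) : N.mulVec u y = 2 * (((y.1 : ℕ) : K) + (y.2 : ℕ)) * u y := by
    rw [Matrix.mulVec, dotProduct, Finset.sum_eq_single y]
    · rw [hN, dsymTensor_apply_self]; simp; left; ring
    · intro z _ hz
      rw [hN, dsymTensor_diag_apply_ne _ _ _ _ _ _ hz.symm, zero_mul]
    · simp
  have hfin : (2 * W : K) • u - N.mulVec u + (4 : K) • Λ.mulVec u' = 0 := by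
    ext y
    have := weightPart_connection hv W' y
    rw [← hW', ← hu] at this
    simp only [Pi.add_apply, Pi.sub_apply, Pi.smul_apply, hNu, smul_eq_mul, Pi.zero_apply]
    linear_combination 2 * this
  have hΛw' : M.mulVec (Dg.mulVec w') = Λ.mulVec u' := by
    rw [Matrix.mulVec_mulVec, ← hΛM, ← Matrix.mulVec_mulVec, hMw']
  have hNw : M.mulVec (Q.mulVec w) = N.mulVec u := by
    rw [Matrix.mulVec_mulVec, ← hNM, ← Matrix.mulVec_mulVec, hMw]
  have hfin2 : (2 * W : K) • w - Q.mulVec w + (4 : K) • Dg.mulVec w' = 0 := by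
    have h1 : M.mulVec ((2 * W : K) • w - Q.mulVec w + (4 : K) • Dg.mulVec w') = 0 := by
      rw [Matrix.mulVec_add, Matrix.mulVec_sub, Matrix.mulVec_smul, Matrix.mulVec_smul, hΛw', hNw, hMw,
        hfin]
    rw [← Matrix.one_mulVec ((2 * W : K) • w - Q.mulVec w + (4 : K) • Dg.mulVec w'), ← hM'M, ← Matrix.mulVec_mulVec, h1,
      Matrix.mulVec_zero]
  have h3 := congrFun hfin2 x
  have hQx : Q.mulVec w x = ((i : K) + j) * w x := by
    rw [Matrix.mulVec, dotProduct, Finset.sum_eq_single x (fun y _ hy => by rw [huniq y hy, mul_zero]) (by simp),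
      hQ, dsymTensor_apply_self, Nat.cast_sub (by omega), Nat.cast_sub (by omega)]
    simp
  have hi2 : ((i : ℤ) - 2 * (x.1 : ℕ) : ℤ) = 0 := by omega
  have hj2 : ((j : ℤ) - 2 * (x.2 : ℕ) : ℤ) = 0 := by omega
  simp only [Pi.add_apply, Pi.sub_apply, Pi.smul_apply, hQx, hDg0, smul_eq_mul, Pi.zero_apply, hi2, hj2] at h3
  have h4 : ((2 * W - (i + j) : ℕ) : K) * w x = 0 := by
    rw [Nat.cast_sub (by omega)]
    push_cast
    linear_combination h3
  exact hchar _ (by omega) (by omega) ((mul_eq_zero.1 h4).resolve_right hx)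

theorem connOp_mulVec_injective_zmod {p : ℕ} [Fact p.Prime] (i j J : ℕ) (hij : 0 < i + j)
    (hp : 2 * (2 * J + i + j) < p) {a : ZMod p} (ha : a ≠ 0)
    (hexc : ∀ r s : ℤ, |r| ≤ i → |s| ≤ j → (r : ZMod p) ^ 2 = (s : ZMod p) ^ 2 * a → r = 0 ∧ s = 0)
    (v : Fin (J + 1) × (Fin (i + 1) × Fin (j + 1)) → ZMod p) (hv : (connOp i j J a).mulVec v = 0) : v = 0 := by
  let f := algebraMap (ZMod p) (AlgebraicClosure (ZMod p))
  obtain ⟨β, hβ⟩ := IsAlgClosed.exists_pow_nat_eq (f a) (n := 2) (by norm_num)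
  have hβ0 : β ≠ 0 := by
    rintro rfl
    apply ha
    rw [← map_eq_zero f, ← hβ]
    norm_num
  have h := connOp_mulVec_injective i j J hij hβ hβ0 (fun n hn hn' h => by
    rw [← map_natCast f, map_eq_zero, ZMod.natCast_eq_zero_iff] at h
    have := Nat.le_of_dvd hn h
    omega) (fun r s hr hs h => hexc r s hr hs (f.injective (by
      rw [map_pow, map_mul, map_pow, map_intCast, map_intCast, ← hβ]
      linear_combination ((r : AlgebraicClosure (ZMod p)) - s * β) * h))) (f ∘ v) (by
      rw [← map_connOp f]
      ext l
      have := congrArg f (congrFun hv l)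
      rw [RingHom.map_mulVec] at this
      rw [this]; simp)
  ext l
  exact f.injective (by simpa using congrFun h l)
end

theorem sum_units_eq_sum_sub {K A : Type*} [Field K] [Fintype K] [DecidableEq K] [AddCommGroup A] (f : K → A) :
    ∑ x : Kˣ, f x = ∑ x, f x - f 0 := by
  rw [Fintype.sum_eq_add_sum_compl (0 : K) f, add_sub_cancel_left,
    Finset.sum_subtype (p := fun x : K => x ≠ 0) _ (by simp)]
  exact Fintype.sum_equiv unitsEquivNeZero _ _ fun _ => rfl

section
variable {F R : Type*} [Field F] [Fintype F] [DecidableEq F] [CommRing R]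

theorem map_kloosMoment {S : Type*} [CommRing S] (f : R →+* S) (Ψ : AddChar F R) (Ψ' : AddChar F S)
    (h : ∀ t, f (Ψ t) = Ψ' t) (i j : ℕ) (a : F) : f (kloosMoment Ψ i j a) = kloosMoment Ψ' i j a := by
  have hk (x : F) : f (kloos Ψ x) = kloos Ψ' x := by simp only [kloos, map_sum, h]
  simp only [kloosMoment, map_sum, map_mul, map_chebF, map_neg, hk, map_natCast]

theorem kloos_mulShift (Ψ : AddChar F R) (c : Fˣ) (x : F) :
    kloos (Ψ.mulShift (c : F)) x = kloos Ψ ((c : F) ^ 2 * x) := by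
  rw [kloos, kloos]
  refine Fintype.sum_equiv (Equiv.mulLeft c) _ _ fun y => ?_
  rw [AddChar.mulShift_apply]
  congr 1
  simp only [Equiv.coe_mulLeft, Units.val_mul]
  field_simp

theorem kloosMoment_mulShift (Ψ : AddChar F R) (c : Fˣ) (i j : ℕ) (a : F) :
    kloosMoment (Ψ.mulShift (c : F)) i j a = kloosMoment Ψ i j a := by
  rw [kloosMoment, kloosMoment]
  refine Fintype.sum_equiv (Equiv.mulLeft (c ^ 2)) _ _ fun y => ?_
  rw [kloos_mulShift, kloos_mulShift]
  simp only [Equiv.coe_mulLeft, Units.val_mul, Units.val_pow_eq_pow_val]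
  rw [mul_left_comm]

/-- The universal additive character. -/
noncomputable def univChar (F : Type*) [Field F] : AddChar F (AddMonoidAlgebra ℤ F) where
  toFun t := AddMonoidAlgebra.single t 1
  map_zero_eq_one' := rfl
  map_add_eq_mul' a b := by simp [AddMonoidAlgebra.single_mul_single]

theorem exists_coeff_kloosMoment (F : Type*) [Field F] [Fintype F] [DecidableEq F] (i j : ℕ) (a : F) :
    ∃ H : F → ℤ, ∀ (R : Type) [CommRing R] (Ψ : AddChar F R), kloosMoment Ψ i j a = ∑ t, (H t : R) * Ψ t := by
  refine ⟨fun t => (kloosMoment (univChar F) i j a).coeff t, fun R _ Ψ => ?_⟩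
  have h := map_kloosMoment (AddMonoidAlgebra.lift ℤ R F Ψ.toMonoidHom).toRingHom (univChar F) Ψ (by
    intro t
    change AddMonoidAlgebra.lift ℤ R F Ψ.toMonoidHom (AddMonoidAlgebra.single t 1) = _
    rw [AddMonoidAlgebra.lift_single]; simp) i j a
  rw [← h]
  change AddMonoidAlgebra.lift ℤ R F Ψ.toMonoidHom _ = _
  rw [AddMonoidAlgebra.lift_apply, Finsupp.sum_fintype _ _ (by simp)]
  simp

theorem exists_int_kloosMoment (p : ℕ) [Fact p.Prime] [Algebra (ZMod p) F] (i j : ℕ) (a : F) :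
    ∃ Z : ℤ, ∀ (R : Type) [CommRing R] (Ψ : AddChar F R),
      (∀ t : F, ∑ c : ZMod p, Ψ (c • t) = if Algebra.trace (ZMod p) F t = 0 then (p : R) else 0) →
      ((p : R) - 1) * kloosMoment Ψ i j a = Z := by
  obtain ⟨H, hH⟩ := exists_coeff_kloosMoment F i j a
  refine ⟨∑ t, H t * ((if Algebra.trace (ZMod p) F t = 0 then (p : ℤ) else 0) - 1), fun R _ Ψ hΨ => ?_⟩
  have h1 : ∑ c : (ZMod p)ˣ, kloosMoment (Ψ.mulShift (algebraMap (ZMod p) F c)) i j a = ((p : R) - 1) * kloosMoment Ψ i j a := by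
    have (c : (ZMod p)ˣ) : kloosMoment (Ψ.mulShift (algebraMap (ZMod p) F c)) i j a = kloosMoment Ψ i j a :=
      kloosMoment_mulShift Ψ (Units.map (algebraMap (ZMod p) F).toMonoidHom c) i j a
    rw [Finset.sum_congr rfl fun c _ => this c, Finset.sum_const, Finset.card_univ, ZMod.card_units_eq_totient,
      Nat.totient_prime Fact.out, nsmul_eq_mul, Nat.cast_sub (Fact.out : p.Prime).one_le, Nat.cast_one]
  have h2 (t : F) : ∑ c : (ZMod p)ˣ, Ψ (c • t) = (if Algebra.trace (ZMod p) F t = 0 then (p : R) else 0) - 1 := by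
    rw [← hΨ t]
    have := sum_units_eq_sum_sub (fun c : ZMod p => Ψ (c • t))
    rw [zero_smul, AddChar.map_zero_eq_one] at this
    exact this
  rw [← h1]
  simp only [hH R, AddChar.mulShift_apply, ← Algebra.smul_def]
  rw [Finset.sum_comm, Int.cast_sum]
  refine Finset.sum_congr rfl fun t _ => ?_
  rw [← Finset.mul_sum]
  have := h2 t
  simp only [Units.smul_def] at this
  rw [this]
  push_cast
  simp
end

section
variable (p : ℕ) [Fact p.Prime] (F : Type*) [Field F] [Fintype F] [DecidableEq F] [Algebra (ZMod p) F]

/-- The standard complex additive character of a finite field. -/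
noncomputable def stdChar : AddChar F ℂ := ZMod.stdAddChar.compAddMonoidHom (Algebra.trace (ZMod p) F).toAddMonoidHom

omit [Fintype F] [DecidableEq F] in
theorem stdChar_apply (t : F) : stdChar p F t = ZMod.stdAddChar (Algebra.trace (ZMod p) F t) := rfl

omit [Fintype F] [DecidableEq F] in
theorem sum_stdChar_smul (t : F) :
    ∑ c : ZMod p, stdChar p F (c • t) = if Algebra.trace (ZMod p) F t = 0 then (p : ℂ) else 0 := by
  simp only [stdChar_apply, map_smul, smul_eq_mul]
  rw [AddChar.sum_mulShift _ (ZMod.isPrimitive_stdAddChar p), ZMod.card]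
  simp

theorem norm_kloos_stdChar_le (x : F) : ‖kloos (stdChar p F) x‖ ≤ Fintype.card F := by
  refine (norm_sum_le _ _).trans ?_
  simp only [AddChar.norm_apply, Finset.sum_const, nsmul_eq_mul, mul_one, Finset.card_univ]
  exact_mod_cast Fintype.card_le_of_injective _ Units.val_injective

theorem norm_chebF_le {s q : ℂ} {Q : ℝ} (hQ : 1 ≤ Q) (hs : ‖s‖ ≤ Q) (hq : ‖q‖ ≤ Q) :
    ∀ k, ‖chebF s q k‖ ≤ (2 * Q) ^ k
  | 0 => by simp [chebF]
  | 1 => by simp [chebF]; linarith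
  | k + 2 => by
    have h1 := norm_chebF_le hQ hs hq (k + 1)
    have h2 := norm_chebF_le hQ hs hq k
    have h3 : 0 ≤ (2 * Q) ^ k := by positivity
    calc ‖chebF s q (k + 2)‖ ≤ ‖s‖ * ‖chebF s q (k + 1)‖ + ‖q‖ * ‖chebF s q k‖ := by
          rw [chebF, ← norm_mul, ← norm_mul]; exact norm_sub_le _ _
      _ ≤ Q * (2 * Q) ^ (k + 1) + Q * (2 * Q) ^ k := by gcongr
      _ = (2 * Q) ^ k * (2 * Q * Q + Q) := by ring
      _ ≤ (2 * Q) ^ k * (2 * Q * (2 * Q)) := by gcongr; nlinarith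
      _ = _ := by ring

theorem norm_kloosMoment_stdChar_le (i j : ℕ) (a : F) :
    ‖kloosMoment (stdChar p F) i j a‖ ≤ (2 * Fintype.card F : ℝ) ^ (i + j + 1) := by
  have hQ : (1 : ℝ) ≤ Fintype.card F := by exact_mod_cast Fintype.card_pos
  have hb (x : F) (k : ℕ) : ‖chebF (-kloos (stdChar p F) x) (Fintype.card F : ℂ) k‖ ≤ (2 * Fintype.card F : ℝ) ^ k :=
    norm_chebF_le hQ (by rw [norm_neg]; exact norm_kloos_stdChar_le p F x) (by simp) k
  refine (norm_sum_le _ _).trans ?_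
  calc ∑ x : Fˣ, _ ≤ ∑ x : Fˣ, (2 * Fintype.card F : ℝ) ^ (i + j) := by
        refine Finset.sum_le_sum fun x _ => ?_
        rw [norm_mul, pow_add]
        gcongr <;> exact hb _ _
    _ ≤ (2 * Fintype.card F : ℝ) * (2 * Fintype.card F : ℝ) ^ (i + j) := by
        rw [Finset.sum_const, nsmul_eq_mul]
        gcongr
        have : (Finset.univ : Finset Fˣ).card ≤ Fintype.card F :=
          Fintype.card_le_of_injective _ Units.val_injective
        have : ((Finset.univ : Finset Fˣ).card : ℝ) ≤ Fintype.card F := by exact_mod_cast this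
        linarith
    _ = _ := by ring
end

theorem abs_newtonB_le {h : ℕ → ℤ} {A C : ℕ} {m : ℕ} (hA : 1 ≤ A) (hC : (m + 1) * m ^ m ≤ C)
    (hh : ∀ n, 1 ≤ n → n ≤ m → |h n| ≤ A) : ∀ k ≤ m, |newtonB h k| ≤ ((C * A) ^ k : ℕ) := by
  intro k
  induction k using Nat.strong_induction_on with
  | _ k ih =>
    intro hk
    cases k with
    | zero => simp [newtonB_zero]
    | succ k =>
      have hC1 : 1 ≤ C * A := by
        have : 1 ≤ (m + 1) * m ^ m := Nat.succ_le_of_lt (Nat.mul_pos m.succ_pos Nat.pow_self_pos)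
        nlinarith
      rw [newtonB_succ]
      refine (Finset.abs_sum_le_sum_abs _ _).trans ?_
      calc ∑ i ∈ Finset.range (k + 1), |((k.descFactorial i : ℕ) : ℤ) * h (i + 1) * newtonB h (k - i)|
          ≤ ∑ i ∈ Finset.range (k + 1), ((m ^ m * A * (C * A) ^ k : ℕ) : ℤ) := by
            refine Finset.sum_le_sum fun i hi => ?_
            rw [Finset.mem_range] at hi
            rw [abs_mul, abs_mul, Nat.abs_cast]
            push_cast
            have h1 : ((k.descFactorial i : ℕ) : ℤ) ≤ (m : ℤ) ^ m := by
              have : k.descFactorial i ≤ m ^ m :=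
                (Nat.descFactorial_le_pow k i).trans ((Nat.pow_le_pow_left (by omega) i).trans
                  (Nat.pow_le_pow_right (by omega) (by omega)))
              exact_mod_cast this
            have h2 := ih (k - i) (by omega) (by omega)
            have h3 : ((C * A) ^ (k - i) : ℕ) ≤ (C * A) ^ k := Nat.pow_le_pow_right hC1 (by omega)
            have h4 : |newtonB h (k - i)| ≤ ((C : ℤ) * A) ^ k := h2.trans (by exact_mod_cast h3)
            have h5 := hh (i + 1) (by omega) (by omega)
            gcongr
        _ ≤ _ := by
            rw [Finset.sum_const, Finset.card_range, nsmul_eq_mul]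
            norm_cast
            calc (k + 1) * (m ^ m * A * (C * A) ^ k) = ((k + 1) * m ^ m) * (A * (C * A) ^ k) := by ring
              _ ≤ C * (A * (C * A) ^ k) := by
                  gcongr
                  exact (Nat.mul_le_mul_right _ (by omega)).trans hC
              _ = _ := by ring

theorem DworkChar.intCast_kloosMoment {p M n : ℕ} [Fact p.Prime] {e : ℕ → ZMod (p ^ M)} {F : Type}
    [Field F] [Fintype F] [DecidableEq F] [Algebra (ZMod p) F] {R : Type} [CommRing R]
    (D : DworkChar p M n e F R) {i j : ℕ} {a : F} {Z : ℤ} {t : ZMod (p ^ M)}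
    (hZ : ((p : R) - 1) * kloosMoment D.Ψ i j a = Z) (ht : kloosMoment D.Ψ i j a = -D.ι t) :
    (Z : ZMod (p ^ M)) = ((p : ZMod (p ^ M)) - 1) * -t := by
  obtain ⟨k, rfl⟩ := ZMod.intCast_surjective t
  have h : ((Z + ((p : ℤ) - 1) * k : ℤ) : R) = 0 := by
    push_cast
    rw [← hZ, ht, map_intCast]; ring
  have := (ZMod.intCast_zmod_eq_zero_iff_dvd _ _).2 (D.dvd_of_cast _ h)
  push_cast at this
  rw [eq_neg_of_add_eq_zero_left this]; ring

theorem newtonB_eq_zero_of_congr {N A C m : ℕ} {κ : Type*} [Fintype κ] [DecidableEq κ]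
    {g : ℕ → ℤ} (Γ : Matrix κ κ (ZMod N)) (c : ZMod N) (hA : 1 ≤ A) (hC : (m + 1) * m ^ m ≤ C)
    (hg : ∀ n, 1 ≤ n → n ≤ m → |g n| ≤ A)
    (hc : ∀ n, 1 ≤ n → n ≤ m → (g n : ZMod N) = c ^ n * -(Γ ^ n).trace) (hN : (C * A) ^ m < N)
    (hm : Fintype.card κ < m) : newtonB g m = 0 := by
  have h1 : ((newtonB g m : ℤ) : ZMod N) = 0 := by
    have h2 := map_newtonB (Int.castRingHom (ZMod N)) g m
    rw [eq_intCast] at h2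
    rw [h2, newtonB_congr (h' := fun n => c ^ n * -(Γ ^ n).trace) (fun n h1 h2 => by simpa using hc n h1 h2),
      newtonB_scale, Matrix.newtonB_neg_trace_pow_eq_zero Γ m hm, mul_zero]
  refine Int.eq_zero_of_abs_lt_dvd ((ZMod.intCast_zmod_eq_zero_iff_dvd _ _).1 h1) ?_
  exact (abs_newtonB_le hA hC hg m le_rfl).trans_lt (by exact_mod_cast hN)

/-- The parameters `(r, s)` produce no coincidence of slopes between `x` and `a x`. -/
def NonExc {p : ℕ} (i j : ℕ) (a : ZMod p) : Prop :=
  ∀ r s : ℤ, |r| ≤ i → |s| ≤ j → (r : ZMod p) ^ 2 = (s : ZMod p) ^ 2 * a → r = 0 ∧ s = 0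

theorem newtonB_kloosMoment_eq_zero (i j m₀ : ℕ) (hij : 0 < i + j) :
    ∃ P₀ : ℕ, ∀ (p : ℕ) [Fact p.Prime], P₀ ≤ p → ∀ a : ZMod p, a ≠ 0 → NonExc i j a →
      ∀ (F : ℕ → Type) [∀ n, Field (F n)] [∀ n, Fintype (F n)] [∀ n, DecidableEq (F n)]
        [∀ n, Algebra (ZMod p) (F n)], (∀ n, n ≠ 0 → Fintype.card (F n) = p ^ n) →
        ∀ m, (i + 1) * (j + 1) < m → m ≤ m₀ →
          newtonB (fun n => kloosMoment (stdChar p (F n)) i j (algebraMap (ZMod p) (F n) a)) m = 0 := by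
  set c₁ := m₀ + (m₀ + 1) * (i + j + 1) with hc₁
  set M := (c₁ + 1) * m₀ + 1 with hM
  refine ⟨(m₀ + 1) * m₀ ^ m₀ + 2 * (4 * M + i + j) + 4 * M + 5, ?_⟩
  intro p _ hp a ha hexc F _ _ _ _ hF m hm hm₀
  have hp2 : 2 ≤ p := (Fact.out : p.Prime).two_le
  obtain ⟨e, he0, he, he1, hD⟩ := exists_dworkChar p M (by omega) (by omega)
  obtain ⟨Γ, hΓ⟩ := exists_kloosMoment_eq_neg_trace_pow (p := p) (M := M) (by omega) (by omega) he0 he1 he i j a ha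
    (connOp_mulVec_injective_zmod i j (2 * M) hij (by omega) ha hexc)
  choose Z hZ using fun n => exists_int_kloosMoment p i j (algebraMap (ZMod p) (F n) a)
  have hZΓ (n : ℕ) (hn : 1 ≤ n) : (Z n : ZMod (p ^ M)) = ((p : ZMod (p ^ M)) - 1) * -(Γ ^ n).trace := by
    obtain ⟨R, _, ⟨D⟩⟩ := hD n (by omega) (F n) (hF n (by omega))
    exact D.intCast_kloosMoment (hZ n R D.Ψ D.sum_Ψ) (hΓ n (by omega) (F n) R D (hF n (by omega)))
  have hZC (n : ℕ) : ((p : ℂ) - 1) * kloosMoment (stdChar p (F n)) i j (algebraMap (ZMod p) (F n) a) = Z n :=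
    hZ n ℂ _ (sum_stdChar_smul p (F n))
  set g : ℕ → ℤ := fun n => ((p : ℤ) - 1) ^ (n - 1) * Z n with hg
  have hgC (n : ℕ) (hn : 1 ≤ n) : (g n : ℂ) =
      ((p : ℂ) - 1) ^ n * kloosMoment (stdChar p (F n)) i j (algebraMap (ZMod p) (F n) a) := by
    obtain ⟨k, rfl⟩ : ∃ k, n = k + 1 := ⟨n - 1, by omega⟩
    simp only [hg, Nat.add_sub_cancel]
    push_cast
    rw [← hZC, pow_succ]; ring
  have hnorm : ‖(p : ℂ) - 1‖ ≤ p := by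
    have : ((p - 1 : ℕ) : ℂ) = (p : ℂ) - 1 := by push_cast [show 1 ≤ p by omega]; ring
    rw [← this, Complex.norm_natCast]
    exact_mod_cast Nat.sub_le _ _
  have hgA (n : ℕ) (h1 : 1 ≤ n) (h2 : n ≤ m) : |g n| ≤ (p ^ c₁ : ℕ) := by
    have h3 : ‖(g n : ℂ)‖ ≤ (p : ℝ) ^ n * (2 * (p : ℝ) ^ n) ^ (i + j + 1) := by
      rw [hgC n h1, norm_mul, norm_pow]
      have := norm_kloosMoment_stdChar_le p (F n) i j (algebraMap (ZMod p) (F n) a)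
      rw [hF n (by omega)] at this
      push_cast at this
      gcongr
    have hp1 : (1 : ℝ) ≤ p := by exact_mod_cast (by omega : 1 ≤ p)
    have h4 : (p : ℝ) ^ n * (2 * (p : ℝ) ^ n) ^ (i + j + 1) ≤ (p : ℝ) ^ c₁ := by
      calc (p : ℝ) ^ n * (2 * (p : ℝ) ^ n) ^ (i + j + 1)
          ≤ (p : ℝ) ^ m₀ * ((p : ℝ) * (p : ℝ) ^ m₀) ^ (i + j + 1) := by
            have : (2 : ℝ) ≤ p := by exact_mod_cast hp2
            gcongr <;> first | exact hp1 | omega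
        _ = _ := by rw [hc₁, pow_add _ m₀, pow_mul, pow_succ (p : ℝ) m₀, mul_comm (p : ℝ)]
    have h5 := h3.trans h4
    rw [Complex.norm_intCast] at h5
    exact_mod_cast h5
  have hzero : newtonB g m = 0 := by
    refine newtonB_eq_zero_of_congr (N := p ^ M) (A := p ^ c₁) (C := p) Γ ((p : ZMod (p ^ M)) - 1)
      (Nat.one_le_pow _ _ (by omega)) ?_ hgA ?_ ?_ (by simpa using hm)
    · have h1 : m ^ m ≤ m₀ ^ m₀ := (Nat.pow_le_pow_left hm₀ m).trans (Nat.pow_le_pow_right (by omega) hm₀)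
      have : (m + 1) * m ^ m ≤ (m₀ + 1) * m₀ ^ m₀ := Nat.mul_le_mul (by omega) h1
      omega
    · intro n h1 h2
      obtain ⟨k, rfl⟩ : ∃ k, n = k + 1 := ⟨n - 1, by omega⟩
      simp only [hg, Nat.add_sub_cancel]
      push_cast
      rw [hZΓ _ h1]; ring
    · rw [← pow_succ', ← pow_mul]
      refine Nat.pow_lt_pow_right (by omega) ?_
      have := Nat.mul_le_mul_left (c₁ + 1) hm₀
      omega
  have h1 := map_newtonB (Int.castRingHom ℂ) g m
  rw [hzero, map_zero, newtonB_congr (h' := fun n => ((p : ℂ) - 1) ^ n *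
    kloosMoment (stdChar p (F n)) i j (algebraMap (ZMod p) (F n) a)) (fun n h1 _ => by simpa using hgC n h1),
    newtonB_scale] at h1
  have hp1 : (p : ℂ) - 1 ≠ 0 := by
    rw [sub_ne_zero]; exact_mod_cast (by omega : p ≠ 1)
  exact (mul_eq_zero.1 h1.symm).resolve_left (pow_ne_zero _ hp1)

/-- Autocorrelation functions of finite actions; these are positive definite functions on `G`. -/
def IsAutocorr {G : Type} [CommGroup G] (g : G → ℝ) : Prop :=
  ∃ (Ω : Type) (_ : Fintype Ω) (_ : MulAction G Ω) (f : Ω → ℝ), ∀ a, g a = ∑ ω, f ω * f (a • ω)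

namespace IsAutocorr

variable {G : Type} [CommGroup G] {g g' : G → ℝ}

theorem add (h : IsAutocorr g) (h' : IsAutocorr g') : IsAutocorr (fun a => g a + g' a) := by
  obtain ⟨Ω, _, _, f, hf⟩ := h
  obtain ⟨Ω', _, _, f', hf'⟩ := h'
  exact ⟨Ω ⊕ Ω', inferInstance, inferInstance, Sum.elim f f', fun a => by simp [hf, hf']⟩

theorem mul (h : IsAutocorr g) (h' : IsAutocorr g') : IsAutocorr (fun a => g a * g' a) := by
  obtain ⟨Ω, _, _, f, hf⟩ := h
  obtain ⟨Ω', _, _, f', hf'⟩ := h'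
  refine ⟨Ω × Ω', inferInstance, inferInstance, fun w => f w.1 * f' w.2, fun a => ?_⟩
  simp only [hf, hf']
  rw [Fintype.sum_mul_sum, Fintype.sum_prod_type]
  refine Finset.sum_congr rfl fun x _ => Finset.sum_congr rfl fun y _ => ?_
  simp only [Prod.smul_mk]
  ring

theorem const {c : ℝ} (hc : 0 ≤ c) : IsAutocorr (fun _ : G => c) :=
  ⟨Unit, inferInstance, inferInstance, fun _ => √c, fun a => by simp [Real.mul_self_sqrt hc]⟩

theorem sum {ι : Type*} {s : Finset ι} {g : ι → G → ℝ} (h : ∀ i ∈ s, IsAutocorr (g i)) :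
    IsAutocorr (fun a => ∑ i ∈ s, g i a) := by
  classical
  induction s using Finset.induction_on with
  | empty => simpa using const le_rfl
  | insert i s hi ih =>
    simp only [Finset.sum_insert hi]
    exact (h i (by simp)).add (ih fun j hj => h j (by simp [hj]))

theorem abs_le (h : IsAutocorr g) (a : G) : |g a| ≤ g 1 := by
  obtain ⟨Ω, _, _, f, hf⟩ := h
  have h1 : ∑ ω, f (a • ω) ^ 2 = ∑ ω, f ω ^ 2 :=
    Fintype.sum_equiv (MulAction.toPerm a) _ _ fun _ => rfl
  rw [hf, hf]
  simp only [one_smul, ← pow_two]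
  refine (Finset.abs_sum_le_sum_abs _ _).trans ?_
  calc ∑ ω, |f ω * f (a • ω)| ≤ ∑ ω, (f ω ^ 2 + f (a • ω) ^ 2) / 2 := by
        refine Finset.sum_le_sum fun ω _ => ?_
        rw [abs_mul]
        nlinarith [sq_nonneg (|f ω| - |f (a • ω)|), sq_abs (f ω), sq_abs (f (a • ω))]
    _ = _ := by rw [← Finset.sum_div, Finset.sum_add_distrib, h1]; ring

theorem sum_nonneg [Fintype G] (h : IsAutocorr g) : 0 ≤ ∑ a, g a := by
  obtain ⟨Ω, _, _, f, hf⟩ := h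
  have h1 : ∑ ω, (∑ a : G, f (a • ω)) ^ 2 = Fintype.card G * ∑ a, g a := by
    simp only [pow_two, Finset.sum_mul_sum]
    rw [Finset.sum_comm, ← nsmul_eq_mul, ← Finset.card_univ, ← Finset.sum_const]
    refine Finset.sum_congr rfl fun b _ => ?_
    rw [Finset.sum_comm]
    refine Fintype.sum_equiv (Equiv.mulRight b⁻¹) _ _ fun c => ?_
    rw [hf]
    refine Fintype.sum_equiv (MulAction.toPerm b) _ _ fun ω => ?_
    simp [MulAction.toPerm_apply, smul_smul]
  have h2 : 0 ≤ (Fintype.card G : ℝ) * ∑ a, g a := h1 ▸ Finset.sum_nonneg fun _ _ => sq_nonneg _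
  exact nonneg_of_mul_nonneg_right h2 (by exact_mod_cast Fintype.card_pos)

theorem newtonB {h : ℕ → G → ℝ} (H : ∀ n, 1 ≤ n → IsAutocorr (h n)) (m : ℕ) :
    IsAutocorr (fun a => newtonB (fun n => h n a) m) := by
  induction m using Nat.strong_induction_on with
  | _ m ih =>
    cases m with
    | zero => simpa [newtonB_zero] using const zero_le_one
    | succ m =>
      simp only [newtonB_succ]
      exact sum fun i _ => ((const (Nat.cast_nonneg _)).mul (H _ (by omega))).mul (ih _ (by omega))

theorem newtonB_sub_pow {h : ℕ → G → ℝ} (H : ∀ n, 1 ≤ n → IsAutocorr (h n)) (m : ℕ) :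
    IsAutocorr (fun a => _root_.newtonB (fun n => h n a) m - h 1 a ^ m) := by
  induction m with
  | zero => simpa [newtonB_zero] using const le_rfl
  | succ m ih =>
    have : (fun a => _root_.newtonB (fun n => h n a) (m + 1) - h 1 a ^ (m + 1)) = fun a =>
        ∑ i ∈ Finset.range m, (m.descFactorial (i + 1) : ℝ) * h (i + 1 + 1) a *
          _root_.newtonB (fun n => h n a) (m - (i + 1)) +
        h 1 a * (_root_.newtonB (fun n => h n a) m - h 1 a ^ m) := by
      funext a
      rw [newtonB_succ, Finset.sum_range_succ']
      simp only [Nat.descFactorial_zero, Nat.cast_one, zero_add, Nat.sub_zero]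
      ring
    rw [this]
    exact (sum fun i _ => ((const (Nat.cast_nonneg _)).mul (H _ (by omega))).mul (newtonB H _)).add
      ((H 1 le_rfl).mul ih)

end IsAutocorr

theorem newtonB_nonneg {h : ℕ → ℝ} (H : ∀ n, 0 ≤ h n) (m : ℕ) : 0 ≤ newtonB h m := by
  induction m using Nat.strong_induction_on with
  | _ m ih =>
    cases m with
    | zero => simp [newtonB_zero]
    | succ m =>
      rw [newtonB_succ]
      exact Finset.sum_nonneg fun i _ => mul_nonneg (mul_nonneg (Nat.cast_nonneg _) (H _)) (ih _ (by omega))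

theorem newtonB_mul_le {h : ℕ → ℝ} (H : ∀ n, 0 ≤ h n) (i j : ℕ) :
    newtonB h i * newtonB h j ≤ newtonB h (i + j) := by
  induction i using Nat.strong_induction_on with
  | _ i ih =>
    cases i with
    | zero => simp [newtonB_zero]
    | succ i =>
      rw [newtonB_succ, show i + 1 + j = i + j + 1 by omega, newtonB_succ, Finset.sum_mul]
      calc _ ≤ ∑ l ∈ Finset.range (i + 1), ((i + j).descFactorial l : ℝ) * h (l + 1) * newtonB h (i + j - l) := by
            refine Finset.sum_le_sum fun l hl => ?_
            rw [Finset.mem_range] at hl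
            have h1 := ih (i - l) (by omega)
            rw [show i - l + j = i + j - l by omega] at h1
            rw [mul_assoc]
            have h2 : (i.descFactorial l : ℝ) ≤ ((i + j).descFactorial l : ℝ) := by
              exact_mod_cast Nat.descFactorial_le l (by omega)
            have h3 := H (l + 1)
            have h4 := newtonB_nonneg H i
            have h5 := mul_nonneg (newtonB_nonneg H (i - l)) (newtonB_nonneg H j)
            gcongr
        _ ≤ _ := by
            refine Finset.sum_le_sum_of_subset_of_nonneg (Finset.range_mono (by omega)) fun l _ _ => ?_
            exact mul_nonneg (mul_nonneg (Nat.cast_nonneg _) (H _)) (newtonB_nonneg H _)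

open PowerSeries in
/-- The power series `exp (∑ h n T ^ n / n)`. -/
noncomputable def expSeries (h : ℕ → ℝ) : PowerSeries ℝ :=
  PowerSeries.mk fun m => newtonB h m / m.factorial

theorem coeff_expSeries (h : ℕ → ℝ) (m : ℕ) :
    PowerSeries.coeff m (expSeries h) = newtonB h m / m.factorial := PowerSeries.coeff_mk _ _

theorem expSeries_unique {h : ℕ → ℝ} {E : PowerSeries ℝ} (h0 : PowerSeries.coeff 0 E = 1)
    (hE : PowerSeries.derivative ℝ E = PowerSeries.mk (fun n => h (n + 1)) * E) : E = expSeries h := by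
  ext m
  rw [coeff_expSeries]
  induction m using Nat.strong_induction_on with
  | _ m ih =>
    cases m with
    | zero => simp [newtonB_zero, h0]
    | succ m =>
      have h1 := congrArg (PowerSeries.coeff m) hE
      rw [PowerSeries.coeff_derivative, PowerSeries.coeff_mul,
        Finset.Nat.sum_antidiagonal_eq_sum_range_succ (fun i j => PowerSeries.coeff i (PowerSeries.mk fun n => h (n + 1)) * PowerSeries.coeff j E)] at h1
      have h2 : ((m : ℝ) + 1) ≠ 0 := by positivity
      have h3 : (m.factorial : ℝ) ≠ 0 := by positivity
      rw [eq_div_iff (by positivity), Nat.factorial_succ, newtonB_succ]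
      push_cast
      rw [← mul_assoc, h1, Finset.sum_mul]
      refine Finset.sum_congr rfl fun i hi => ?_
      rw [Finset.mem_range] at hi
      rw [PowerSeries.coeff_mk, ih _ (by omega)]
      have h4 : (m.factorial : ℝ) = (m - i).factorial * m.descFactorial i := by
        exact_mod_cast (Nat.factorial_mul_descFactorial (by omega : i ≤ m)).symm
      rw [h4]
      field_simp

theorem derivative_expSeries (h : ℕ → ℝ) :
    PowerSeries.derivative ℝ (expSeries h) = PowerSeries.mk (fun n => h (n + 1)) * expSeries h := by
  ext m
  rw [PowerSeries.coeff_derivative, PowerSeries.coeff_mul,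
    Finset.Nat.sum_antidiagonal_eq_sum_range_succ (fun i j => PowerSeries.coeff i (PowerSeries.mk fun n => h (n + 1)) * PowerSeries.coeff j (expSeries h)), coeff_expSeries, newtonB_succ, Nat.factorial_succ, Finset.sum_div, Finset.sum_mul]
  refine Finset.sum_congr rfl fun i hi => ?_
  rw [Finset.mem_range] at hi
  rw [PowerSeries.coeff_mk, coeff_expSeries]
  have h4 : (m.factorial : ℝ) = (m - i).factorial * m.descFactorial i := by
    exact_mod_cast (Nat.factorial_mul_descFactorial (by omega : i ≤ m)).symm
  push_cast
  rw [h4]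
  have h5 : (m.descFactorial i : ℝ) ≠ 0 := by
    exact_mod_cast (Nat.descFactorial_pos.2 (by omega)).ne'
  field_simp

theorem coeff_zero_expSeries (h : ℕ → ℝ) : PowerSeries.coeff 0 (expSeries h) = 1 := by
  simp [coeff_expSeries, newtonB_zero]

theorem expSeries_add (h h' : ℕ → ℝ) : expSeries (fun n => h n + h' n) = expSeries h * expSeries h' := by
  refine (expSeries_unique ?_ ?_).symm
  · have := coeff_zero_expSeries h
    have h2 := coeff_zero_expSeries h'
    rw [PowerSeries.coeff_zero_eq_constantCoeff] at *
    rw [map_mul, this, h2, one_mul]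
  · rw [Derivation.leibniz, derivative_expSeries, derivative_expSeries, smul_eq_mul, smul_eq_mul]
    have : PowerSeries.mk (fun n => h (n + 1) + h' (n + 1)) =
      PowerSeries.mk (fun n => h (n + 1)) + PowerSeries.mk (fun n => h' (n + 1)) := by ext; simp
    rw [this]; ring

theorem expSeries_neg_pow (c : ℝ) : expSeries (fun n => -c ^ n) = 1 - PowerSeries.C c * PowerSeries.X := by
  refine (expSeries_unique ?_ ?_).symm
  · simp
  · have h1 : PowerSeries.derivative ℝ (1 - PowerSeries.C c * PowerSeries.X) = -PowerSeries.C c := by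
      ext m
      rw [PowerSeries.coeff_derivative, map_sub, PowerSeries.coeff_one, if_neg (by omega),
        PowerSeries.coeff_succ_mul_X, map_neg, PowerSeries.coeff_C]
      split_ifs with hm <;> simp [hm]
    rw [h1]
    ext m
    rw [mul_sub, mul_one, ← mul_assoc, mul_comm _ (PowerSeries.C c), mul_assoc, map_sub, PowerSeries.coeff_C_mul]
    cases m with
    | zero => simp
    | succ m =>
      rw [PowerSeries.coeff_succ_mul_X, PowerSeries.coeff_mk, PowerSeries.coeff_mk, map_neg, PowerSeries.coeff_C,
        if_neg (by omega)]
      ring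

/-- The coefficients of `E` in degrees in the interval `(d, m₀]` vanish. -/
def VanishIoc (d m₀ : ℕ) (E : PowerSeries ℝ) : Prop := ∀ m, d < m → m ≤ m₀ → PowerSeries.coeff m E = 0

theorem VanishIoc.mul {d d' m₀ : ℕ} {E E' : PowerSeries ℝ} (h : VanishIoc d m₀ E) (h' : VanishIoc d' m₀ E') :
    VanishIoc (d + d') m₀ (E * E') := by
  intro m h1 h2
  rw [PowerSeries.coeff_mul]
  refine Finset.sum_eq_zero fun x hx => ?_
  rw [Finset.HasAntidiagonal.mem_antidiagonal] at hx
  by_cases h3 : d < x.1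
  · rw [h x.1 h3 (by omega), zero_mul]
  · rw [h' x.2 (by omega) (by omega), mul_zero]

theorem vanishIoc_expSeries_sum {ι : Type*} (s : Finset ι) (h : ι → ℕ → ℝ) (d : ι → ℕ) (m₀ : ℕ)
    (H : ∀ i ∈ s, VanishIoc (d i) m₀ (expSeries (h i))) :
    VanishIoc (∑ i ∈ s, d i) m₀ (expSeries fun n => ∑ i ∈ s, h i n) := by
  classical
  induction s using Finset.induction_on with
  | empty =>
    have : expSeries (fun n => ∑ i ∈ (∅ : Finset ι), h i n) = 1 :=
      (expSeries_unique (by simp) (by ext; simp)).symm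
    rw [this]
    intro m h1 _
    rw [PowerSeries.coeff_one, if_neg (by simpa using h1.ne')]
  | insert i s hi ih =>
    simp only [Finset.sum_insert hi]
    rw [expSeries_add]
    exact (H i (by simp)).mul (ih fun j hj => H j (by simp [hj]))

theorem newtonB_le_of_vanishIoc {h : ℕ → ℝ} {N : ℕ} (h0 : ∀ n, 0 ≤ h n)
    (hv : VanishIoc N (2 * N) (expSeries fun n => h n - 1)) :
    newtonB h (2 * N) ≤ ((2 * N).factorial : ℝ) ^ 2 := by
  have h1 : expSeries h * (1 - PowerSeries.X) = expSeries (fun n => h n - 1) := by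
    have h2 := expSeries_add h (fun n => -1 ^ n)
    rw [expSeries_neg_pow, map_one, one_mul] at h2
    rw [← h2]
    simp [sub_eq_add_neg]
  have h2 (k : ℕ) : k ≤ N → PowerSeries.coeff (N + k) (expSeries h) = PowerSeries.coeff N (expSeries h) := by
    induction k with
    | zero => simp
    | succ k ih =>
      intro hk
      have h3 := congrArg (PowerSeries.coeff (N + k + 1)) h1
      rw [hv _ (by omega) (by omega), mul_sub, mul_one, map_sub, PowerSeries.coeff_succ_mul_X, sub_eq_zero] at h3
      rw [← ih (by omega), ← h3]; rfl
  have h3 := h2 N le_rfl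
  rw [← two_mul, coeff_expSeries, coeff_expSeries] at h3
  have h4 := newtonB_mul_le h0 N N
  rw [← two_mul] at h4
  have hN : (1 : ℝ) ≤ N.factorial := by exact_mod_cast Nat.one_le_iff_ne_zero.2 (Nat.factorial_ne_zero N)
  have hN2 : (0 : ℝ) < (2 * N).factorial := by positivity
  rw [div_eq_iff hN2.ne'] at h3
  have h5 := newtonB_nonneg h0 N
  have h6 : newtonB h N ≤ (2 * N).factorial := by
    by_contra! hc
    have h7 : newtonB h N / N.factorial * (2 * N).factorial ≤ newtonB h N * (2 * N).factorial :=
      mul_le_mul_of_nonneg_right (div_le_self h5 hN) hN2.le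
    have h8 : 0 < newtonB h N := hN2.trans hc
    nlinarith
  rw [h3, pow_two]
  exact mul_le_mul_of_nonneg_right ((div_le_self h5 hN).trans h6) hN2.le

theorem chebF_add {R : Type*} [CommRing R] (s q : R) (m : ℕ) :
    ∀ n, chebF s q (m + n + 2) = chebF s q (m + 1) * chebF s q (n + 1) - q * (chebF s q m * chebF s q n)
  | 0 => by simp [chebF]; ring
  | 1 => by simp [chebF]; ring
  | n + 2 => by
    rw [show m + (n + 2) + 2 = (m + (n + 1) + 1) + 2 by ring, chebF,
      show m + (n + 1) + 1 + 1 = m + (n + 1) + 2 by ring, chebF_add s q m (n + 1),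
      show m + (n + 1) + 1 = m + n + 2 by ring, chebF_add s q m n]
    simp only [chebF]
    ring

theorem chebF_sq {R : Type*} [CommRing R] (s q : R) (k : ℕ) :
    chebF s q k ^ 2 = ∑ j ∈ Finset.range (k + 1), q ^ (k - j) * chebF s q (2 * j) := by
  induction k with
  | zero => simp [chebF]
  | succ k ih =>
    rw [Finset.sum_range_succ]
    have h1 : ∑ j ∈ Finset.range (k + 1), q ^ (k + 1 - j) * chebF s q (2 * j) = q * chebF s q k ^ 2 := by
      rw [ih, Finset.mul_sum]
      refine Finset.sum_congr rfl fun j hj => ?_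
      rw [Finset.mem_range] at hj
      rw [show k + 1 - j = k - j + 1 by omega, pow_succ]; ring
    rw [h1, show 2 * (k + 1) = k + k + 2 by ring, chebF_add, Nat.sub_self]
    ring

section
variable (p : ℕ) [Fact p.Prime] (F : Type*) [Field F] [Fintype F] [DecidableEq F] [Algebra (ZMod p) F]

/-- The Kloosterman sum for the standard character, as a real number. -/
noncomputable def kloosRe (x : F) : ℝ := (kloos (stdChar p F) x).re

theorem ofReal_kloosRe (x : F) : (kloosRe p F x : ℂ) = kloos (stdChar p F) x := by
  rw [kloosRe, ← Complex.conj_eq_iff_re, kloos, map_sum]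
  refine Fintype.sum_equiv (Equiv.neg _) _ _ fun y => ?_
  rw [← AddChar.map_neg_eq_conj]
  congr 1
  simp only [Equiv.neg_apply, Units.val_neg, inv_neg]
  ring

/-- The real version of `kloosMoment` for the standard character. -/
noncomputable def momentRe (i j : ℕ) (a : F) : ℝ :=
  ∑ x : Fˣ, chebF (-kloosRe p F x) (Fintype.card F) i * chebF (-kloosRe p F (a * x)) (Fintype.card F) j

theorem ofReal_momentRe (i j : ℕ) (a : F) : (momentRe p F i j a : ℂ) = kloosMoment (stdChar p F) i j a := by
  have h (s q : ℝ) (k : ℕ) : ((chebF s q k : ℝ) : ℂ) = chebF (s : ℂ) q k := map_chebF Complex.ofRealHom s q k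
  rw [momentRe, kloosMoment]
  push_cast
  simp only [h]
  push_cast
  simp only [ofReal_kloosRe]

variable {F}

theorem kloosRe_algEquiv {F' : Type*} [Field F'] [Fintype F'] [DecidableEq F'] [Algebra (ZMod p) F']
    (e : F ≃ₐ[ZMod p] F') (x : F) : kloosRe p F' (e x) = kloosRe p F x := by
  rw [kloosRe, kloosRe, kloos, kloos]
  congr 1
  symm
  refine Fintype.sum_equiv (Units.mapEquiv e.toMulEquiv).toEquiv _ _ fun y => ?_
  rw [stdChar_apply, stdChar_apply, ← Algebra.trace_eq_of_algEquiv e]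
  simp

theorem momentRe_algEquiv {F' : Type*} [Field F'] [Fintype F'] [DecidableEq F'] [Algebra (ZMod p) F']
    (e : F ≃ₐ[ZMod p] F') (i j : ℕ) (a : F) : momentRe p F' i j (e a) = momentRe p F i j a := by
  rw [momentRe, momentRe, Fintype.card_congr e.toEquiv]
  symm
  refine Fintype.sum_equiv (Units.mapEquiv e.toMulEquiv).toEquiv _ _ fun y => ?_
  have h : (((Units.mapEquiv e.toMulEquiv).toEquiv y : F'ˣ) : F') = e y := rfl
  rw [h, ← map_mul, kloosRe_algEquiv, kloosRe_algEquiv]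

end

theorem isAutocorr_momentRe (p : ℕ) [Fact p.Prime] (F : Type) [Field F] [Fintype F] [DecidableEq F]
    [Algebra (ZMod p) F] (k : ℕ) :
    IsAutocorr fun a : (ZMod p)ˣ => momentRe p F k k (algebraMap (ZMod p) F a) :=
  ⟨Fˣ, inferInstance, MulAction.compHom _ (Units.map (algebraMap (ZMod p) F).toMonoidHom),
    fun x => chebF (-kloosRe p F x) (Fintype.card F) k, fun _ => rfl⟩

theorem momentRe_self_one (p : ℕ) [Fact p.Prime] (F : Type*) [Field F] [Fintype F] [DecidableEq F]
    [Algebra (ZMod p) F] (k : ℕ) : momentRe p F k k 1 =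
      ∑ j ∈ Finset.range (k + 1), (Fintype.card F : ℝ) ^ (k - j) * momentRe p F (2 * j) 0 1 := by
  simp only [momentRe, one_mul, ← pow_two, chebF_sq, chebF, mul_one, Finset.mul_sum]
  exact Finset.sum_comm

theorem momentRe_self_one_nonneg (p : ℕ) [Fact p.Prime] (F : Type*) [Field F] [Fintype F] [DecidableEq F]
    [Algebra (ZMod p) F] (k : ℕ) : 0 ≤ momentRe p F k k 1 := by
  simp only [momentRe, one_mul]
  exact Finset.sum_nonneg fun _ _ => mul_self_nonneg _

theorem sum_momentRe_zmod (p : ℕ) [Fact p.Prime] (k : ℕ) : ∑ a : (ZMod p)ˣ, momentRe p (ZMod p) k k a =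
    (∑ x : (ZMod p)ˣ, chebF (-kloosRe p (ZMod p) x) p k) ^ 2 := by
  simp only [momentRe, ZMod.card]
  rw [Finset.sum_comm, pow_two, Finset.sum_mul]
  refine Finset.sum_congr rfl fun x _ => ?_
  rw [← Finset.mul_sum]
  congr 1
  exact Fintype.sum_equiv (Equiv.mulRight x) _ _ fun _ => rfl

open scoped Classical in
theorem card_not_nonExc_le {p : ℕ} [Fact p.Prime] {k : ℕ} (hk : k < p) :
    (Finset.univ.filter fun a : (ZMod p)ˣ => ¬NonExc k k (a : ZMod p)).card ≤ (2 * k + 1) ^ 2 := by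
  set I := Finset.Icc (-(k : ℤ)) k
  have hI : I.card = 2 * k + 1 := by rw [Int.card_Icc]; omega
  rw [pow_two, ← hI, ← Finset.card_product, ← Finset.card_image_of_injective _ (Units.val_injective (α := ZMod p))]
  refine (Finset.card_le_card (t := (I ×ˢ I).image fun x => (x.1 : ZMod p) ^ 2 * ((x.2 : ZMod p) ^ 2)⁻¹) ?_).trans
    Finset.card_image_le
  intro b hb
  obtain ⟨a, ha, rfl⟩ := Finset.mem_image.1 hb
  have h1 := (Finset.mem_filter.1 ha).2
  unfold NonExc at h1
  push Not at h1
  obtain ⟨r, s, hr, hs, h, h0⟩ := h1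
  have hz (t : ℤ) (ht : |t| ≤ k) (h0 : (t : ZMod p) = 0) : t = 0 :=
    Int.eq_zero_of_abs_lt_dvd ((ZMod.intCast_zmod_eq_zero_iff_dvd _ _).1 h0) (by omega)
  have hs0 : (s : ZMod p) ≠ 0 := by
    intro h2
    rw [h2, zero_pow two_ne_zero, zero_mul] at h
    exact h0 (hz r hr (pow_eq_zero_iff two_ne_zero |>.1 h)) (hz s hs h2)
  refine Finset.mem_image.2 ⟨(r, s), Finset.mem_product.2 ⟨?_, ?_⟩, ?_⟩
  · exact Finset.mem_Icc.2 (abs_le.1 hr)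
  · exact Finset.mem_Icc.2 (abs_le.1 hs)
  · simp only [h]; field_simp

theorem expSeries_congr {h h' : ℕ → ℝ} (H : ∀ n, 1 ≤ n → h n = h' n) : expSeries h = expSeries h' := by
  ext m
  rw [coeff_expSeries, coeff_expSeries, newtonB_congr fun n h1 _ => H n h1]

theorem sum_range_two_mul_add_one (k : ℕ) : ∑ j ∈ Finset.range k, (2 * j + 1) = k ^ 2 := by
  induction k with
  | zero => rfl
  | succ k ih => rw [Finset.sum_range_succ, ih]; ring

theorem newtonB_momentRe_eq_zero (i j m₀ : ℕ) (hij : 0 < i + j) :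
    ∃ P₀ : ℕ, ∀ (p : ℕ) [Fact p.Prime], P₀ ≤ p → ∀ a : ZMod p, a ≠ 0 → NonExc i j a →
      ∀ (F : ℕ → Type) [∀ n, Field (F n)] [∀ n, Fintype (F n)] [∀ n, DecidableEq (F n)]
        [∀ n, Algebra (ZMod p) (F n)], (∀ n, n ≠ 0 → Fintype.card (F n) = p ^ n) →
        ∀ m, (i + 1) * (j + 1) < m → m ≤ m₀ →
          newtonB (fun n => momentRe p (F n) i j (algebraMap (ZMod p) (F n) a)) m = 0 := by
  obtain ⟨P₀, hP⟩ := newtonB_kloosMoment_eq_zero i j m₀ hij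
  refine ⟨P₀, fun p _ hp a ha hexc F _ _ _ _ hF m hm hm₀ => ?_⟩
  have h1 := hP p hp a ha hexc F hF m hm hm₀
  simp only [← ofReal_momentRe] at h1
  have h2 := map_newtonB Complex.ofRealHom (fun n => momentRe p (F n) i j (algebraMap (ZMod p) (F n) a)) m
  exact Complex.ofReal_injective ((h2.trans h1).trans Complex.ofReal_zero.symm)

theorem newtonB_momentRe_one_le (k : ℕ) :
    ∃ P₀ : ℕ, ∀ (p : ℕ) [Fact p.Prime], P₀ ≤ p →
      ∀ (F : ℕ → Type) [∀ n, Field (F n)] [∀ n, Fintype (F n)] [∀ n, DecidableEq (F n)]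
        [∀ n, Algebra (ZMod p) (F n)], (∀ n, n ≠ 0 → Fintype.card (F n) = p ^ n) →
          newtonB (fun n => momentRe p (F n) k k 1) (2 * (k + 1) ^ 2) ≤
            ((p : ℝ) ^ (k + 1)) ^ (2 * (k + 1) ^ 2) * ((2 * (k + 1) ^ 2).factorial : ℝ) ^ 2 := by
  choose P₀ hP using fun j : ℕ => newtonB_momentRe_eq_zero (2 * (j + 1)) 0 (2 * (k + 1) ^ 2) (by omega)
  refine ⟨∑ j ∈ Finset.range k, P₀ j + 2 * k + 1, fun p _ hp F _ _ _ _ hF => ?_⟩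
  have hp0 : (p : ℝ) ≠ 0 := by exact_mod_cast (Fact.out : p.Prime).ne_zero
  set c : ℝ := (p : ℝ) ^ (k + 1) with hc
  have hc0 : 0 < c := by positivity
  have h1 : newtonB (fun n => momentRe p (F n) k k 1) (2 * (k + 1) ^ 2) =
      c ^ (2 * (k + 1) ^ 2) * newtonB (fun n => (c ^ n)⁻¹ * momentRe p (F n) k k 1) (2 * (k + 1) ^ 2) := by
    rw [← newtonB_scale]
    refine newtonB_congr fun n _ _ => ?_
    field_simp
  rw [h1]
  refine mul_le_mul_of_nonneg_left (newtonB_le_of_vanishIoc (fun n => ?_) ?_) (by positivity)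
  · exact mul_nonneg (by positivity) (momentRe_self_one_nonneg _ _ _)
  set g : ℕ → ℕ → ℝ := fun j n => if j = 0 then -((p : ℝ)⁻¹) ^ n else
    (((p : ℝ)⁻¹) ^ (j + 1)) ^ n * momentRe p (F n) (2 * j) 0 1 with hg
  have h2 : expSeries (fun n => (c ^ n)⁻¹ * momentRe p (F n) k k 1 - 1) =
      expSeries (fun n => ∑ j ∈ Finset.range (k + 1), g j n) := by
    refine expSeries_congr fun n hn => ?_
    rw [momentRe_self_one, hF n (by omega), Finset.mul_sum, Finset.sum_range_succ', Finset.sum_range_succ' (fun j => g j n)]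
    have h3 : momentRe p (F n) (2 * 0) 0 1 = (p : ℝ) ^ n - 1 := by
      simp only [momentRe, chebF, mul_one, Finset.sum_const, Finset.card_univ, nsmul_eq_mul]
      rw [Fintype.card_units, hF n (by omega), Nat.cast_sub (Nat.one_le_pow _ _ (Fact.out : p.Prime).pos)]
      push_cast; ring
    rw [h3, add_sub_assoc]
    congr 1
    · refine Finset.sum_congr rfl fun j hj => ?_
      rw [Finset.mem_range] at hj
      simp only [hg, hc, if_neg (Nat.succ_ne_zero j)]
      rw [← mul_assoc]
      congr 1
      push_cast
      rw [inv_mul_eq_iff_eq_mul₀ (by positivity), inv_pow, inv_pow, eq_mul_inv_iff_mul_eq₀ (by positivity)]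
      rw [← pow_mul, ← pow_mul, ← pow_mul, ← pow_add]
      congr 1
      obtain ⟨l, rfl⟩ : ∃ l, k = j + 1 + l := ⟨k - (j + 1), by omega⟩
      rw [Nat.add_sub_cancel_left]
      ring
    · simp only [hg, hc, if_true]
      push_cast
      rw [Nat.sub_zero, inv_pow]
      field_simp
      ring
  rw [h2]
  have h4 := vanishIoc_expSeries_sum (Finset.range (k + 1)) g (fun j => 2 * j + 1) (2 * (k + 1) ^ 2) ?_
  · rwa [sum_range_two_mul_add_one] at h4
  intro j hj
  rw [Finset.mem_range] at hj
  cases j with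
  | zero =>
    simp only [hg, if_true]
    rw [expSeries_neg_pow]
    intro m hm _
    obtain ⟨l, rfl⟩ : ∃ l, m = l + 2 := ⟨m - 2, by omega⟩
    rw [map_sub, PowerSeries.coeff_one, if_neg (by omega), PowerSeries.coeff_succ_mul_X, PowerSeries.coeff_C,
      if_neg (by omega), sub_zero]
  | succ j =>
    simp only [hg, if_neg (Nat.succ_ne_zero j)]
    intro m hm hm'
    rw [coeff_expSeries, newtonB_scale]
    have hPj : P₀ j ≤ ∑ j ∈ Finset.range k, P₀ j :=
      Finset.single_le_sum (f := P₀) (fun _ _ => Nat.zero_le _) (Finset.mem_range.2 (by omega))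
    have h5 := hP j p (by omega) 1 one_ne_zero ?_ F hF m (by omega) hm'
    · simp only [map_one] at h5
      rw [h5, mul_zero, zero_div]
    · intro r s hr hs h
      have hs0 : s = 0 := by simpa using hs
      subst hs0
      refine ⟨?_, rfl⟩
      have h6 : (r : ZMod p) = 0 := by
        rw [Int.cast_zero, zero_pow two_ne_zero, zero_mul] at h
        exact pow_eq_zero_iff two_ne_zero |>.1 h
      exact Int.eq_zero_of_abs_lt_dvd ((ZMod.intCast_zmod_eq_zero_iff_dvd _ _).1 h6) (by push_cast at hr; omega)

theorem IsAutocorr.sum_pow_le {G : Type} [CommGroup G] [Fintype G] {h : ℕ → G → ℝ} (hA : ∀ n, IsAutocorr (h n))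
    {m : ℕ} (hm0 : m ≠ 0) (hm : Even m) (E : Finset G) (hE : ∀ a, a ∉ E → _root_.newtonB (fun n => h n a) m = 0) :
    (∑ a, h 1 a) ^ m ≤ (Fintype.card G : ℝ) ^ (m - 1) * (E.card * _root_.newtonB (fun n => h n 1) m) := by
  have hc : (0 : ℝ) < Fintype.card G := by exact_mod_cast Fintype.card_pos
  have h2 : (∑ a, h 1 a) ^ m ≤ (Fintype.card G : ℝ) ^ (m - 1) * ∑ a, h 1 a ^ m := by
    have := Real.pow_arith_mean_le_arith_mean_pow_of_even Finset.univ (fun _ : G => (Fintype.card G : ℝ)⁻¹) (h 1)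
      (fun _ _ => by positivity) (by simp) hm
    rw [← Finset.mul_sum, ← Finset.mul_sum, mul_pow, inv_pow, inv_mul_le_iff₀ (by positivity)] at this
    refine this.trans (le_of_eq ?_)
    obtain ⟨l, rfl⟩ : ∃ l, m = l + 1 := ⟨m - 1, by omega⟩
    rw [Nat.add_sub_cancel, pow_succ]
    field_simp
  refine h2.trans (mul_le_mul_of_nonneg_left ?_ (by positivity))
  have hB := IsAutocorr.newtonB (fun n _ => hA n) m
  have h3 : ∑ a, h 1 a ^ m ≤ ∑ a, _root_.newtonB (fun n => h n a) m := by
    have := (IsAutocorr.newtonB_sub_pow (fun n _ => hA n) m).sum_nonneg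
    rw [Finset.sum_sub_distrib] at this
    linarith
  refine h3.trans ?_
  rw [← Finset.sum_subset (Finset.subset_univ E) fun a _ ha => hE a ha, ← nsmul_eq_mul]
  exact Finset.sum_le_card_nsmul _ _ _ fun a _ => (le_abs_self _).trans (hB.abs_le a)

theorem sum_chebF_pow_le (k : ℕ) (hk : 0 < k) :
    ∃ P₀ : ℕ, ∀ (p : ℕ) [Fact p.Prime], P₀ ≤ p →
      (∑ x : (ZMod p)ˣ, chebF (-kloosRe p (ZMod p) x) p k) ^ (2 * (2 * (k + 1) ^ 2)) ≤
        (p : ℝ) ^ (2 * (k + 1) ^ 2 - 1) * ((2 * k + 1 : ℕ) ^ 2 * (((p : ℝ) ^ (k + 1)) ^ (2 * (k + 1) ^ 2) *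
          ((2 * (k + 1) ^ 2).factorial : ℝ) ^ 2)) := by
  classical
  obtain ⟨P₁, hP₁⟩ := newtonB_momentRe_one_le k
  obtain ⟨P₂, hP₂⟩ := newtonB_momentRe_eq_zero k k (2 * (k + 1) ^ 2) (by omega)
  refine ⟨P₁ + P₂ + k + 1, fun p _ hp => ?_⟩
  let F : ℕ → Type := fun n => GaloisField p n
  let _ : ∀ n, Fintype (F n) := fun n => Fintype.ofFinite _
  have hF (n : ℕ) (hn : n ≠ 0) : Fintype.card (F n) = p ^ n := by
    rw [← Nat.card_eq_fintype_card]; exact GaloisField.card p n hn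
  have hN : 0 < (k + 1) ^ 2 := by positivity
  have h1 : ∑ a : (ZMod p)ˣ, momentRe p (F 1) k k (algebraMap (ZMod p) (F 1) a) =
      (∑ x : (ZMod p)ˣ, chebF (-kloosRe p (ZMod p) x) p k) ^ 2 := by
    rw [← sum_momentRe_zmod]
    refine Finset.sum_congr rfl fun a _ => ?_
    have := momentRe_algEquiv p (GaloisField.equivZmodP p) k k (algebraMap (ZMod p) (GaloisField p 1) a)
    rw [AlgEquiv.commutes] at this
    exact this.symm
  rw [pow_mul, ← h1]
  refine (IsAutocorr.sum_pow_le (h := fun n (a : (ZMod p)ˣ) => momentRe p (F n) k k (algebraMap (ZMod p) (F n) a))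
    (fun n => isAutocorr_momentRe p (F n) k) (by omega) ⟨(k + 1) ^ 2, by omega⟩
    (Finset.univ.filter fun a : (ZMod p)ˣ => ¬NonExc k k (a : ZMod p)) fun a ha => ?_).trans ?_
  · refine hP₂ p (by omega) (a : ZMod p) (Units.ne_zero a) (by simpa using ha) F hF _ ?_ le_rfl
    rw [← pow_two]; omega
  · have h6 := hP₁ p (by omega) F hF
    simp only [Units.val_one, map_one]
    have hcard : (Fintype.card (ZMod p)ˣ : ℝ) ≤ p := by
      rw [ZMod.card_units_eq_totient]; exact_mod_cast Nat.totient_le p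
    have h7 : 0 ≤ newtonB (fun n => momentRe p (F n) k k 1) (2 * (k + 1) ^ 2) :=
      newtonB_nonneg (fun n => momentRe_self_one_nonneg _ _ _) _
    have h8 := card_not_nonExc_le (p := p) (k := k) (by omega)
    have h9 : (((Finset.univ.filter fun a : (ZMod p)ˣ => ¬NonExc k k (a : ZMod p)).card : ℕ) : ℝ) ≤
      ((2 * k + 1 : ℕ) : ℝ) ^ 2 := by exact_mod_cast h8
    exact mul_le_mul (pow_le_pow_left₀ (Nat.cast_nonneg _) hcard _) (mul_le_mul h9 h6 h7 (by positivity))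
      (mul_nonneg (Nat.cast_nonneg _) h7) (by positivity)

section
open MeasureTheory Filter Topology Set

/-- The density of the Sato–Tate law in the angle variable. -/
noncomputable def satoTateAngle : Measure ℝ :=
  (volume.restrict (Icc 0 Real.pi)).withDensity fun θ => ENNReal.ofReal (2 / Real.pi * Real.sin θ ^ 2)

theorem integral_satoTateAngle (f : ℝ → ℝ) :
    ∫ θ, f θ ∂satoTateAngle = 2 / Real.pi * ∫ θ in (0 : ℝ)..Real.pi, Real.sin θ ^ 2 * f θ := by
  rw [satoTateAngle, integral_withDensity_eq_integral_toReal_smul (by fun_prop) (by simp),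
    intervalIntegral.integral_of_le Real.pi_pos.le, integral_Icc_eq_integral_Ioc, ← integral_const_mul]
  refine integral_congr_ae (Eventually.of_forall fun θ => ?_)
  simp only [smul_eq_mul]
  rw [ENNReal.toReal_ofReal (by positivity), mul_assoc]

instance : IsProbabilityMeasure satoTateAngle := by
  have h : ∫⁻ θ in Icc 0 Real.pi, ENNReal.ofReal (2 / Real.pi * Real.sin θ ^ 2) = 1 := by
    rw [← ofReal_integral_eq_lintegral_ofReal, integral_Icc_eq_integral_Ioc,
      ← intervalIntegral.integral_of_le Real.pi_pos.le, intervalIntegral.integral_const_mul, integral_sin_sq]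
    · simp
    · exact (by fun_prop : Continuous fun θ => 2 / Real.pi * Real.sin θ ^ 2).integrableOn_Icc
    · exact Eventually.of_forall fun θ => by positivity
  exact ⟨by rw [satoTateAngle, withDensity_apply _ MeasurableSet.univ, Measure.restrict_univ, h]⟩

/-- The Sato–Tate measure on traces. -/
noncomputable def satoTate : ProbabilityMeasure ℝ :=
  ⟨satoTateAngle.map fun θ => 2 * Real.cos θ, Measure.isProbabilityMeasure_map (by fun_prop)⟩

theorem integral_satoTate {f : ℝ → ℝ} (hf : Continuous f) : ∫ t, f t ∂(satoTate : Measure ℝ) =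
    2 / Real.pi * ∫ θ in (0 : ℝ)..Real.pi, Real.sin θ ^ 2 * f (2 * Real.cos θ) := by
  rw [← integral_satoTateAngle, satoTate, ProbabilityMeasure.coe_mk,
    integral_map (by fun_prop) hf.aestronglyMeasurable]

theorem integrable_satoTate {f : ℝ → ℝ} (hf : Continuous f) : Integrable f (satoTate : Measure ℝ) := by
  obtain ⟨C, hC⟩ := (isCompact_Icc (a := (-2 : ℝ)) (b := 2)).exists_bound_of_continuousOn hf.continuousOn
  refine Integrable.of_bound hf.aestronglyMeasurable C ?_
  rw [satoTate, ProbabilityMeasure.coe_mk, ae_map_iff (by fun_prop) (measurableSet_le (by fun_prop) (by fun_prop))]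
  refine Eventually.of_forall fun θ => hC _ ⟨?_, ?_⟩
  · linarith [Real.neg_one_le_cos θ]
  · linarith [Real.cos_le_one θ]

theorem chebF_two_cos_mul_sin (θ : ℝ) : ∀ k : ℕ, chebF (2 * Real.cos θ) 1 k * Real.sin θ = Real.sin ((k + 1) * θ)
  | 0 => by simp [chebF]
  | 1 => by
    simp only [chebF]; push_cast
    rw [one_add_one_eq_two, Real.sin_two_mul]; ring
  | k + 2 => by
    have h1 := chebF_two_cos_mul_sin θ k
    have h2 := chebF_two_cos_mul_sin θ (k + 1)
    rw [chebF, sub_mul, one_mul, h1, mul_assoc, h2]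
    push_cast
    have e1 : ((k : ℝ) + 2 + 1) * θ = ((k : ℝ) + 1 + 1) * θ + θ := by ring
    have e2 : ((k : ℝ) + 1) * θ = ((k : ℝ) + 1 + 1) * θ - θ := by ring
    rw [e1, e2, Real.sin_add, Real.sin_sub]; ring

theorem continuous_chebF (k : ℕ) : Continuous fun t : ℝ => chebF t 1 k := by
  induction k using Nat.strong_induction_on with
  | _ k ih =>
    match k with
    | 0 => simp only [chebF]; fun_prop
    | 1 => simp only [chebF]; fun_prop
    | k + 2 =>
      simp only [chebF]
      have := ih k (by omega)
      have := ih (k + 1) (by omega)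
      fun_prop

theorem integral_cos_nat_mul {k : ℕ} (hk : k ≠ 0) : ∫ θ in (0 : ℝ)..Real.pi, Real.cos (k * θ) = 0 := by
  rw [intervalIntegral.integral_comp_mul_left (fun x => Real.cos x) (by exact_mod_cast hk), integral_cos]
  simp [Real.sin_nat_mul_pi]

theorem integral_chebF_satoTate {k : ℕ} (hk : k ≠ 0) : ∫ t, chebF t 1 k ∂(satoTate : Measure ℝ) = 0 := by
  rw [integral_satoTate (continuous_chebF k)]
  have h (θ : ℝ) : Real.sin θ ^ 2 * chebF (2 * Real.cos θ) 1 k =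
      (Real.cos ((k : ℕ) * θ) - Real.cos ((k + 2 : ℕ) * θ)) / 2 := by
    rw [pow_two, mul_assoc, mul_comm _ (chebF _ _ _), chebF_two_cos_mul_sin]
    push_cast
    have e1 : (k : ℝ) * θ = (k + 1) * θ - θ := by ring
    have e2 : ((k : ℝ) + 2) * θ = (k + 1) * θ + θ := by ring
    rw [e1, e2, Real.cos_add, Real.cos_sub]; ring
  simp only [h]
  rw [intervalIntegral.integral_div, intervalIntegral.integral_sub, integral_cos_nat_mul hk,
    integral_cos_nat_mul (by omega)]
  · simp
  · exact (by fun_prop : Continuous _).intervalIntegrable _ _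
  · exact (by fun_prop : Continuous _).intervalIntegrable _ _

theorem satoTate_Icc {a b : ℝ} (ha : 0 ≤ a) (hab : a ≤ b) (hb : b ≤ Real.pi) :
    (satoTate : Measure ℝ).real (Icc (2 * Real.cos b) (2 * Real.cos a)) =
      2 / Real.pi * ∫ θ in a..b, Real.sin θ ^ 2 := by
  have hm : Measurable fun θ : ℝ => 2 * Real.cos θ := by fun_prop
  have h1 : (fun θ : ℝ => 2 * Real.cos θ) ⁻¹' Icc (2 * Real.cos b) (2 * Real.cos a) ∩ Icc 0 Real.pi = Icc a b := by
    ext θ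
    simp only [mem_inter_iff, mem_preimage, mem_Icc]
    constructor
    · rintro ⟨⟨h1, h2⟩, h3, h4⟩
      constructor
      · by_contra! hc
        linarith [Real.cos_lt_cos_of_nonneg_of_le_pi h3 (hab.trans hb) hc]
      · by_contra! hc
        linarith [Real.cos_lt_cos_of_nonneg_of_le_pi (ha.trans hab) h4 hc]
    · rintro ⟨h1, h2⟩
      refine ⟨⟨?_, ?_⟩, ha.trans h1, h2.trans hb⟩
      · linarith [Real.cos_le_cos_of_nonneg_of_le_pi (ha.trans h1) hb h2]
      · linarith [Real.cos_le_cos_of_nonneg_of_le_pi ha (h2.trans hb) h1]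
  rw [satoTate, ProbabilityMeasure.coe_mk, Measure.real, Measure.map_apply hm measurableSet_Icc, satoTateAngle,
    withDensity_apply _ (hm measurableSet_Icc), Measure.restrict_restrict (hm measurableSet_Icc), h1,
    ← ofReal_integral_eq_lintegral_ofReal, ENNReal.toReal_ofReal, integral_Icc_eq_integral_Ioc,
    ← intervalIntegral.integral_of_le hab, intervalIntegral.integral_const_mul]
  · exact integral_nonneg fun θ => by positivity
  · exact (by fun_prop : Continuous fun θ => 2 / Real.pi * Real.sin θ ^ 2).integrableOn_Icc
  · exact Eventually.of_forall fun θ => by positivity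

theorem satoTate_singleton (c : ℝ) : (satoTate : Measure ℝ) {c} = 0 := by
  have hm : Measurable fun θ : ℝ => 2 * Real.cos θ := by fun_prop
  rw [satoTate, ProbabilityMeasure.coe_mk, Measure.map_apply hm (measurableSet_singleton c), satoTateAngle]
  refine withDensity_absolutelyContinuous _ _ ?_
  rw [Measure.restrict_apply (hm (measurableSet_singleton c))]
  refine Set.Subsingleton.measure_zero (fun x hx y hy => Real.injOn_cos hx.2 hy.2 ?_) _
  have h1 : 2 * Real.cos x = c := hx.1
  have h2 : 2 * Real.cos y = c := hy.1
  linarith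

section
variable {ι : Type*} {L : Filter ι} {μs : ι → ProbabilityMeasure ℝ}
  (hint : ∀ i (f : ℝ → ℝ), Continuous f → Integrable f (μs i : Measure ℝ))
  (hmom : ∀ k : ℕ, k ≠ 0 → Tendsto (fun i => ∫ t, chebF t 1 k ∂(μs i : Measure ℝ)) L (𝓝 0))

include hint hmom in
theorem tendsto_integral_pow_mul_chebF (n : ℕ) : ∀ k, Tendsto
    (fun i => ∫ t, t ^ n * chebF t 1 k ∂(μs i : Measure ℝ)) L (𝓝 (∫ t, t ^ n * chebF t 1 k ∂(satoTate : Measure ℝ))) := by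
  induction n with
  | zero =>
    intro k
    rcases eq_or_ne k 0 with rfl | hk
    · simpa [chebF] using tendsto_const_nhds
    · simpa [integral_chebF_satoTate hk] using hmom k hk
  | succ n ih =>
    intro k
    cases k with
    | zero =>
      have h1 (t : ℝ) : t ^ (n + 1) * chebF t 1 0 = t ^ n * chebF t 1 1 := by simp only [chebF]; ring
      simpa only [h1] using ih 1
    | succ k =>
      have h1 (t : ℝ) : t ^ (n + 1) * chebF t 1 (k + 1) = t ^ n * chebF t 1 (k + 2) + t ^ n * chebF t 1 k := by
        simp only [chebF]; ring
      have h2 (j : ℕ) : Continuous fun t : ℝ => t ^ n * chebF t 1 j := (continuous_pow n).mul (continuous_chebF j)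
      simp only [h1]
      rw [integral_add (integrable_satoTate (h2 _)) (integrable_satoTate (h2 _))]
      refine ((ih (k + 2)).add (ih k)).congr fun i => ?_
      rw [integral_add (hint i _ (h2 _)) (hint i _ (h2 _))]

include hint hmom in
theorem tendsto_integral_polynomial (P : Polynomial ℝ) : Tendsto
    (fun i => ∫ t, P.eval t ∂(μs i : Measure ℝ)) L (𝓝 (∫ t, P.eval t ∂(satoTate : Measure ℝ))) := by
  induction P using Polynomial.induction_on' with
  | add P Q hP hQ =>
    simp only [Polynomial.eval_add]
    rw [integral_add (integrable_satoTate P.continuous) (integrable_satoTate Q.continuous)]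
    refine (hP.add hQ).congr fun i => ?_
    rw [integral_add (hint i _ P.continuous) (hint i _ Q.continuous)]
  | monomial n c =>
    simp only [Polynomial.eval_monomial, integral_const_mul]
    have := tendsto_integral_pow_mul_chebF hint hmom n 0
    simp only [chebF, mul_one] at this
    exact this.const_mul c

theorem abs_eval_le (P : Polynomial ℝ) : ∃ C, 0 ≤ C ∧ ∀ t : ℝ, 1 ≤ |t| → |P.eval t| ≤ C * t ^ (2 * P.natDegree) := by
  refine ⟨∑ i ∈ Finset.range (P.natDegree + 1), |P.coeff i|, Finset.sum_nonneg fun _ _ => abs_nonneg _, fun t ht => ?_⟩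
  rw [Polynomial.eval_eq_sum_range, Finset.sum_mul]
  refine (Finset.abs_sum_le_sum_abs _ _).trans (Finset.sum_le_sum fun i hi => ?_)
  rw [abs_mul, abs_pow, ← (even_two_mul P.natDegree).pow_abs t]
  rw [Finset.mem_range] at hi
  exact mul_le_mul_of_nonneg_left (pow_le_pow_right₀ ht (by omega)) (abs_nonneg _)

theorem integral_pow_satoTate_le (n : ℕ) : ∫ t, t ^ (2 * n) ∂(satoTate : Measure ℝ) ≤ 4 ^ n := by
  have h : ∀ᵐ t ∂(satoTate : Measure ℝ), t ^ (2 * n) ≤ 4 ^ n := by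
    rw [satoTate, ProbabilityMeasure.coe_mk, ae_map_iff (by fun_prop) (measurableSet_le (by fun_prop) (by fun_prop))]
    refine Eventually.of_forall fun θ => ?_
    rw [pow_mul]
    refine pow_le_pow_left₀ (sq_nonneg _) ?_ n
    nlinarith [Real.cos_sq_le_one θ]
  refine (integral_mono_ae (integrable_satoTate (continuous_pow _)) (integrable_const _) h).trans ?_
  simp

include hint hmom in
theorem tendsto_satoTate : Tendsto μs L (𝓝 satoTate) := by
  rw [ProbabilityMeasure.tendsto_iff_forall_integral_tendsto]
  intro φ
  rw [Metric.tendsto_nhds]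
  intro ε hε
  obtain ⟨P, hP⟩ := exists_polynomial_near_of_continuousOn (-3) 3 φ φ.continuous.continuousOn (ε / 10) (by positivity)
  obtain ⟨C, hC0, hC⟩ := abs_eval_le P
  set d := P.natDegree
  set C' := C + ‖φ‖ with hC'
  have hC'0 : 0 ≤ C' := add_nonneg hC0 (norm_nonneg _)
  obtain ⟨R, hR⟩ : ∃ R : ℕ, C' * 4 ^ d * (4 / 9 : ℝ) ^ R < ε / 10 := by
    have h := (tendsto_pow_atTop_nhds_zero_of_lt_one (r := (4 / 9 : ℝ)) (by norm_num) (by norm_num)).const_mul (C' * 4 ^ d)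
    rw [mul_zero] at h
    exact (h.eventually (gt_mem_nhds (by positivity))).exists
  have hbd (t : ℝ) : |P.eval t - φ t| ≤ ε / 10 + C' * (1 / 9) ^ R * t ^ (2 * (d + R)) := by
    by_cases ht : t ∈ Icc (-3 : ℝ) 3
    · have h1 : 0 ≤ t ^ (2 * (d + R)) := (even_two_mul _).pow_nonneg t
      have h2 : 0 ≤ C' * (1 / 9) ^ R * t ^ (2 * (d + R)) := by positivity
      linarith [hP t ht]
    · have ht3 : 3 ≤ |t| := by
        by_contra! hc
        exact ht (abs_le.1 hc.le)
      have h1 : 1 ≤ t ^ (2 * d) := by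
        rw [← (even_two_mul d).pow_abs t]; exact one_le_pow₀ (by linarith)
      have h2 : (1 : ℝ) ≤ (1 / 9) ^ R * t ^ (2 * R) := by
        rw [pow_mul, ← mul_pow]
        refine one_le_pow₀ ?_
        nlinarith [sq_abs t]
      have h3 := φ.norm_coe_le_norm t
      rw [Real.norm_eq_abs] at h3
      have h4 : C' * t ^ (2 * d) * 1 ≤ C' * t ^ (2 * d) * ((1 / 9) ^ R * t ^ (2 * R)) :=
        mul_le_mul_of_nonneg_left h2 (mul_nonneg hC'0 (by linarith))
      have h5 : ‖φ‖ * 1 ≤ ‖φ‖ * t ^ (2 * d) := mul_le_mul_of_nonneg_left h1 (norm_nonneg _)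
      have h6 : C' * (1 / 9) ^ R * t ^ (2 * (d + R)) = C' * t ^ (2 * d) * ((1 / 9) ^ R * t ^ (2 * R)) := by
        rw [mul_add, pow_add]; ring
      have h7 := (abs_sub (P.eval t) (φ t)).trans (add_le_add (hC t (by linarith)) h3)
      rw [h6]
      have h8 : C' * t ^ (2 * d) = C * t ^ (2 * d) + ‖φ‖ * t ^ (2 * d) := by rw [hC']; ring
      linarith
  have hcp : Continuous fun t : ℝ => t ^ (2 * (d + R)) := continuous_pow _
  have key (ν : Measure ℝ) [IsProbabilityMeasure ν] (hν : ∀ f : ℝ → ℝ, Continuous f → Integrable f ν) :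
      |∫ t, P.eval t ∂ν - ∫ t, φ t ∂ν| ≤ ε / 10 + C' * (1 / 9) ^ R * ∫ t, t ^ (2 * (d + R)) ∂ν := by
    rw [← integral_sub (hν _ P.continuous) (hν _ φ.continuous)]
    refine (abs_integral_le_integral_abs).trans ?_
    refine (integral_mono (hν _ (by fun_prop)) (hν _ (by fun_prop)) hbd).trans ?_
    rw [integral_add (hν _ (by fun_prop)) (hν _ (by fun_prop)), integral_const_mul]
    simp
  have hsmall : C' * (1 / 9) ^ R * ∫ t, t ^ (2 * (d + R)) ∂(satoTate : Measure ℝ) < ε / 10 := by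
    refine (mul_le_mul_of_nonneg_left (integral_pow_satoTate_le (d + R)) (by positivity)).trans_lt ?_
    refine lt_of_eq_of_lt ?_ hR
    rw [pow_add, show (4 / 9 : ℝ) = 1 / 9 * 4 by norm_num, mul_pow]; ring
  have hT := (tendsto_integral_polynomial hint hmom (Polynomial.X ^ (2 * (d + R)))).const_mul (C' * (1 / 9) ^ R)
  simp only [Polynomial.eval_pow, Polynomial.eval_X] at hT
  filter_upwards [hT.eventually (gt_mem_nhds hsmall),
    (Metric.tendsto_nhds.1 (tendsto_integral_polynomial hint hmom P)) (ε / 10) (by positivity)] with i h1 h2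
  have k1 := key (μs i) (hint i)
  have k2 := key (satoTate : Measure ℝ) fun f hf => integrable_satoTate hf
  rw [Real.dist_eq] at h2 ⊢
  rw [abs_le] at k1 k2
  rw [abs_lt] at h2 ⊢
  constructor <;> linarith [k1.1, k1.2, k2.1, k2.2, h2.1, h2.2]

include hint hmom in
theorem tendsto_real_Icc {a b : ℝ} (ha : 0 ≤ a) (hab : a ≤ b) (hb : b ≤ Real.pi) :
    Tendsto (fun i => (μs i : Measure ℝ).real (Icc (2 * Real.cos b) (2 * Real.cos a))) L
      (𝓝 (2 / Real.pi * ∫ θ in a..b, Real.sin θ ^ 2)) := by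
  rw [← satoTate_Icc ha hab hb]
  have h := ProbabilityMeasure.tendsto_measure_of_null_frontier_of_tendsto' (tendsto_satoTate hint hmom)
    (E := Icc (2 * Real.cos b) (2 * Real.cos a)) ?_
  · exact (ENNReal.tendsto_toReal (measure_ne_top _ _)).comp h
  · have hle : 2 * Real.cos b ≤ 2 * Real.cos a := by
      linarith [Real.cos_le_cos_of_nonneg_of_le_pi ha hb hab]
    rw [frontier_Icc hle]
    refine measure_mono_null (Set.insert_eq _ _).subset ?_
    exact measure_union_null (satoTate_singleton _) (satoTate_singleton _)
end
end

open Filter Topology MeasureTheory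

theorem chebF_smul {R : Type*} [CommRing R] (c s q : R) : ∀ k, chebF (c * s) (c ^ 2 * q) k = c ^ k * chebF s q k
  | 0 => by simp [chebF]
  | 1 => by simp [chebF]
  | k + 2 => by
    rw [chebF, chebF, chebF_smul c s q k, chebF_smul c s q (k + 1)]; ring

theorem abs_sum_chebF_le (k : ℕ) (hk : 0 < k) {ε : ℝ} (hε : 0 < ε) :
    ∃ P₀ : ℕ, ∀ (p : ℕ) [Fact p.Prime], P₀ ≤ p →
      |∑ x : (ZMod p)ˣ, chebF (kloosRe p (ZMod p) x / √p) 1 k| ≤ ε * (p - 1) := by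
  obtain ⟨P₁, hP₁⟩ := sum_chebF_pow_le k hk
  set m := 2 * (k + 1) ^ 2 with hm
  have hm0 : 0 < m := by positivity
  set D : ℝ := (2 * k + 1 : ℕ) ^ 2 * (m.factorial : ℝ) ^ 2 with hD
  obtain ⟨P₂, hP₂⟩ := exists_nat_gt (D / (ε / 2) ^ (2 * m))
  refine ⟨P₁ + P₂, fun p _ hp => ?_⟩
  have hp2 : (2 : ℝ) ≤ p := by exact_mod_cast (Fact.out : p.Prime).two_le
  have hp0 : (0 : ℝ) < p := by linarith
  set S := ∑ x : (ZMod p)ˣ, chebF (kloosRe p (ZMod p) x / √p) 1 k with hS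
  have h1 : ∑ x : (ZMod p)ˣ, chebF (-kloosRe p (ZMod p) x) p k = (-√p) ^ k * S := by
    rw [hS, Finset.mul_sum]
    refine Finset.sum_congr rfl fun x _ => ?_
    rw [← chebF_smul, neg_sq, Real.sq_sqrt hp0.le, mul_one, neg_mul, mul_div_cancel₀ _ (by positivity)]
  have h2 := hP₁ p (by omega)
  rw [h1] at h2
  have h3 : ((-√p) ^ k * S) ^ (2 * m) = (p : ℝ) ^ (k * m) * |S| ^ (2 * m) := by
    rw [mul_pow, (even_two_mul m).pow_abs, ← pow_mul, show k * (2 * m) = 2 * (k * m) by ring, pow_mul (-√(p : ℝ)),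
      neg_sq, Real.sq_sqrt hp0.le]
  have h4 : (p : ℝ) ^ (m - 1) * ((2 * k + 1 : ℕ) ^ 2 * (((p : ℝ) ^ (k + 1)) ^ m * (m.factorial : ℝ) ^ 2)) =
      (p : ℝ) ^ (k * m) * (D * (p : ℝ) ^ (2 * m - 1)) := by
    have : (p : ℝ) ^ (2 * m - 1) = (p : ℝ) ^ (m - 1) * (p : ℝ) ^ m := by
      rw [← pow_add]; congr 1; omega
    rw [this, hD, ← pow_mul, add_mul, one_mul, pow_add]
    ring
  rw [h3, h4] at h2
  have h5 : |S| ^ (2 * m) ≤ D * (p : ℝ) ^ (2 * m - 1) := le_of_mul_le_mul_left h2 (by positivity)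
  by_contra! hc
  have h6 : ε / 2 * p ≤ |S| := by nlinarith
  have h7 : (ε / 2 * p) ^ (2 * m) ≤ |S| ^ (2 * m) := pow_le_pow_left₀ (by positivity) h6 _
  have h8 : (p : ℝ) ^ (2 * m) = (p : ℝ) ^ (2 * m - 1) * p := by rw [← pow_succ, Nat.sub_add_cancel (by omega)]
  have h9 : D < (ε / 2) ^ (2 * m) * p := by
    rw [div_lt_iff₀ (by positivity)] at hP₂
    have : (P₂ : ℝ) ≤ p := by exact_mod_cast (by omega : P₂ ≤ p)
    have h10 : (P₂ : ℝ) * (ε / 2) ^ (2 * m) ≤ p * (ε / 2) ^ (2 * m) := mul_le_mul_of_nonneg_right this (by positivity)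
    linarith
  rw [mul_pow, h8] at h7
  have h11 : (0 : ℝ) < (p : ℝ) ^ (2 * m - 1) := by positivity
  have h12 := mul_lt_mul_of_pos_right h9 h11
  nlinarith

theorem sum_units_zmod {A : Type*} [AddCommMonoid A] (p : ℕ) [Fact p.Prime] (f : ZMod p → A) :
    ∑ x : (ZMod p)ˣ, f x = ∑ x ∈ (Finset.range p).filter (fun x => Nat.Coprime x p), f (x : ZMod p) := by
  have : NeZero p := ⟨(Fact.out : p.Prime).ne_zero⟩
  refine Finset.sum_bij (fun x _ => (x : ZMod p).val) (fun x _ => ?_) (fun x _ y _ h => ?_) (fun n hn => ?_) (fun x _ => ?_)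
  · rw [Finset.mem_filter, Finset.mem_range]
    exact ⟨ZMod.val_lt _, ZMod.val_coe_unit_coprime x⟩
  · exact Units.ext (ZMod.val_injective p h)
  · rw [Finset.mem_filter, Finset.mem_range] at hn
    refine ⟨ZMod.unitOfCoprime n hn.2, Finset.mem_univ _, ?_⟩
    rw [ZMod.coe_unitOfCoprime, ZMod.val_natCast_of_lt hn.1]
  · rw [ZMod.natCast_zmod_val]

theorem re_Kl2 (p : ℕ) [Fact p.Prime] (a : ZMod p) : (Kl2 p a).re = kloosRe p (ZMod p) a / √p := by
  have : NeZero p := ⟨(Fact.out : p.Prime).ne_zero⟩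
  have h : Kl2 p a = (√(p : ℝ) : ℂ)⁻¹ * kloos (stdChar p (ZMod p)) a := by
    rw [Kl2, kloos, sum_units_zmod p fun y => stdChar p (ZMod p) (y + a * y⁻¹), Finset.sum_filter]
    congr 1
    refine Finset.sum_congr rfl fun x _ => ?_
    split_ifs with hx
    · rw [stdChar_apply, Algebra.trace_self_apply]
      conv_rhs => rw [← ZMod.natCast_zmod_val ((x : ZMod p) + a * (x : ZMod p)⁻¹)]
      have := ZMod.stdAddChar_coe (N := p) (((x : ZMod p) + a * (x : ZMod p)⁻¹).val : ℤ)
      rw [Int.cast_natCast] at this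
      rw [this]
      congr 1
      push_cast
      ring
    · rfl
  rw [h, ← ofReal_kloosRe, ← Complex.ofReal_inv, ← Complex.ofReal_mul, Complex.ofReal_re, div_eq_inv_mul]

/-- The uniform measure on the normalised Kloosterman sums modulo `p`. -/
noncomputable def kloosMeasure (p : ℕ) [Fact p.Prime] : ProbabilityMeasure ℝ :=
  ⟨((Fintype.card (ZMod p)ˣ : ENNReal)⁻¹) • ∑ x : (ZMod p)ˣ, Measure.dirac (kloosRe p (ZMod p) x / √p), ⟨by
    rw [Measure.smul_apply, Measure.finsetSum_apply]
    simp only [measure_univ, Finset.sum_const, Finset.card_univ, nsmul_eq_mul, mul_one, smul_eq_mul]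
    exact ENNReal.inv_mul_cancel (by exact_mod_cast Fintype.card_ne_zero) (ENNReal.natCast_ne_top _)⟩⟩

theorem integrable_kloosMeasure (p : ℕ) [Fact p.Prime] {f : ℝ → ℝ} : Integrable f (kloosMeasure p : Measure ℝ) := by
  rw [kloosMeasure, ProbabilityMeasure.coe_mk]
  refine Integrable.smul_measure ?_ (by simp [(Fact.out : p.Prime).ne_zero])
  exact integrable_finsetSum_measure.2 fun x _ => integrable_dirac (by simp)

theorem integral_kloosMeasure (p : ℕ) [Fact p.Prime] (f : ℝ → ℝ) : ∫ t, f t ∂(kloosMeasure p : Measure ℝ) =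
    ((p : ℝ) - 1)⁻¹ * ∑ x : (ZMod p)ˣ, f (kloosRe p (ZMod p) x / √p) := by
  rw [kloosMeasure, ProbabilityMeasure.coe_mk, integral_smul_measure,
    integral_finsetSum_measure fun x _ => integrable_dirac (by simp)]
  simp only [integral_dirac, smul_eq_mul]
  rw [ZMod.card_units_eq_totient, Nat.totient_prime Fact.out, ENNReal.toReal_inv, ENNReal.toReal_natCast,
    Nat.cast_sub (Fact.out : p.Prime).one_le, Nat.cast_one]

/-- Katz's vertical Sato–Tate law for Kloosterman sums: the angles `θ_{q,x} ∈ [0,π]`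
defined by `Kl₂(x;q) = 2 cos θ_{q,x}` become equidistributed with respect to the
Sato–Tate measure `(2/π) sin²θ dθ` as `q → ∞` over the primes; equivalently, for
`0 ≤ a ≤ b ≤ π` the proportion of `x ∈ (ℤ/qℤ)ˣ` with
`2 cos b ≤ Kl₂(x;q) ≤ 2 cos a` tends to `(2/π) ∫_a^b sin²θ dθ`. -/
theorem stmt_14 (a b : ℝ) (ha : 0 ≤ a) (hab : a ≤ b) (hb : b ≤ Real.pi)
    (ε : ℝ) (hε : 0 < ε) :
    ∃ Q : ℕ, ∀ q : ℕ, q.Prime → Q ≤ q →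
      |(((Finset.range q).filter (fun x =>
              Nat.Coprime x q ∧ 2 * Real.cos b ≤ (Kl2 q (x : ZMod q)).re ∧
                (Kl2 q (x : ZMod q)).re ≤ 2 * Real.cos a)).card : ℝ) / ((q : ℝ) - 1)
          - (2 / Real.pi) * ∫ θ in a..b, Real.sin θ ^ 2| < ε := by
  have hfact (q : Nat.Primes) : Fact (q : ℕ).Prime := ⟨q.2⟩
  have h := tendsto_real_Icc (ι := Nat.Primes) (L := comap ((↑) : Nat.Primes → ℕ) atTop)
    (μs := fun q : Nat.Primes => kloosMeasure (q : ℕ))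
    (fun (q : Nat.Primes) f _ => integrable_kloosMeasure (q : ℕ)) (fun k hk => ?_) ha hab hb
  · obtain ⟨Q, hQ⟩ := eventually_atTop.1 (eventually_comap.1 (Metric.tendsto_nhds.1 h ε hε))
    refine ⟨Q, fun q hq hQq => ?_⟩
    have : Fact q.Prime := ⟨hq⟩
    have h1 := hQ q hQq ⟨q, hq⟩ rfl
    rw [Real.dist_eq] at h1
    convert h1 using 3
    rw [← integral_indicator_one measurableSet_Icc, integral_kloosMeasure, div_eq_inv_mul]
    congr 1
    rw [sum_units_zmod q fun x => (Set.Icc (2 * Real.cos b) (2 * Real.cos a)).indicator 1 (kloosRe q (ZMod q) x / √q),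
      ← Finset.filter_filter, Finset.card_filter]
    push_cast
    refine Finset.sum_congr rfl fun x _ => ?_
    rw [← re_Kl2, Set.indicator_apply]
    rfl
  · rw [Metric.tendsto_nhds]
    intro δ hδ
    obtain ⟨P₀, hP⟩ := abs_sum_chebF_le k (Nat.pos_of_ne_zero hk) (half_pos hδ)
    filter_upwards [preimage_mem_comap (mem_atTop P₀)] with q hq
    have hq1 : (0 : ℝ) < (q : ℕ) - 1 := by
      have : (2 : ℝ) ≤ (q : ℕ) := by exact_mod_cast q.2.two_le
      linarith
    rw [integral_kloosMeasure, Real.dist_eq, sub_zero, abs_mul, abs_inv, abs_of_pos hq1, inv_mul_lt_iff₀ hq1]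
    have := hP q hq
    nlinarith
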